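/- Let Ω ⊂ ℝⁿ (n ≥ 2) be a domain and u ∈ C^{1,β}_{loc}(Ω) a weak solution of -Δ_p u = f in Ω. Define the sequence q_N by q_0 = 4 and q_N = 2(q_{N-1}-1), and let q > q_0 satisfy q_N < q ≤ q_{N+1} for some N ∈ ℕ₀. Assume 2 - 1/C(n,q) < p < min{2 + 1/(q-1), 2 + 1/C(n,q)}. Let f ∈ W^{2,q/(q-1)}_{loc}(Ω) ∩ C^{1,β'}_{loc}(Ω) and assume there exists τ > 0 with f ≥ τ in Ω (or f ≤ -τ in Ω). Then for every α > (q-q_N)(1-p)/(2^N q) + (3-p)/2^N + 1 and every k > (α+1)/2, the vector field |∇u|^{k-1} ∇u belongs to W^{2,1}_{loc}(Ω, ℝⁿ). -/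

import Mathlib

open MeasureTheory Real Set
open scoped InnerProductSpace ENNReal NNReal Topology

noncomputable section

abbrev Euc (n : ℕ) : Type := EuclideanSpace ℝ (Fin n)

variable {n : ℕ}

/-- A smooth test function compactly supported in `Ω`. -/
def IsTestFun (Ω : Set (Euc n)) (ψ : Euc n → ℝ) : Prop :=
  ContDiff ℝ (⊤ : ℕ∞) ψ ∧ HasCompactSupport ψ ∧ tsupport ψ ⊆ Ω

/-- `u` is a weak solution of `-Δ_p u = f` in `Ω`. -/
def IsPWeakSol (p : ℝ) (Ω : Set (Euc n)) (u f : Euc n → ℝ) : Prop :=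
  ∀ ψ : Euc n → ℝ, IsTestFun Ω ψ →
    (∫ x in Ω, ‖gradient u x‖ ^ (p - 2) * ⟪gradient u x, gradient ψ x⟫_ℝ) =
      ∫ x in Ω, f x * ψ x

/-- `f ∈ C^{0,β}_loc(Ω)`. -/
def C0Loc (Ω : Set (Euc n)) (β : ℝ≥0) (f : Euc n → ℝ) : Prop :=
  ContinuousOn f Ω ∧
  ∀ K : Set (Euc n), K ⊆ Ω → IsCompact K → ∃ C : ℝ≥0, HolderOnWith C β f K

/-- `u ∈ C^{1,β}_loc(Ω)`. -/
def C1Loc (Ω : Set (Euc n)) (β : ℝ≥0) (u : Euc n → ℝ) : Prop :=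
  (∀ x ∈ Ω, DifferentiableAt ℝ u x) ∧
  ∀ K : Set (Euc n), K ⊆ Ω → IsCompact K →
    ∃ C : ℝ≥0, HolderOnWith C β (fun x => gradient u x) K

/-- The `i`-th partial derivative of `g`. -/
def pd (g : Euc n → ℝ) (i : Fin n) (x : Euc n) : ℝ :=
  fderiv ℝ g x (EuclideanSpace.single i 1)

/-- `h` is the weak `i`-th partial derivative of `g` on `Ω`. -/
def HasWeakPD (Ω : Set (Euc n)) (g h : Euc n → ℝ) (i : Fin n) : Prop :=
  ∀ ψ : Euc n → ℝ, IsTestFun Ω ψ →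
    (∫ x in Ω, g x * pd ψ i x) = - ∫ x in Ω, h x * ψ x

/-- `g ∈ W^{1,q}_loc(Ω)`. -/
def MemW1Loc (Ω : Set (Euc n)) (q : ℝ) (g : Euc n → ℝ) : Prop :=
  ∃ d : Fin n → Euc n → ℝ,
    (∀ i, HasWeakPD Ω g (d i) i) ∧
    ∀ K : Set (Euc n), K ⊆ Ω → IsCompact K →
      IntegrableOn (fun x => |g x| ^ q) K volume ∧
      ∀ i, IntegrableOn (fun x => |d i x| ^ q) K volume

/-- `g ∈ W^{2,q}_loc(Ω)`. -/
def MemW2Loc (Ω : Set (Euc n)) (q : ℝ) (g : Euc n → ℝ) : Prop :=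
  ∃ d : Fin n → Euc n → ℝ, ∃ d2 : Fin n → Fin n → Euc n → ℝ,
    (∀ i, HasWeakPD Ω g (d i) i) ∧
    (∀ i j, HasWeakPD Ω (d i) (d2 i j) j) ∧
    ∀ K : Set (Euc n), K ⊆ Ω → IsCompact K →
      IntegrableOn (fun x => |g x| ^ q) K volume ∧
      (∀ i, IntegrableOn (fun x => |d i x| ^ q) K volume) ∧
      (∀ i j, IntegrableOn (fun x => |d2 i j x| ^ q) K volume)

/-- The Laplacian of `w`. -/
def lapl (w : Euc n → ℝ) (x : Euc n) : ℝ :=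
  ∑ i : Fin n, iteratedFDeriv ℝ 2 w x ![EuclideanSpace.single i 1, EuclideanSpace.single i 1]

/-- The Calderón–Zygmund constant `C(n,q)`: the best constant in
`‖D²w‖_{L^q} ≤ C ‖Δw‖_{L^q}`. -/
def CZ (n : ℕ) (q : ℝ) : ℝ :=
  sInf {C : ℝ | 0 ≤ C ∧ ∀ w : Euc n → ℝ, ContDiff ℝ (⊤ : ℕ∞) w → HasCompactSupport w →
    (∫ x, ‖iteratedFDeriv ℝ 2 w x‖ ^ q) ^ (1 / q) ≤ C * (∫ x, |lapl w x| ^ q) ^ (1 / q)}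

/-- The critical set `Z_u` of `u`. -/
def Zset (u : Euc n → ℝ) : Set (Euc n) := {x | gradient u x = 0}

/-- The recursion `q_N = 2 (q_{N-1} - 1)` starting from `q0`. -/
def qseq (q0 : ℝ) : ℕ → ℝ
  | 0 => q0
  | N + 1 => 2 * (qseq q0 N - 1)

/-- `A` is compactly contained in `Ω`. -/
def CptIn (A Ω : Set (Euc n)) : Prop :=
  IsOpen A ∧ IsCompact (closure A) ∧ closure A ⊆ Ω

/-- `v` is a weak solution of the regularized problem
`-div((ε + |∇v|²)^{(p-2)/2} ∇v) = f` in `B`. -/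
def IsRegWeakSol (p ε : ℝ) (B : Set (Euc n)) (v f : Euc n → ℝ) : Prop :=
  ∀ ψ : Euc n → ℝ, IsTestFun B ψ →
    (∫ x in B, (ε + ‖gradient v x‖ ^ (2 : ℝ)) ^ ((p - 2) / 2) *
        ⟪gradient v x, gradient ψ x⟫_ℝ) =
      ∫ x in B, f x * ψ x

/-- The smooth cut-off `s ↦ χ(s / ε² - 1)`, vanishing for `s ≤ ε²`, equal to one for `2 ε² ≤ s`. -/
def cutT (ε s : ℝ) : ℝ := Real.smoothTransition (s / ε ^ 2 - 1)

/-- The power `s ^ e` smoothly truncated near zero. -/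
def tr (ε e s : ℝ) : ℝ := cutT ε s * s ^ e

open Filter Metric
open Finset (abs_sum_le_sum_abs measurable_fun_sum mul_sum single_le_sum sum_add_distrib sum_comm sum_congr sum_const sum_div sum_eq_zero sum_le_sum sum_mul sum_mul_sum sum_neg_distrib sum_nonneg sum_sub_distrib)
open ENNReal (mul_ne_top ofReal ofReal_add ofReal_le_ofReal ofReal_le_ofReal_iff ofReal_lt_top ofReal_mul ofReal_ne_top ofReal_ofNat ofReal_rpow_of_nonneg ofReal_toReal rpow_ne_top_of_nonneg toReal_mono toReal_mul toReal_nonneg toReal_ofReal)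

section

abbrev Smooth {E G : Type*} [NormedAddCommGroup E] [NormedSpace ℝ E] [NormedAddCommGroup G]
    [NormedSpace ℝ G] (g : E → G) : Prop := ContDiff ℝ (⊤ : ℕ∞) g

variable {F : Type*} [NormedAddCommGroup F] [NormedSpace ℝ F]
  {ε h s m t a b p q r C δ κ d e α c η L M : ℝ} {K O Ω : Set (Euc n)} {x z : Euc n} {i j k l : Fin n}
  {φ g w u f ψ χ ζ θ ω v : Euc n → ℝ} {H A : Fin n → Fin n → Euc n → ℝ} {X : Euc n → Euc n}

lemma _root_.Continuous.integrable_cpt {g : Euc n → F} (hg : Continuous g)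
    (h : HasCompactSupport g) :
    Integrable g := hg.integrable_of_hasCompactSupport h

lemma zero_off_tsupport {S T : Type*} [Zero S] [TopologicalSpace T] {f : T → S} {x : T}
    (h : x ∉ tsupport f) : f x = 0 := image_eq_zero_of_notMem_tsupport h

lemma setIntegral_eq_of_off {s : Set (Euc n)} {f : Euc n → F} (h : ∀ x ∉ s, f x = 0) :
    ∫ x in s, f x = ∫ x, f x := setIntegral_eq_integral_of_forall_compl_eq_zero h

lemma mul_le_left (h : b ≤ c) (ha : 0 ≤ a) : a * b ≤ a * c := mul_le_mul_of_nonneg_left h ha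

lemma mul_le_right (h : b ≤ c) (ha : 0 ≤ a) : b * a ≤ c * a := mul_le_mul_of_nonneg_right h ha

lemma cutT_zero (hε : 0 < ε) (hs : s ≤ ε ^ 2) : cutT ε s = 0 := by
  refine smoothTransition.zero_of_nonpos ?_
  have : s / ε ^ 2 ≤ 1 := by rw [div_le_one (by positivity)]; exact hs
  linarith

lemma cutT_one (hε : 0 < ε) (hs : 2 * ε ^ 2 ≤ s) : cutT ε s = 1 := by
  refine smoothTransition.one_of_one_le ?_
  have : 2 ≤ s / ε ^ 2 := by rw [le_div_iff₀ (by positivity)]; exact hs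
  linarith

lemma cutT_nonneg (ε s : ℝ) : 0 ≤ cutT ε s := smoothTransition.nonneg _

lemma cutT_le_one (ε s : ℝ) : cutT ε s ≤ 1 := smoothTransition.le_one _

lemma cutT_contDiff (ε : ℝ) : Smooth (cutT ε) :=
  smoothTransition.contDiff.comp ((contDiff_id.div_const _).sub contDiff_const)

lemma cutT_monotone : Monotone (cutT ε) := fun a b hab =>
  smoothTransition.monotone (by gcongr)

lemma cutT_deriv_nonneg (ε s : ℝ) : 0 ≤ deriv (cutT ε) s := cutT_monotone.deriv_nonneg

lemma cutT_hasDerivAt (ε s : ℝ) : HasDerivAt (cutT ε) (deriv (cutT ε) s) s :=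
  ((cutT_contDiff ε).differentiable (by simp) s).hasDerivAt

lemma cutT_deriv_bound : ∃ C : ℝ, 0 ≤ C ∧ ∀ ε s : ℝ, 0 < ε → 0 < s →
    deriv (cutT ε) s ≤ C / s := by
  have hcd : ContDiff ℝ 1 smoothTransition := by fun_prop
  have hcont : Continuous (deriv smoothTransition) := hcd.continuous_deriv le_rfl
  obtain ⟨C, hC⟩ := (isCompact_Icc (a := (0:ℝ)) (b := 1)).exists_bound_of_continuousOn
    hcont.continuousOn
  have hC0 : 0 ≤ C := (norm_nonneg _).trans (hC 0 (by simp))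
  refine ⟨2 * C, by positivity, fun ε s hε hs => ?_⟩
  have hd : deriv (cutT ε) s = deriv smoothTransition (s / ε ^ 2 - 1) * (1 / ε ^ 2) := by
    have h1 : HasDerivAt (fun s : ℝ => s / ε ^ 2 - 1) (1 / ε ^ 2) s :=
      ((hasDerivAt_id s).div_const _).sub_const _
    have h2 := (hcd.differentiable (by simp) (s / ε ^ 2 - 1)).hasDerivAt
    exact (h2.comp s h1).deriv
  by_cases hlt : 2 * ε ^ 2 < s
  · have : deriv (cutT ε) s = 0 := by
      have : cutT ε =ᶠ[𝓝 s] fun _ => 1 := by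
        filter_upwards [lt_mem_nhds hlt] with y hy using cutT_one hε hy.le
      rw [this.deriv_eq]; simp
    rw [this]; positivity
  by_cases hgt : s < ε ^ 2
  · have : deriv (cutT ε) s = 0 := by
      have : cutT ε =ᶠ[𝓝 s] fun _ => 0 := by
        filter_upwards [gt_mem_nhds hgt] with y hy using cutT_zero hε hy.le
      rw [this.deriv_eq]; simp
    rw [this]; positivity
  push Not at hlt hgt
  have hmem : s / ε ^ 2 - 1 ∈ Icc (0:ℝ) 1 := by
    constructor
    · have : 1 ≤ s / ε ^ 2 := by rw [le_div_iff₀ (by positivity)]; linarith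
      linarith
    · have : s / ε ^ 2 ≤ 2 := by rw [div_le_iff₀ (by positivity)]; linarith
      linarith
  have h3 := (le_abs_self _).trans (hC _ hmem)
  rw [hd, le_div_iff₀ hs]
  calc deriv smoothTransition (s / ε ^ 2 - 1) * (1 / ε ^ 2) * s
      = deriv smoothTransition (s / ε ^ 2 - 1) * (s / ε ^ 2) := by ring
    _ ≤ C * 2 := by
        refine mul_le_mul h3 ?_ (by positivity) hC0
        rw [div_le_iff₀ (by positivity)]; linarith
    _ = 2 * C := by ring

lemma tr_zero (e : ℝ) (hε : 0 < ε) (hs : s ≤ ε ^ 2) : tr ε e s = 0 := by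
  simp [tr, cutT_zero hε hs]

lemma tr_eq (e : ℝ) (hε : 0 < ε) (hs : 2 * ε ^ 2 ≤ s) : tr ε e s = s ^ e := by
  simp [tr, cutT_one hε hs]

lemma tr_nonneg (e : ℝ) (hs : 0 ≤ s) : 0 ≤ tr ε e s :=
  mul_nonneg (cutT_nonneg _ _) (rpow_nonneg hs _)

lemma tr_le (e : ℝ) (hs : 0 ≤ s) : tr ε e s ≤ s ^ e :=
  mul_le_of_le_one_left (rpow_nonneg hs _) (cutT_le_one _ _)

lemma tr_contDiff (e : ℝ) (hε : 0 < ε) : ContDiff ℝ (⊤ : ℕ∞) (tr ε e) := by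
  rw [contDiff_iff_contDiffAt]
  intro s
  by_cases hs : s < ε ^ 2
  · have : tr ε e =ᶠ[𝓝 s] fun _ => 0 := by
      filter_upwards [gt_mem_nhds hs] with y hy using tr_zero e hε hy.le
    exact contDiffAt_const.congr_of_eventuallyEq this
  · have hs0 : s ≠ 0 := by
      have : 0 < ε ^ 2 := by positivity
      intro h; rw [h] at hs; exact hs this
    exact (cutT_contDiff ε).contDiffAt.mul (contDiffAt_rpow_const_of_ne hs0)

lemma tr_hasDerivAt (e : ℝ) (hε : 0 < ε) (s : ℝ) :
    HasDerivAt (tr ε e) (deriv (tr ε e) s) s :=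
  ((tr_contDiff e hε).differentiable (by simp) s).hasDerivAt

lemma tr_deriv (e : ℝ) (hs : 0 < s) :
    deriv (tr ε e) s = deriv (cutT ε) s * s ^ e + cutT ε s * (e * s ^ (e - 1)) := by
  have h := (cutT_hasDerivAt ε s).mul (hasDerivAt_rpow_const (p := e) (Or.inl hs.ne'))
  exact h.deriv

lemma tr_deriv_zero (e : ℝ) (hε : 0 < ε) (hs : s < ε ^ 2) : deriv (tr ε e) s = 0 := by
  have : tr ε e =ᶠ[𝓝 s] fun _ => 0 := by
    filter_upwards [gt_mem_nhds hs] with y hy using tr_zero e hε hy.le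
  rw [this.deriv_eq]; simp

lemma tr_deriv_eq (e : ℝ) (hε : 0 < ε) (hs : 2 * ε ^ 2 < s) :
    deriv (tr ε e) s = e * s ^ (e - 1) := by
  have h0 : 0 < s := lt_trans (by positivity) hs
  have : tr ε e =ᶠ[𝓝 s] fun y => y ^ e := by
    filter_upwards [lt_mem_nhds hs] with y hy using tr_eq e hε hy.le
  rw [this.deriv_eq]; exact (hasDerivAt_rpow_const (Or.inl h0.ne')).deriv

lemma tr_deriv_ge (e : ℝ) (hs : 0 < s) :
    e * tr ε e s ≤ s * deriv (tr ε e) s := by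
  rw [tr_deriv e hs, tr]
  have h1 : s * s ^ (e - 1) = s ^ e := by
    rw [mul_comm, ← rpow_add_one hs.ne']; simp
  have h2 := cutT_deriv_nonneg ε s
  have h3 : 0 < s ^ e := rpow_pos_of_pos hs e
  have : s * (deriv (cutT ε) s * s ^ e + cutT ε s * (e * s ^ (e - 1)))
    = s * deriv (cutT ε) s * s ^ e + e * (cutT ε s * (s * s ^ (e - 1))) := by ring
  rw [this, h1]
  have : 0 ≤ s * deriv (cutT ε) s * s ^ e := by positivity
  linarith

lemma tr_deriv_bound (e : ℝ) : ∃ C : ℝ, 0 ≤ C ∧ ∀ ε s : ℝ, 0 < ε → 0 < s →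
    |deriv (tr ε e) s| ≤ C * s ^ (e - 1) := by
  obtain ⟨C, hC0, hC⟩ := cutT_deriv_bound
  refine ⟨C + |e|, by positivity, fun ε s hε hs => ?_⟩
  rw [tr_deriv e hs]
  have h3 : 0 < s ^ (e - 1) := rpow_pos_of_pos hs _
  have h1 : s ^ e = s * s ^ (e - 1) := by
    rw [mul_comm, ← rpow_add_one hs.ne']; simp
  have h4 := hC ε s hε hs
  rw [le_div_iff₀ hs] at h4
  calc |deriv (cutT ε) s * s ^ e + cutT ε s * (e * s ^ (e - 1))|
      ≤ |deriv (cutT ε) s * s ^ e| + |cutT ε s * (e * s ^ (e - 1))| := abs_add_le _ _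
    _ = (deriv (cutT ε) s * s) * s ^ (e - 1) + cutT ε s * |e| * s ^ (e - 1) := by
        rw [abs_of_nonneg (mul_nonneg (cutT_deriv_nonneg _ _) (rpow_nonneg hs.le _)),
          abs_mul, abs_mul, abs_of_nonneg (cutT_nonneg _ _), abs_of_pos h3, h1]; ring
    _ ≤ C * s ^ (e - 1) + 1 * |e| * s ^ (e - 1) := by
        gcongr
        exact cutT_le_one _ _
    _ = _ := by ring

lemma tr_scale (e : ℝ) (hε : 0 < ε) (hs : 0 ≤ s) :
    tr ε e (ε ^ 2 * s) = ε ^ (2 * e) * tr 1 e s := by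
  unfold tr cutT
  have h1 : (ε ^ 2 * s) ^ e = ε ^ (2 * e) * s ^ e := by
    rw [mul_rpow (by positivity) hs, rpow_mul hε.le]; norm_cast
  rw [h1]
  have : ε ^ 2 * s / ε ^ 2 = s := by field_simp
  rw [this]; simp; ring

/-- The power vector field `z ↦ ‖z‖ ^ m • z`. -/
def pv (m : ℝ) (z : Euc n) : Euc n := ‖z‖ ^ m • z

/-- The smooth truncation of `pv m` near the origin. -/
def Phi (ε m : ℝ) (z : Euc n) : Euc n := tr ε (m / 2) (‖z‖ ^ 2) • z

/-- The derivative of `pv m` away from the origin. -/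
def pvD (m : ℝ) (a : Euc n) : Euc n →L[ℝ] Euc n :=
  ‖a‖ ^ m • ContinuousLinearMap.id ℝ (Euc n) +
    (m * ‖a‖ ^ (m - 2)) • (innerSL ℝ a).smulRight a

lemma pvD_apply (m : ℝ) (a ξ : Euc n) :
    pvD m a ξ = ‖a‖ ^ m • ξ + (m * ‖a‖ ^ (m - 2)) • (⟪a, ξ⟫_ℝ • a) := by bound

lemma sq_rpow_half (ht : 0 ≤ t) (m : ℝ) : (t ^ 2) ^ (m / 2) = t ^ m := by
  rw [← rpow_natCast, ← rpow_mul ht]; congr 1; push_cast; ring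

lemma Phi_eq_pv (hε : 0 < ε) (hz : 2 * ε ^ 2 ≤ ‖z‖ ^ 2) :
    Phi ε m z = pv m z := by
  rw [Phi, pv, tr_eq _ hε hz, sq_rpow_half (norm_nonneg _)]

lemma Phi_zero (hε : 0 < ε) (hz : ‖z‖ ≤ ε) : Phi ε m z = 0 := by
  rw [Phi, tr_zero _ hε (by gcongr), zero_smul]

lemma Phi_contDiff (m : ℝ) (hε : 0 < ε) : Smooth (Phi (n := n) ε m) :=
  ((tr_contDiff (m / 2) hε).comp (contDiff_norm_sq ℝ)).smul contDiff_id

lemma Phi_scale (m : ℝ) (hε : 0 < ε) (z : Euc n) :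
    Phi ε m z = ε ^ (m + 1) • Phi 1 m (ε⁻¹ • z) := by
  have h1 : ‖z‖ ^ 2 = ε ^ 2 * ‖ε⁻¹ • z‖ ^ 2 := by
    rw [norm_smul, norm_inv, norm_of_nonneg hε.le]; field_simp
  have h2 : (2:ℝ) * (m / 2) = m := by ring
  rw [Phi, Phi, h1, tr_scale _ hε (by positivity), smul_smul, smul_smul, h2, rpow_add hε,
    rpow_one]
  congr 1
  field_simp

lemma exists_scaling_bound
    (G : ℝ → Euc n → F) (m : ℝ) (hcont : Continuous (G 1))
    (hscale : ∀ ε, 0 < ε → ∀ z, G ε z = ε ^ m • G 1 (ε⁻¹ • z))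
    (hzero : ∀ z, ‖z‖ < 1 → G 1 z = 0)
    (hbig : ∀ ε, 0 < ε → ∀ z, 2 * ε < ‖z‖ → G ε z = G (‖z‖ / 2) z) :
    ∃ C : ℝ, 0 ≤ C ∧ ∀ ε, 0 < ε → ∀ z, z ≠ 0 → ‖G ε z‖ ≤ C * ‖z‖ ^ m := by
  obtain ⟨C0, hC0⟩ := (isCompact_closedBall (0 : Euc n) 2).exists_bound_of_continuousOn
    hcont.continuousOn
  have hC00 : 0 ≤ C0 := (norm_nonneg _).trans (hC0 0 (by simp))
  have key : ∀ ε, 0 < ε → ∀ z : Euc n, z ≠ 0 → ‖z‖ ≤ 2 * ε →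
      ‖G ε z‖ ≤ C0 * 2 ^ |m| * ‖z‖ ^ m := by
    intro ε hε z hz hz2
    have hzp : 0 < ‖z‖ := norm_pos_iff.2 hz
    by_cases hlt : ‖z‖ < ε
    · rw [hscale ε hε, hzero]
      · simp; positivity
      · rw [norm_smul, norm_inv, norm_of_nonneg hε.le, inv_mul_lt_iff₀ hε]; simpa using hlt
    · push Not at hlt
      rw [hscale ε hε, norm_smul, norm_of_nonneg (rpow_nonneg hε.le _)]
      have h1 : ‖G 1 (ε⁻¹ • z)‖ ≤ C0 := by
        apply hC0
        rw [mem_closedBall_zero_iff, norm_smul, norm_inv, norm_of_nonneg hε.le,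
          inv_mul_le_iff₀ hε]; linarith
      have h2 : ε ^ m ≤ 2 ^ |m| * ‖z‖ ^ m := by
        rcases le_total 0 m with hm | hm
        · rw [abs_of_nonneg hm]
          calc ε ^ m ≤ ‖z‖ ^ m := rpow_le_rpow hε.le hlt hm
            _ ≤ 2 ^ m * ‖z‖ ^ m := le_mul_of_one_le_left (by positivity)
              (one_le_rpow (by norm_num) hm)
        · rw [abs_of_nonpos hm]
          have h3 : (2 * ε) ^ m ≤ ‖z‖ ^ m := rpow_le_rpow_of_nonpos hzp hz2 hm
          rw [mul_rpow (by norm_num) hε.le] at h3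
          calc ε ^ m = 2 ^ (-m) * (2 ^ m * ε ^ m) := by
                rw [← mul_assoc, ← rpow_add (by norm_num)]; simp
            _ ≤ _ := by gcongr
      calc ε ^ m * ‖G 1 (ε⁻¹ • z)‖ ≤ (2 ^ |m| * ‖z‖ ^ m) * C0 := by gcongr
        _ = _ := by ring
  refine ⟨C0 * 2 ^ |m|, by positivity, fun ε hε z hz => ?_⟩
  have hzp : 0 < ‖z‖ := norm_pos_iff.2 hz
  by_cases h : ‖z‖ ≤ 2 * ε
  · exact key ε hε z hz h
  · rw [hbig ε hε z (not_le.1 h)]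
    exact key _ (by positivity) z hz (by linarith)

lemma Phi_eventuallyEq_pv (hε : 0 < ε) (hz : 2 * ε ^ 2 < ‖z‖ ^ 2) :
    Phi ε m =ᶠ[𝓝 z] pv m := by
  have hc : Continuous fun y : Euc n => ‖y‖ ^ 2 := by fun_prop
  filter_upwards [hc.continuousAt.eventually (lt_mem_nhds hz)] with y hy
    using Phi_eq_pv hε (le_of_lt hy)

lemma Phi_eventuallyEq_Phi (hε : 0 < ε) (hz : 2 * ε < ‖z‖) :
    Phi ε m =ᶠ[𝓝 z] Phi (‖z‖ / 2) m := by
  have hzp : 0 < ‖z‖ := lt_trans (by positivity) hz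
  exact (Phi_eventuallyEq_pv hε (by nlinarith)).trans
    (Phi_eventuallyEq_pv (ε := ‖z‖ / 2) (by positivity) (by nlinarith)).symm

lemma Phi_fderiv_scale (m : ℝ) (hε : 0 < ε) (z : Euc n) :
    fderiv ℝ (Phi ε m) z = ε ^ m • fderiv ℝ (Phi (n := n) 1 m) (ε⁻¹ • z) := by
  have : Phi (n := n) ε m = fun z => ε ^ (m + 1) • Phi 1 m (ε⁻¹ • z) :=
    funext (Phi_scale m hε)
  rw [this, fderiv_fun_const_smul, fderiv_comp_smul, smul_smul, rpow_add_one hε.ne']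
  · field_simp
  · exact (((Phi_contDiff m one_pos).comp (contDiff_const_smul _)).differentiable (by simp)) z

lemma Phi_fderiv_contDiff (m : ℝ) (hε : 0 < ε) :
    Smooth (fderiv ℝ (Phi (n := n) ε m)) :=
  (Phi_contDiff m hε).fderiv_right (by simp)

lemma Phi_fderiv2_scale (m : ℝ) (hε : 0 < ε) (z : Euc n) :
    fderiv ℝ (fderiv ℝ (Phi ε m)) z
      = ε ^ (m - 1) • fderiv ℝ (fderiv ℝ (Phi (n := n) 1 m)) (ε⁻¹ • z) := by
  have : fderiv ℝ (Phi (n := n) ε m) = fun z => ε ^ m • fderiv ℝ (Phi 1 m) (ε⁻¹ • z) :=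
    funext (Phi_fderiv_scale m hε)
  have hd : DifferentiableAt ℝ (fun z : Euc n => fderiv ℝ (Phi 1 m) (ε⁻¹ • z)) z :=
    (((Phi_fderiv_contDiff m one_pos).comp (contDiff_const_smul _)).differentiable (by simp)) z
  rw [this]
  refine (hd.hasFDerivAt.const_smul (ε ^ m)).fderiv.trans ?_
  rw [fderiv_comp_smul (f := fderiv ℝ (Phi 1 m)), smul_smul, rpow_sub_one hε.ne']
  congr 1

lemma Phi_eventuallyEq_zero (hε : 0 < ε) (hz : ‖z‖ < ε) :
    Phi ε m =ᶠ[𝓝 z] fun _ => 0 := by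
  filter_upwards [continuous_norm.continuousAt.eventually (gt_mem_nhds hz)] with y hy
    using Phi_zero hε (le_of_lt hy)

lemma Phi_fderiv_bound (m : ℝ) : ∃ C : ℝ, 0 ≤ C ∧ ∀ ε, 0 < ε → ∀ z : Euc n, z ≠ 0 →
    ‖fderiv ℝ (Phi ε m) z‖ ≤ C * ‖z‖ ^ m := by
  refine exists_scaling_bound (fun ε => fderiv ℝ (Phi ε m)) m
    (Phi_fderiv_contDiff m one_pos).continuous (fun ε hε z => Phi_fderiv_scale m hε z) ?_ ?_
  · intro z hz
    rw [(Phi_eventuallyEq_zero one_pos hz).fderiv_eq]; simp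
  · intro ε hε z hz
    exact (Phi_eventuallyEq_Phi hε hz).fderiv_eq

lemma Phi_fderiv2_bound (m : ℝ) : ∃ C : ℝ, 0 ≤ C ∧ ∀ ε, 0 < ε → ∀ z : Euc n, z ≠ 0 →
    ‖fderiv ℝ (fderiv ℝ (Phi ε m)) z‖ ≤ C * ‖z‖ ^ (m - 1) := by
  refine exists_scaling_bound (fun ε => fderiv ℝ (fderiv ℝ (Phi ε m))) (m - 1)
    ((Phi_fderiv_contDiff m one_pos).fderiv_right (m := (⊤ : ℕ∞)) (by simp)).continuous
    (fun ε hε z => Phi_fderiv2_scale m hε z) ?_ ?_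
  · intro z hz
    rw [(Phi_eventuallyEq_zero one_pos hz).fderiv.fderiv_eq]; simp
  · intro ε hε z hz
    exact (Phi_eventuallyEq_Phi hε hz).fderiv.fderiv_eq

lemma Phi_hasFDerivAt (m : ℝ) (hε : 0 < ε) (z : Euc n) :
    HasFDerivAt (Phi ε m) (fderiv ℝ (Phi ε m) z) z :=
  ((Phi_contDiff m hε).differentiable (by simp) z).hasFDerivAt

lemma pv_hasFDerivAt (m : ℝ) {a : Euc n} (ha : a ≠ 0) : HasFDerivAt (pv m) (pvD m a) a := by
  have hap : 0 < ‖a‖ := norm_pos_iff.2 ha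
  have h1 : HasFDerivAt (fun z : Euc n => ‖z‖ ^ 2) (2 • innerSL ℝ a) a :=
    (hasStrictFDerivAt_norm_sq a).hasFDerivAt
  have h2 : HasFDerivAt (fun z : Euc n => (‖z‖ ^ 2) ^ (m / 2))
      ((m / 2 * (‖a‖ ^ 2) ^ (m / 2 - 1)) • (2 • innerSL ℝ a)) a :=
    (hasDerivAt_rpow_const (p := m / 2) (Or.inl (by positivity))).comp_hasFDerivAt a h1
  have h3 := h2.smul (hasFDerivAt_id a)
  have h4 : pv (n := n) m = fun z => (‖z‖ ^ 2) ^ (m / 2) • z := by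
    ext1 z; rw [pv, sq_rpow_half (norm_nonneg _)]
  rw [h4]
  refine h3.congr_fderiv ?_
  ext1 ξ
  have e1 : (‖a‖ ^ 2) ^ (m / 2 - 1) = ‖a‖ ^ (m - 2) := by
    have : m / 2 - 1 = (m - 2) / 2 := by ring
    rw [this, sq_rpow_half (norm_nonneg _)]
  rw [pvD_apply, e1, sq_rpow_half (norm_nonneg _)]
  simp [smul_smul, mul_comm, mul_left_comm]
  congr 1
  ring

lemma Phi_fderiv_eq (m : ℝ) (hε : 0 < ε) {a : Euc n} (ha : 2 * ε ^ 2 < ‖a‖ ^ 2) :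
    fderiv ℝ (Phi ε m) a = pvD m a := by
  have ha0 : a ≠ 0 := by
    rintro rfl; simp at ha; have : 0 < ε ^ 2 := by positivity
    linarith
  rw [(Phi_eventuallyEq_pv hε ha).fderiv_eq, (pv_hasFDerivAt m ha0).fderiv]

lemma rpow_comparable (m : ℝ) (ht : 0 < t) (h1 : t / 2 ≤ s) (h2 : s ≤ 2 * t) :
    s ^ m ≤ 2 ^ |m| * t ^ m := by
  have hs : 0 < s := by linarith
  rcases le_total 0 m with hm | hm
  · rw [abs_of_nonneg hm, ← mul_rpow (by norm_num) ht.le]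
    exact rpow_le_rpow hs.le h2 hm
  · rw [abs_of_nonpos hm]
    have h3 : s ^ m ≤ (t / 2) ^ m := rpow_le_rpow_of_nonpos (by positivity) h1 hm
    refine h3.trans_eq ?_
    rw [div_eq_mul_inv, mul_rpow ht.le (by norm_num), mul_comm, inv_rpow (by norm_num),
      ← rpow_neg (by norm_num)]

lemma Phi_mean_value (m : ℝ) : ∃ C : ℝ, 0 ≤ C ∧ ∀ ε, 0 < ε → ∀ a y z : Euc n, a ≠ 0 →
    ‖y - a‖ ≤ ‖a‖ / 2 → ‖z - a‖ ≤ ‖a‖ / 2 →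
    ‖Phi ε m y - Phi ε m z‖ ≤ C * ‖a‖ ^ m * ‖y - z‖ := by
  obtain ⟨C, hC0, hC⟩ := Phi_fderiv_bound (n := n) m
  refine ⟨C * 2 ^ |m|, by positivity, fun ε hε a y z ha hy hz => ?_⟩
  have hap : 0 < ‖a‖ := norm_pos_iff.2 ha
  refine (convex_closedBall a (‖a‖ / 2)).norm_image_sub_le_of_norm_hasFDerivWithin_le
    (fun x _ => (Phi_hasFDerivAt m hε x).hasFDerivWithinAt) (fun x hx => ?_)
    (by simpa [dist_eq_norm] using hz) (by simpa [dist_eq_norm] using hy)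
  rw [mem_closedBall_iff_norm] at hx
  have h1 : ‖a‖ / 2 ≤ ‖x‖ := by
    have := norm_sub_norm_le a x; rw [norm_sub_rev] at this; linarith
  have h2 : ‖x‖ ≤ 2 * ‖a‖ := by have := norm_sub_norm_le x a; linarith
  have hx0 : x ≠ 0 := norm_pos_iff.1 (by linarith)
  calc _ ≤ C * ‖x‖ ^ m := hC ε hε x hx0
    _ ≤ C * (2 ^ |m| * ‖a‖ ^ m) := by gcongr; exact rpow_comparable m hap h1 h2
    _ = _ := by ring

lemma Phi_fderiv_mean_value (m : ℝ) : ∃ C : ℝ, 0 ≤ C ∧ ∀ ε, 0 < ε → ∀ a y z : Euc n, a ≠ 0 →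
    ‖y - a‖ ≤ ‖a‖ / 2 → ‖z - a‖ ≤ ‖a‖ / 2 →
    ‖fderiv ℝ (Phi ε m) y - fderiv ℝ (Phi ε m) z‖ ≤ C * ‖a‖ ^ (m - 1) * ‖y - z‖ := by
  obtain ⟨C, hC0, hC⟩ := Phi_fderiv2_bound (n := n) m
  refine ⟨C * 2 ^ |m - 1|, by positivity, fun ε hε a y z ha hy hz => ?_⟩
  have hap : 0 < ‖a‖ := norm_pos_iff.2 ha
  refine (convex_closedBall a (‖a‖ / 2)).norm_image_sub_le_of_norm_hasFDerivWithin_le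
    (fun x _ => (((Phi_fderiv_contDiff m hε).differentiable (by simp)
      x).hasFDerivAt).hasFDerivWithinAt) (fun x hx => ?_)
    (by simpa [dist_eq_norm] using hz) (by simpa [dist_eq_norm] using hy)
  rw [mem_closedBall_iff_norm] at hx
  have h1 : ‖a‖ / 2 ≤ ‖x‖ := by
    have := norm_sub_norm_le a x; rw [norm_sub_rev] at this; linarith
  have h2 : ‖x‖ ≤ 2 * ‖a‖ := by have := norm_sub_norm_le x a; linarith
  have hx0 : x ≠ 0 := norm_pos_iff.1 (by linarith)
  calc _ ≤ C * ‖x‖ ^ (m - 1) := hC ε hε x hx0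
    _ ≤ C * (2 ^ |m - 1| * ‖a‖ ^ (m - 1)) := by gcongr; exact rpow_comparable _ hap h1 h2
    _ = _ := by ring

lemma Phi_taylor (m : ℝ) : ∃ C : ℝ, 0 ≤ C ∧ ∀ ε, 0 < ε → ∀ (a y z : Euc n) (r : ℝ), a ≠ 0 →
    r ≤ ‖a‖ / 2 → ‖y - a‖ ≤ r → ‖z - a‖ ≤ r →
    ‖Phi ε m y - Phi ε m z - fderiv ℝ (Phi ε m) a (y - z)‖ ≤ C * ‖a‖ ^ (m - 1) * r * ‖y - z‖ := by
  obtain ⟨C, hC0, hC⟩ := Phi_fderiv_mean_value (n := n) m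
  refine ⟨C, hC0, fun ε hε a y z r ha hr hy hz => ?_⟩
  refine (convex_closedBall a r).norm_image_sub_le_of_norm_hasFDerivWithin_le'
    (fun x _ => (Phi_hasFDerivAt m hε x).hasFDerivWithinAt) (fun x hx => ?_)
    (by simpa [dist_eq_norm] using hz) (by simpa [dist_eq_norm] using hy)
  rw [mem_closedBall_iff_norm] at hx
  calc _ ≤ C * ‖a‖ ^ (m - 1) * ‖x - a‖ := hC ε hε a x a ha (hx.trans hr) (by simp; positivity)
    _ ≤ _ := by gcongr

lemma Phi_second_diff (m : ℝ) : ∃ C : ℝ, 0 ≤ C ∧ ∀ ε, 0 < ε → ∀ (a ξ η : Euc n), a ≠ 0 →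
    ‖ξ‖ ≤ ‖a‖ / 4 → ‖η‖ ≤ ‖a‖ / 4 →
    ‖Phi ε m (a + ξ + η) - Phi ε m (a + ξ) - (Phi ε m (a + η) - Phi ε m a)‖
      ≤ C * ‖a‖ ^ (m - 1) * ‖ξ‖ * ‖η‖ := by
  obtain ⟨C, hC0, hC⟩ := Phi_fderiv_mean_value (n := n) m
  refine ⟨C, hC0, fun ε hε a ξ η ha hξ hη => ?_⟩
  have hap : 0 < ‖a‖ := norm_pos_iff.2 ha
  have key := (convex_closedBall (0 : Euc n) (‖a‖ / 4)).norm_image_sub_le_of_norm_hasFDerivWithin_le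
    (f := fun ζ => Phi ε m (a + ζ + η) - Phi ε m (a + ζ))
    (f' := fun ζ => fderiv ℝ (Phi ε m) (a + ζ + η) - fderiv ℝ (Phi ε m) (a + ζ))
    (C := C * ‖a‖ ^ (m - 1) * ‖η‖) (x := 0) (y := ξ)
    (fun x _ => ?_) (fun x hx => ?_) (by simp; positivity) (by simpa using hξ)
  · simp only [add_zero, sub_zero] at key
    calc _ ≤ _ := key
      _ = _ := by ring
  · refine HasFDerivAt.hasFDerivWithinAt ?_
    have h1 : HasFDerivAt (fun ζ : Euc n => a + ζ + η) (ContinuousLinearMap.id ℝ _) x :=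
      ((hasFDerivAt_id x).const_add a).add_const η
    have h2 : HasFDerivAt (fun ζ : Euc n => a + ζ) (ContinuousLinearMap.id ℝ _) x :=
      (hasFDerivAt_id x).const_add a
    exact ((Phi_hasFDerivAt m hε _).comp x h1).sub ((Phi_hasFDerivAt m hε _).comp x h2)
  · rw [mem_closedBall_zero_iff] at hx
    have := hC ε hε a (a + x + η) (a + x) ha ?_ ?_
    · simpa using this
    · have : a + x + η - a = x + η := by abel
      rw [this]; exact (norm_add_le _ _).trans (by linarith)
    · simp; linarith

lemma Phi_second_taylor (m : ℝ) : ∃ C : ℝ, 0 ≤ C ∧ ∀ ε, 0 < ε → ∀ (a b c d : Euc n) (r : ℝ),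
    a ≠ 0 → r ≤ ‖a‖ / 8 → ‖b - a‖ ≤ r → ‖c - a‖ ≤ r → ‖d - a‖ ≤ r →
    ‖Phi ε m d - Phi ε m c - (Phi ε m b - Phi ε m a)
        - fderiv ℝ (Phi ε m) a (d - c - (b - a))‖
      ≤ C * ‖a‖ ^ (m - 1) * (r * ‖d - c - (b - a)‖ + ‖b - a‖ * ‖c - a‖) := by
  obtain ⟨C1, hC10, hC1⟩ := Phi_taylor (n := n) m
  obtain ⟨C2, hC20, hC2⟩ := Phi_second_diff (n := n) m
  refine ⟨2 * C1 + C2, by positivity, fun ε hε a b c d r ha hr hb hc hd => ?_⟩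
  have hr0 : 0 ≤ r := (norm_nonneg _).trans hb
  have hz : ‖a + (b - a) + (c - a) - a‖ ≤ 2 * r := by
    have : a + (b - a) + (c - a) - a = (b - a) + (c - a) := by abel
    rw [this]; exact (norm_add_le _ _).trans (by linarith)
  have k1 := hC1 ε hε a d (a + (b - a) + (c - a)) (2 * r) ha (by linarith) (by linarith) hz
  have k2 := hC2 ε hε a (b - a) (c - a) ha (by linarith) (by linarith)
  have e1 : d - (a + (b - a) + (c - a)) = d - c - (b - a) := by abel
  have e2 : a + (b - a) = b := by abel
  have e3 : a + (c - a) = c := by abel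
  rw [e1] at k1
  rw [e2, e3] at k2
  rw [e2] at k1
  have hP : 0 ≤ ‖a‖ ^ (m - 1) := by positivity
  calc _ = ‖(Phi ε m d - Phi ε m (b + (c - a)) - fderiv ℝ (Phi ε m) a (d - c - (b - a)))
        + (Phi ε m (b + (c - a)) - Phi ε m b - (Phi ε m c - Phi ε m a))‖ := by
        congr 1; abel
    _ ≤ C1 * ‖a‖ ^ (m - 1) * (2 * r) * ‖d - c - (b - a)‖
        + C2 * ‖a‖ ^ (m - 1) * ‖b - a‖ * ‖c - a‖ := (norm_add_le _ _).trans (add_le_add k1 k2)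
    _ ≤ _ := by
        have h1 : 0 ≤ C2 * ‖a‖ ^ (m - 1) * (r * ‖d - c - (b - a)‖) := by positivity
        have h2 : 0 ≤ C1 * ‖a‖ ^ (m - 1) * (‖b - a‖ * ‖c - a‖) := by positivity
        nlinarith

lemma pv_eq_Phi_on_ball (m : ℝ) {a y : Euc n} (ha : a ≠ 0) (hy : ‖y - a‖ ≤ ‖a‖ / 2) :
    pv m y = Phi (‖a‖ / 4) m y := by
  have hap : 0 < ‖a‖ := norm_pos_iff.2 ha
  have h1 : ‖a‖ / 2 ≤ ‖y‖ := by
    have := norm_sub_norm_le a y; rw [norm_sub_rev] at this; linarith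
  refine (Phi_eq_pv (by positivity) ?_).symm
  nlinarith

lemma pvD_eq_Phi (m : ℝ) {a : Euc n} (ha : a ≠ 0) :
    pvD m a = fderiv ℝ (Phi (‖a‖ / 4) m) a := by
  have hap : 0 < ‖a‖ := norm_pos_iff.2 ha
  exact (Phi_fderiv_eq m (by positivity) (by nlinarith)).symm

lemma pv_taylor (m : ℝ) : ∃ C : ℝ, 0 ≤ C ∧ ∀ (a y z : Euc n) (r : ℝ), a ≠ 0 →
    r ≤ ‖a‖ / 2 → ‖y - a‖ ≤ r → ‖z - a‖ ≤ r →
    ‖pv m y - pv m z - pvD m a (y - z)‖ ≤ C * ‖a‖ ^ (m - 1) * r * ‖y - z‖ := by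
  obtain ⟨C, hC0, hC⟩ := Phi_taylor (n := n) m
  refine ⟨C, hC0, fun a y z r ha hr hy hz => ?_⟩
  rw [pv_eq_Phi_on_ball m ha (hy.trans hr), pv_eq_Phi_on_ball m ha (hz.trans hr), pvD_eq_Phi m ha]
  exact hC _ (by have := norm_pos_iff.2 ha; positivity) a y z r ha hr hy hz

lemma pv_second_taylor (m : ℝ) : ∃ C : ℝ, 0 ≤ C ∧ ∀ (a b c d : Euc n) (r : ℝ),
    a ≠ 0 → r ≤ ‖a‖ / 8 → ‖b - a‖ ≤ r → ‖c - a‖ ≤ r → ‖d - a‖ ≤ r →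
    ‖pv m d - pv m c - (pv m b - pv m a) - pvD m a (d - c - (b - a))‖
      ≤ C * ‖a‖ ^ (m - 1) * (r * ‖d - c - (b - a)‖ + ‖b - a‖ * ‖c - a‖) := by
  obtain ⟨C, hC0, hC⟩ := Phi_second_taylor (n := n) m
  refine ⟨C, hC0, fun a b c d r ha hr hb hc hd => ?_⟩
  have hap := norm_pos_iff.2 ha
  rw [pv_eq_Phi_on_ball m ha (y := d) (by linarith), pv_eq_Phi_on_ball m ha (y := c) (by linarith),
    pv_eq_Phi_on_ball m ha (y := b) (by linarith), pv_eq_Phi_on_ball m ha (y := a) (by simp; positivity),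
    pvD_eq_Phi m ha]
  exact hC _ (by positivity) a b c d r ha hr hb hc hd

lemma pvD_norm_le (m : ℝ) {a : Euc n} (ha : a ≠ 0) (ξ : Euc n) :
    ‖pvD m a ξ‖ ≤ (1 + |m|) * ‖a‖ ^ m * ‖ξ‖ := by
  have hap := norm_pos_iff.2 ha
  rw [pvD_apply]
  refine (norm_add_le _ _).trans ?_
  rw [norm_smul, norm_smul, norm_smul, norm_mul, norm_eq_abs, norm_eq_abs,
    norm_eq_abs, norm_eq_abs, abs_of_pos (rpow_pos_of_pos hap _),
    abs_of_pos (rpow_pos_of_pos hap _)]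
  have h1 : |⟪a, ξ⟫_ℝ| ≤ ‖a‖ * ‖ξ‖ := abs_real_inner_le_norm _ _
  have h2 : ‖a‖ ^ m = ‖a‖ ^ (m - 2) * ‖a‖ ^ 2 := by
    rw [← rpow_natCast, ← rpow_add hap]; norm_num
  calc _ ≤ ‖a‖ ^ m * ‖ξ‖ + |m| * ‖a‖ ^ (m - 2) * ((‖a‖ * ‖ξ‖) * ‖a‖) := by gcongr
    _ = _ := by rw [h2]; ring

lemma pvD_coercive (m : ℝ) {a : Euc n} (ha : a ≠ 0) (ξ : Euc n) :
    min 1 (1 + m) * ‖a‖ ^ m * ‖ξ‖ ^ 2 ≤ ⟪pvD m a ξ, ξ⟫_ℝ := by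
  have hap := norm_pos_iff.2 ha
  rw [pvD_apply, inner_add_left, real_inner_smul_left, real_inner_smul_left, real_inner_smul_left,
    real_inner_self_eq_norm_sq]
  have h1 : ⟪a, ξ⟫_ℝ ^ 2 ≤ ‖a‖ ^ 2 * ‖ξ‖ ^ 2 := by
    rw [← mul_pow]; exact sq_le_sq' (by have := abs_le.1 (abs_real_inner_le_norm a ξ); linarith)
      (real_inner_le_norm _ _)
  have h2 : ‖a‖ ^ m = ‖a‖ ^ (m - 2) * ‖a‖ ^ 2 := by
    rw [← rpow_natCast, ← rpow_add hap]; norm_num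
  have hP : 0 < ‖a‖ ^ (m - 2) := rpow_pos_of_pos hap _
  rw [h2]
  rcases le_total 0 m with hm | hm
  · have : min 1 (1 + m) = 1 := min_eq_left (by linarith)
    rw [this]
    have : 0 ≤ m * ‖a‖ ^ (m - 2) * (⟪a, ξ⟫_ℝ * ⟪a, ξ⟫_ℝ) := by
      have := mul_self_nonneg ⟪a, ξ⟫_ℝ
      positivity
    linarith
  · have : min 1 (1 + m) = 1 + m := min_eq_right (by linarith)
    rw [this]
    have : (-m) * ‖a‖ ^ (m - 2) * (⟪a, ξ⟫_ℝ ^ 2) ≤ (-m) * ‖a‖ ^ (m - 2) * (‖a‖ ^ 2 * ‖ξ‖ ^ 2) := by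
      gcongr
      exact mul_nonneg (by linarith) hP.le
    nlinarith

lemma pvD_symm (m : ℝ) (a ξ η : Euc n) : ⟪pvD m a ξ, η⟫_ℝ = ⟪pvD m a η, ξ⟫_ℝ := by
  simp only [pvD_apply, inner_add_left, real_inner_smul_left, real_inner_comm η ξ]
  ring

lemma pv_norm (m : ℝ) (hz : z ≠ 0) : ‖pv m z‖ = ‖z‖ ^ (m + 1) := by
  have hp := norm_pos_iff.2 hz
  rw [pv, norm_smul, norm_of_nonneg (by positivity), rpow_add_one hp.ne']

lemma pv_norm_le (hm : -1 < m) (z : Euc n) : ‖pv m z‖ ≤ ‖z‖ ^ (m + 1) := by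
  by_cases hz : z = 0
  · rw [hz]; simp [pv]; positivity
  · exact (pv_norm m hz).le

lemma pv_continuous (hm : -1 < m) : Continuous (pv (n := n) m) := by
  rw [continuous_iff_continuousAt]
  intro z
  by_cases hz : z = 0
  · subst hz
    have h0 : pv m (0 : Euc n) = 0 := by simp [pv]
    rw [ContinuousAt, h0]
    refine squeeze_zero_norm (pv_norm_le hm) ?_
    have : Continuous fun z : Euc n => ‖z‖ ^ (m + 1) :=
      continuous_norm.rpow_const (fun _ => Or.inr (by linarith))
    have h := this.tendsto 0
    simpa [zero_rpow (by linarith : m + 1 ≠ 0)] using h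
  · exact (pv_hasFDerivAt m hz).continuousAt

lemma Phi_norm_sub_pv (hm : -1 < m) (hε : 0 < ε) (z : Euc n) :
    ‖Phi ε m z - pv m z‖ ≤ (2 * ε) ^ (m + 1) := by
  by_cases h : 2 * ε ^ 2 ≤ ‖z‖ ^ 2
  · rw [Phi_eq_pv hε h]; simp; positivity
  · push Not at h
    have hz : ‖z‖ ≤ 2 * ε := by
      by_contra hc; push Not at hc; nlinarith
    have h1 : Phi ε m z - pv m z = (cutT ε (‖z‖ ^ 2) - 1) • pv m z := by
      rw [Phi, pv, tr, sq_rpow_half (norm_nonneg _), sub_smul, one_smul, smul_smul]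
    rw [h1, norm_smul, norm_eq_abs]
    have h2 : |cutT ε (‖z‖ ^ 2) - 1| ≤ 1 := by
      rw [abs_le]; constructor <;> linarith [cutT_nonneg ε (‖z‖ ^ 2), cutT_le_one ε (‖z‖ ^ 2)]
    calc _ ≤ 1 * ‖z‖ ^ (m + 1) := by
          gcongr
          exact pv_norm_le hm z
      _ ≤ _ := by rw [one_mul]; exact rpow_le_rpow (norm_nonneg _) hz (by linarith)

/-- The `k`-th coordinate vector. -/
def ev (k : Fin n) : Euc n := EuclideanSpace.single k 1

/-- The difference quotient of `g` with step `h` in the direction `k`. -/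
def dq (h : ℝ) (k : Fin n)
    (g : Euc n → F) (x : Euc n) : F := h⁻¹ • (g (x + h • ev k) - g x)

section Basic

@[simp] lemma norm_ev (k : Fin n) : ‖ev k‖ = 1 := by simp [ev]

lemma norm_smul_ev (h : ℝ) (k : Fin n) : ‖h • ev k‖ = |h| := by simp [norm_smul]

lemma inner_ev (z : Euc n) (k : Fin n) : ⟪z, ev k⟫_ℝ = z k := by
  simp [ev, EuclideanSpace.inner_single_right]

lemma abs_apply_le_norm (z : Euc n) (k : Fin n) : |z k| ≤ ‖z‖ := by
  rw [← inner_ev]; simpa using abs_real_inner_le_norm z (ev k)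

lemma dq_continuous {g : Euc n → F} (hg : Continuous g) (h : ℝ) (k : Fin n) :
    Continuous (dq h k g) := by
  unfold dq; fun_prop

lemma dq_contDiff {m : WithTop ℕ∞} {g : Euc n → F} (hg : ContDiff ℝ m g) (h : ℝ) (k : Fin n) :
    ContDiff ℝ m (dq h k g) :=
  ((hg.comp (contDiff_id.add contDiff_const)).sub hg).const_smul _

lemma dq_hasFDerivAt {g : Euc n → F} {G : Euc n → Euc n →L[ℝ] F}
    (hg : ∀ x, HasFDerivAt g (G x) x) (h : ℝ) (k : Fin n) (x : Euc n) :
    HasFDerivAt (dq h k g) (dq h k G x) x := by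
  have h1 : HasFDerivAt (fun x => g (x + h • ev k)) (G (x + h • ev k)) x := by
    have := (hg (x + h • ev k)).comp x ((hasFDerivAt_id x).add_const (h • ev k))
    exact this.congr_fderiv (by ext; simp)
  exact (h1.sub (hg x)).const_smul _

lemma dq_clm {G : Type*} [NormedAddCommGroup G] [NormedSpace ℝ G] (L : F →L[ℝ] G)
    (g : Euc n → F) (h : ℝ) (k : Fin n) (x : Euc n) :
    dq h k (fun y => L (g y)) x = L (dq h k g x) := by
  simp [dq]

lemma dq_sub (f g : Euc n → F) (h : ℝ) (k : Fin n) (x : Euc n) :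
    dq h k (fun y => f y - g y) x = dq h k f x - dq h k g x := by
  simp only [dq, ← smul_sub]; congr 1; abel

lemma dq_comm (g : Euc n → F) (h h' : ℝ) (k l : Fin n) (x : Euc n) :
    dq h k (dq h' l g) x = dq h' l (dq h k g) x := by
  simp only [dq, ← smul_sub, smul_smul, mul_comm h⁻¹ h'⁻¹]
  congr 1
  rw [add_right_comm]; abel

lemma dq_norm_le_of_lipschitz {g : Euc n → F} (hL : ∀ x y, ‖g x - g y‖ ≤ L * ‖x - y‖)
    (hh : h ≠ 0) (k : Fin n) (x : Euc n) : ‖dq h k g x‖ ≤ L := by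
  have := hL (x + h • ev k) x
  rw [add_sub_cancel_left, norm_smul_ev] at this
  rw [dq, norm_smul, norm_inv, norm_eq_abs, inv_mul_le_iff₀ (abs_pos.2 hh)]
  linarith

lemma dq_tsupport_subset {g : Euc n → F} (k : Fin n) :
    Function.support (dq h k g) ⊆ cthickening |h| (tsupport g) := by
  intro x hx
  by_contra hc
  have h1 : g x = 0 := by
    by_contra h0
    exact hc (self_subset_cthickening _ (subset_tsupport _ h0))
  have h2 : g (x + h • ev k) = 0 := by
    by_contra h0
    refine hc (mem_cthickening_of_dist_le x _ |h| _ (subset_tsupport _ h0) ?_)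
    rw [dist_eq_norm]; simp [norm_smul]
  exact hx (by simp [dq, h1, h2])

lemma dq_cpt {g : Euc n → F} (hg : HasCompactSupport g) (h : ℝ) (k : Fin n) :
    HasCompactSupport (dq h k g) :=
  HasCompactSupport.of_support_subset_isCompact (IsCompact.cthickening hg) (dq_tsupport_subset k)

end Basic

lemma integral_shift (g : Euc n → F)
    (v : Euc n) : ∫ x, g (x + v) = ∫ x, g x := integral_add_right_eq_self g v

lemma integral_dq_mul (hg : Continuous g) (hφ : Continuous φ)
    (hφs : HasCompactSupport φ) (h : ℝ) (k : Fin n) :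
    ∫ x, dq h k g x * φ x = - ∫ x, g x * dq (-h) k φ x := by
  have i1 : Integrable (fun x => g (x + h • ev k) * φ x) :=
    Continuous.integrable_cpt (by fun_prop) hφs.mul_left
  have i2 : Integrable (fun x => g x * φ x) :=
    Continuous.integrable_cpt (by fun_prop) hφs.mul_left
  have i3 : Integrable (fun x => g x * φ (x + (-h) • ev k)) := by
    have := i1.comp_add_right ((-h) • ev k)
    refine this.congr (.of_forall fun x => ?_)
    simp
  have e1 : ∫ x, g (x + h • ev k) * φ x = ∫ x, g x * φ (x + (-h) • ev k) := by
    rw [← integral_shift (fun x => g x * φ (x + (-h) • ev k)) (h • ev k)]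
    simp
  calc ∫ x, dq h k g x * φ x = ∫ x, h⁻¹ * (g (x + h • ev k) * φ x - g x * φ x) := by
        congr 1; ext x; simp [dq]; ring
    _ = h⁻¹ * (∫ x, g x * φ (x + (-h) • ev k)) - h⁻¹ * ∫ x, g x * φ x := by
        rw [integral_const_mul, integral_sub i1 i2, e1]; ring
    _ = ∫ x, h⁻¹ * (g x * φ (x + (-h) • ev k) - g x * φ x) := by
        rw [integral_const_mul, integral_sub i3 i2]; ring
    _ = _ := by
        rw [← integral_neg]; congr 1; ext x; simp [dq, inv_neg]; ring

lemma hasFDerivAt_pd (hg : Smooth g) (x : Euc n) :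
    HasFDerivAt g (fderiv ℝ g x) x := (hg.differentiable (by simp) x).hasFDerivAt

lemma pd_contDiff (hg : Smooth g) (k : Fin n) :
    Smooth (pd g k) :=
  (hg.fderiv_right (m := (⊤ : ℕ∞)) (by simp)).clm_apply contDiff_const

lemma pd_cpt (hg : HasCompactSupport g) (k : Fin n) :
    HasCompactSupport (pd g k) :=
  HasCompactSupport.intro (hg.fderiv (𝕜 := ℝ)) (fun x hx => by
    have : fderiv ℝ g x = 0 := by
      by_contra h; exact hx (subset_tsupport _ h)
    simp [pd, this])

lemma tsupport_pd_subset (g : Euc n → ℝ) (k : Fin n) : tsupport (pd g k) ⊆ tsupport g := by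
  refine closure_minimal (fun x hx => ?_) (isClosed_tsupport g)
  refine support_fderiv_subset ℝ (f := g) fun h => hx ?_
  simp [pd, h]

lemma exists_lipschitz {g : Euc n → F}
    (hg : ContDiff ℝ 1 g) (hs : HasCompactSupport g) :
    ∃ L : ℝ, 0 ≤ L ∧ ∀ x y, ‖g x - g y‖ ≤ L * ‖x - y‖ := by
  obtain ⟨L, hL⟩ := hg.lipschitzWith_of_hasCompactSupport hs (by simp)
  exact ⟨L, L.2, fun x y => hL.norm_sub_le x y⟩

lemma dq_sub_le {G : Euc n → Euc n →L[ℝ] ℝ} (hg : ∀ x, HasFDerivAt g (G x) x)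
    (k : Fin n) (hL : ∀ x y, |G x (ev k) - G y (ev k)| ≤ L * ‖x - y‖)
    (hh : h ≠ 0) (x : Euc n) : |dq h k g x - G x (ev k)| ≤ L * |h| := by
  have hd : ∀ t : ℝ, HasDerivAt (fun t : ℝ => g (x + t • ev k) - t * G x (ev k))
      (G (x + t • ev k) (ev k) - G x (ev k)) t := by
    intro t
    have h1 : HasDerivAt (fun t : ℝ => x + t • ev k) (ev k) t := by
      simpa using ((hasDerivAt_id t).smul_const (ev k)).const_add x
    have h2 := (hg (x + t • ev k)).comp_hasDerivAt t h1
    exact h2.sub (by simpa using (hasDerivAt_id t).mul_const (G x (ev k)))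
  have hL0 : 0 ≤ L * |h| := by
    have h0 := hL (x + h • ev k) x
    rw [add_sub_cancel_left, norm_smul_ev] at h0
    exact (abs_nonneg _).trans h0
  have key := (convex_uIcc (0:ℝ) h).norm_image_sub_le_of_norm_hasDerivWithin_le
    (fun t _ => (hd t).hasDerivWithinAt) (C := L * |h|) (x := 0) (y := h) (fun t ht => ?_)
    left_mem_uIcc right_mem_uIcc
  · simp only [zero_smul, add_zero, zero_mul, sub_zero, norm_eq_abs] at key
    have : dq h k g x - G x (ev k) = h⁻¹ * (g (x + h • ev k) - h * G x (ev k) - g x) := by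
      rw [dq, smul_eq_mul]; field_simp; ring
    rw [this, abs_mul, abs_inv, inv_mul_le_iff₀ (abs_pos.2 hh)]
    linarith
  · have h0 := hL (x + t • ev k) x
    rw [add_sub_cancel_left, norm_smul_ev] at h0
    refine h0.trans ?_
    have hL' : 0 ≤ L := by
      by_contra hc; push Not at hc
      have : L * |h| < 0 := mul_neg_of_neg_of_pos hc (abs_pos.2 hh)
      linarith
    have : |t| ≤ |h| := by simpa using abs_sub_left_of_mem_uIcc ht
    gcongr

lemma dq_sub_pd_le (hφ : Smooth φ) (hs : HasCompactSupport φ)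
    (k : Fin n) : ∃ L : ℝ, 0 ≤ L ∧ ∀ h : ℝ, h ≠ 0 → ∀ x, |dq h k φ x - pd φ k x| ≤ L * |h| := by
  obtain ⟨L, hL0, hL⟩ := exists_lipschitz ((pd_contDiff hφ k).of_le (by simp))
    (pd_cpt hs k)
  exact ⟨L, hL0, fun h hh x => dq_sub_le (hasFDerivAt_pd hφ) k hL hh x⟩

lemma dq_dq_sub_pd_le (hφ : Smooth φ) (hs : HasCompactSupport φ)
    (j k : Fin n) : ∃ L : ℝ, 0 ≤ L ∧ ∀ h : ℝ, h ≠ 0 → ∀ x,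
      |dq h j (dq h k φ) x - pd (pd φ k) j x| ≤ L * |h| := by
  obtain ⟨L1, hL10, hL1⟩ := dq_sub_pd_le (pd_contDiff hφ k) (pd_cpt hs k) j
  choose L2 hL20 hL2 using fun i => dq_sub_pd_le (pd_contDiff hφ i) (pd_cpt hs i) k
  have hsw : ∀ x i, pd (pd φ i) k x = pd (pd φ k) i x := by
    intro x i
    have hsymm : IsSymmSndFDerivAt ℝ φ x :=
      ((contDiff_infty.1 hφ 2).contDiffAt (x := x)).isSymmSndFDerivAt
        (by simp)
    have hd : DifferentiableAt ℝ (fderiv ℝ φ) x :=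
      (hφ.fderiv_right (m := (⊤ : ℕ∞)) (by simp)).differentiable (by simp) x
    have e : ∀ i k, pd (pd φ i) k x = fderiv ℝ (fderiv ℝ φ) x (ev k) (ev i) := by
      intro i k
      have h1 : HasFDerivAt (pd φ i) ((fderiv ℝ (fderiv ℝ φ) x).flip (ev i)) x := by
        have := hd.hasFDerivAt.clm_apply (hasFDerivAt_const (ev i) x)
        exact this.congr_fderiv (by ext; simp)
      rw [pd, h1.fderiv]; rfl
    rw [e, e]; exact hsymm _ _
  refine ⟨L2 j + L1, add_nonneg (hL20 j) hL10, fun h hh x => ?_⟩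
  have h1 : |dq h j (fun y => dq h k φ y - pd φ k y) x| ≤ L2 j * |h| := by
    have hdiff : ∀ y, HasFDerivAt (fun y => dq h k φ y - pd φ k y)
        (dq h k (fderiv ℝ φ) y - fderiv ℝ (pd φ k) y) y := fun y =>
      (dq_hasFDerivAt (hasFDerivAt_pd hφ) h k y).sub (hasFDerivAt_pd (pd_contDiff hφ k) y)
    have hb : ∀ y, |(dq h k (fderiv ℝ φ) y - fderiv ℝ (pd φ k) y) (ev j)| ≤ L2 j * |h| := by
      intro y
      have e1 : (dq h k (fderiv ℝ φ) y - fderiv ℝ (pd φ k) y) (ev j)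
          = dq h k (pd φ j) y - pd (pd φ j) k y := by
        rw [hsw y j]
        simp [dq, pd, ev]
      rw [e1]; exact hL2 j h hh y
    have hcurve : ∀ t : ℝ, HasDerivAt (fun t : ℝ => dq h k φ (x + t • ev j) - pd φ k (x + t • ev j))
        ((dq h k (fderiv ℝ φ) (x + t • ev j) - fderiv ℝ (pd φ k) (x + t • ev j)) (ev j)) t := by
      intro t
      have h1 : HasDerivAt (fun t : ℝ => x + t • ev j) (ev j) t := by
        simpa using ((hasDerivAt_id t).smul_const (ev j)).const_add x
      exact (hdiff (x + t • ev j)).comp_hasDerivAt t h1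
    have key := convex_univ.norm_image_sub_le_of_norm_hasDerivWithin_le
      (fun t _ => (hcurve t).hasDerivWithinAt) (fun t _ => hb _) (mem_univ (0:ℝ)) (mem_univ h)
    simp only [zero_smul, add_zero, sub_zero, norm_eq_abs] at key
    rw [dq, smul_eq_mul, abs_mul, abs_inv, inv_mul_le_iff₀ (abs_pos.2 hh)]
    linarith
  rw [dq_sub] at h1
  have h2 := hL1 h hh x
  calc |dq h j (dq h k φ) x - pd (pd φ k) j x|
      = |(dq h j (dq h k φ) x - dq h j (pd φ k) x) + (dq h j (pd φ k) x - pd (pd φ k) j x)| := by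
        congr 1; ring
    _ ≤ _ := (abs_add_le _ _).trans (by linarith)

lemma tendsto_integral_mul_of_rate {φh : ℝ → Euc n → ℝ} (hg : Continuous g)
    (hφ : Continuous φ) (hφh : ∀ h, Continuous (φh h)) (hK : IsCompact K)
    (hφK : ∀ x ∉ K, φ x = 0) (hφhK : ∀ h, |h| ≤ 1 → ∀ x ∉ K, φh h x = 0)
    (hL : ∀ h, h ≠ 0 → ∀ x, |φh h x - φ x| ≤ L * |h|) :
    Tendsto (fun h => ∫ x, g x * φh h x) (𝓝[≠] 0) (𝓝 (∫ x, g x * φ x)) := by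
  have hint : ∀ {ψ : Euc n → ℝ}, Continuous ψ → (∀ x ∉ K, ψ x = 0) →
      Integrable (fun x => g x * ψ x) := fun hψ h0 =>
    (hg.mul hψ).integrable_cpt
      (HasCompactSupport.intro hK fun x hx => by simp [h0 x hx])
  rw [tendsto_iff_norm_sub_tendsto_zero]
  have hb : ∀ᶠ h in 𝓝[≠] (0:ℝ), ‖(∫ x, g x * φh h x) - ∫ x, g x * φ x‖
      ≤ (∫ x in K, |g x|) * L * |h| := by
    have hmem : closedBall (0:ℝ) 1 ∈ 𝓝[≠] (0:ℝ) :=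
      mem_nhdsWithin_of_mem_nhds (closedBall_mem_nhds _ one_pos)
    filter_upwards [hmem, self_mem_nhdsWithin] with h h1 h0
    have hh1 : |h| ≤ 1 := by simpa using h1
    rw [← integral_sub (hint (hφh h) (hφhK h hh1)) (hint hφ hφK)]
    have e : (fun x => g x * φh h x - g x * φ x) = K.indicator (fun x => g x * (φh h x - φ x)) := by
      ext x
      by_cases hx : x ∈ K
      · simp [hx]; ring
      · simp [hx, hφK x hx, hφhK h hh1 x hx]
    rw [e, integral_indicator hK.measurableSet, mul_assoc, ← integral_mul_const]
    refine norm_integral_le_of_norm_le ?_ (.of_forall fun x => ?_)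
    · exact (hg.abs.continuousOn.integrableOn_compact hK).mul_const _
    · rw [norm_mul, norm_eq_abs, norm_eq_abs]
      gcongr
      exact hL h h0 x
  refine squeeze_zero' (.of_forall fun _ => norm_nonneg _) hb ?_
  have : Tendsto (fun h : ℝ => (∫ x in K, |g x|) * L * |h|) (𝓝 0) (𝓝 0) := by
    have hc : Continuous (fun h : ℝ => (∫ x in K, |g x|) * L * |h|) := by fun_prop
    simpa using hc.tendsto 0
  exact this.mono_left nhdsWithin_le_nhds

lemma tendsto_integral_mul_dq (hg : Continuous g)
    (hφ : Smooth φ) (hs : HasCompactSupport φ) (k : Fin n) :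
    Tendsto (fun h => ∫ x, g x * dq h k φ x) (𝓝[≠] 0) (𝓝 (∫ x, g x * pd φ k x)) := by
  obtain ⟨L, -, hL⟩ := dq_sub_pd_le hφ hs k
  refine tendsto_integral_mul_of_rate hg (pd_contDiff hφ k).continuous
    (fun h => dq_continuous hφ.continuous h k) (K := cthickening 1 (tsupport φ))
    (IsCompact.cthickening hs) (fun x hx => ?_) (fun h hh x hx => ?_) hL
  · by_contra h0
    exact hx (self_subset_cthickening _ (tsupport_pd_subset φ k (subset_tsupport _ h0)))
  · by_contra h0
    exact hx (cthickening_mono hh _ (dq_tsupport_subset k h0))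

lemma tendsto_integral_mul_dq_dq (hg : Continuous g)
    (hφ : Smooth φ) (hs : HasCompactSupport φ) (j k : Fin n) :
    Tendsto (fun h => ∫ x, g x * dq h j (dq h k φ) x) (𝓝[≠] 0)
      (𝓝 (∫ x, g x * pd (pd φ k) j x)) := by
  obtain ⟨L, -, hL⟩ := dq_dq_sub_pd_le hφ hs j k
  refine tendsto_integral_mul_of_rate hg (pd_contDiff (pd_contDiff hφ k) j).continuous
    (fun h => dq_continuous (dq_continuous hφ.continuous h k) h j)
    (K := cthickening 2 (tsupport φ))
    (IsCompact.cthickening hs) (fun x hx => ?_) (fun h hh x hx => ?_) hL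
  · by_contra h0
    exact hx (self_subset_cthickening _ (tsupport_pd_subset φ k
      (tsupport_pd_subset _ j (subset_tsupport _ h0))))
  · by_contra h0
    have hx1 := dq_tsupport_subset j h0
    have hx2 : x ∈ cthickening (|h| + |h|) (tsupport φ) := by
      refine cthickening_cthickening_subset (abs_nonneg _) (abs_nonneg _) _
        (cthickening_subset_of_subset _ ?_ hx1)
      exact closure_minimal (dq_tsupport_subset k) isClosed_cthickening
    exact hx (cthickening_mono (by linarith) _ hx2)

lemma dq_eq_integral [CompleteSpace F]
    {g : Euc n → F} {G : Euc n → Euc n →L[ℝ] F} (hg : ∀ x, HasFDerivAt g (G x) x)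
    (hG : Continuous G) (hh : h ≠ 0) (l : Fin n) (x : Euc n) :
    dq h l g x = ∫ t in Ioc (0:ℝ) 1, G (x + (t * h) • ev l) (ev l) := by
  have hd : ∀ t : ℝ, HasDerivAt (fun t : ℝ => g (x + (t * h) • ev l))
      (h • G (x + (t * h) • ev l) (ev l)) t := by
    intro t
    have h1 : HasDerivAt (fun t : ℝ => x + (t * h) • ev l) (h • ev l) t := by
      simpa using (((hasDerivAt_id t).mul_const h).smul_const (ev l)).const_add x
    have := (hg (x + (t * h) • ev l)).comp_hasDerivAt t h1
    rw [map_smul] at this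
    exact this
  have hc : Continuous fun t : ℝ => G (x + (t * h) • ev l) (ev l) := by fun_prop
  have key := intervalIntegral.integral_eq_sub_of_hasDerivAt (a := 0) (b := 1)
    (fun t _ => hd t) ((hc.const_smul h).intervalIntegrable _ _)
  rw [intervalIntegral.integral_smul, intervalIntegral.integral_of_le zero_le_one] at key
  rw [dq]
  simp only [one_mul, zero_mul, zero_smul, add_zero] at key
  rw [← key, smul_smul, inv_mul_cancel₀ hh, one_smul]

lemma enorm_dq_rpow_le [CompleteSpace F]
    {g : Euc n → F} {G : Euc n → Euc n →L[ℝ] F} (hg : ∀ x, HasFDerivAt g (G x) x)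
    (hG : Continuous G) (hr : 1 ≤ r) (hh : h ≠ 0) (l : Fin n) (x : Euc n) :
    ‖dq h l g x‖ₑ ^ r ≤ ∫⁻ t in Ioc (0:ℝ) 1, ‖G (x + (t * h) • ev l) (ev l)‖ₑ ^ r := by
  have hr0 : 0 < r := by linarith
  have hc : Continuous fun t : ℝ => G (x + (t * h) • ev l) (ev l) := by fun_prop
  have : IsProbabilityMeasure (volume.restrict (Ioc (0:ℝ) 1)) := ⟨by simp⟩
  have h1 := eLpNorm'_le_eLpNorm'_of_exponent_le (μ := volume.restrict (Ioc (0:ℝ) 1))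
    one_pos hr hc.aestronglyMeasurable
  rw [eLpNorm'_eq_lintegral_enorm, eLpNorm'_eq_lintegral_enorm] at h1
  simp only [ENNReal.rpow_one, one_div, inv_one] at h1
  have h2 : ‖dq h l g x‖ₑ ≤
      (∫⁻ t in Ioc (0:ℝ) 1, ‖G (x + (t * h) • ev l) (ev l)‖ₑ ^ r) ^ (r⁻¹) := by
    rw [dq_eq_integral hg hG hh]
    exact (enorm_integral_le_lintegral_enorm _).trans h1
  calc _ ≤ ((∫⁻ t in Ioc (0:ℝ) 1, ‖G (x + (t * h) • ev l) (ev l)‖ₑ ^ r) ^ (r⁻¹)) ^ r := by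
        gcongr
    _ = _ := by rw [← ENNReal.rpow_mul, inv_mul_cancel₀ hr0.ne', ENNReal.rpow_one]

lemma lintegral_dq_le [CompleteSpace F]
    {g : Euc n → F} {G : Euc n → Euc n →L[ℝ] F} (hg : ∀ x, HasFDerivAt g (G x) x)
    (hG : Continuous G) (hr : 1 ≤ r) (hh : h ≠ 0) (l : Fin n)
    {ω ω' : Euc n → ℝ≥0∞} (hωm : Measurable ω)
    (hω : ∀ x v, ‖v‖ ≤ |h| → ω x ≤ ω' (x + v)) :
    ∫⁻ x, ω x * ‖dq h l g x‖ₑ ^ r ≤ ∫⁻ x, ω' x * ‖G x (ev l)‖ₑ ^ r := by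
  have hc : Continuous fun z : Euc n × ℝ => G (z.1 + (z.2 * h) • ev l) (ev l) := by fun_prop
  calc ∫⁻ x, ω x * ‖dq h l g x‖ₑ ^ r
      ≤ ∫⁻ x, ∫⁻ t in Ioc (0:ℝ) 1, ω x * ‖G (x + (t * h) • ev l) (ev l)‖ₑ ^ r := by
        refine lintegral_mono fun x => ?_
        have hc : Continuous fun t : ℝ => G (x + (t * h) • ev l) (ev l) := by fun_prop
        rw [lintegral_const_mul _ (hc.enorm.measurable.pow_const r)]
        gcongr
        exact enorm_dq_rpow_le hg hG hr hh l x
    _ = ∫⁻ t in Ioc (0:ℝ) 1, ∫⁻ x, ω x * ‖G (x + (t * h) • ev l) (ev l)‖ₑ ^ r := by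
        refine lintegral_lintegral_swap ?_
        exact ((hωm.comp measurable_fst).mul (hc.enorm.measurable.pow_const r)).aemeasurable
    _ ≤ ∫⁻ t in Ioc (0:ℝ) 1, ∫⁻ x, ω' x * ‖G x (ev l)‖ₑ ^ r := by
        refine setLIntegral_mono measurable_const fun t ht => ?_
        rw [← lintegral_add_right_eq_self (fun x => ω' x * ‖G x (ev l)‖ₑ ^ r) ((t * h) • ev l)]
        refine lintegral_mono fun x => ?_
        gcongr
        refine hω _ _ ?_
        rw [norm_smul_ev, abs_mul, abs_of_pos ht.1]
        exact mul_le_of_le_one_left (abs_nonneg _) ht.2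
    _ = _ := by simp

lemma ofReal_setIntegral_weight {F : Type*} [NormedAddCommGroup F] {A : Set (Euc n)}
    (hA : IsCompact A) (hω0 : ∀ x ∈ A, 0 ≤ ω x) (hω : ContinuousOn ω A)
    {v : Euc n → F} (hv : Continuous v) (hr : 0 ≤ r) :
    ofReal (∫ x in A, ω x * ‖v x‖ ^ r)
      = ∫⁻ x, A.indicator (fun x => ofReal (ω x)) x * ‖v x‖ₑ ^ r := by
  rw [ofReal_integral_eq_lintegral_ofReal]
  · rw [← lintegral_indicator hA.measurableSet]
    congr 1; ext x
    by_cases hx : x ∈ A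
    · simp only [indicator_of_mem hx]
      rw [ofReal_mul (hω0 x hx), ← ofReal_rpow_of_nonneg (norm_nonneg _) hr,
        ofReal_norm]
    · simp [indicator_of_notMem hx]
  · refine ContinuousOn.integrableOn_compact hA ?_
    exact hω.mul ((hv.norm.continuousOn).rpow_const fun x _ => Or.inr hr)
  · filter_upwards [ae_restrict_mem hA.measurableSet] with x hx
    exact mul_nonneg (hω0 x hx) (by positivity)

lemma setIntegral_dq_le [CompleteSpace F]
    {g : Euc n → F} {G : Euc n → Euc n →L[ℝ] F} (hg : ∀ x, HasFDerivAt g (G x) x)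
    (hG : Continuous G) (hr : 1 ≤ r) (hh : h ≠ 0) (l : Fin n)
    {A B : Set (Euc n)} (hA : IsCompact A) (hB : IsCompact B)
    (hω0 : ∀ x ∈ B, 0 ≤ ω x) (hω : ContinuousOn ω B) (hc : 0 ≤ c)
    (hAB : ∀ x ∈ A, ∀ v, ‖v‖ ≤ |h| → x + v ∈ B ∧ ω x ≤ c * ω (x + v)) :
    ∫ x in A, ω x * ‖dq h l g x‖ ^ r ≤ c * ∫ x in B, ω x * ‖G x (ev l)‖ ^ r := by
  have hsub : A ⊆ B := fun x hx => by simpa using (hAB x hx 0 (by simp)).1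
  have hgc : Continuous g := continuous_iff_continuousAt.2 fun x => (hg x).continuousAt
  have hr0 : 0 ≤ r := by linarith
  rw [← ofReal_le_ofReal_iff (mul_nonneg hc (setIntegral_nonneg hB.measurableSet
    fun x hx => mul_nonneg (hω0 x hx) (by positivity))), ofReal_mul hc,
    ofReal_setIntegral_weight hA (fun x hx => hω0 x (hsub hx)) (hω.mono hsub)
      (dq_continuous hgc h l) hr0,
    ofReal_setIntegral_weight hB hω0 hω (v := fun x => G x (ev l)) (by fun_prop) hr0,
    ← lintegral_const_mul' _ _ ofReal_ne_top]
  have hmeas : Measurable (A.indicator fun x => ofReal (ω x)) := by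
    have : A.indicator (fun x => ofReal (ω x))
        = fun x => ofReal (A.indicator ω x) := by
      ext x; by_cases hx : x ∈ A <;> simp [hx]
    rw [this]
    refine ENNReal.measurable_ofReal.comp ?_
    classical
    have h := (hω.mono hsub).measurable_piecewise (g := fun _ => 0) continuousOn_const
      hA.measurableSet
    exact piecewise_eq_indicator (s := A) (f := ω) ▸ h
  calc _ ≤ ∫⁻ x, (ofReal c * B.indicator (fun x => ofReal (ω x)) x)
          * ‖G x (ev l)‖ₑ ^ r := by
        refine lintegral_dq_le hg hG hr hh l hmeas fun x v hv => ?_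
        by_cases hx : x ∈ A
        · obtain ⟨h1, h2⟩ := hAB x hx v hv
          rw [indicator_of_mem hx, indicator_of_mem h1, ← ofReal_mul hc]
          exact ofReal_le_ofReal h2
        · simp [hx]
    _ = _ := by simp_rw [mul_assoc]

lemma integral_dq_le [CompleteSpace F]
    {g : Euc n → F} {G : Euc n → Euc n →L[ℝ] F} (hg : ∀ x, HasFDerivAt g (G x) x)
    (hG : Continuous G) (hs : HasCompactSupport g) (hr : 1 ≤ r) (hh : h ≠ 0)
    (l : Fin n) : ∫ x, ‖dq h l g x‖ ^ r ≤ ∫ x, ‖G x (ev l)‖ ^ r := by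
  have hr0 : r ≠ 0 := by linarith
  have hGs : ∀ x ∉ tsupport g, G x = 0 := fun x hx => by
    rw [← (hg x).fderiv]
    by_contra h0
    exact hx (support_fderiv_subset ℝ h0)
  have h1 := setIntegral_dq_le hg hG hr hh l (A := cthickening |h| (tsupport g))
    (B := cthickening (|h| + |h|) (tsupport g)) (IsCompact.cthickening hs)
    (IsCompact.cthickening hs) (ω := fun _ => 1) (by simp) continuousOn_const zero_le_one
    (fun x hx v hv => ⟨?_, by simp⟩)
  · simp only [one_mul] at h1
    rwa [setIntegral_eq_of_off,
      setIntegral_eq_of_off] at h1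
    · intro x hx
      rw [hGs x (fun hx' => hx (self_subset_cthickening _ hx'))]
      simp [hr0]
    · intro x hx
      have : dq h l g x = 0 := by
        by_contra h0
        exact hx (dq_tsupport_subset l h0)
      simp [this, hr0]
  · refine cthickening_cthickening_subset (abs_nonneg _) (abs_nonneg _) _ ?_
    refine mem_cthickening_of_dist_le _ x _ _ hx ?_
    simpa [dist_eq_norm] using hv

/-- `-div V = g` weakly, tested against `C¹` functions compactly supported in `O`. -/
def WeakEq (O : Set (Euc n)) (V : Euc n → Euc n) (g : Euc n → ℝ) : Prop :=
  ∀ φ : Euc n → ℝ, ContDiff ℝ 1 φ → HasCompactSupport φ → tsupport φ ⊆ O →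
    ∫ x, fderiv ℝ φ x (V x) = ∫ x, g x * φ x

lemma WeakEq.dq {O' : Set (Euc n)} {V : Euc n → Euc n}
    (hw : WeakEq O V g) (hV : Continuous V) (hg : Continuous g) (k : Fin n)
    (hO : ∀ x ∈ O', x ∈ O ∧ x + h • ev k ∈ O) : WeakEq O' (dq h k V) (dq h k g) := by
  intro φ hφ hs hsub
  have hc : Continuous (fderiv ℝ φ) := hφ.continuous_fderiv (by simp)
  have e1 := hw φ hφ hs (fun x hx => (hO x (hsub hx)).1)
  have hφ' : ContDiff ℝ 1 (fun x => φ (x - h • ev k)) := hφ.comp (contDiff_id.sub contDiff_const)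
  have hs' : HasCompactSupport (fun x => φ (x - h • ev k)) :=
    hs.comp_homeomorph (Homeomorph.subRight (h • ev k))
  have hts : tsupport (fun x => φ (x - h • ev k)) ⊆ O := by
    have h1 : tsupport (fun x => φ (x - h • ev k)) ⊆ (fun x => x - h • ev k) ⁻¹' tsupport φ :=
      closure_minimal (fun x hx => subset_tsupport φ hx)
        ((isClosed_tsupport φ).preimage (by fun_prop))
    intro x hx
    have := (hO _ (hsub (h1 hx))).2
    simpa using this
  have e2 := hw _ hφ' hs' hts
  have hfd : ∀ x, fderiv ℝ (fun x => φ (x - h • ev k)) x = fderiv ℝ φ (x - h • ev k) :=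
    fun x => fderiv_comp_sub (𝕜 := ℝ) (f := φ) (h • ev k)
  simp_rw [hfd] at e2
  rw [← integral_shift _ (h • ev k), ← integral_shift (fun x => g x * _) (h • ev k)] at e2
  simp only [add_sub_cancel_right] at e2
  have i0 : ∀ v : Euc n, Integrable (fun x => fderiv ℝ φ x (V (x + v))) := fun v =>
    Continuous.integrable_cpt (by fun_prop)
      ((hs.fderiv (𝕜 := ℝ)).mono fun x hx h0 => hx (by simp [h0]))
  have i1 : ∀ v : Euc n, Integrable (fun x => g (x + v) * φ x) := fun v =>
    Continuous.integrable_cpt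
      ((hg.comp (by fun_prop)).mul hφ.continuous) hs.mul_left
  have i0' := i0 0
  have i1' := i1 0
  simp only [add_zero] at i0' i1'
  simp only [_root_.dq, map_smul, map_sub, smul_eq_mul, mul_assoc, sub_mul]
  rw [integral_const_mul, integral_const_mul, integral_sub (i0 _) i0', integral_sub (i1 _) i1',
    e1, e2]

/-- Localised data of a solution of the `p`-Laplace equation in an open set `O`. -/
structure PData (p : ℝ) (O : Set (Euc n)) (u f : Euc n → ℝ) (X : Euc n → Euc n) : Prop where
  one_lt : 1 < p
  lt_three : p < 3
  isOpen : IsOpen O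
  hasFDerivAt : ∀ x, HasFDerivAt u (innerSL ℝ (X x)) x
  cont : Continuous X
  cpt : HasCompactSupport u
  f_contDiff : ContDiff ℝ 1 f
  f_cpt : HasCompactSupport f
  eq : WeakEq O (fun x => pv (p - 2) (X x)) f

local notation "flux" => fun x => pv (p - 2) (X x)
local notation "∀₀" h "," A => Filter.Eventually (fun h => A) (𝓝[≠] (0:ℝ))

variable (P : PData p O u f X)

/-- The vector of difference quotients of `u`. -/
def dvec (h : ℝ) (u : Euc n → ℝ) (x : Euc n) : Euc n := WithLp.toLp 2 fun k => dq h k u x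

@[simp] lemma dvec_apply (h : ℝ) (u : Euc n → ℝ) (x : Euc n) (k : Fin n) :
    dvec h u x k = dq h k u x := rfl

lemma norm_le_sum_abs (z : Euc n) : ‖z‖ ≤ ∑ k, |z k| := by
  have : z = ∑ k, z k • ev k := by
    ext j
    simp [ev, Pi.single_apply]
  calc ‖z‖ = ‖∑ k, z k • ev k‖ := by rw [← this]
    _ ≤ ∑ k, ‖z k • ev k‖ := norm_sum_le _ _
    _ = ∑ k, |z k| := by simp [norm_smul]

/-- `h` is a step for which all relevant quantities oscillate at most by `η`. -/
structure GoodStep (X : Euc n → Euc n) (u : Euc n → ℝ) (η h : ℝ) : Prop where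
  ne : h ≠ 0
  osc : ∀ x v, ‖v‖ ≤ 2 * |h| → ‖X (x + v) - X x‖ ≤ η
  dvec : ∀ x, ‖dvec h u x - X x‖ ≤ η

namespace PData

include P

lemma u_contDiff : ContDiff ℝ 1 u := by
  rw [contDiff_one_iff_hasFDerivAt]
  exact ⟨fun x => innerSL ℝ (X x), (innerSL ℝ).continuous.comp P.cont, P.hasFDerivAt⟩

lemma X_eq_zero (hx : x ∉ tsupport u) : X x = 0 := by
  have h1 : fderiv ℝ u x = 0 := by
    by_contra h0; exact hx (support_fderiv_subset ℝ h0)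
  rw [(P.hasFDerivAt x).fderiv] at h1
  have := congrArg (fun L => L (X x)) h1
  simpa using this

lemma X_cpt : HasCompactSupport X :=
  HasCompactSupport.intro P.cpt fun _ hx => P.X_eq_zero hx

lemma exists_bound : ∃ M : ℝ, 0 < M ∧ ∀ x, ‖X x‖ ≤ M := by
  obtain ⟨M, hM⟩ := P.X_cpt.exists_bound_of_continuous P.cont
  exact ⟨max M 1, by positivity, fun x => (hM x).trans (le_max_left _ _)⟩

lemma dvec_hasFDerivAt (h : ℝ) (x : Euc n) :
    HasFDerivAt (dvec h u)
      (∑ k, (innerSL ℝ (dq h k X x)).smulRight (ev k)) x := by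
  have h1 : dvec h u = fun x => ∑ k, dq h k u x • ev k := by
    funext x; ext j
    simp [ev, Pi.single_apply]
  rw [h1]
  refine HasFDerivAt.fun_sum fun k _ => ?_
  have h2 := dq_hasFDerivAt P.hasFDerivAt h k x
  rw [dq_clm (innerSL ℝ)] at h2
  exact h2.smul_const (ev k)

lemma dvec_contDiff (h : ℝ) : ContDiff ℝ 1 (dvec h u) := by
  rw [contDiff_euclidean]
  exact fun k => dq_contDiff P.u_contDiff h k

lemma dqX_continuous (h : ℝ) (k : Fin n) : Continuous (dq h k X) :=
  dq_continuous P.cont h k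

lemma dqu_hasFDerivAt (h : ℝ) (k : Fin n) (x : Euc n) :
    HasFDerivAt (dq h k u) (innerSL ℝ (dq h k X x)) x := by
  have h2 := dq_hasFDerivAt P.hasFDerivAt h k x
  rwa [dq_clm (innerSL ℝ)] at h2

lemma uniform (hη : 0 < η) :
    ∃ δ > 0, ∀ x v, ‖v‖ ≤ δ → ‖X (x + v) - X x‖ ≤ η := by
  have huc := P.X_cpt.uniformContinuous_of_continuous P.cont
  obtain ⟨δ, hδ, h⟩ := uniformContinuous_iff.1 huc η hη
  refine ⟨δ / 2, by positivity, fun x v hv => ?_⟩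
  have := h (a := x + v) (b := x) (by simp [dist_eq_norm]; linarith)
  rw [dist_eq_norm] at this
  exact this.le

lemma eventually_good (hη : 0 < η) :
    ∀₀ h, GoodStep X u η h := by
  have hη' : 0 < η / (n + 1) := by positivity
  obtain ⟨δ, hδ, hosc⟩ := P.uniform hη'
  have h1 : ∀₀ h, |h| ≤ δ / 2 := by
    refine nhdsWithin_le_nhds ?_
    filter_upwards [ball_mem_nhds (0:ℝ) (half_pos hδ)] with h hh
    simpa using (mem_ball_zero_iff.1 hh).le
  filter_upwards [h1, self_mem_nhdsWithin] with h hh hne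
  have hne : h ≠ 0 := hne
  have hle : η / (n + 1) ≤ η := div_le_self hη.le (by linarith [n.cast_nonneg (α := ℝ)])
  refine ⟨hne, fun x v hv => (hosc x v (by linarith)).trans hle, fun x => ?_⟩
  refine (norm_le_sum_abs _).trans ?_
  have hk : ∀ k, |(dvec h u x - X x) k| ≤ η / (n + 1) := by
    intro k
    rw [PiLp.sub_apply, dvec_apply,
      dq_eq_integral P.hasFDerivAt (by have := P.cont; fun_prop) hne]
    have hi : Integrable (fun t : ℝ => innerSL ℝ (X (x + (t * h) • ev k)) (ev k))
        (volume.restrict (Ioc 0 1)) := by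
      have := P.cont
      have hc : Continuous (fun t : ℝ => innerSL ℝ (X (x + (t * h) • ev k)) (ev k)) := by fun_prop
      exact (hc.integrableOn_Icc).mono_set Ioc_subset_Icc_self
    have hX : X x k = ∫ t in Ioc (0:ℝ) 1, X x k := by simp
    rw [hX, ← integral_sub hi (by simp)]
    have := norm_setIntegral_le_of_norm_le_const (μ := volume) (s := Ioc (0:ℝ) 1)
      (f := fun t : ℝ => innerSL ℝ (X (x + (t * h) • ev k)) (ev k) - X x k) (C := η / (n + 1))
      (by simp) (fun t ht => ?_)
    · simpa using this
    · rw [innerSL_apply_apply, inner_ev, norm_eq_abs, ← PiLp.sub_apply]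
      refine (abs_apply_le_norm _ _).trans (hosc x _ ?_)
      rw [norm_smul_ev, abs_mul, abs_of_pos ht.1]
      calc t * |h| ≤ 1 * |h| := by gcongr; exact ht.2
        _ ≤ δ := by linarith
  calc ∑ k, |(dvec h u x - X x) k| ≤ ∑ _k : Fin n, η / (n + 1) := sum_le_sum fun k _ => hk k
    _ = n * (η / (n + 1)) := by simp
    _ = η * (n / (n + 1)) := by ring
    _ ≤ η * 1 := by
      gcongr
      rw [div_le_one (by positivity)]; linarith
    _ = η := mul_one _

end PData

/-- A smooth cutoff function equal to one near `K` and compactly supported in `O`. -/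
structure Cutoff (O K : Set (Euc n)) (ψ : Euc n → ℝ) : Prop where
  contDiff : Smooth ψ
  cpt : HasCompactSupport ψ
  sub : tsupport ψ ⊆ O
  nonneg : ∀ x, 0 ≤ ψ x
  le_one : ∀ x, ψ x ≤ 1
  one_nhds : ∀ᶠ x in 𝓝ˢ K, ψ x = 1

lemma Cutoff.one (h : Cutoff O K ψ)
    (hx : x ∈ K) : ψ x = 1 := h.one_nhds.self_of_nhdsSet x hx

lemma exists_cutoff (hO : IsOpen O) (hK : IsCompact K) (hKO : K ⊆ O) :
    ∃ ψ, Cutoff O K ψ := by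
  obtain ⟨δ, hδ, hsub⟩ := hK.exists_cthickening_subset_open hO hKO
  have h1 : K ⊆ interior (cthickening δ K) :=
    (self_subset_thickening hδ K).trans
      (interior_maximal (thickening_subset_cthickening _ _) isOpen_thickening)
  obtain ⟨ψ, h1, h0, h01⟩ := exists_contMDiffMap_one_nhds_of_subset_interior (n := (⊤ : ℕ∞))
    (modelWithCornersSelf ℝ (Euc n)) hK.isClosed h1
  have hts : tsupport ψ ⊆ cthickening δ K :=
    closure_minimal (fun x hx => by by_contra hc; exact hx (h0 x hc)) isClosed_cthickening
  exact ⟨ψ, ψ.contMDiff.contDiff, hK.cthickening.of_isClosed_subset (isClosed_tsupport _) hts,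
    hts.trans hsub, fun x => (h01 x).1, fun x => (h01 x).2, h1⟩

lemma eventually_add_mem (hO : IsOpen O) (hK : IsCompact K) (hKO : K ⊆ O) :
    ∀₀ h, ∀ x ∈ K, ∀ v, ‖v‖ ≤ 2 * |h| → x + v ∈ O := by
  obtain ⟨δ, hδ, hsub⟩ := hK.exists_cthickening_subset_open hO hKO
  refine nhdsWithin_le_nhds ?_
  filter_upwards [ball_mem_nhds (0:ℝ) (half_pos hδ)] with h hh x hx v hv
  have hh : |h| < δ / 2 := by simpa using hh
  refine hsub (mem_cthickening_of_dist_le _ x _ _ hx ?_)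
  rw [dist_eq_norm, add_sub_cancel_left]
  linarith

/-- The part of `K` where `X` is not small. -/
def bset (X : Euc n → Euc n) (K : Set (Euc n)) (ε : ℝ) : Set (Euc n) := K ∩ {x | ε ≤ ‖X x‖}

lemma bset_compact (hX : Continuous X) (hK : IsCompact K)
    (ε : ℝ) : IsCompact (bset X K ε) :=
  hK.inter_right (isClosed_le continuous_const hX.norm)

lemma integral_lower {A B : Set (Euc n)} (hA : IsCompact A) (hB : IsCompact B)
    {E F₁ F₂ : Euc n → ℝ} (hE : Continuous E) (hEs : HasCompactSupport E)
    (h1 : ContinuousOn F₁ A) (h2 : ContinuousOn F₂ B)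
    (h : ∀ x, A.indicator F₁ x ≤ E x + B.indicator F₂ x) :
    ∫ x in A, F₁ x ≤ (∫ x, E x) + ∫ x in B, F₂ x := by
  have i1 := (integrable_indicator_iff hA.measurableSet).2 (h1.integrableOn_compact (μ := volume) hA)
  have i2 := (integrable_indicator_iff hB.measurableSet).2 (h2.integrableOn_compact (μ := volume) hB)
  have i3 := hE.integrable_cpt hEs
  rw [← integral_indicator hA.measurableSet, ← integral_indicator hB.measurableSet,
    ← integral_add i3 i2]
  exact integral_mono i1 (i3.add i2) h

lemma abs_integral_le_of_bound (hK : IsCompact K)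
    (h0 : ∀ x ∉ K, g x = 0) (hC : ∀ x ∈ K, |g x| ≤ C) : |∫ x, g x| ≤ C * volume.real K := by
  rw [← setIntegral_eq_of_off h0]
  exact norm_setIntegral_le_of_norm_le_const (f := g) hK.measure_lt_top hC

lemma fderiv_sq_mul {q : Euc n → ℝ} {ψ' q' : Euc n →L[ℝ] ℝ}
    (hψ : HasFDerivAt ψ ψ' x) (hq : HasFDerivAt q q' x) (v : Euc n) :
    fderiv ℝ (fun x => ψ x ^ 2 * q x) x v = 2 * ψ x * q x * ψ' v + ψ x ^ 2 * q' v := by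
  have h : HasFDerivAt (fun x => ψ x ^ 2 * q x) _ x := (hψ.pow 2).mul hq
  rw [h.fderiv]
  simp
  ring

lemma tsupport_sq_mul_subset (ψ q : Euc n → ℝ) :
    tsupport (fun x => ψ x ^ 2 * q x) ⊆ tsupport ψ :=
  closure_minimal (fun x hx => subset_tsupport ψ fun h0 => hx (by simp [h0])) (isClosed_tsupport ψ)

lemma hasCompactSupport_sq_mul (h : HasCompactSupport ψ) (q : Euc n → ℝ) :
    HasCompactSupport (fun x => ψ x ^ 2 * q x) :=
  h.of_isClosed_subset (isClosed_tsupport _) (tsupport_sq_mul_subset ψ q)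

lemma fderiv_pairing_hasCompactSupport (h : HasCompactSupport φ)
    (V : Euc n → Euc n) : HasCompactSupport (fun x => fderiv ℝ φ x (V x)) :=
  (h.fderiv (𝕜 := ℝ)).mono fun x hx h0 => hx (by simp [h0])

lemma Cutoff.fderiv_bound (h : Cutoff O K ψ) :
    ∃ L, 0 < L ∧ ∀ x v, |fderiv ℝ ψ x v| ≤ L * ‖v‖ := by
  obtain ⟨L, hL⟩ := (h.cpt.fderiv (𝕜 := ℝ)).exists_bound_of_continuous
    (h.contDiff.continuous_fderiv (by simp))
  exact ⟨max L 1, by positivity, fun x v => (ContinuousLinearMap.le_opNorm _ _).trans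
    (mul_le_right ((hL x).trans (le_max_left _ _)) (norm_nonneg _))⟩

lemma Cutoff.hasFDerivAt (h : Cutoff O K ψ) (x : Euc n) :
    HasFDerivAt ψ (fderiv ℝ ψ x) x := (h.contDiff.differentiable (by simp) x).hasFDerivAt

lemma young (hδ : 0 < δ) : a * b ≤ δ * a ^ 2 + b ^ 2 / (4 * δ) := by
  have : 0 ≤ δ * (a - b / (2 * δ)) ^ 2 := by positivity
  have e : δ * (a - b / (2 * δ)) ^ 2 = δ * a ^ 2 - a * b + b ^ 2 / (4 * δ) := by
    field_simp
    try ring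
  linarith

lemma exists_dqS (hp1 : 1 < p) : ∃ C > 0, ∃ c > 0, ∃ δ > 0, δ ≤ 1 / 16 ∧
    ∀ (X : Euc n → Euc n) (u : Euc n → ℝ) (η h : ℝ) (x : Euc n) (k : Fin n),
      GoodStep X u η h → X x ≠ 0 → η ≤ δ * ‖X x‖ →
      ‖dq h k (fun x => pv (p - 2) (X x)) x - pvD (p - 2) (X x) (dq h k X x)‖
          ≤ C * ‖X x‖ ^ (p - 3) * η * ‖dq h k X x‖ ∧
      ‖dq h k (fun x => pv (p - 2) (X x)) x‖ ≤ C * ‖X x‖ ^ (p - 2) * ‖dq h k X x‖ ∧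
      c * ‖X x‖ ^ (p - 2) * ‖dq h k X x‖ ^ 2
        ≤ ⟪dq h k X x, dq h k (fun x => pv (p - 2) (X x)) x⟫_ℝ := by
  obtain ⟨C, hC0, hC⟩ := pv_taylor (n := n) (p - 2)
  set c := min 1 (1 + (p - 2)) with hc
  have hcpos : 0 < c := lt_min one_pos (by linarith)
  have hδ : 0 < min (1 / 16) (c / (2 * (C + 1))) := by positivity
  refine ⟨C + 2 + |p - 2|, by positivity, c / 2, by positivity, _, hδ, min_le_left _ _, ?_⟩
  intro X u η h x k hg hx hη
  have hη0 : 0 ≤ η := (norm_nonneg _).trans (hg.dvec x)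
  have ht : 0 < ‖X x‖ := norm_pos_iff.2 hx
  set t := ‖X x‖
  set Y := dq h k X x with hY
  set V := dq h k (fun x => pv (p - 2) (X x)) x with hV
  have hη1 : η ≤ t / 16 := hη.trans (by
    have := mul_le_right (min_le_left (1 / 16) (c / (2 * (C + 1)))) ht.le
    linarith)
  have hη2 : C * η ≤ c / 2 * t := by
    have h1 := hη.trans (mul_le_right (min_le_right (1 / 16) (c / (2 * (C + 1)))) ht.le)
    calc C * η ≤ (C + 1) * η := by linarith
      _ ≤ (C + 1) * (c / (2 * (C + 1)) * t) := by gcongr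
      _ = c / 2 * t := by field_simp
  have hosc : ‖X (x + h • ev k) - X x‖ ≤ η := hg.osc x _ (by rw [norm_smul_ev]; linarith [abs_nonneg h])
  have h1 := hC (X x) (X (x + h • ev k)) (X x) η hx (by linarith) hosc (by simpa using hη0)
  have hR : ‖V - pvD (p - 2) (X x) Y‖ ≤ C * t ^ (p - 3) * η * ‖Y‖ := by
    have e : V - pvD (p - 2) (X x) Y = h⁻¹ • (pv (p - 2) (X (x + h • ev k)) - pv (p - 2) (X x)
        - pvD (p - 2) (X x) (X (x + h • ev k) - X x)) := by
      simp only [hV, hY, dq, map_smul, ← smul_sub]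
    rw [e, norm_smul, hY, dq, norm_smul]
    calc _ ≤ ‖h⁻¹‖ * (C * t ^ (p - 2 - 1) * η * ‖X (x + h • ev k) - X x‖) := by gcongr
      _ = _ := by rw [show p - 2 - 1 = p - 3 by ring]; ring
  have hpow : t ^ (p - 3) * t = t ^ (p - 2) := by
    rw [← rpow_add_one ht.ne']; congr 1; ring
  have hT : 0 < t ^ (p - 2) := rpow_pos_of_pos ht _
  have hT3 : 0 < t ^ (p - 3) := rpow_pos_of_pos ht _
  have hR2 : ‖V - pvD (p - 2) (X x) Y‖ ≤ c / 2 * t ^ (p - 2) * ‖Y‖ := by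
    refine hR.trans ?_
    calc C * t ^ (p - 3) * η * ‖Y‖ = t ^ (p - 3) * (C * η) * ‖Y‖ := by ring
      _ ≤ t ^ (p - 3) * (c / 2 * t) * ‖Y‖ := by gcongr
      _ = c / 2 * t ^ (p - 2) * ‖Y‖ := by rw [← hpow]; ring
  have hA := pvD_norm_le (p - 2) hx Y
  have hcl : c ≤ 1 := min_le_left _ _
  refine ⟨hR.trans ?_, ?_, ?_⟩
  · gcongr
    have := abs_nonneg (p - 2)
    linarith
  · calc ‖V‖ ≤ ‖V - pvD (p - 2) (X x) Y‖ + ‖pvD (p - 2) (X x) Y‖ := by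
          simpa using norm_add_le (V - pvD (p - 2) (X x) Y) (pvD (p - 2) (X x) Y)
      _ ≤ c / 2 * t ^ (p - 2) * ‖Y‖ + (1 + |p - 2|) * t ^ (p - 2) * ‖Y‖ := add_le_add hR2 hA
      _ = (c / 2 + 1 + |p - 2|) * (t ^ (p - 2) * ‖Y‖) := by ring
      _ ≤ (C + 2 + |p - 2|) * (t ^ (p - 2) * ‖Y‖) := by gcongr ?_ * _; linarith
      _ = _ := by ring
  · have h2 := pvD_coercive (p - 2) hx Y
    have h3 : ⟪Y, V⟫_ℝ = ⟪pvD (p - 2) (X x) Y, Y⟫_ℝ + ⟪Y, V - pvD (p - 2) (X x) Y⟫_ℝ := by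
      rw [inner_sub_right, real_inner_comm Y (pvD (p - 2) (X x) Y)]; ring
    have h4 := (abs_le.1 (abs_real_inner_le_norm Y (V - pvD (p - 2) (X x) Y))).1
    have h5 : ‖Y‖ * ‖V - pvD (p - 2) (X x) Y‖ ≤ ‖Y‖ * (c / 2 * t ^ (p - 2) * ‖Y‖) := by gcongr
    rw [h3]
    nlinarith

namespace PData

include P

lemma S_continuous : Continuous flux :=
  (pv_continuous (by linarith [P.one_lt])).comp P.cont

lemma weakEq_dq (hK : ∀ x ∈ K, ∀ v, ‖v‖ ≤ 2 * |h| → x + v ∈ O) (k : Fin n) :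
    WeakEq K (dq h k flux) (dq h k f) := by
  refine P.eq.dq P.S_continuous P.f_contDiff.continuous k fun x hx => ⟨?_, ?_⟩
  · simpa using hK x hx 0 (by simp)
  · exact hK x hx _ (by rw [norm_smul_ev]; linarith [abs_nonneg h])

lemma weakEq_dq_dq (hK : ∀ x ∈ K, ∀ v, ‖v‖ ≤ 2 * |h| → x + v ∈ O) (k l : Fin n) :
    WeakEq K (dq h l (dq h k flux)) (dq h l (dq h k f)) := by
  have h1 : WeakEq {x | x ∈ O ∧ x + h • ev k ∈ O} (dq h k flux) (dq h k f) :=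
    P.eq.dq P.S_continuous P.f_contDiff.continuous k fun x hx => hx
  have hh := abs_nonneg h
  refine h1.dq (dq_continuous P.S_continuous h k)
    (dq_continuous P.f_contDiff.continuous h k) l fun x hx => ⟨⟨?_, ?_⟩, ?_, ?_⟩
  · simpa using hK x hx 0 (by simp)
  · exact hK x hx _ (by rw [norm_smul_ev]; linarith)
  · exact hK x hx _ (by rw [norm_smul_ev]; linarith)
  · rw [add_assoc]
    refine hK x hx _ ((norm_add_le _ _).trans ?_)
    rw [norm_smul_ev, norm_smul_ev]; linarith

lemma dqf_bound : ∃ L, 0 < L ∧ ∀ h, h ≠ 0 → ∀ k x, |dq h k f x| ≤ L := by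
  obtain ⟨L, hL0, hL⟩ := exists_lipschitz P.f_contDiff P.f_cpt
  refine ⟨L + 1, by linarith, fun h hh k x => ?_⟩
  have := dq_norm_le_of_lipschitz hL hh k x
  rw [norm_eq_abs] at this
  linarith

lemma local_bound (hK : IsCompact K) (hKO : K ⊆ O)
    (hε : 0 < ε) :
    ∃ C, ∀₀ h, ∀ k, ∫ x in bset X K ε, ‖dq h k X x‖ ^ 2 ≤ C := by
  obtain ⟨C, hC, c, hc, δ, hδ, -, hS⟩ := exists_dqS (n := n) P.one_lt
  obtain ⟨M, hM, hXM⟩ := P.exists_bound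
  obtain ⟨Lf, hLf, hdf⟩ := P.dqf_bound
  have hU : IsOpen (O ∩ {x | X x ≠ 0}) := P.isOpen.inter (isOpen_ne_fun P.cont continuous_const)
  have hB := bset_compact P.cont hK ε
  have hBU : bset X K ε ⊆ O ∩ {x | X x ≠ 0} := fun x hx =>
    ⟨hKO hx.1, norm_pos_iff.1 (hε.trans_le hx.2)⟩
  obtain ⟨ψ, hψ⟩ := exists_cutoff hU hB hBU
  obtain ⟨L, hL, hψL⟩ := hψ.fderiv_bound
  set K' := tsupport ψ with hK'
  have hK'c : IsCompact K' := hψ.cpt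
  have hX0 : ∀ x ∈ K', X x ≠ 0 := fun x hx => (hψ.sub hx).2
  obtain ⟨m, hm, hmX⟩ := hK'c.exists_forall_le' P.cont.norm.continuousOn (a := 0)
    (fun x hx => norm_pos_iff.2 (hX0 x hx))
  have hTc : ContinuousOn (fun x => ‖X x‖ ^ (p - 2)) K' :=
    P.cont.norm.continuousOn.rpow_const fun x hx => Or.inl (norm_ne_zero_iff.2 (hX0 x hx))
  obtain ⟨T0, hT0, hT0X⟩ := hK'c.exists_forall_le' hTc (a := 0)
    (fun x hx => rpow_pos_of_pos (norm_pos_iff.2 (hX0 x hx)) _)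
  obtain ⟨T1, hT1X⟩ := hK'c.exists_bound_of_continuousOn hTc
  set D := 2 * L * (M + 1) * C * T1 with hD
  have hηpos : 0 < min 1 (δ * m) := by positivity
  refine ⟨((Lf * (M + 1)) * volume.real K' + (D ^ 2 / (2 * (c * T0))) * volume.real K')
    / (c * T0 / 2), ?_⟩
  filter_upwards [P.eventually_good hηpos,
    eventually_add_mem P.isOpen hK'c (hψ.sub.trans inter_subset_left)] with h hg hadd k
  have heq := P.weakEq_dq hadd k
  have hq : ∀ x, |dq h k u x| ≤ M + 1 := fun x => by
    calc |dq h k u x| = |dvec h u x k| := rfl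
      _ ≤ ‖dvec h u x‖ := abs_apply_le_norm _ _
      _ ≤ ‖dvec h u x - X x‖ + ‖X x‖ := by simpa using norm_add_le (dvec h u x - X x) (X x)
      _ ≤ M + 1 := by linarith [hg.dvec x, hXM x, min_le_left 1 (δ * m)]
  set V := dq h k fun x => pv (p - 2) (X x) with hV
  have hVc : Continuous V := dq_continuous P.S_continuous h k
  have hφ : ContDiff ℝ 1 (fun x => ψ x ^ 2 * dq h k u x) :=
    ((hψ.contDiff.of_le (by simp)).pow 2).mul (dq_contDiff P.u_contDiff h k)
  have hφs := hasCompactSupport_sq_mul hψ.cpt (dq h k u)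
  have heq := heq _ hφ hφs (tsupport_sq_mul_subset _ _)
  have hfd : ∀ x, fderiv ℝ (fun x => ψ x ^ 2 * dq h k u x) x (V x)
      = 2 * ψ x * dq h k u x * fderiv ℝ ψ x (V x) + ψ x ^ 2 * ⟪dq h k X x, V x⟫_ℝ := fun x =>
    fderiv_sq_mul (hψ.hasFDerivAt x) (P.dqu_hasFDerivAt h k x) (V x)
  have hEc : Continuous fun x => fderiv ℝ (fun x => ψ x ^ 2 * dq h k u x) x (V x) :=
    (hφ.continuous_fderiv (by simp)).clm_apply hVc
  have hlow := integral_lower hB hK'c (F₁ := fun x => c * T0 / 2 * ‖dq h k X x‖ ^ 2)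
    (F₂ := fun _ => D ^ 2 / (2 * (c * T0))) hEc
    (fderiv_pairing_hasCompactSupport hφs V)
    ((((P.dqX_continuous h k).norm.pow 2).const_mul _).continuousOn) continuousOn_const ?_
  · rw [heq, integral_const_mul] at hlow
    have hr := abs_integral_le_of_bound hK'c
      (g := fun x => dq h k f x * (ψ x ^ 2 * dq h k u x)) (C := Lf * (M + 1))
      (fun x hx => by simp [zero_off_tsupport hx])
      (fun x _ => by
        have h1 : |ψ x ^ 2| ≤ 1 := by
          rw [abs_of_nonneg (sq_nonneg _)]; exact pow_le_one₀ (hψ.nonneg x) (hψ.le_one x)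
        rw [abs_mul, abs_mul]
        have := mul_le_mul h1 (hq x) (abs_nonneg _) zero_le_one
        rw [one_mul] at this
        exact mul_le_mul (hdf h hg.ne k x) this (by positivity) hLf.le)
    have hr := (le_abs_self _).trans hr
    rw [setIntegral_const, smul_eq_mul] at hlow
    rw [le_div_iff₀ (by positivity)]
    linarith
  · intro x
    by_cases hx : x ∈ K'
    · rw [indicator_of_mem hx, hfd]
      obtain ⟨-, h2, h3⟩ := hS X u _ h x k hg (hX0 x hx) ((min_le_right _ _).trans (by
        have := hmX x hx; gcongr))
      have e1 : (bset X K ε).indicator (fun x => c * T0 / 2 * ‖dq h k X x‖ ^ 2) x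
          ≤ c * T0 / 2 * (ψ x * ‖dq h k X x‖) ^ 2 := by
        by_cases hxB : x ∈ bset X K ε
        · rw [indicator_of_mem hxB, hψ.one hxB, one_mul]
        · rw [indicator_of_notMem hxB]; positivity
      have hT1 : ‖X x‖ ^ (p - 2) ≤ T1 := (le_abs_self _).trans (hT1X x hx)
      have hVn : ‖V x‖ ≤ C * T1 * ‖dq h k X x‖ := h2.trans (by gcongr)
      have hψ0 := hψ.nonneg x
      have e2 : |2 * ψ x * dq h k u x * fderiv ℝ ψ x (V x)| ≤ (ψ x * ‖dq h k X x‖) * D := by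
        rw [abs_mul, abs_mul, abs_of_nonneg (by positivity : 0 ≤ 2 * ψ x)]
        calc 2 * ψ x * |dq h k u x| * |fderiv ℝ ψ x (V x)|
            ≤ 2 * ψ x * (M + 1) * (L * (C * T1 * ‖dq h k X x‖)) := by
              gcongr
              · exact hq x
              · exact (hψL x _).trans (by gcongr)
          _ = _ := by rw [hD]; ring
      have e3 := young (a := ψ x * ‖dq h k X x‖) (b := D) (δ := c * T0 / 2) (by positivity)
      have e4 : c * T0 * (ψ x * ‖dq h k X x‖) ^ 2 ≤ ψ x ^ 2 * ⟪dq h k X x, V x⟫_ℝ := by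
        calc c * T0 * (ψ x * ‖dq h k X x‖) ^ 2 = ψ x ^ 2 * (c * T0 * ‖dq h k X x‖ ^ 2) := by ring
          _ ≤ ψ x ^ 2 * (c * ‖X x‖ ^ (p - 2) * ‖dq h k X x‖ ^ 2) := by
            have := hT0X x hx; gcongr
          _ ≤ _ := by gcongr
      have e5 := (abs_le.1 e2).1
      have e6 : D ^ 2 / (4 * (c * T0 / 2)) = D ^ 2 / (2 * (c * T0)) := by congr 1; ring
      rw [e6] at e3
      linarith
    · have hxB : x ∉ bset X K ε := fun hb => hx (subset_tsupport ψ (by simp [hψ.one hb]))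
      rw [indicator_of_notMem hx, indicator_of_notMem hxB, hfd,
        zero_off_tsupport hx]
      simp

end PData

/-- The squared size of all difference quotients of `X`. -/
def sqn (h : ℝ) (X : Euc n → Euc n) (x : Euc n) : ℝ := ∑ k, ‖dq h k X x‖ ^ 2

lemma sqn_nonneg (h : ℝ) (X : Euc n → Euc n) (x : Euc n) : 0 ≤ sqn h X x :=
  sum_nonneg fun _ _ => sq_nonneg _

lemma sq_le_sqn (h : ℝ) (X : Euc n → Euc n) (x : Euc n) (k : Fin n) :
    ‖dq h k X x‖ ^ 2 ≤ sqn h X x :=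
  single_le_sum (f := fun k => ‖dq h k X x‖ ^ 2) (fun _ _ => sq_nonneg _)
    (Finset.mem_univ k)

lemma norm_le_sqrt_sqn (h : ℝ) (X : Euc n → Euc n) (x : Euc n) (k : Fin n) :
    ‖dq h k X x‖ ≤ √(sqn h X x) := le_sqrt_of_sq_le (sq_le_sqn h X x k)

lemma sum_norm_le_sqrt_sqn (h : ℝ) (X : Euc n → Euc n) (x : Euc n) :
    ∑ k, ‖dq h k X x‖ ≤ n * √(sqn h X x) := by
  calc ∑ k, ‖dq h k X x‖ ≤ ∑ _k : Fin n, √(sqn h X x) :=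
        sum_le_sum fun k _ => norm_le_sqrt_sqn h X x k
    _ = _ := by simp

lemma sqn_continuous (hX : Continuous X) (h : ℝ) : Continuous (sqn h X) :=
  continuous_finsetSum _ fun k _ => (dq_continuous hX h k).norm.pow 2

/-- Half the gradient of the squared norm of the vector of difference quotients. -/
def nvec (h : ℝ) (u : Euc n → ℝ) (X : Euc n → Euc n) (x : Euc n) : Euc n :=
  ∑ k, dq h k u x • dq h k X x

lemma norm_sum_smul_le {ι : Type*} [Fintype ι] (d : ι → ℝ) (Y : ι → Euc n) {D : ℝ}
    (hd : ∀ k, |d k| ≤ D) : ‖∑ k, d k • Y k‖ ≤ D * ∑ k, ‖Y k‖ := by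
  rw [mul_sum]
  refine (norm_sum_le _ _).trans (sum_le_sum fun k _ => ?_)
  rw [norm_smul, norm_eq_abs]
  gcongr
  exact hd k

lemma form_sum_le (A : Euc n →L[ℝ] Euc n) (hs : ∀ ξ η, ⟪A ξ, η⟫_ℝ = ⟪A η, ξ⟫_ℝ)
    (hp : ∀ ξ, 0 ≤ ⟪A ξ, ξ⟫_ℝ) (d : Euc n) (Y : Fin n → Euc n) :
    ⟪A (∑ k, d k • Y k), ∑ k, d k • Y k⟫_ℝ ≤ ‖d‖ ^ 2 * ∑ k, ⟪A (Y k), Y k⟫_ℝ := by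
  have key : ∀ k l, d k * d l * ⟪A (Y k), Y l⟫_ℝ
      ≤ (d k ^ 2 * ⟪A (Y l), Y l⟫_ℝ + d l ^ 2 * ⟪A (Y k), Y k⟫_ℝ) / 2 := by
    intro k l
    have h1 := hp (d l • Y k - d k • Y l)
    simp only [map_sub, map_smul, inner_sub_left, inner_sub_right, real_inner_smul_left,
      real_inner_smul_right] at h1
    rw [hs (Y l) (Y k)] at h1
    nlinarith
  have e1 : ⟪A (∑ k, d k • Y k), ∑ k, d k • Y k⟫_ℝ
      = ∑ k, ∑ l, d k * d l * ⟪A (Y k), Y l⟫_ℝ := by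
    simp only [map_sum, map_smul, sum_inner, inner_sum, real_inner_smul_left,
      real_inner_smul_right]
    rw [sum_comm]
    refine sum_congr rfl fun k _ => sum_congr rfl fun l _ => by ring
  rw [e1]
  calc _ ≤ ∑ k, ∑ l, (d k ^ 2 * ⟪A (Y l), Y l⟫_ℝ + d l ^ 2 * ⟪A (Y k), Y k⟫_ℝ) / 2 :=
        sum_le_sum fun k _ => sum_le_sum fun l _ => key k l
    _ = (∑ k, d k ^ 2) * ∑ k, ⟪A (Y k), Y k⟫_ℝ := by
        simp only [← sum_div, sum_add_distrib, ← mul_sum, ← sum_mul]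
        ring
    _ = _ := by rw [EuclideanSpace.norm_sq_eq]; simp

namespace PData
lemma dvec_normsq_hasFDerivAt (P : PData p O u f X) (h : ℝ) (x : Euc n) :
    HasFDerivAt (fun x => ‖dvec h u x‖ ^ 2) (innerSL ℝ ((2:ℝ) • nvec h u X x)) x := by
  have h1 := (P.dvec_hasFDerivAt h x).norm_sq
  refine h1.congr_fderiv (ContinuousLinearMap.ext fun v => ?_)
  simp [nvec, inner_sum, sum_inner, real_inner_smul_left, real_inner_smul_right, inner_ev,
    mul_sum, mul_comm, mul_left_comm]

lemma nvec_norm_le (u : Euc n → ℝ) (X : Euc n → Euc n) (h : ℝ) (x : Euc n) :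
    ‖nvec h u X x‖ ≤ ‖dvec h u x‖ * (n * √(sqn h X x)) :=
  (norm_sum_smul_le _ _ fun k => abs_apply_le_norm (dvec h u x) k).trans
    (by gcongr; exact sum_norm_le_sqrt_sqn h X x)

lemma _root_.GoodStep.comparable (hg : GoodStep X u η h) (hη : η ≤ ε / 4)
    (hx : ε ≤ ‖dvec h u x‖) (hε : 0 < ε) :
    ε / 2 ≤ ‖X x‖ ∧ ‖X x‖ / 2 ≤ ‖dvec h u x‖ ∧ ‖dvec h u x‖ ≤ 2 * ‖X x‖ := by
  have h1 := hg.dvec x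
  have h2 : ‖dvec h u x‖ ≤ ‖dvec h u x - X x‖ + ‖X x‖ := by
    simpa using norm_add_le (dvec h u x - X x) (X x)
  have h3 : ‖X x‖ ≤ ‖dvec h u x - X x‖ + ‖dvec h u x‖ := by
    rw [norm_sub_rev]
    simpa using norm_add_le (X x - dvec h u x) (dvec h u x)
  refine ⟨by linarith, by linarith, by linarith⟩

lemma _root_.GoodStep.large (hg : GoodStep X u η h) (hη : η ≤ ε / 4)
    (hx : 2 * ε ≤ ‖X x‖) (hε : 0 < ε) :
    ε ≤ ‖dvec h u x‖ ∧ 2 * ε ^ 2 ≤ ‖dvec h u x‖ ^ 2 := by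
  have h1 := hg.dvec x
  have h3 : ‖X x‖ ≤ ‖dvec h u x - X x‖ + ‖dvec h u x‖ := by
    rw [norm_sub_rev]
    simpa using norm_add_le (X x - dvec h u x) (dvec h u x)
  have h4 : 3 / 2 * ε ≤ ‖dvec h u x‖ := by linarith
  refine ⟨by linarith, ?_⟩
  nlinarith

lemma _root_.exists_tr_bounds (e : ℝ) (hε : 0 < ε) (M : ℝ) :
    ∃ G, 0 < G ∧ ∀ s, 0 ≤ s → s ≤ M → |tr ε e s| ≤ G ∧ |deriv (tr ε e) s| ≤ G := by
  obtain ⟨G1, h1⟩ := (isCompact_Icc (a := (0:ℝ)) (b := M)).exists_bound_of_continuousOn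
    (tr_contDiff e hε).continuous.continuousOn
  obtain ⟨G2, h2⟩ := (isCompact_Icc (a := (0:ℝ)) (b := M)).exists_bound_of_continuousOn
    ((tr_contDiff e hε).continuous_deriv (by simp)).continuousOn
  refine ⟨max (max G1 G2) 1, by positivity, fun s h0 hM => ⟨?_, ?_⟩⟩
  · exact (h1 s ⟨h0, hM⟩).trans ((le_max_left _ _).trans (le_max_left _ _))
  · exact (h2 s ⟨h0, hM⟩).trans ((le_max_right _ _).trans (le_max_left _ _))

end PData

lemma sum_norm_le_sqrt (Y : Fin n → Euc n) : ∑ k, ‖Y k‖ ≤ n * √(∑ k, ‖Y k‖ ^ 2) := by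
  calc ∑ k, ‖Y k‖ ≤ ∑ _k : Fin n, √(∑ k, ‖Y k‖ ^ 2) :=
        sum_le_sum fun k _ => le_sqrt_of_sq_le
          (single_le_sum (f := fun k => ‖Y k‖ ^ 2) (fun _ _ => sq_nonneg _)
            (Finset.mem_univ k))
    _ = _ := by simp

lemma pvD_nonneg (hp : 1 < p) {a : Euc n} (ha : a ≠ 0) (ξ : Euc n) :
    0 ≤ ⟪pvD (p - 2) a ξ, ξ⟫_ℝ :=
  le_trans (by have : 0 ≤ min 1 (1 + (p - 2)) := le_min zero_le_one (by linarith)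
               positivity) (pvD_coercive (p - 2) ha ξ)

lemma norm_sum_smul_le_sqrt {Y R : Fin n → Euc n} {D : Euc n} {B : ℝ} (hB : 0 ≤ B)
    (hR : ∀ k, ‖R k‖ ≤ B * ‖Y k‖) :
    ‖∑ k, D k • R k‖ ≤ ‖D‖ * (B * (n * √(∑ k, ‖Y k‖ ^ 2))) := by
  refine (norm_sum_smul_le _ _ (abs_apply_le_norm D)).trans ?_
  gcongr
  calc ∑ k, ‖R k‖ ≤ ∑ k, B * ‖Y k‖ := sum_le_sum fun k _ => hR k
    _ = B * ∑ k, ‖Y k‖ := by rw [mul_sum]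
    _ ≤ _ := by gcongr; exact sum_norm_le_sqrt Y

lemma abs_sum_inner_le {Y R : Fin n → Euc n} {B : ℝ} (hR : ∀ k, ‖R k‖ ≤ B * ‖Y k‖) :
    |∑ k, ⟪Y k, R k⟫_ℝ| ≤ B * ∑ k, ‖Y k‖ ^ 2 := by
  refine (abs_sum_le_sum_abs _ _).trans ?_
  rw [mul_sum]
  refine sum_le_sum fun k _ => (abs_real_inner_le_norm _ _).trans ?_
  calc ‖Y k‖ * ‖R k‖ ≤ ‖Y k‖ * (B * ‖Y k‖) := by gcongr; exact hR k
    _ = _ := by ring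

lemma abs_inner_sum_le {Y R : Fin n → Euc n} {D : Euc n} {B : ℝ} (hB : 0 ≤ B)
    (hR : ∀ k, ‖R k‖ ≤ B * ‖Y k‖) :
    |⟪∑ k, D k • Y k, ∑ k, D k • R k⟫_ℝ| ≤ B * (n ^ 2 * ‖D‖ ^ 2) * ∑ k, ‖Y k‖ ^ 2 := by
  have h1 := norm_sum_smul_le_sqrt (D := D) hB hR
  have h2 := norm_sum_smul_le_sqrt (Y := Y) (R := Y) (D := D) zero_le_one (by simp)
  have hS0 : 0 ≤ ∑ k, ‖Y k‖ ^ 2 := sum_nonneg fun _ _ => sq_nonneg _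
  refine (abs_real_inner_le_norm _ _).trans ((mul_le_mul h2 h1 (norm_nonneg _)
    (by positivity)).trans_eq ?_)
  calc _ = B * (n ^ 2 * ‖D‖ ^ 2) * √(∑ k, ‖Y k‖ ^ 2) ^ 2 := by ring
    _ = _ := by rw [sq_sqrt hS0]

lemma weighted_arith {cA g g' Q S F I1 I2 T E G Er Z ψ t2 tp : ℝ} (hψ : 0 ≤ ψ) (hψ1 : ψ ≤ 1)
    (hκ : 0 < κ) (hκ1 : κ ≤ 1) (hg : 0 ≤ g) (hgG : g ≤ G) (hgG' : |g'| ≤ G) (hS : 0 ≤ S)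
    (ht2 : 0 ≤ t2) (hcA : 0 ≤ cA) (hgg : -(1 - κ) / 2 * g ≤ d ^ 2 * g')
    (hQ : cA * t2 * S ≤ Q) (hF : F ≤ d ^ 2 * Q) (hF0 : 0 ≤ F)
    (hI1 : |I1| ≤ E * S) (hI2 : |I2| ≤ E * Er * S) (hT : |T| ≤ g * Z)
    (hZ : Z ≤ κ * cA / 2 * (ψ ^ 2 * (t2 * S)) + tp) :
    κ * cA / 2 * (ψ ^ 2 * (g * t2 * S)) - g * tp - G * E * (1 + 2 * Er) * S
      ≤ T + ψ ^ 2 * (g * Q + g * I1 + 2 * g' * F + 2 * g' * I2) := by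
  have hG : 0 ≤ G := hg.trans hgG
  have hQ0 : 0 ≤ Q := (by positivity : 0 ≤ cA * t2 * S).trans hQ
  have e5 : κ * (g * Q) ≤ g * Q + 2 * g' * F := by
    have h1 : -(1 - κ) / 2 * g * Q ≤ g' * F := by
      rcases le_total 0 g' with h0 | h0
      · refine le_trans ?_ (mul_nonneg h0 hF0)
        have : 0 ≤ (1 - κ) / 2 * g * Q := by
          have : 0 ≤ 1 - κ := by linarith
          positivity
        linarith
      · have h2 := mul_le_right hgg hQ0
        have h3 := mul_le_mul_of_nonpos_left hF h0
        linarith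
    linarith
  have e6 : κ * (g * (cA * t2 * S)) ≤ κ * (g * Q) := by gcongr
  have e7 : |g * I1 + 2 * g' * I2| ≤ G * E * (1 + 2 * Er) * S := by
    refine (abs_add_le _ _).trans ?_
    rw [abs_mul, abs_mul, abs_mul, abs_of_nonneg hg, abs_two]
    have h1 := mul_le_mul hgG hI1 (abs_nonneg _) hG
    have h2 := mul_le_mul hgG' hI2 (abs_nonneg _) hG
    linarith
  have hψ2 : ψ ^ 2 ≤ 1 := pow_le_one₀ hψ hψ1
  have e8 : -(G * E * (1 + 2 * Er) * S) ≤ ψ ^ 2 * (g * I1 + 2 * g' * I2) := by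
    have h0 := (abs_nonneg _).trans e7
    have h1 := (abs_le.1 e7).1
    nlinarith [sq_nonneg ψ]
  have e9 := mul_le_left (e6.trans e5) (sq_nonneg ψ)
  have e10 := mul_le_left hZ hg
  have e11 := (abs_le.1 hT).1
  linarith

lemma cutoff_term_le {g ψ S v w : ℝ} (hψ : 0 ≤ ψ) (hg : 0 ≤ g) (hL : 0 ≤ L)
    (hC : 0 ≤ C) (ht : 0 < t) (hd : d ≤ 2 * t) (hv : |v| ≤ L * w)
    (hw : w ≤ d * (C * t ^ (p - 2) * (n * √S))) :
    |2 * ψ * g * v| ≤ g * ((4 * L * C * n) * (ψ * √S) * t ^ (p - 1)) := by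
  rw [abs_mul, abs_of_nonneg (by positivity : 0 ≤ 2 * ψ * g)]
  have hp1 : t ^ (p - 1) = t * t ^ (p - 2) := by
    rw [show p - 1 = 1 + (p - 2) by ring, rpow_add ht, rpow_one]
  have h2 : w ≤ 2 * t * (C * t ^ (p - 2) * (n * √S)) :=
    hw.trans (mul_le_right hd (by positivity))
  calc 2 * ψ * g * |v| ≤ 2 * ψ * g * (L * (2 * t * (C * t ^ (p - 2) * (n * √S)))) :=
        mul_le_left (hv.trans (mul_le_left h2 hL)) (by positivity)
    _ = _ := by rw [hp1]; ring

lemma cutoff_term_young {ψ S : ℝ} (ht : 0 < t) (hS : 0 ≤ S) (hδ : 0 < δ) :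
    b * (ψ * √S) * t ^ (p - 1)
      ≤ δ / 2 * (ψ ^ 2 * (t ^ (p - 2) * S)) + b ^ 2 / (2 * δ) * t ^ p := by
  have h1 := young (a := ψ * √S * t ^ ((p - 2) / 2)) (b := b * t ^ (p / 2))
    (δ := δ / 2) (by positivity)
  have h2 : t ^ ((p - 2) / 2) * t ^ (p / 2) = t ^ (p - 1) := by
    rw [← rpow_add ht]; congr 1; ring
  have h3 : (t ^ ((p - 2) / 2)) ^ 2 = t ^ (p - 2) := by
    rw [← rpow_natCast, ← rpow_mul ht.le]; congr 1; push_cast; ring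
  have h4 : (t ^ (p / 2)) ^ 2 = t ^ p := by
    rw [← rpow_natCast, ← rpow_mul ht.le]; congr 1; push_cast; ring
  rw [mul_pow, mul_pow, mul_pow, h3, h4, sq_sqrt hS,
    show 4 * (δ / 2) = 2 * δ by ring] at h1
  rw [← h2]
  calc _ = ψ * √S * t ^ ((p - 2) / 2) * (b * t ^ (p / 2)) := by ring
    _ ≤ _ := h1
    _ = _ := by ring

lemma weighted_form_lower {G g g' ψ : ℝ} (hp : 1 < p) (hκ : 0 < κ)
    (hκ1 : κ ≤ 1) (hC : 0 ≤ C) (hL : 0 ≤ L) (hη : 0 ≤ η) {a D : Euc n} (ha : a ≠ 0)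
    {Y V : Fin n → Euc n}
    (hR : ∀ k, ‖V k - pvD (p - 2) a (Y k)‖ ≤ C * ‖a‖ ^ (p - 3) * η * ‖Y k‖)
    (hV : ∀ k, ‖V k‖ ≤ C * ‖a‖ ^ (p - 2) * ‖Y k‖)
    (hD1 : 0 < ‖D‖) (hD2 : ‖D‖ ≤ 2 * ‖a‖) (hg : 0 ≤ g) (hgG : g ≤ G) (hgG' : |g'| ≤ G)
    (hgg : -(1 - κ) / 2 * g ≤ ‖D‖ ^ 2 * g') (hψ : 0 ≤ ψ) (hψ1 : ψ ≤ 1)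
    {ψ' : Euc n →L[ℝ] ℝ} (hψ' : ∀ v, |ψ' v| ≤ L * ‖v‖) :
    κ * min 1 (p - 1) / 2 * (ψ ^ 2 * (g * ‖a‖ ^ (p - 2) * ∑ k, ‖Y k‖ ^ 2))
      - (4 * L * C * n) ^ 2 / (2 * (κ * min 1 (p - 1))) * (g * ‖a‖ ^ p)
      - η * (G * C * ‖a‖ ^ (p - 3) * (1 + 8 * n ^ 2 * ‖a‖ ^ 2)) * ∑ k, ‖Y k‖ ^ 2
    ≤ ∑ k, (2 * ψ * (g * D k) * ψ' (V k) + ψ ^ 2 * (g * ⟪Y k, V k⟫_ℝ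
        + D k * (g' * ⟪(2:ℝ) • ∑ l, D l • Y l, V k⟫_ℝ))) := by
  set A := pvD (p - 2) a with hA
  set S := ∑ k, ‖Y k‖ ^ 2 with hS
  set N := ∑ l, D l • Y l with hN
  set R : Fin n → Euc n := fun k => V k - A (Y k) with hRd
  have hVR : ∀ k, V k = A (Y k) + R k := fun k => by simp [hRd]
  have ht : 0 < ‖a‖ := norm_pos_iff.2 ha
  have hS0 : 0 ≤ S := sum_nonneg fun _ _ => sq_nonneg _
  set Q := ∑ k, ⟪A (Y k), Y k⟫_ℝ with hQ
  have hQl : min 1 (p - 1) * ‖a‖ ^ (p - 2) * S ≤ Q := by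
    rw [hS, hQ, mul_sum]
    refine sum_le_sum fun k _ => ?_
    have := pvD_coercive (p - 2) ha (Y k)
    rwa [show 1 + (p - 2) = p - 1 by ring] at this
  have hform : ⟪A N, N⟫_ℝ ≤ ‖D‖ ^ 2 * Q := form_sum_le A (pvD_symm _ a) (pvD_nonneg hp ha) D Y
  have hform0 : 0 ≤ ⟪A N, N⟫_ℝ := pvD_nonneg hp ha N
  have e0 : ∑ k, (2 * ψ * (g * D k) * ψ' (V k) + ψ ^ 2 * (g * ⟪Y k, V k⟫_ℝ
        + D k * (g' * ⟪(2:ℝ) • N, V k⟫_ℝ)))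
      = 2 * ψ * g * ψ' (∑ k, D k • V k) + ψ ^ 2 * (g * Q + g * ∑ k, ⟪Y k, R k⟫_ℝ
        + 2 * g' * ⟪A N, N⟫_ℝ + 2 * g' * ⟪N, ∑ k, D k • R k⟫_ℝ) := by
    have h1 : ⟪A N, N⟫_ℝ = ∑ k, D k * ⟪N, A (Y k)⟫_ℝ := by
      rw [real_inner_comm, hN]
      simp only [map_sum, map_smul, inner_sum, real_inner_smul_right]
    rw [h1]
    simp only [map_sum, map_smul, smul_eq_mul, inner_sum, real_inner_smul_right,
      real_inner_smul_left, hQ, mul_sum, ← sum_add_distrib]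
    refine sum_congr rfl fun k _ => ?_
    rw [hVR k, inner_add_right, inner_add_right, map_add, real_inner_comm (Y k) (A (Y k))]
    ring
  rw [e0]
  have hE : 0 ≤ C * ‖a‖ ^ (p - 3) * η := by positivity
  have hcA0 : 0 < min 1 (p - 1) := lt_min one_pos (by linarith)
  have e1 := abs_sum_inner_le (Y := Y) (R := R) hR
  have e2 : |⟪N, ∑ k, D k • R k⟫_ℝ| ≤ C * ‖a‖ ^ (p - 3) * η * (n ^ 2 * (4 * ‖a‖ ^ 2)) * S := by
    refine (abs_inner_sum_le (Y := Y) (R := R) (D := D) hE hR).trans ?_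
    have hD3 : ‖D‖ ^ 2 ≤ 4 * ‖a‖ ^ 2 := by nlinarith [norm_nonneg D]
    exact mul_le_right (mul_le_left
      (mul_le_left hD3 (sq_nonneg _)) hE) hS0
  have e3 := cutoff_term_le (n := n) hψ hg hL hC ht hD2 (hψ' (∑ k, D k • V k))
    (norm_sum_smul_le_sqrt (Y := Y) (R := V) (D := D)
      (mul_nonneg hC (rpow_nonneg ht.le _)) hV)
  have e4 := cutoff_term_young (p := p) (b := 4 * L * C * n) (ψ := ψ) ht hS0 (mul_pos hκ hcA0)
  have := weighted_arith hψ hψ1 hκ hκ1 hg hgG hgG' hS0 (rpow_nonneg ht.le (p - 2)) hcA0.le hgg hQl hform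
    hform0 e1 e2 e3 e4
  convert this using 1
  ring

lemma tr_weight (hm0 : -1 ≤ m) (hm1 : m ≤ 0) (ht : 0 < t) (h1 : t / 2 ≤ d)
    (h2 : d ≤ 2 * t) :
    tr ε (m / 2) (d ^ 2) ≤ 2 * t ^ m ∧
      (0 < ε → 2 * ε ^ 2 ≤ d ^ 2 → t ^ m ≤ 2 * tr ε (m / 2) (d ^ 2)) := by
  have hd : 0 < d := by linarith
  have h3 : (2:ℝ) ^ |m| ≤ 2 := by
    calc (2:ℝ) ^ |m| ≤ 2 ^ (1:ℝ) := by
          apply rpow_le_rpow_of_exponent_le (by norm_num)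
          rw [abs_of_nonpos hm1]; linarith
      _ = 2 := by simp
  constructor
  · calc _ ≤ (d ^ 2) ^ (m / 2) := tr_le _ (sq_nonneg _)
      _ = d ^ m := sq_rpow_half hd.le m
      _ ≤ 2 ^ |m| * t ^ m := rpow_comparable m ht h1 h2
      _ ≤ _ := by gcongr
  · intro hε h4
    rw [tr_eq _ hε h4, sq_rpow_half hd.le m]
    calc t ^ m ≤ 2 ^ |m| * d ^ m := rpow_comparable m hd (by linarith) (by linarith)
      _ ≤ _ := by gcongr

namespace PData

include P

lemma weighted_test_hasFDerivAt (hε : 0 < ε) (h : ℝ) (k : Fin n)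
    (x : Euc n) :
    HasFDerivAt (fun x => tr ε e (‖dvec h u x‖ ^ 2) * dq h k u x)
      (tr ε e (‖dvec h u x‖ ^ 2) • innerSL ℝ (dq h k X x)
        + dq h k u x • (deriv (tr ε e) (‖dvec h u x‖ ^ 2) •
            innerSL ℝ ((2:ℝ) • nvec h u X x))) x :=
  ((tr_hasDerivAt e hε _).comp_hasFDerivAt x (P.dvec_normsq_hasFDerivAt h x)).mul
    (P.dqu_hasFDerivAt h k x)

lemma weighted_test_contDiff (hε : 0 < ε) (h : ℝ) (k : Fin n) :
    ContDiff ℝ 1 (fun x => tr ε e (‖dvec h u x‖ ^ 2) * dq h k u x) :=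
  (((tr_contDiff e hε).of_le (by simp)).comp ((P.dvec_contDiff h).norm_sq ℝ)).mul
    (dq_contDiff P.u_contDiff h k)

omit P in
lemma weighted_test_bound (hκ : 0 < κ) (hκ1 : κ ≤ 1) (hε : 0 < ε)
    (hM : 0 ≤ M) (htM : t ≤ M) (hd : 0 ≤ d) (hc : ε ≤ d → 0 < t ∧ t / 2 ≤ d ∧ d ≤ 2 * t) :
    tr ε ((κ - 1) / 2) (d ^ 2) * d ≤ 4 * M ^ κ := by
  rcases lt_or_ge d ε with h | h
  · rw [tr_zero _ hε (by gcongr)]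
    rw [zero_mul]; positivity
  · obtain ⟨h1, h2, h3⟩ := hc h
    have h4 := (tr_weight (ε := ε) (m := κ - 1) (by linarith) (by linarith) h1 h2 h3).1
    calc _ ≤ (2 * t ^ (κ - 1)) * (2 * t) := by gcongr
      _ = 4 * t ^ κ := by
        have : t ^ κ = t ^ (κ - 1) * t := by
          rw [rpow_sub_one h1.ne']; field_simp
        rw [this]; ring
      _ ≤ 4 * M ^ κ := by gcongr

lemma weighted_pointwise {G : ℝ} (hκ : 0 < κ)
    (hκ1 : κ ≤ 1) (hC : 0 < C) (hδ : 0 < δ) (hL : 0 < L) (hε : 0 < ε) (hη0 : 0 < η)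
    (hη : η ≤ ε / 4) (hηδ : η ≤ δ * (ε / 2)) (hXM : ∀ x, ‖X x‖ ≤ M)
    (hS : ∀ (η h : ℝ) (x : Euc n) (k : Fin n),
      GoodStep X u η h → X x ≠ 0 → η ≤ δ * ‖X x‖ →
      ‖dq h k flux x - pvD (p - 2) (X x) (dq h k X x)‖
          ≤ C * ‖X x‖ ^ (p - 3) * η * ‖dq h k X x‖ ∧
      ‖dq h k flux x‖ ≤ C * ‖X x‖ ^ (p - 2) * ‖dq h k X x‖ ∧
      c * ‖X x‖ ^ (p - 2) * ‖dq h k X x‖ ^ 2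
        ≤ ⟪dq h k X x, dq h k flux x⟫_ℝ)
    (hG : 0 < G) (hGb : ∀ s, 0 ≤ s → s ≤ (2 * M) ^ 2 →
      |tr ε ((κ - 1) / 2) s| ≤ G ∧ |deriv (tr ε ((κ - 1) / 2)) s| ≤ G)
    (hg : GoodStep X u η h) (x : Euc n) {ψ : ℝ} {ψ' : Euc n →L[ℝ] ℝ} (hψ : 0 ≤ ψ) (hψ1 : ψ ≤ 1)
    (hψ' : ∀ v, |ψ' v| ≤ L * ‖v‖) (hd : ε ≤ ‖dvec h u x‖) :
    κ * min 1 (p - 1) / 2 * (ψ ^ 2 * (tr ε ((κ - 1) / 2) (‖dvec h u x‖ ^ 2)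
        * ‖X x‖ ^ (p - 2) * sqn h X x))
      - (4 * L * C * n) ^ 2 / (2 * (κ * min 1 (p - 1))) * (2 * M ^ (p - 1 + κ))
      - η * (G * C * (ε / 2) ^ (p - 3) * (1 + 8 * n ^ 2 * M ^ 2)) * sqn h X x
    ≤ ∑ k, (2 * ψ * (tr ε ((κ - 1) / 2) (‖dvec h u x‖ ^ 2) * dq h k u x)
        * ψ' (dq h k flux x)
        + ψ ^ 2 * (tr ε ((κ - 1) / 2) (‖dvec h u x‖ ^ 2)
            * ⟪dq h k X x, dq h k flux x⟫_ℝ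
          + dq h k u x * (deriv (tr ε ((κ - 1) / 2)) (‖dvec h u x‖ ^ 2)
            * ⟪(2:ℝ) • nvec h u X x, dq h k flux x⟫_ℝ))) := by
  obtain ⟨h1, h2, h3⟩ := hg.comparable hη hd hε
  have hp := P.one_lt
  have ht : 0 < ‖X x‖ := by linarith
  have ha : X x ≠ 0 := norm_pos_iff.1 ht
  have hM := hXM x
  have hηt : η ≤ δ * ‖X x‖ := hηδ.trans (by gcongr)
  have hd0 : 0 < ‖dvec h u x‖ := by linarith
  have hdM : ‖dvec h u x‖ ^ 2 ≤ (2 * M) ^ 2 := by gcongr; linarith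
  obtain ⟨hG1, hG2⟩ := hGb _ (sq_nonneg _) hdM
  have hg0 := tr_nonneg (ε := ε) ((κ - 1) / 2) (sq_nonneg ‖dvec h u x‖)
  have hgg := tr_deriv_ge (ε := ε) ((κ - 1) / 2) (s := ‖dvec h u x‖ ^ 2) (by positivity)
  have key := weighted_form_lower (G := G) hp hκ hκ1 hC.le hL.le hη0.le ha
    (fun k => (hS η h x k hg ha hηt).1) (fun k => (hS η h x k hg ha hηt).2.1) hd0 h3 hg0
    ((le_abs_self _).trans hG1) hG2 (by convert hgg using 1; ring) hψ hψ1 hψ'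
  refine le_trans ?_ key
  have hS0 := sqn_nonneg h X x
  have hw := (tr_weight (ε := ε) (m := κ - 1) (by linarith) (by linarith) ht h2 h3).1
  have e1 : tr ε ((κ - 1) / 2) (‖dvec h u x‖ ^ 2) * ‖X x‖ ^ p ≤ 2 * M ^ (p - 1 + κ) := by
    calc _ ≤ 2 * ‖X x‖ ^ (κ - 1) * ‖X x‖ ^ p := by gcongr
      _ = 2 * ‖X x‖ ^ (p - 1 + κ) := by
        rw [mul_assoc, ← rpow_add ht]; ring_nf
      _ ≤ _ := by gcongr
  have e2 : ‖X x‖ ^ (p - 3) ≤ (ε / 2) ^ (p - 3) :=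
    rpow_le_rpow_of_nonpos (by positivity) h1 (by linarith [P.lt_three])
  have e3 : η * (G * C * ‖X x‖ ^ (p - 3) * (1 + 8 * n ^ 2 * ‖X x‖ ^ 2)) * sqn h X x
      ≤ η * (G * C * (ε / 2) ^ (p - 3) * (1 + 8 * n ^ 2 * M ^ 2)) * sqn h X x := by
    gcongr
  have e4 : (4 * L * C * n) ^ 2 / (2 * (κ * min 1 (p - 1)))
        * (tr ε ((κ - 1) / 2) (‖dvec h u x‖ ^ 2) * ‖X x‖ ^ p)
      ≤ (4 * L * C * n) ^ 2 / (2 * (κ * min 1 (p - 1))) * (2 * M ^ (p - 1 + κ)) := by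
    have : 0 < min 1 (p - 1) := lt_min one_pos (by linarith)
    exact mul_le_left e1 (by positivity)
  unfold sqn at *
  linarith

lemma local_bound_sqn (hK : IsCompact K) (hKO : K ⊆ O)
    (hε : 0 < ε) :
    ∃ C, 0 < C ∧ ∀₀ h, ∫ x in bset X K ε, sqn h X x ≤ C := by
  obtain ⟨C, hC⟩ := P.local_bound hK hKO hε
  refine ⟨n * |C| + 1, by positivity, hC.mono fun h hh => ?_⟩
  have hi : ∀ k, IntegrableOn (fun x => ‖dq h k X x‖ ^ 2) (bset X K ε) := fun k =>
    (((P.dqX_continuous h k).norm.pow 2).continuousOn).integrableOn_compact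
      (bset_compact P.cont hK ε)
  calc ∫ x in bset X K ε, sqn h X x = ∑ k, ∫ x in bset X K ε, ‖dq h k X x‖ ^ 2 :=
        integral_finsetSum _ fun k _ => hi k
    _ ≤ ∑ _k : Fin n, |C| := sum_le_sum fun k _ => (hh k).trans (le_abs_self C)
    _ ≤ _ := by simp

lemma weighted_bound (hκ : 0 < κ) (hκ1 : κ ≤ 1)
    (hK : IsCompact K) (hKO : K ⊆ O) :
    ∃ B, ∀ ε, 0 < ε → ∀₀ h,
      ∫ x in bset X K ε, ‖X x‖ ^ (p - 3 + κ) * sqn h X x ≤ B := by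
  obtain ⟨C, hC, c, hc, δ, hδ, -, hS⟩ := exists_dqS (n := n) P.one_lt
  obtain ⟨M, hM, hXM⟩ := P.exists_bound
  obtain ⟨Lf, hLf, hdf⟩ := P.dqf_bound
  obtain ⟨ψ, hψ⟩ := exists_cutoff P.isOpen hK hKO
  obtain ⟨L, hL, hψL⟩ := hψ.fderiv_bound
  have hcA : 0 < min 1 (p - 1) := lt_min one_pos (by linarith [P.one_lt])
  set K' := tsupport ψ with hK'
  have hK'c : IsCompact K' := hψ.cpt
  set C1 := (4 * L * C * n) ^ 2 / (2 * (κ * min 1 (p - 1))) * (2 * M ^ (p - 1 + κ)) with hC1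
  have hC1' : 0 ≤ C1 := by rw [hC1]; positivity
  refine ⟨(n * (Lf * (4 * M ^ κ) * volume.real K') + (C1 * volume.real K' + 1))
    / (κ * min 1 (p - 1) / 4), fun ε0 hε0 => ?_⟩
  set ε := ε0 / 2 with hεd
  have hε : 0 < ε := by positivity
  obtain ⟨Cl, hCl, hloc⟩ := P.local_bound_sqn hK'c hψ.sub (half_pos hε)
  obtain ⟨G, hG, hGb⟩ := exists_tr_bounds ((κ - 1) / 2) hε ((2 * M) ^ 2)
  set Cε := G * C * (ε / 2) ^ (p - 3) * (1 + 8 * n ^ 2 * M ^ 2) with hCε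
  have hCε0 : 0 < Cε := by rw [hCε]; positivity
  set η := min (min (ε / 4) (δ * (ε / 2))) (1 / (Cε * Cl)) with hη
  have hη0 : 0 < η := by positivity
  have hη1 : η ≤ ε / 4 := (min_le_left _ _).trans (min_le_left _ _)
  have hη2 : η ≤ δ * (ε / 2) := (min_le_left _ _).trans (min_le_right _ _)
  have hη3 : η * Cε * Cl ≤ 1 := by
    calc η * Cε * Cl ≤ 1 / (Cε * Cl) * Cε * Cl := by gcongr; exact min_le_right _ _
      _ = 1 := by field_simp
  clear_value C1 ε Cε η
  filter_upwards [P.eventually_good hη0, hloc, eventually_add_mem P.isOpen hK'c hψ.sub]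
    with h hg hloc hadd
  set V : Fin n → Euc n → Euc n := fun k => dq h k fun x => pv (p - 2) (X x) with hV
  have hVc : ∀ k, Continuous (V k) := fun k => dq_continuous P.S_continuous h k
  set q : Fin n → Euc n → ℝ := fun k x => tr ε ((κ - 1) / 2) (‖dvec h u x‖ ^ 2) * dq h k u x
    with hq
  have hφ : ∀ k, ContDiff ℝ 1 (fun x => ψ x ^ 2 * q k x) := fun k =>
    ((hψ.contDiff.of_le (by simp)).pow 2).mul (P.weighted_test_contDiff hε h k)
  have hφs : ∀ k, HasCompactSupport (fun x => ψ x ^ 2 * q k x) := fun k =>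
    hasCompactSupport_sq_mul hψ.cpt (q k)
  set E : Euc n → ℝ := fun x => ∑ k, fderiv ℝ (fun x => ψ x ^ 2 * q k x) x (V k x) with hE
  have hEk : ∀ k, Continuous fun x => fderiv ℝ (fun x => ψ x ^ 2 * q k x) x (V k x) := fun k =>
    ((hφ k).continuous_fderiv (by simp)).clm_apply (hVc k)
  have hEc : Continuous E := continuous_finsetSum _ fun k _ => hEk k
  have hEx : ∀ x, E x = ∑ k, (2 * ψ x * q k x * fderiv ℝ ψ x (V k x) + ψ x ^ 2 *
      (tr ε ((κ - 1) / 2) (‖dvec h u x‖ ^ 2) * ⟪dq h k X x, V k x⟫_ℝ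
          + dq h k u x * (deriv (tr ε ((κ - 1) / 2)) (‖dvec h u x‖ ^ 2)
            * ⟪(2:ℝ) • nvec h u X x, V k x⟫_ℝ))) := fun x => by
    refine sum_congr rfl fun k _ => ?_
    rw [fderiv_sq_mul (hψ.hasFDerivAt x) (P.weighted_test_hasFDerivAt hε h k x) (V k x)]
    rfl
  have hE0 : ∀ x, x ∉ K' → E x = 0 := fun x hx => by
    rw [hEx]; simp [zero_off_tsupport hx]
  have hEs : HasCompactSupport E := HasCompactSupport.of_support_subset_isCompact hK'c
    fun x hx => by_contra fun h => hx (hE0 x h)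
  have hB := bset_compact P.cont hK'c (ε / 2)
  have hA := bset_compact P.cont hK ε0
  have hsq := sqn_continuous P.cont h
  have hlow := integral_lower hA hB
    (F₁ := fun x => κ * min 1 (p - 1) / 4 * (‖X x‖ ^ (p - 3 + κ) * sqn h X x))
    (F₂ := fun x => C1 + η * Cε * sqn h X x) hEc hEs
    (((P.cont.norm.continuousOn.rpow_const fun x hx =>
      Or.inl (hε0.trans_le hx.2).ne').mul hsq.continuousOn).const_smul
        (κ * min 1 (p - 1) / 4)) (by fun_prop) ?_
  · have hint : ∫ x, E x ≤ n * (Lf * (4 * M ^ κ) * volume.real K') := by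
      rw [hE, integral_finsetSum _ fun k _ => (hEk k).integrable_cpt
        (fderiv_pairing_hasCompactSupport (hφs k) _)]
      calc _ ≤ ∑ _k : Fin n, Lf * (4 * M ^ κ) * volume.real K' := ?_
        _ = _ := by simp
      refine sum_le_sum fun k _ => ?_
      rw [P.weakEq_dq hadd k _ (hφ k) (hφs k) (tsupport_sq_mul_subset _ _)]
      refine (le_abs_self _).trans (abs_integral_le_of_bound hK'c
        (fun x hx => by simp [zero_off_tsupport hx]) fun x _ => ?_)
      rw [abs_mul, abs_mul, abs_of_nonneg (sq_nonneg (ψ x))]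
      have h1 : ψ x ^ 2 ≤ 1 := pow_le_one₀ (hψ.nonneg x) (hψ.le_one x)
      have h2 : |q k x| ≤ 4 * M ^ κ := by
        rw [hq, abs_mul, abs_of_nonneg (tr_nonneg _ (sq_nonneg _))]
        refine le_trans (mul_le_left (abs_apply_le_norm (dvec h u x) k)
          (tr_nonneg _ (sq_nonneg _))) ?_
        refine weighted_test_bound hκ hκ1 hε hM.le (hXM x) (norm_nonneg _) fun hd => ?_
        obtain ⟨a1, a2, a3⟩ := hg.comparable hη1 hd hε
        exact ⟨by linarith, a2, a3⟩
      have h3 : ψ x ^ 2 * |q k x| ≤ 1 * (4 * M ^ κ) := by gcongr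
      rw [one_mul] at h3
      exact mul_le_mul (hdf h hg.ne k x) h3 (by positivity) hLf.le
    have hF2 : ∫ x in bset X K' (ε / 2), (C1 + η * Cε * sqn h X x)
        ≤ C1 * volume.real K' + 1 := by
      rw [integral_add (continuousOn_const.integrableOn_compact hB)
        ((hsq.const_mul _ |>.continuousOn).integrableOn_compact hB), integral_const_mul,
        setIntegral_const, smul_eq_mul]
      have h1 : volume.real (bset X K' (ε / 2)) ≤ volume.real K' :=
        measureReal_mono inter_subset_left hK'c.measure_lt_top.ne
      have h2 := mul_le_left hloc (by positivity : 0 ≤ η * Cε)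
      have h3 := mul_le_right h1 hC1'
      linarith
    rw [integral_const_mul] at hlow
    rw [le_div_iff₀ (by positivity)]
    linarith
  · intro x
    have hS0 := sqn_nonneg h X x
    by_cases hx : x ∈ K' ∧ ε ≤ ‖dvec h u x‖
    · obtain ⟨a1, a2, a3⟩ := hg.comparable hη1 hx.2 hε
      rw [indicator_of_mem (show x ∈ bset X K' (ε / 2) from ⟨hx.1, a1⟩), hEx]
      have key := P.weighted_pointwise hκ hκ1 hC hδ hL hε hη0 hη1 hη2 hXM
        (fun η h x k => hS X u η h x k) hG hGb hg x (hψ.nonneg x) (hψ.le_one x) (hψL x) hx.2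
      rw [← hC1, ← hCε] at key
      have e1 : (bset X K ε0).indicator
          (fun x => κ * min 1 (p - 1) / 4 * (‖X x‖ ^ (p - 3 + κ) * sqn h X x)) x
          ≤ κ * min 1 (p - 1) / 2 * (ψ x ^ 2 * (tr ε ((κ - 1) / 2) (‖dvec h u x‖ ^ 2)
            * ‖X x‖ ^ (p - 2) * sqn h X x)) := by
        by_cases hxA : x ∈ bset X K ε0
        · rw [indicator_of_mem hxA, hψ.one hxA.1]
          have ht : 0 < ‖X x‖ := by linarith
          have h1 := (tr_weight (ε := ε) (m := κ - 1) (by linarith) (by linarith) ht a2 a3).2 hε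
            (hg.large hη1 (by rw [hεd]; linarith [hxA.2.out]) hε).2
          have h2 : ‖X x‖ ^ (p - 3 + κ) = ‖X x‖ ^ (κ - 1) * ‖X x‖ ^ (p - 2) := by
            rw [← rpow_add ht]; ring_nf
          rw [h2]
          calc _ ≤ κ * min 1 (p - 1) / 4 * ((2 * tr ε ((κ - 1) / 2) (‖dvec h u x‖ ^ 2))
                * ‖X x‖ ^ (p - 2) * sqn h X x) := by gcongr
            _ = _ := by ring
        · rw [indicator_of_notMem hxA]
          have := tr_nonneg (ε := ε) ((κ - 1) / 2) (sq_nonneg ‖dvec h u x‖)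
          positivity
      refine e1.trans ?_
      have : η * Cε * sqn h X x = η * Cε * sqn h X x := rfl
      linarith
    · have hxE : E x = 0 := by
        by_cases hxK : x ∈ K'
        · have hd : ‖dvec h u x‖ < ε := not_le.1 fun hh => hx ⟨hxK, hh⟩
          rw [hEx, tr_deriv_zero _ hε (by gcongr)]
          simp [hq, tr_zero _ hε (by gcongr : ‖dvec h u x‖ ^ 2 ≤ ε ^ 2)]
        · exact hE0 x hxK
      have hxA : x ∉ bset X K ε0 := fun hxA => hx
        ⟨subset_tsupport ψ (by simp [hψ.one hxA.1]),
          (hg.large hη1 (by rw [hεd]; linarith [hxA.2.out]) hε).1⟩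
      rw [indicator_of_notMem hxA, hxE, zero_add]
      exact indicator_nonneg (fun x _ => by have := sqn_nonneg h X x; positivity) x

end PData

/-- A smooth positive function comparable to `max s (ε ^ 2) ^ (-b / 2)`. -/
def gtr (ε b s : ℝ) : ℝ := tr ε (-b / 2) s + (1 - cutT ε s) * ε ^ (-b)

lemma gtr_contDiff (b : ℝ) (hε : 0 < ε) : Smooth (gtr ε b) :=
  (tr_contDiff _ hε).add ((contDiff_const.sub (cutT_contDiff ε)).mul contDiff_const)

lemma gtr_hasDerivAt (b : ℝ) (hε : 0 < ε) (s : ℝ) :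
    HasDerivAt (gtr ε b) (deriv (gtr ε b) s) s :=
  ((gtr_contDiff b hε).differentiable (by simp) s).hasDerivAt

lemma gtr_bounds (hε : 0 < ε) (hb : 0 < b) (hd : 0 ≤ d) :
    (max d ε) ^ (-b) ≤ gtr ε b (d ^ 2) ∧ gtr ε b (d ^ 2) ≤ 2 ^ b * (max d ε) ^ (-b) := by
  have h0 := cutT_nonneg ε (d ^ 2)
  have h1 := cutT_le_one ε (d ^ 2)
  have hm : 0 < max d ε := lt_max_of_lt_right hε
  have h2b : (1:ℝ) ≤ 2 ^ b := one_le_rpow (by norm_num) hb.le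
  have hmb : 0 < (max d ε) ^ (-b) := by positivity
  have e1 : (max d ε) ^ (-b) ≤ ε ^ (-b) :=
    rpow_le_rpow_of_nonpos hε (le_max_right _ _) (by linarith)
  have e3 : (1 - cutT ε (d ^ 2)) * ε ^ (-b) ≤ (1 - cutT ε (d ^ 2)) * (2 ^ b * (max d ε) ^ (-b)) := by
    rcases le_or_gt (2 * ε ^ 2) (d ^ 2) with h | h
    · rw [cutT_one hε h]; simp
    · refine mul_le_left ?_ (by linarith)
      have hd2 : d ≤ 2 * ε := by nlinarith
      have : max d ε ≤ 2 * ε := max_le hd2 (by linarith)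
      calc ε ^ (-b) = 2 ^ b * (2 * ε) ^ (-b) := by
            rw [mul_rpow (by norm_num) hε.le, ← mul_assoc, ← rpow_add (by norm_num)]
            simp
        _ ≤ _ := by
          refine mul_le_left ?_ (by positivity)
          exact rpow_le_rpow_of_nonpos hm this (by linarith)
  rcases hd.eq_or_lt with h | h
  · subst h
    have hc : cutT ε (0 ^ 2) = 0 := cutT_zero hε (by simpa using sq_nonneg ε)
    simp only [gtr, tr, hc, zero_mul, zero_add, sub_zero, one_mul] at *
    exact ⟨e1, e3⟩
  · have e2 : (max d ε) ^ (-b) ≤ d ^ (-b) :=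
      rpow_le_rpow_of_nonpos h (le_max_left _ _) (by linarith)
    have e4 : cutT ε (d ^ 2) * d ^ (-b) ≤ cutT ε (d ^ 2) * (2 ^ b * (max d ε) ^ (-b)) := by
      rcases le_or_gt d ε with h' | h'
      · rw [cutT_zero hε (by gcongr)]; simp
      · rw [max_eq_left h'.le]
        refine mul_le_left ?_ h0
        nlinarith [rpow_pos_of_pos h (-b)]
    simp only [gtr, tr, sq_rpow_half hd]
    constructor
    · have a1 := mul_le_left e1 (by linarith : 0 ≤ 1 - cutT ε (d ^ 2))
      have a2 := mul_le_left e2 h0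
      linarith
    · linarith

lemma gtr_deriv (b : ℝ) (hε : 0 < ε) (s : ℝ) :
    deriv (gtr ε b) s = deriv (tr ε (-b / 2)) s - deriv (cutT ε) s * ε ^ (-b) := by
  have h := (tr_hasDerivAt (-b / 2) hε s).add
    (((hasDerivAt_const s (1:ℝ)).sub (cutT_hasDerivAt ε s)).mul_const (ε ^ (-b)))
  refine h.deriv.trans ?_
  ring

lemma cutT_deriv_zero (hε : 0 < ε) (hs : s < ε ^ 2) : deriv (cutT ε) s = 0 := by
  have : cutT ε =ᶠ[𝓝 s] fun _ => 0 :=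
    (eventually_lt_nhds hs).mono fun y hy => cutT_zero hε hy.le
  rw [this.deriv_eq]; simp

lemma cutT_deriv_zero' (hε : 0 < ε) (hs : 2 * ε ^ 2 < s) : deriv (cutT ε) s = 0 := by
  have : cutT ε =ᶠ[𝓝 s] fun _ => 1 :=
    (eventually_gt_nhds hs).mono fun y hy => cutT_one hε hy.le
  rw [this.deriv_eq]; simp

lemma gtr_deriv_zero (b : ℝ) (hε : 0 < ε) (hs : s < ε ^ 2) : deriv (gtr ε b) s = 0 := by
  rw [gtr_deriv b hε, tr_deriv_zero _ hε hs, cutT_deriv_zero hε hs]; simp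

lemma gtr_deriv_bound (hb : 0 < b) : ∃ C : ℝ, 0 ≤ C ∧ ∀ ε s : ℝ, 0 < ε → 0 < s →
    |deriv (gtr ε b) s| ≤ C * s ^ (-b / 2 - 1) := by
  obtain ⟨C1, hC1, h1⟩ := tr_deriv_bound (-b / 2)
  obtain ⟨C2, hC2, h2⟩ := cutT_deriv_bound
  refine ⟨C1 + C2 * 2 ^ (b / 2), by positivity, fun ε s hε hs => ?_⟩
  rw [gtr_deriv b hε, add_mul]
  refine (abs_sub _ _).trans (add_le_add (h1 ε s hε hs) ?_)
  rcases lt_or_ge (2 * ε ^ 2) s with h | h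
  · rw [cutT_deriv_zero' hε h]; simp; positivity
  · rw [abs_of_nonneg (mul_nonneg (cutT_deriv_nonneg _ _) (by positivity))]
    have e1 : ε ^ (-b) ≤ 2 ^ (b / 2) * s ^ (-b / 2) := by
      rw [← sq_rpow_half hε.le (-b)]
      calc (ε ^ 2) ^ (-b / 2) = 2 ^ (b / 2) * (2 * ε ^ 2) ^ (-b / 2) := by
            rw [mul_rpow (by norm_num) (sq_nonneg ε), ← mul_assoc,
              ← rpow_add (by norm_num), show b / 2 + -b / 2 = 0 by ring]
            simp
        _ ≤ _ := by
          refine mul_le_left ?_ (by positivity)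
          exact rpow_le_rpow_of_nonpos hs h (by linarith)
    calc _ ≤ C2 / s * (2 ^ (b / 2) * s ^ (-b / 2)) := by
          gcongr; exact h2 ε s hε hs
      _ = _ := by rw [rpow_sub_one hs.ne']; ring

lemma neg_power_cross {τ Cg g g' S N W : ℝ} (hd : 0 < d) (ht : t / 2 ≤ d)
    (ht' : d ≤ 2 * t) (hp : 1 < p) (hτ : 0 < τ) (hCg : 0 ≤ Cg) (hS : 0 ≤ S)
    (hg : d ^ (-(p - 1 - κ)) ≤ g) (hg' : |g'| ≤ Cg * (d ^ 2) ^ (-(p - 1 - κ) / 2 - 1))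
    (hN : N ≤ d * (n * √S)) (hN0 : 0 ≤ N) (hW : W ≤ t ^ (p - 1)) (hW0 : 0 ≤ W) :
    |g'| * (2 * N * W) ≤ τ / 2 * g
      + (2 * Cg * n * 2 ^ (p - 1)) ^ 2 / (2 * τ) * (2 ^ |p - 3 + κ| * t ^ (p - 3 + κ) * S) := by
  have ht0 : 0 < t := by linarith
  have e0 : (d ^ 2) ^ (-(p - 1 - κ) / 2 - 1) = d ^ (-(p - 1 - κ) - 2) := by
    rw [← sq_rpow_half hd.le]; congr 1; ring
  have e1 : |g'| * (2 * N * W)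
      ≤ Cg * d ^ (-(p - 1 - κ) - 2) * (2 * (d * (n * √S)) * (2 * d) ^ (p - 1)) := by
    rw [← e0]
    have : W ≤ (2 * d) ^ (p - 1) :=
      hW.trans (rpow_le_rpow ht0.le (by linarith) (by linarith))
    gcongr
  have e2 : Cg * d ^ (-(p - 1 - κ) - 2) * (2 * (d * (n * √S)) * (2 * d) ^ (p - 1))
      = d ^ (-(p - 1 - κ) / 2) * ((2 * Cg * n * 2 ^ (p - 1)) * (d ^ ((p - 3 + κ) / 2) * √S)) := by
    rw [mul_rpow (by norm_num) hd.le]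
    have : d ^ (-(p - 1 - κ) - 2) * d * d ^ (p - 1)
        = d ^ (-(p - 1 - κ) / 2) * d ^ ((p - 3 + κ) / 2) := by
      rw [← rpow_add_one hd.ne', ← rpow_add hd, ← rpow_add hd]; congr 1; ring
    calc _ = (d ^ (-(p - 1 - κ) - 2) * d * d ^ (p - 1)) * (2 * Cg * n * 2 ^ (p - 1) * √S) := by
          ring
      _ = _ := by rw [this]; ring
  have e3 := young (a := d ^ (-(p - 1 - κ) / 2))
    (b := (2 * Cg * n * 2 ^ (p - 1)) * (d ^ ((p - 3 + κ) / 2) * √S)) (δ := τ / 2) (by positivity)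
  have e4 : (d ^ (-(p - 1 - κ) / 2)) ^ 2 = d ^ (-(p - 1 - κ)) := by
    rw [← rpow_natCast, ← rpow_mul hd.le]; congr 1; push_cast; ring
  have e5 : (d ^ ((p - 3 + κ) / 2)) ^ 2 = d ^ (p - 3 + κ) := by
    rw [← rpow_natCast, ← rpow_mul hd.le]; congr 1; push_cast; ring
  have e6 : d ^ (p - 3 + κ) ≤ 2 ^ |p - 3 + κ| * t ^ (p - 3 + κ) :=
    rpow_comparable _ ht0 ht ht'
  rw [mul_pow, mul_pow (d ^ ((p - 3 + κ) / 2)), e4, e5, sq_sqrt hS] at e3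
  calc _ ≤ _ := e1
    _ = _ := e2
    _ ≤ _ := e3
    _ ≤ τ / 2 * g + (2 * Cg * n * 2 ^ (p - 1)) ^ 2 * (2 ^ |p - 3 + κ| * t ^ (p - 3 + κ) * S)
        / (4 * (τ / 2)) := by gcongr
    _ = _ := by ring

lemma neg_power_cutoff {M1 g ψ v w : ℝ} (hε : 0 < ε) (hp : 1 < p)
    (hκ : 0 < κ) (ht0 : 0 ≤ t) (ht : t ≤ 2 * max d ε) (hM1 : max d ε ≤ M1) (hL : 0 ≤ L)
    (hψ : 0 ≤ ψ) (hψ1 : ψ ≤ 1) (hg0 : 0 ≤ g)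
    (hg : g ≤ 2 ^ (p - 1 - κ) * (max d ε) ^ (-(p - 1 - κ)))
    (hv : |v| ≤ L * w) (hw : w ≤ t ^ (p - 1)) :
    |2 * ψ * g * v| ≤ 2 * L * 2 ^ (p - 1 - κ) * 2 ^ (p - 1) * M1 ^ κ := by
  have hm : 0 < max d ε := lt_max_of_lt_right hε
  rw [abs_mul, abs_of_nonneg (by positivity : 0 ≤ 2 * ψ * g)]
  have h1 : w ≤ (2 * max d ε) ^ (p - 1) := hw.trans (rpow_le_rpow ht0 ht (by linarith))
  have h2 : |v| ≤ L * (2 * max d ε) ^ (p - 1) := hv.trans (mul_le_left h1 hL)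
  calc 2 * ψ * g * |v| ≤ 2 * 1 * (2 ^ (p - 1 - κ) * (max d ε) ^ (-(p - 1 - κ)))
        * (L * (2 * max d ε) ^ (p - 1)) := by gcongr
    _ = 2 * L * 2 ^ (p - 1 - κ) * 2 ^ (p - 1) * (max d ε) ^ κ := by
      rw [mul_rpow (by norm_num) hm.le]
      have : (max d ε) ^ κ = (max d ε) ^ (-(p - 1 - κ)) * (max d ε) ^ (p - 1) := by
        rw [← rpow_add hm]; congr 1; ring
      rw [this]; ring
    _ ≤ _ := by gcongr

lemma neg_power_combine {τ ψ F A D I T σ : ℝ} (k3 : σ * A ≤ C)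
    (k5 : ψ ^ 2 * (σ * D) ≤ ψ ^ 2 * (τ / 2 * q + I)) (k6 : ψ ^ 2 * τ * q ≤ ψ ^ 2 * (σ * F) * q)
    (k7 : ψ ^ 2 * I ≤ 1 * I) (k8 : T ≤ ψ ^ 2 * (τ / 2) * q) :
    T ≤ ψ ^ 2 * (σ * F) * q - σ * A - ψ ^ 2 * (σ * D) + C + I := by
  linarith

namespace PData

include P

set_option maxHeartbeats 1000000 in
lemma neg_power_bound (hκ : 0 < κ) (hκ1 : κ ≤ 1) (hκp : κ < p - 1)
    {τ σ : ℝ} (hτ : 0 < τ) (hσ : ∀ x ∈ O, τ ≤ σ * f x) (hσ1 : |σ| = 1)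
    (hK : IsCompact K) (hKO : K ⊆ O) :
    ∃ B, ∀ ε, 0 < ε → ε ≤ 1 → ∫ x in K, (max ‖X x‖ ε) ^ (-(p - 1 - κ)) ≤ B := by
  obtain ⟨M, hM, hXM⟩ := P.exists_bound
  obtain ⟨ψ, hψ⟩ := exists_cutoff P.isOpen hK hKO
  obtain ⟨L, hL, hψL⟩ := hψ.fderiv_bound
  set K' := tsupport ψ with hK'
  have hK'c : IsCompact K' := hψ.cpt
  obtain ⟨ψ₂, hψ₂⟩ := exists_cutoff P.isOpen hK'c hψ.sub
  obtain ⟨B, hB⟩ := P.weighted_bound hκ hκ1 hK'c hψ.sub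
  have hb : 0 < p - 1 - κ := by linarith
  have hp := P.one_lt
  obtain ⟨Cg, hCg, hCgb⟩ := gtr_deriv_bound hb
  set C0 := 2 * L * 2 ^ (p - 1 - κ) * 2 ^ (p - 1) * (2 * M + 1) ^ κ with hC0
  set C2 := (2 * Cg * n * 2 ^ (p - 1)) ^ 2 / (2 * τ) * 2 ^ |p - 3 + κ| with hC2
  have hC00 : 0 ≤ C0 := by rw [hC0]; positivity
  have hC20 : 0 ≤ C2 := by rw [hC2]; positivity
  refine ⟨(C0 * (∫ x, ψ₂ x) + C2 * B) / (τ / 2 * 2 ^ (-(p - 1 - κ))), fun ε hε hε1 => ?_⟩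
  have hη : 0 < min (ε / 4) (M / 2) := by positivity
  obtain ⟨h, hg, hBh⟩ := ((P.eventually_good hη).and (hB (ε / 2) (half_pos hε))).exists
  have hη1 := min_le_left (ε / 4) (M / 2)
  have hη2 := min_le_right (ε / 4) (M / 2)
  set b := p - 1 - κ with hbd
  set q : Euc n → ℝ := fun x => gtr ε b (‖dvec h u x‖ ^ 2) with hq
  set S : Euc n → Euc n := fun x => pv (p - 2) (X x) with hSd
  have hqd : ∀ x, HasFDerivAt q (deriv (gtr ε b) (‖dvec h u x‖ ^ 2) •
      innerSL ℝ ((2:ℝ) • nvec h u X x)) x := fun x =>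
    (gtr_hasDerivAt b hε _).comp_hasFDerivAt x (P.dvec_normsq_hasFDerivAt h x)
  have hqc : ContDiff ℝ 1 q :=
    ((gtr_contDiff b hε).of_le (by simp)).comp ((P.dvec_contDiff h).norm_sq ℝ)
  have hφ : ContDiff ℝ 1 (fun x => ψ x ^ 2 * q x) :=
    ((hψ.contDiff.of_le (by simp)).pow 2).mul hqc
  have hφs : HasCompactSupport (fun x => ψ x ^ 2 * q x) := hasCompactSupport_sq_mul hψ.cpt q
  have heq := P.eq _ hφ hφs ((tsupport_sq_mul_subset _ _).trans hψ.sub)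
  set E : Euc n → ℝ := fun x => σ * (f x * (ψ x ^ 2 * q x))
    - σ * fderiv ℝ (fun x => ψ x ^ 2 * q x) x (S x) + C0 * ψ₂ x with hE
  have c1 : Continuous fun x => f x * (ψ x ^ 2 * q x) :=
    P.f_contDiff.continuous.mul hφ.continuous
  have c2 : Continuous fun x => fderiv ℝ (fun x => ψ x ^ 2 * q x) x (S x) :=
    (hφ.continuous_fderiv (by simp)).clm_apply P.S_continuous
  have s1 : HasCompactSupport fun x => f x * (ψ x ^ 2 * q x) := hφs.mul_left
  have s2 := fderiv_pairing_hasCompactSupport hφs S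
  have hEc : Continuous E :=
    ((c1.const_mul σ).sub (c2.const_mul σ)).add (hψ₂.contDiff.continuous.const_mul C0)
  have hEs : HasCompactSupport E :=
    ((s1.mul_left (f := fun _ => σ)).sub (s2.mul_left (f := fun _ => σ))).add
      (hψ₂.cpt.mul_left (f := fun _ => C0))
  have hEi : ∫ x, E x = C0 * ∫ x, ψ₂ x := by
    have i1 := c1.integrable_cpt s1
    have i2 := c2.integrable_cpt s2
    have i3 := hψ₂.contDiff.continuous.integrable_cpt hψ₂.cpt
    have j : Integrable (fun x => σ * (f x * (ψ x ^ 2 * q x))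
        - σ * fderiv ℝ (fun x => ψ x ^ 2 * q x) x (S x)) := (i1.const_mul σ).sub (i2.const_mul σ)
    have e : ∫ x, E x = ∫ x, ((σ * (f x * (ψ x ^ 2 * q x))
        - σ * fderiv ℝ (fun x => ψ x ^ 2 * q x) x (S x)) + C0 * ψ₂ x) := rfl
    rw [e, integral_add j (i3.const_mul C0),
      integral_sub (i1.const_mul σ) (i2.const_mul σ), integral_const_mul, integral_const_mul,
      integral_const_mul, heq]
    ring
  have hmax : ∀ x, 0 < max ‖X x‖ ε := fun x => lt_max_of_lt_right hε
  have hlow := integral_lower hK (bset_compact P.cont hK'c (ε / 2))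
    (F₁ := fun x => τ / 2 * 2 ^ (-b) * (max ‖X x‖ ε) ^ (-b))
    (F₂ := fun x => C2 * (‖X x‖ ^ (p - 3 + κ) * sqn h X x)) hEc hEs
    (((P.cont.norm.max continuous_const).rpow_const
      fun x => Or.inl (hmax x).ne').const_smul (τ / 2 * 2 ^ (-b))).continuousOn
    (((P.cont.norm.continuousOn.rpow_const fun x hx =>
      Or.inl ((half_pos hε).trans_le hx.2).ne').mul
        (sqn_continuous P.cont h).continuousOn).const_smul C2) ?_
  · rw [integral_const_mul, integral_const_mul, hEi] at hlow
    rw [le_div_iff₀ (by positivity)]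
    have := mul_le_left hBh hC20
    linarith
  · intro x
    have hS0 := sqn_nonneg h X x
    have hind : 0 ≤ (bset X K' (ε / 2)).indicator
        (fun x => C2 * (‖X x‖ ^ (p - 3 + κ) * sqn h X x)) x :=
      indicator_nonneg (fun x _ => by have := sqn_nonneg h X x; positivity) x
    by_cases hx : x ∈ K'
    · have hEx : E x = ψ x ^ 2 * (σ * f x) * q x - σ * (2 * ψ x * q x * fderiv ℝ ψ x (S x))
          - ψ x ^ 2 * (σ * (deriv (gtr ε b) (‖dvec h u x‖ ^ 2) *
            ⟪(2:ℝ) • nvec h u X x, S x⟫_ℝ)) + C0 := by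
        simp only [hE]
        rw [fderiv_sq_mul (hψ.hasFDerivAt x) (hqd x) (S x), hψ₂.one hx]
        simp only [_root_.smul_apply, innerSL_apply_apply, smul_eq_mul]
        ring
      obtain ⟨g1, g2⟩ := gtr_bounds hε hb (norm_nonneg (dvec h u x))
      have hdx := hg.dvec x
      have n1 : ‖X x‖ ≤ ‖dvec h u x‖ + ε / 4 := by
        have := norm_sub_norm_le (X x) (dvec h u x)
        rw [norm_sub_rev] at this; linarith
      have n2 : ‖dvec h u x‖ ≤ ‖X x‖ + min (ε / 4) (M / 2) := by
        have := norm_sub_norm_le (dvec h u x) (X x); linarith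
      have hmd : 0 < max ‖dvec h u x‖ ε := lt_max_of_lt_right hε
      have m1 : ‖X x‖ ≤ 2 * max ‖dvec h u x‖ ε := by
        have := le_max_left ‖dvec h u x‖ ε
        have := le_max_right ‖dvec h u x‖ ε
        linarith
      have m2 : max ‖dvec h u x‖ ε ≤ 2 * M + 1 :=
        max_le (by linarith [hXM x]) (by linarith)
      have m3 : max ‖dvec h u x‖ ε ≤ 2 * max ‖X x‖ ε := by
        have h1 := le_max_left ‖X x‖ ε
        have h2 := le_max_right ‖X x‖ ε
        exact max_le (by linarith) (by linarith)
      have hq0 : 0 ≤ q x := le_trans (by positivity) g1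
      have hSn : ‖S x‖ ≤ ‖X x‖ ^ (p - 1) := by
        have := pv_norm_le (m := p - 2) (by linarith) (X x)
        rwa [show p - 2 + 1 = p - 1 by ring] at this
      have k1 : |2 * ψ x * q x * fderiv ℝ ψ x (S x)| ≤ C0 :=
        neg_power_cutoff hε hp hκ (norm_nonneg _) m1 m2 hL.le (hψ.nonneg x) (hψ.le_one x) hq0 g2
          (hψL x (S x)) hSn
      have k2 : |deriv (gtr ε b) (‖dvec h u x‖ ^ 2) * ⟪(2:ℝ) • nvec h u X x, S x⟫_ℝ|
          ≤ τ / 2 * q x + (bset X K' (ε / 2)).indicator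
            (fun x => C2 * (‖X x‖ ^ (p - 3 + κ) * sqn h X x)) x := by
        rcases lt_or_ge ‖dvec h u x‖ ε with hd | hd
        · rw [gtr_deriv_zero b hε (by gcongr), zero_mul, abs_zero]
          positivity
        · obtain ⟨a1, a2, a3⟩ := hg.comparable hη1 hd hε
          rw [indicator_of_mem (show x ∈ bset X K' (ε / 2) from ⟨hx, a1⟩), abs_mul]
          have hd0 : 0 < ‖dvec h u x‖ := hε.trans_le hd
          rw [max_eq_left hd] at g1
          have key := neg_power_cross (n := n) (τ := τ) hd0 a2 a3 hp hτ hCg hS0 g1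
            (hCgb ε (‖dvec h u x‖ ^ 2) hε (by positivity))
            (nvec_norm_le u X h x) (norm_nonneg _) hSn (norm_nonneg _)
          calc _ ≤ |deriv (gtr ε b) (‖dvec h u x‖ ^ 2)| * (2 * ‖nvec h u X x‖ * ‖S x‖) := by
                gcongr
                refine (abs_real_inner_le_norm _ _).trans_eq ?_
                rw [norm_smul]; simp
            _ ≤ _ := key
            _ = _ := by rw [hC2]; ring
      have hσa : ∀ z, |σ * z| = |z| := fun z => by rw [abs_mul, hσ1, one_mul]
      rw [← hσa] at k1 k2
      have k3 := (abs_le.1 k1).2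
      have k4 := (abs_le.1 k2).2
      have hψ2 : ψ x ^ 2 ≤ 1 := pow_le_one₀ (hψ.nonneg x) (hψ.le_one x)
      have k5 := mul_le_left k4 (sq_nonneg (ψ x))
      have k6 : ψ x ^ 2 * τ * q x ≤ ψ x ^ 2 * (σ * f x) * q x := by
        have := hσ x (hψ.sub hx); gcongr
      have k7 := mul_le_right hψ2 hind
      have k8 : K.indicator (fun x => τ / 2 * 2 ^ (-b) * (max ‖X x‖ ε) ^ (-b)) x
          ≤ ψ x ^ 2 * (τ / 2) * q x := by
        by_cases hxK : x ∈ K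
        · rw [indicator_of_mem hxK, hψ.one hxK]
          have : 2 ^ (-b) * (max ‖X x‖ ε) ^ (-b) ≤ q x := by
            rw [← mul_rpow (by norm_num) (hmax x).le]
            exact (rpow_le_rpow_of_nonpos hmd m3 (by linarith)).trans g1
          calc _ = τ / 2 * (2 ^ (-b) * (max ‖X x‖ ε) ^ (-b)) := by ring
            _ ≤ τ / 2 * q x := mul_le_left this (half_pos hτ).le
            _ = _ := by ring
        · rw [indicator_of_notMem hxK]; positivity
      rw [hEx]
      exact neg_power_combine k3 k5 k6 k7 k8
    · have hxK : x ∉ K := fun hb => hx (subset_tsupport ψ (by simp [hψ.one hb]))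
      have hEx : E x = C0 * ψ₂ x := by
        simp only [hE]
        rw [fderiv_sq_mul (hψ.hasFDerivAt x) (hqd x) (S x), zero_off_tsupport hx]
        simp
      rw [indicator_of_notMem hxK, hEx]
      have := hψ₂.nonneg x
      positivity

end PData

lemma integrable_neg_power (hK : IsCompact K)
    (hg : Continuous g) (hg0 : ∀ x, 0 ≤ g x) {B : ℝ} (hb : 0 < b)
    (hB : ∀ ε, 0 < ε → ε ≤ 1 → ∫ x in K, (max (g x) ε) ^ (-b) ≤ B) :
    IntegrableOn (fun x => g x ^ (-b)) K ∧ ∀ᵐ x ∂(volume.restrict K), g x ≠ 0 := by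
  set e : ℕ → ℝ := fun j => 1 / ((j : ℝ) + 1) with he
  have e0 : ∀ j, 0 < e j := fun j => Nat.one_div_pos_of_nat
  have e1 : ∀ j, e j ≤ 1 := fun j => by
    rw [he]; simp only; rw [div_le_one (by positivity)]; linarith [Nat.cast_nonneg (α := ℝ) j]
  have em : Antitone e := fun i j hij => by
    simp only [he]; gcongr
  set F : ℕ → Euc n → ℝ≥0∞ := fun j x => ofReal ((max (g x) (e j)) ^ (-b)) with hF
  have hmax : ∀ j x, 0 < max (g x) (e j) := fun j x => lt_max_of_lt_right (e0 j)
  have hFc : ∀ j, Continuous fun x => (max (g x) (e j)) ^ (-b) := fun j =>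
    (hg.max continuous_const).rpow_const fun x => Or.inl (hmax j x).ne'
  have hFm : ∀ j, Measurable (F j) := fun j => (hFc j).measurable.ennreal_ofReal
  have hmono : Monotone F := fun i j hij x => ofReal_le_ofReal
    (rpow_le_rpow_of_nonpos (hmax j x) (max_le_max le_rfl (em hij)) (by linarith))
  have hint : ∀ j, ∫⁻ x in K, F j x ≤ ofReal B := fun j => by
    rw [← ofReal_integral_eq_lintegral_ofReal ((hFc j).continuousOn.integrableOn_compact hK)
      (.of_forall fun x => (rpow_nonneg (hmax j x).le _))]
    exact ofReal_le_ofReal (hB _ (e0 j) (e1 j))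
  have hsup : ∫⁻ x in K, ⨆ j, F j x ≤ ofReal B := by
    rw [lintegral_iSup hFm hmono]; exact iSup_le hint
  have hae := ae_lt_top (Measurable.iSup hFm) (hsup.trans_lt ofReal_lt_top).ne
  have hne : ∀ᵐ x ∂(volume.restrict K), g x ≠ 0 := by
    filter_upwards [hae] with x hx h0
    obtain ⟨R, hR⟩ := ENNReal.lt_iff_exists_real_btwn.1 hx
    have h1 : ∀ j, (max (g x) (e j)) ^ (-b) ≤ R := fun j => by
      have := (le_iSup (fun j => F j x) j).trans hR.2.1.le
      exact (ofReal_le_ofReal_iff hR.1).1 this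
    have h2 : Tendsto (fun j : ℕ => ((j : ℝ) + 1) ^ b) atTop atTop :=
      (tendsto_rpow_atTop hb).comp
        (tendsto_atTop_add_const_right _ _ tendsto_natCast_atTop_atTop)
    obtain ⟨j, hj⟩ := (h2.eventually_gt_atTop R).exists
    refine absurd (h1 j) (not_le.2 (hj.trans_le ?_))
    rw [h0, max_eq_right (e0 j).le, he]
    simp only [one_div]
    rw [inv_rpow (by positivity), rpow_neg (by positivity), inv_inv]
  refine ⟨⟨(hg.measurable.pow_const _).aestronglyMeasurable, ?_⟩, hne⟩
  refine lt_of_le_of_lt ?_ (hsup.trans_lt ofReal_lt_top)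
  refine lintegral_mono_ae ?_
  filter_upwards [hne] with x hx
  have hx0 : 0 < g x := lt_of_le_of_ne (hg0 x) (Ne.symm hx)
  obtain ⟨j, hj⟩ := exists_nat_one_div_lt hx0
  refine le_trans (le_of_eq ?_) (le_iSup (fun j => F j x) j)
  rw [enorm_eq_ofReal (rpow_nonneg hx0.le _), hF]
  simp only [he]
  rw [max_eq_left hj.le]

namespace PData

include P

lemma neg_power_integrable (hκ : 0 < κ) (hκ1 : κ ≤ 1)
    (hκp : κ < p - 1) {τ σ : ℝ} (hτ : 0 < τ) (hσ : ∀ x ∈ O, τ ≤ σ * f x) (hσ1 : |σ| = 1)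
    (hK : IsCompact K) (hKO : K ⊆ O) :
    IntegrableOn (fun x => ‖X x‖ ^ (-(p - 1 - κ))) K ∧
      ∀ᵐ x ∂(volume.restrict K), X x ≠ 0 := by
  obtain ⟨B, hB⟩ := P.neg_power_bound hκ hκ1 hκp hτ hσ hσ1 hK hKO
  have := integrable_neg_power hK P.cont.norm (fun x => norm_nonneg _)
    (by linarith : 0 < p - 1 - κ) hB
  exact ⟨this.1, this.2.mono fun x hx => by simpa using hx⟩

end PData

lemma exists_riesz {V H : Type*} [AddCommGroup V] [Module ℝ V] [NormedAddCommGroup H]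
    [InnerProductSpace ℝ H] [CompleteSpace H] (ι : V →ₗ[ℝ] H) (T : V →ₗ[ℝ] ℝ)
    (hT : ∀ v, |T v| ≤ C * ‖ι v‖) : ∃ G : H, ∀ v, T v = ⟪G, ι v⟫_ℝ := by
  have hker : LinearMap.ker ι ≤ LinearMap.ker T := fun v hv => by
    have := hT v
    rw [LinearMap.mem_ker.1 hv, norm_zero, mul_zero] at this
    exact LinearMap.mem_ker.2 (abs_nonpos_iff.1 this)
  set T' : LinearMap.range ι →ₗ[ℝ] ℝ :=
    (LinearMap.ker ι).liftQ T hker ∘ₗ ι.quotKerEquivRange.symm.toLinearMap with hT'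
  have hval : ∀ v, T' ⟨ι v, LinearMap.mem_range_self ι v⟩ = T v := fun v => by
    have : ι.quotKerEquivRange.symm ⟨ι v, LinearMap.mem_range_self ι v⟩
        = (LinearMap.ker ι).mkQ v := by
      rw [LinearEquiv.symm_apply_eq]; ext; simp
    simp only [hT', LinearMap.comp_apply, LinearEquiv.coe_coe, this]
    simp
  have hb : ∀ y : LinearMap.range ι, ‖T' y‖ ≤ C * ‖y‖ := by
    rintro ⟨_, v, rfl⟩
    rw [hval]; exact hT v
  obtain ⟨g, hg, -⟩ := exists_extension_norm_eq (𝕜 := ℝ) (LinearMap.range ι) (T'.mkContinuous C hb)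
  refine ⟨(InnerProductSpace.toDual ℝ H).symm g, fun v => ?_⟩
  rw [InnerProductSpace.toDual_symm_apply, ← hval v]
  exact (hg ⟨ι v, LinearMap.mem_range_self ι v⟩).symm

/-- The smooth functions with compact support inside `K`. -/
def testSub (K : Set (Euc n)) : Submodule ℝ (Euc n → ℝ) where
  carrier := {φ | IsTestFun K φ}
  add_mem' := fun {a b} ha hb => ⟨ha.1.add hb.1, ha.2.1.add hb.2.1,
    (tsupport_add a b).trans (union_subset ha.2.2 hb.2.2)⟩
  zero_mem' := ⟨contDiff_const, HasCompactSupport.zero, by simp⟩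
  smul_mem' := fun c a ha => ⟨contDiff_const.smul ha.1, ha.2.1.smul_left (f := fun _ => c),
    (tsupport_smul_subset_right (fun _ => c) a).trans ha.2.2⟩

lemma exists_representation (hw : Integrable w)
    (hw0 : ∀ x, 0 ≤ w x) (T : (Euc n → ℝ) → ℝ)
    (hadd : ∀ φ ψ, IsTestFun K φ → IsTestFun K ψ → T (fun x => φ x + ψ x) = T φ + T ψ)
    (hsmul : ∀ (c : ℝ) φ, IsTestFun K φ → T (fun x => c * φ x) = c * T φ)
    (hT : ∀ φ, IsTestFun K φ → |T φ| ≤ C * √(∫ x, φ x ^ 2 * w x)) :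
    ∃ G : Euc n → ℝ, MemLp G 2 ∧ ∀ φ, IsTestFun K φ → T φ = ∫ x, G x * √(w x) * φ x := by
  have hm : ∀ φ : testSub K, MemLp (fun x => √(w x) * φ.1 x) 2 := fun φ => by
    have hφ : IsTestFun K φ.1 := φ.2
    obtain ⟨c, hc⟩ := hφ.2.1.exists_bound_of_continuous hφ.1.continuous
    have hs : AEStronglyMeasurable (fun x => √(w x) * φ.1 x) volume :=
      (hw.1.aemeasurable.sqrt.aestronglyMeasurable).mul hφ.1.continuous.aestronglyMeasurable
    rw [memLp_two_iff_integrable_sq hs]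
    refine (hw.mul_const (c ^ 2)).mono' (hs.pow 2) (.of_forall fun x => ?_)
    rw [mul_pow, sq_sqrt (hw0 x), norm_of_nonneg (mul_nonneg (hw0 x) (sq_nonneg _)),
      ← sq_abs (φ.1 x)]
    exact mul_le_left (pow_le_pow_left₀ (abs_nonneg _) (hc x) 2) (hw0 x)
  set ι : testSub K →ₗ[ℝ] Lp ℝ 2 (volume : Measure (Euc n)) :=
    { toFun := fun φ => (hm φ).toLp _
      map_add' := fun a b => by
        rw [← MemLp.toLp_add]; congr 1; ext x; simp [mul_add]
      map_smul' := fun c a => by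
        rw [RingHom.id_apply, ← MemLp.toLp_const_smul]; congr 1; ext x
        simp [mul_left_comm] } with hι
  set T' : testSub K →ₗ[ℝ] ℝ :=
    { toFun := fun φ => T φ.1
      map_add' := fun a b => hadd a.1 b.1 a.2 b.2
      map_smul' := fun c a => hsmul c a.1 a.2 } with hT'
  have hnorm : ∀ φ : testSub K, ‖ι φ‖ = √(∫ x, φ.1 x ^ 2 * w x) := fun φ => by
    rw [← sqrt_sq (norm_nonneg (ι φ)), ← real_inner_self_eq_norm_sq, L2.inner_def]
    congr 1
    refine integral_congr_ae ?_
    filter_upwards [(hm φ).coeFn_toLp] with x hx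
    have : (ι φ) x = √(w x) * φ.1 x := hx
    rw [this]
    simp only [RCLike.inner_apply, conj_trivial]
    rw [mul_mul_mul_comm, mul_self_sqrt (hw0 x)]; ring
  obtain ⟨G, hG⟩ := exists_riesz ι T' (C := C) (fun φ => by
    rw [hnorm]; exact hT φ.1 φ.2)
  refine ⟨G, Lp.memLp G, fun φ hφ => ?_⟩
  have h1 : T φ = ⟪G, ι ⟨φ, hφ⟩⟫_ℝ := hG ⟨φ, hφ⟩
  rw [h1, L2.inner_def]
  refine integral_congr_ae ?_
  filter_upwards [(hm ⟨φ, hφ⟩).coeFn_toLp] with x hx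
  have : (ι ⟨φ, hφ⟩) x = √(w x) * φ x := hx
  rw [this]
  simp only [RCLike.inner_apply, conj_trivial]
  ring

lemma exists_exhaustion (hΩ : IsOpen Ω) : ∃ K : ℕ → Set (Euc n),
    (∀ j, IsCompact (K j)) ∧ (∀ j, K j ⊆ Ω) ∧ Monotone (fun j => interior (K j)) ∧
      Ω ⊆ ⋃ j, interior (K j) := by
  have : LocallyCompactSpace Ω := hΩ.locallyCompactSpace
  set E := CompactExhaustion.choice Ω with hE
  refine ⟨fun j => Subtype.val '' E j, fun j => (E.isCompact j).image continuous_subtype_val,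
    fun j => by rintro _ ⟨x, -, rfl⟩; exact x.2, fun i j hij => interior_mono
      (image_mono (E.subset hij)), fun x hx => ?_⟩
  obtain ⟨j, hj⟩ := E.exists_mem ⟨x, hx⟩
  refine mem_iUnion.2 ⟨j + 1, ?_⟩
  exact hΩ.isOpenMap_subtype_val.image_interior_subset _
    ⟨⟨x, hx⟩, E.subset_interior_succ j hj, rfl⟩

lemma exists_glued_representation (hΩ : IsOpen Ω) (D : (Euc n → ℝ) → ℝ)
    (hloc : ∀ K, IsCompact K → K ⊆ Ω → ∃ h : Euc n → ℝ, Integrable h ∧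
      ∀ φ, IsTestFun (interior K) φ → D φ = ∫ x, h x * φ x) :
    ∃ h : Euc n → ℝ, (∀ K, IsCompact K → K ⊆ Ω → IntegrableOn h K) ∧
      ∀ φ, IsTestFun Ω φ → D φ = ∫ x, h x * φ x := by
  classical
  obtain ⟨K, hKc, hKΩ, hmono, hcov⟩ := exists_exhaustion hΩ
  choose h hi hD using fun j => hloc (K j) (hKc j) (hKΩ j)
  have hag : ∀ i j, i ≤ j → ∀ᵐ x, x ∈ interior (K i) → h i x = h j x := fun i j hij => by
    have := isOpen_interior.ae_eq_zero_of_integral_contDiff_smul_eq_zero (μ := volume)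
      (U := interior (K i)) (f := fun x => h i x - h j x)
      (((hi i).sub (hi j)).locallyIntegrable.locallyIntegrableOn _)
      (fun g hg hgs hgU => by
        have e1 := hD i g ⟨hg, hgs, hgU⟩
        have e2 := hD j g ⟨hg, hgs, hgU.trans (hmono hij)⟩
        obtain ⟨c, hc⟩ := hgs.exists_bound_of_continuous hg.continuous
        have int : ∀ k, Integrable fun x => h k x * g x := fun k =>
          (hi k).mul_bdd hg.continuous.aestronglyMeasurable (.of_forall hc)
        calc ∫ x, g x • (h i x - h j x) = ∫ x, (h i x * g x - h j x * g x) := by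
              congr 1; ext x; simp only [smul_eq_mul]; ring
          _ = 0 := by rw [integral_sub (int i) (int j), ← e1, ← e2, sub_self])
    filter_upwards [this] with x hx hxU
    exact sub_eq_zero.1 (hx hxU)
  set H : Euc n → ℝ := fun x =>
    if hx : ∃ j, x ∈ interior (K j) then h (Nat.find hx) x else 0 with hH
  have hHj : ∀ j, ∀ᵐ x, x ∈ interior (K j) → H x = h j x := fun j => by
    have : ∀ᵐ x, ∀ i, i ≤ j → x ∈ interior (K i) → h i x = h j x :=
      ae_all_iff.2 fun i => by
        by_cases hij : i ≤ j
        · filter_upwards [hag i j hij] with x hx _ using hx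
        · exact Eventually.of_forall fun x h => absurd h hij
    filter_upwards [this] with x hx hxj
    have hex : ∃ j, x ∈ interior (K j) := ⟨j, hxj⟩
    rw [hH]; simp only [dif_pos hex]
    exact hx _ (Nat.find_min' hex hxj) (Nat.find_spec hex)
  have hdir : Directed (· ⊆ ·) fun j => interior (K j) := hmono.directed_le
  have hin : ∀ A, IsCompact A → A ⊆ Ω → ∃ j, A ⊆ interior (K j) := fun A hA hAΩ =>
    hA.elim_directed_cover _ (fun j => isOpen_interior) (hAΩ.trans hcov) hdir
  refine ⟨H, fun A hA hAΩ => ?_, fun φ hφ => ?_⟩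
  · obtain ⟨j, hj⟩ := hin A hA hAΩ
    refine ((hi j).integrableOn (s := A)).congr ?_
    filter_upwards [ae_restrict_of_ae (hHj j), ae_restrict_mem hA.measurableSet] with x hx hxA
    exact (hx (hj hxA)).symm
  · obtain ⟨j, hj⟩ := hin _ hφ.2.1 hφ.2.2
    rw [hD j φ ⟨hφ.1, hφ.2.1, hj⟩]
    refine integral_congr_ae ?_
    filter_upwards [hHj j] with x hx
    by_cases hxs : x ∈ tsupport φ
    · rw [hx (hj hxs)]
    · rw [zero_off_tsupport hxs]; simp

lemma setIntegral_mul_le_sqrt {A : Set (Euc n)} (hA : IsCompact A)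
    (hf : ContinuousOn f A) (hg : ContinuousOn g A) :
    ∫ x in A, |f x| * |g x| ≤ √(∫ x in A, f x ^ 2) * √(∫ x in A, g x ^ 2) := by
  have hmem : ∀ {f : Euc n → ℝ}, ContinuousOn f A → MemLp f (ofReal 2)
      (volume.restrict A) := fun {f} hf => by
    rw [ofReal_ofNat, memLp_two_iff_integrable_sq
      (hf.aestronglyMeasurable hA.measurableSet)]
    exact (hf.pow 2).integrableOn_compact hA
  have := integral_mul_norm_le_Lp_mul_Lq Real.HolderConjugate.two_two (hmem hf) (hmem hg)
  simpa [sqrt_eq_rpow, norm_eq_abs] using this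

lemma exists_Phi_dq (m : ℝ) : ∃ C, 0 ≤ C ∧ ∀ (X : Euc n → Euc n) (u : Euc n → ℝ) (ε η h : ℝ)
    (x : Euc n) (j : Fin n), 0 < ε → GoodStep X u η h → η ≤ ε / 4 →
      (ε / 2 ≤ ‖X x‖ → ‖dq h j (fun x => Phi ε m (X x)) x‖ ≤ C * ‖X x‖ ^ m * ‖dq h j X x‖) ∧
      (‖X x‖ < ε / 2 → dq h j (fun x => Phi ε m (X x)) x = 0) := by
  obtain ⟨C, hC, hCb⟩ := Phi_mean_value (n := n) m
  refine ⟨C, hC, fun X u ε η h x j hε hg hη => ?_⟩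
  have ho : ‖X (x + h • ev j) - X x‖ ≤ η := hg.osc x _ (by
    rw [norm_smul_ev]; linarith [abs_nonneg h])
  refine ⟨fun hx => ?_, fun hx => ?_⟩
  · have hx0 : X x ≠ 0 := fun h0 => by rw [h0, norm_zero] at hx; linarith
    have := hCb ε hε (X x) (X (x + h • ev j)) (X x) hx0 (ho.trans (by linarith))
      (by rw [sub_self, norm_zero]; positivity)
    simp only [dq, norm_smul]
    calc _ ≤ ‖h⁻¹‖ * (C * ‖X x‖ ^ m * ‖X (x + h • ev j) - X x‖) := by gcongr
      _ = _ := by ring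
  · have h1 : ‖X (x + h • ev j)‖ ≤ ε := by
      have := norm_sub_norm_le (X (x + h • ev j)) (X x)
      linarith
    simp only [dq]
    rw [Phi_zero hε h1, Phi_zero hε (by linarith), sub_zero, smul_zero]

lemma tendsto_integral_mul_dq_neg (hg : Continuous g)
    (hφ : Smooth φ) (hs : HasCompactSupport φ) (k : Fin n) :
    Tendsto (fun h => ∫ x, g x * dq (-h) k φ x) (𝓝[≠] 0) (𝓝 (∫ x, g x * pd φ k x)) := by
  have h1 : Tendsto (fun h : ℝ => -h) (𝓝[≠] 0) (𝓝[≠] 0) := by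
    refine tendsto_nhdsWithin_iff.2 ⟨?_, ?_⟩
    · have : Tendsto (fun h : ℝ => -h) (𝓝 0) (𝓝 (-0)) := continuous_neg.tendsto 0
      rw [neg_zero] at this
      exact this.mono_left nhdsWithin_le_nhds
    · filter_upwards [self_mem_nhdsWithin] with h hh using by simpa using hh
  exact (tendsto_integral_mul_dq hg hφ hs k).comp h1

lemma dq_coord (V : Euc n → Euc n) (h : ℝ) (k i : Fin n) (x : Euc n) :
    dq h k (fun x => V x i) x = dq h k V x i := by simp [dq]

lemma abs_integral_pv_le (hX : Continuous X) (hm : -1 < m)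
    (i : Fin n) (hθ : Continuous θ) (hθs : HasCompactSupport θ) {R : ℝ}
    (hR : ∀ ε, 0 < ε → |∫ x, (Phi ε m (X x)) i * θ x| ≤ R) :
    |∫ x, (pv m (X x)) i * θ x| ≤ R := by
  have hi : Continuous fun z : Euc n => z i := by fun_prop
  have hθi := (hθ.abs.integrable_cpt hθs.abs)
  have h1 : ∀ ε, 0 < ε → |∫ x, (pv m (X x)) i * θ x| ≤ R + (2 * ε) ^ (m + 1) * ∫ x, |θ x| :=
    fun ε hε => by
    have c1 : Continuous fun x => (pv m (X x)) i * θ x :=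
      (hi.comp ((pv_continuous hm).comp hX)).mul hθ
    have c2 : Continuous fun x => (Phi ε m (X x)) i * θ x :=
      (hi.comp ((Phi_contDiff m hε).continuous.comp hX)).mul hθ
    have i1 := c1.integrable_cpt hθs.mul_left
    have i2 := c2.integrable_cpt hθs.mul_left
    have e : |(∫ x, (pv m (X x)) i * θ x) - ∫ x, (Phi ε m (X x)) i * θ x|
        ≤ (2 * ε) ^ (m + 1) * ∫ x, |θ x| := by
      rw [← integral_sub i1 i2, ← integral_const_mul]
      refine (abs_integral_le_integral_abs).trans (integral_mono (i1.sub i2).abs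
        (hθi.const_mul _) fun x => ?_)
      simp only
      rw [← sub_mul, abs_mul]
      refine mul_le_right ?_ (abs_nonneg _)
      have := abs_apply_le_norm (Phi ε m (X x) - pv m (X x)) i
      rw [abs_sub_comm]
      exact this.trans (Phi_norm_sub_pv hm hε _)
    have := abs_sub_abs_le_abs_sub (∫ x, (pv m (X x)) i * θ x) (∫ x, (Phi ε m (X x)) i * θ x)
    linarith [hR ε hε]
  have h2 : Tendsto (fun ε : ℝ => R + (2 * ε) ^ (m + 1) * ∫ x, |θ x|) (𝓝[>] 0) (𝓝 R) := by
    have : Tendsto (fun ε : ℝ => R + (2 * ε) ^ (m + 1) * ∫ x, |θ x|) (𝓝 0)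
        (𝓝 (R + (2 * 0) ^ (m + 1) * ∫ x, |θ x|)) := by
      refine Tendsto.const_add _ (Tendsto.mul_const _ ?_)
      exact ((continuous_const.mul continuous_id).tendsto 0).rpow_const
        (Or.inr (by linarith))
    rw [mul_zero, zero_rpow (by linarith), zero_mul, add_zero] at this
    exact this.mono_left nhdsWithin_le_nhds
  exact ge_of_tendsto h2 (by filter_upwards [self_mem_nhdsWithin] with ε hε using h1 ε hε)

lemma integral_sq_restrict_le {A : Set (Euc n)} (hφ : Continuous φ)
    (hs : HasCompactSupport φ) : ∫ x in A, φ x ^ 2 ≤ ∫ x, φ x ^ 2 := by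
  refine setIntegral_le_integral ?_ (.of_forall fun x => sq_nonneg _)
  exact (hφ.pow 2).integrable_cpt (by
    simpa [pow_two] using hs.mul_left (f := φ))

namespace PData

include P

lemma first_deriv_bound (hm : 0 ≤ m)
    (hK : IsCompact K) (hKO : K ⊆ O) : ∃ C, ∀ φ, IsTestFun K φ → ∀ i j,
      |∫ x, (pv m (X x)) i * pd φ j x| ≤ C * √(∫ x, φ x ^ 2) := by
  obtain ⟨M, hM, hXM⟩ := P.exists_bound
  have hp3 := P.lt_three
  set κ := min 1 (3 - p) with hκ
  have hκ0 : 0 < κ := lt_min one_pos (by linarith)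
  have hκp : p - 3 + κ ≤ 0 := by have := min_le_right 1 (3 - p); linarith
  obtain ⟨B, hB⟩ := P.weighted_bound hκ0 (min_le_left _ _) hK hKO
  obtain ⟨C, hC, hCb⟩ := exists_Phi_dq (n := n) m
  refine ⟨√(C ^ 2 * M ^ (2 * m - (p - 3 + κ)) * B), fun φ hφ i j => ?_⟩
  refine abs_integral_pv_le P.cont (by linarith) i (pd_contDiff hφ.1 j).continuous
    (pd_cpt hφ.2.1 j) fun ε hε => ?_
  have hi : Continuous fun z : Euc n => z i := by fun_prop
  have hVc : Continuous fun x => (Phi ε m (X x)) i :=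
    hi.comp ((Phi_contDiff m hε).continuous.comp P.cont)
  refine le_of_tendsto (tendsto_integral_mul_dq_neg hVc hφ.1 hφ.2.1 j).abs ?_
  filter_upwards [P.eventually_good (half_pos (half_pos hε)), hB (ε / 2) (half_pos hε)]
    with h hg hBh
  have hA := bset_compact P.cont hK (ε / 2)
  set A := bset X K (ε / 2) with hAd
  have hAm : MeasurableSet A := hA.measurableSet
  rw [← abs_neg, ← integral_dq_mul hVc hφ.1.continuous hφ.2.1 h j]
  have hApos : ∀ x ∈ A, 0 < ‖X x‖ := fun x hx => (half_pos hε).trans_le hx.2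
  have hcont : ContinuousOn (fun x => C * ‖X x‖ ^ m * ‖dq h j X x‖) A :=
    ((P.cont.norm.continuousOn.rpow_const fun x hx => Or.inl (hApos x hx).ne').const_smul C).mul
      (P.dqX_continuous h j).norm.continuousOn
  have hzero : ∀ x ∉ A, dq h j (fun x => (Phi ε m (X x)) i) x * φ x = 0 := fun x hx => by
    by_cases hxK : x ∈ K
    · have hlt : ‖X x‖ < ε / 2 := not_le.1 fun hle => hx ⟨hxK, hle⟩
      have := (hCb X u ε (ε / 2 / 2) h x j hε hg (by linarith)).2 hlt
      rw [dq_coord (fun x => Phi ε m (X x)), this]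
      simp
    · rw [zero_off_tsupport fun hb => hxK (hφ.2.2 hb), mul_zero]
  have hbd : ∀ x ∈ A, |dq h j (fun x => (Phi ε m (X x)) i) x * φ x|
      ≤ |C * ‖X x‖ ^ m * ‖dq h j X x‖| * |φ x| := fun x hx => by
    rw [abs_mul]
    refine mul_le_right ?_ (abs_nonneg _)
    have h0 : 0 ≤ C * ‖X x‖ ^ m * ‖dq h j X x‖ := by positivity
    rw [abs_of_nonneg h0, dq_coord (fun x => Phi ε m (X x))]
    exact (abs_apply_le_norm _ i).trans ((hCb X u ε (ε / 2 / 2) h x j hε hg (by linarith)).1 hx.2)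
  rw [← setIntegral_eq_of_off hzero]
  have int1 : IntegrableOn (fun x => dq h j (fun x => (Phi ε m (X x)) i) x * φ x) A :=
    ((dq_continuous hVc h j).mul hφ.1.continuous).continuousOn.integrableOn_compact hA
  calc |∫ x in A, dq h j (fun x => (Phi ε m (X x)) i) x * φ x|
      ≤ ∫ x in A, |dq h j (fun x => (Phi ε m (X x)) i) x * φ x| := abs_integral_le_integral_abs
    _ ≤ ∫ x in A, |C * ‖X x‖ ^ m * ‖dq h j X x‖| * |φ x| :=
        setIntegral_mono_on int1.abs
          ((hcont.abs.mul hφ.1.continuous.abs.continuousOn).integrableOn_compact hA) hAm hbd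
    _ ≤ √(∫ x in A, (C * ‖X x‖ ^ m * ‖dq h j X x‖) ^ 2) * √(∫ x in A, φ x ^ 2) :=
        setIntegral_mul_le_sqrt hA hcont hφ.1.continuous.continuousOn
    _ ≤ _ := by
        refine mul_le_mul (sqrt_le_sqrt ?_)
          (sqrt_le_sqrt (integral_sq_restrict_le hφ.1.continuous hφ.2.1))
          (sqrt_nonneg _) (sqrt_nonneg _)
        have hc2 : ContinuousOn (fun x => ‖X x‖ ^ (p - 3 + κ) * sqn h X x) A :=
          (P.cont.norm.continuousOn.rpow_const fun x hx => Or.inl (hApos x hx).ne').mul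
            (sqn_continuous P.cont h).continuousOn
        calc ∫ x in A, (C * ‖X x‖ ^ m * ‖dq h j X x‖) ^ 2
            ≤ ∫ x in A, C ^ 2 * M ^ (2 * m - (p - 3 + κ))
                * (‖X x‖ ^ (p - 3 + κ) * sqn h X x) :=
              setIntegral_mono_on ((hcont.pow 2).integrableOn_compact hA)
                ((hc2.const_smul (C ^ 2 * M ^ (2 * m - (p - 3 + κ)))).integrableOn_compact hA)
                hAm fun x hx => ?_
          _ = C ^ 2 * M ^ (2 * m - (p - 3 + κ))
                * ∫ x in A, ‖X x‖ ^ (p - 3 + κ) * sqn h X x := integral_const_mul _ _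
          _ ≤ _ := mul_le_left hBh (by positivity)
        have hx0 := hApos x hx
        have e1 : (‖X x‖ ^ m) ^ 2 = ‖X x‖ ^ (2 * m - (p - 3 + κ)) * ‖X x‖ ^ (p - 3 + κ) := by
          rw [← rpow_add hx0, ← rpow_natCast, ← rpow_mul hx0.le]
          congr 1; push_cast; ring
        have e2 : ‖X x‖ ^ (2 * m - (p - 3 + κ)) ≤ M ^ (2 * m - (p - 3 + κ)) :=
          rpow_le_rpow hx0.le (hXM x) (by linarith)
        rw [mul_pow, mul_pow, e1]
        have e3 := sq_le_sqn h X x j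
        have e4 : 0 ≤ ‖X x‖ ^ (p - 3 + κ) := by positivity
        calc _ ≤ C ^ 2 * (M ^ (2 * m - (p - 3 + κ)) * ‖X x‖ ^ (p - 3 + κ)) * sqn h X x := by
              gcongr
          _ = _ := by ring

end PData

section

open scoped Convolution in

lemma exists_smooth_approx (hφ : ContDiff ℝ 1 φ) (hs : HasCompactSupport φ)
    (hδ : 0 < δ) : ∃ ψ : Euc n → ℝ, Smooth ψ ∧
      tsupport ψ ⊆ Metric.cthickening δ (tsupport φ) ∧ (∀ x, |ψ x - φ x| ≤ δ) ∧
      ∀ x, ‖fderiv ℝ ψ x - fderiv ℝ φ x‖ ≤ δ := by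
  have hc : Continuous (fderiv ℝ φ) := hφ.continuous_fderiv (by simp)
  have u1 := hs.uniformContinuous_of_continuous hφ.continuous
  have u2 := (hs.fderiv (𝕜 := ℝ)).uniformContinuous_of_continuous hc
  obtain ⟨d1, hd1, h1⟩ := Metric.uniformContinuous_iff.1 u1 δ hδ
  obtain ⟨d2, hd2, h2⟩ := Metric.uniformContinuous_iff.1 u2 δ hδ
  have hr : 0 < min δ (min d1 d2) := by positivity
  have hrd : min δ (min d1 d2) ≤ δ := min_le_left _ _
  have hr1 : min δ (min d1 d2) ≤ d1 := (min_le_right _ _).trans (min_le_left _ _)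
  have hr2 : min δ (min d1 d2) ≤ d2 := (min_le_right _ _).trans (min_le_right _ _)
  generalize min δ (min d1 d2) = r at hr hrd hr1 hr2
  let b : ContDiffBump (0 : Euc n) := ⟨r / 2, r, by positivity, by linarith⟩
  have hbl : LocallyIntegrable (b.normed volume) :=
    (b.continuous_normed).locallyIntegrable
  refine ⟨b.normed volume ⋆[ContinuousLinearMap.lsmul ℝ ℝ, volume] φ, ?_, ?_, ?_, ?_⟩
  · exact b.hasCompactSupport_normed.contDiff_convolution_left _ b.contDiff_normed
      hφ.continuous.locallyIntegrable
  · refine closure_minimal ?_ Metric.isClosed_cthickening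
    intro x hx
    obtain ⟨y, hy, z, hz, rfl⟩ := support_convolution_subset _ hx
    refine Metric.mem_cthickening_of_dist_le _ z δ _ (subset_tsupport _ hz) ?_
    have : ‖y‖ < r := by
      have := b.support_normed_eq (μ := volume) ▸ hy
      simpa using this
    simp only [dist_eq_norm, add_sub_cancel_right]
    linarith
  · intro x
    refine b.dist_normed_convolution_le hφ.continuous.aestronglyMeasurable fun y hy => ?_
    exact (h1 (lt_of_lt_of_le (Metric.mem_ball.1 hy) hr1)).le
  · intro x
    have hd := hs.hasFDerivAt_convolution_right (ContinuousLinearMap.lsmul ℝ ℝ) hbl hφ x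
    rw [hd.fderiv]
    have he : (b.normed volume ⋆[(ContinuousLinearMap.lsmul ℝ ℝ).precompR (Euc n), volume]
        fderiv ℝ φ) x = (b.normed volume ⋆[ContinuousLinearMap.lsmul ℝ ℝ, volume]
        fderiv ℝ φ) x := by
      simp only [convolution]
      congr 1
    rw [he, ← dist_eq_norm]
    refine b.dist_normed_convolution_le hc.aestronglyMeasurable fun y hy => ?_
    exact (h2 (lt_of_lt_of_le (Metric.mem_ball.1 hy) hr2)).le

lemma exists_seq_smooth_approx (hΩ : IsOpen Ω)
    (hφ : ContDiff ℝ 1 φ) (hs : HasCompactSupport φ) (hsub : tsupport φ ⊆ Ω) :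
    ∃ (K : Set (Euc n)) (ψ : ℕ → Euc n → ℝ), IsCompact K ∧ K ⊆ Ω ∧ tsupport φ ⊆ K ∧
      (∀ m, IsTestFun K (ψ m)) ∧ (∀ m x, |ψ m x - φ x| ≤ 1 / (m + 1)) ∧
      ∀ m x, ‖fderiv ℝ (ψ m) x - fderiv ℝ φ x‖ ≤ 1 / (m + 1) := by
  obtain ⟨δ, hδ, hδK⟩ := hs.isCompact.exists_cthickening_subset_open hΩ hsub
  have hK : IsCompact (cthickening δ (tsupport φ)) := hs.isCompact.cthickening
  have hm : ∀ m : ℕ, (0:ℝ) < min δ (1 / (m + 1)) := fun m => by positivity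
  choose ψ h1 h2 h3 h4 using fun m => exists_smooth_approx hφ hs (hm m)
  refine ⟨_, ψ, hK, hδK, self_subset_cthickening _, fun m => ?_, fun m x => ?_, fun m x => ?_⟩
  · have : tsupport (ψ m) ⊆ cthickening δ (tsupport φ) :=
      (h2 m).trans (cthickening_mono (min_le_left _ _) _)
    exact ⟨h1 m, hK.of_isClosed_subset (isClosed_tsupport _) this, this⟩
  · exact (h3 m x).trans (min_le_right _ _)
  · exact (h4 m x).trans (min_le_right _ _)

lemma tendsto_integral_mul_of_unif (hK : IsCompact K) {A : Euc n → ℝ}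
    (hA : IntegrableOn A K) {θm : ℕ → Euc n → ℝ} (hθ : Continuous θ)
    (hθm : ∀ m, Continuous (θm m))
    (h0 : ∀ x ∉ K, θ x = 0) (h0m : ∀ m, ∀ x ∉ K, θm m x = 0)
    (h : ∀ m x, |θm m x - θ x| ≤ 1 / ((m:ℝ) + 1)) :
    Tendsto (fun m => ∫ x, A x * θm m x) atTop (𝓝 (∫ x, A x * θ x)) := by
  have e : ∀ g : Euc n → ℝ, (∀ x ∉ K, g x = 0) → ∫ x, A x * g x = ∫ x in K, A x * g x := by
    intro g hg
    rw [setIntegral_eq_of_off]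
    intro x hx
    simp [hg x hx]
  rw [e θ h0]
  simp_rw [fun m => e (θm m) (h0m m)]
  obtain ⟨B, hB⟩ := hK.exists_bound_of_continuousOn hθ.continuousOn
  refine tendsto_integral_of_dominated_convergence (fun x => |A x| * (B + 1)) (fun m => ?_) ?_
    (fun m => ?_) ?_
  · exact hA.aestronglyMeasurable.mul (hθm m).aestronglyMeasurable
  · exact hA.abs.mul_const _
  · filter_upwards [ae_restrict_mem hK.measurableSet] with x hx
    rw [norm_mul, norm_eq_abs]
    gcongr
    have h1 := hB x hx
    have h2 := h m x
    have h3 : 1 / ((m:ℝ) + 1) ≤ 1 := by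
      rw [div_le_one (by positivity)]; linarith [Nat.cast_nonneg (α := ℝ) m]
    rw [norm_eq_abs] at *
    have : |θm m x| ≤ |θm m x - θ x| + |θ x| := by
      simpa using abs_add_le (θm m x - θ x) (θ x)
    linarith
  · refine Eventually.of_forall fun x => Tendsto.const_mul _ ?_
    rw [tendsto_iff_dist_tendsto_zero]
    refine squeeze_zero (fun _ => dist_nonneg) (fun m => ?_) tendsto_one_div_add_atTop_nhds_zero_nat
    rw [dist_eq]; exact h m x

end

/-- `A` is the square integrable weak Hessian of the compactly supported `C¹` function `w`. -/
structure HasHess (w : Euc n → ℝ) (A : Fin n → Fin n → Euc n → ℝ) : Prop where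
  contDiff : ContDiff ℝ 1 w
  cpt : HasCompactSupport w
  memLp : ∀ i j, MemLp (A i j) 2
  eq : ∀ i j φ, IsTestFun univ φ → ∫ x, pd w i x * pd φ j x = - ∫ x, A i j x * φ x

lemma pd_continuous (hw : ContDiff ℝ 1 w) (i : Fin n) : Continuous (pd w i) :=
  (hw.continuous_fderiv (by simp)).clm_apply continuous_const

lemma pd_dq_of_contDiff (hg : ContDiff ℝ 1 g) (h : ℝ) (k l : Fin n) :
    pd (dq h k g) l = dq h k (pd g l) := by
  funext x
  have := dq_hasFDerivAt (fun x => (hg.differentiable (by simp) x).hasFDerivAt) h k x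
  unfold pd
  rw [this.fderiv]
  simp [dq]

lemma abs_pd_sub_le
    (h : ‖fderiv ℝ φ x - fderiv ℝ ψ x‖ ≤ r) (j : Fin n) : |pd φ j x - pd ψ j x| ≤ r := by
  have := (fderiv ℝ φ x - fderiv ℝ ψ x).le_opNorm (ev j)
  rw [norm_ev, mul_one] at this
  exact this.trans h

lemma eq_zero_of_tsupport (h : tsupport φ ⊆ K)
    (hx : x ∉ K) : φ x = 0 := zero_off_tsupport fun h' => hx (h h')

lemma integral_sq_mul_le (hf : MemLp f 2) (hg : MemLp g 2) :
    ∫ x, f x * g x ≤ (∫ x, f x ^ 2) / 2 + (∫ x, g x ^ 2) / 2 := by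
  rw [← integral_div, ← integral_div, ← integral_add (hf.integrable_sq.div_const _)
    (hg.integrable_sq.div_const _)]
  refine integral_mono (hf.integrable_mul hg) ((hf.integrable_sq.div_const _).add
    (hg.integrable_sq.div_const _)) fun x => ?_
  simp only
  nlinarith [sq_nonneg (f x - g x)]

lemma memLp_of_test (hg : Continuous g) (hs : HasCompactSupport g) (r : ℝ≥0∞) :
    MemLp g r := hg.memLp_of_hasCompactSupport hs

namespace HasHess
variable {A : Fin n → Fin n → Euc n → ℝ}

lemma eq_of_contDiff (H : HasHess w A) (i j : Fin n) (hφ : ContDiff ℝ 1 φ)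
    (hs : HasCompactSupport φ) : ∫ x, pd w i x * pd φ j x = - ∫ x, A i j x * φ x := by
  obtain ⟨K, ψ, hK, -, hsK, hψ, h1, h2⟩ := exists_seq_smooth_approx isOpen_univ hφ hs (subset_univ _)
  have t1 := tendsto_integral_mul_of_unif hK
    (((H.memLp i j).locallyIntegrable (by norm_num)).integrableOn_isCompact hK) hφ.continuous
    (fun m => (hψ m).1.continuous) (fun x hx => eq_zero_of_tsupport hsK hx)
    (fun m x hx => eq_zero_of_tsupport (hψ m).2.2 hx) h1
  have t2 := tendsto_integral_mul_of_unif hK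
    ((pd_continuous H.contDiff i).continuousOn.integrableOn_compact hK) (pd_continuous hφ j)
    (fun m => (pd_contDiff (hψ m).1 j).continuous)
    (fun x hx => eq_zero_of_tsupport ((tsupport_pd_subset φ j).trans hsK) hx)
    (fun m x hx => eq_zero_of_tsupport ((tsupport_pd_subset (ψ m) j).trans (hψ m).2.2) hx)
    (fun m x => abs_pd_sub_le (h2 m x) j)
  refine tendsto_nhds_unique t2 ?_
  refine t1.neg.congr fun m => ?_
  rw [H.eq i j (ψ m) ⟨(hψ m).1, (hψ m).2.1, subset_univ _⟩]

lemma sub {w' : Euc n → ℝ} {A' : Fin n → Fin n → Euc n → ℝ} (H : HasHess w A)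
    (H' : HasHess w' A') :
    HasHess (fun x => w x - w' x) (fun i j x => A i j x - A' i j x) where
  contDiff := H.contDiff.sub H'.contDiff
  cpt := H.cpt.sub H'.cpt
  memLp i j := (H.memLp i j).sub (H'.memLp i j)
  eq i j φ hφ := by
    have e : ∀ x, pd (fun x => w x - w' x) i x = pd w i x - pd w' i x := fun x => by
      unfold pd
      rw [fderiv_fun_sub (H.contDiff.differentiable (by simp) x)
        (H'.contDiff.differentiable (by simp) x)]
      rfl
    have c := (pd_contDiff hφ.1 j).continuous
    have hc := pd_cpt hφ.2.1 j
    have m := memLp_of_test hφ.1.continuous hφ.2.1 2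
    simp_rw [e, sub_mul]
    rw [integral_sub, integral_sub, H.eq i j φ hφ, H'.eq i j φ hφ]
    · ring
    · exact (H.memLp i j).integrable_mul m
    · exact (H'.memLp i j).integrable_mul m
    · exact ((pd_continuous H.contDiff i).mul c).integrable_cpt hc.mul_left
    · exact ((pd_continuous H'.contDiff i).mul c).integrable_cpt hc.mul_left

lemma of_test (hw : Smooth w) (hs : HasCompactSupport w) :
    HasHess w (fun i j => pd (pd w i) j) where
  contDiff := hw.of_le (by simp)
  cpt := hs
  memLp i j := memLp_of_test (pd_contDiff (pd_contDiff hw i) j).continuous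
    (pd_cpt (pd_cpt hs i) j) 2
  eq i j φ hφ := by
    have h1 := pd_contDiff hw i
    have c1 := pd_cpt hs i
    have c2 := pd_cpt hφ.2.1 j
    have c3 := pd_cpt c1 j
    refine integral_mul_fderiv_eq_neg_fderiv_mul_of_integrable ?_ ?_ ?_
      (fun x _ => h1.differentiable (by simp) x)
      (fun x _ => hφ.1.differentiable (by simp) x)
    · exact ((pd_contDiff h1 j).continuous.mul hφ.1.continuous).integrable_cpt
        c3.mul_right
    · exact (h1.continuous.mul (pd_contDiff hφ.1 j).continuous).integrable_cpt
        c1.mul_right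
    · exact (h1.continuous.mul hφ.1.continuous).integrable_cpt c1.mul_right

lemma integral_dq_dq (hw : Continuous w) (hs : HasCompactSupport w) (h : ℝ)
    (i j : Fin n) : ∫ x, dq (-h) i (dq h i w) x * dq (-h) j (dq h j w) x
      = ∫ x, dq h i (dq h j w) x ^ 2 := by
  have ci := dq_continuous hw h i
  have cj := dq_continuous hw h j
  have si := dq_cpt hs h i
  have sj := dq_cpt hs h j
  rw [integral_dq_mul ci (dq_continuous cj _ _) (dq_cpt sj _ _), neg_neg]
  simp_rw [fun x => dq_comm (dq h j w) h (-h) i j x]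
  rw [← integral_dq_mul ci (dq_continuous cj _ _) (dq_cpt sj _ _)]
  refine integral_congr_ae (.of_forall fun x => ?_)
  simp only
  rw [dq_comm w h h j i]
  ring

lemma integral_dq_sq_le (hg : ContDiff ℝ 1 g) (hs : HasCompactSupport g)
    (hh : h ≠ 0) (i : Fin n) : ∫ x, dq h i g x ^ 2 ≤ ∫ x, pd g i x ^ 2 := by
  have := integral_dq_le (fun x => (hg.differentiable (by simp) x).hasFDerivAt)
    (hg.continuous_fderiv (by simp)) hs (r := 2) (by norm_num) hh i
  simp only [rpow_two, norm_eq_abs, sq_abs] at this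
  exact this

lemma integral_trace_mul (H : HasHess w A) (hφ : ContDiff ℝ 1 φ)
    (hs : HasCompactSupport φ) :
    ∑ i, ∫ x, pd w i x * pd φ i x = - ∫ x, (∑ i, A i i x) * φ x := by
  simp_rw [fun i => H.eq_of_contDiff i i hφ hs, sum_mul]
  rw [integral_finsetSum, sum_neg_distrib]
  exact fun i _ => (H.memLp i i).integrable_mul (memLp_of_test hφ.continuous hs 2)

lemma trace_memLp (H : HasHess w A) : MemLp (fun x => ∑ i, A i i x) 2 :=
  memLp_finsetSum _ fun i _ => H.memLp i i

lemma sum_integral_dq_le (H : HasHess w A) (hh : h ≠ 0) :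
    ∑ j, ∑ i, ∫ x, dq h j (pd w i) x ^ 2 ≤ ∫ x, (∑ i, A i i x) ^ 2 := by
  have hw := H.contDiff
  have hs := H.cpt
  set D : Euc n → ℝ := fun x => ∑ j, dq (-h) j (dq h j w) x with hD
  have cD : ∀ j, ContDiff ℝ 1 (dq (-h) j (dq h j w)) := fun j => dq_contDiff (dq_contDiff hw h j) _ _
  have sD : ∀ j, HasCompactSupport (dq (-h) j (dq h j w)) := fun j =>
    dq_cpt (dq_cpt hs _ _) _ _
  have mD : ∀ j, MemLp (dq (-h) j (dq h j w)) 2 := fun j => memLp_of_test (cD j).continuous (sD j) 2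
  have MD : MemLp D 2 := memLp_finsetSum _ fun i _ => mD i
  have e1 : ∑ j, ∑ i, ∫ x, dq h j (pd w i) x ^ 2 = ∫ x, (∑ i, A i i x) * D x := by
    have : ∀ j, ∑ i, ∫ x, dq h j (pd w i) x ^ 2 =
        ∫ x, (∑ i, A i i x) * dq (-h) j (dq h j w) x := by
      intro j
      have e2 : ∀ i, ∫ x, dq h j (pd w i) x ^ 2
          = - ∫ x, pd w i x * pd (dq (-h) j (dq h j w)) i x := by
        intro i
        have ci := pd_continuous hw i
        have si : HasCompactSupport (pd w i) := pd_cpt hs i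
        rw [pd_dq_of_contDiff (dq_contDiff hw h j), pd_dq_of_contDiff hw,
          ← integral_dq_mul ci (dq_continuous ci h j) (dq_cpt si _ _)]
        simp_rw [sq]
      simp_rw [e2]
      rw [sum_neg_distrib, H.integral_trace_mul (cD j) (sD j), neg_neg]
    simp_rw [this, hD, mul_sum]
    rw [integral_finsetSum]
    exact fun j _ => H.trace_memLp.integrable_mul (mD j)
  have e3 : ∫ x, D x ^ 2 ≤ ∑ j, ∑ i, ∫ x, dq h j (pd w i) x ^ 2 := by
    have e4 : ∫ x, D x ^ 2 = ∑ j, ∑ i, ∫ x, dq h i (dq h j w) x ^ 2 := by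
      simp_rw [hD, sq, sum_mul_sum]
      have im : ∀ i j, Integrable fun x => dq (-h) i (dq h i w) x * dq (-h) j (dq h j w) x :=
        fun i j => (mD i).integrable_mul (mD j)
      rw [integral_finsetSum _ fun i _ => integrable_finsetSum _ fun j _ => im i j, sum_comm]
      refine sum_congr rfl fun i _ => ?_
      rw [integral_finsetSum _ fun j _ => im i j]
      refine sum_congr rfl fun j _ => ?_
      rw [integral_dq_dq hw.continuous hs]
      simp_rw [fun x => dq_comm w h h i j x, sq]
    rw [e4]
    refine sum_le_sum fun j _ => sum_le_sum fun i _ => ?_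
    rw [← pd_dq_of_contDiff hw]
    exact integral_dq_sq_le (dq_contDiff hw h j) (dq_cpt hs h j) hh i
  have e5 := integral_sq_mul_le H.trace_memLp MD
  linarith

lemma sum_integral_sq_le (H : HasHess w A) :
    ∑ j, ∑ i, ∫ x, A i j x ^ 2 ≤ ∫ x, (∑ i, A i i x) ^ 2 := by
  have key : ∀ φ : Fin n → Fin n → Euc n → ℝ, (∀ i j, IsTestFun univ (φ i j)) →
      ∑ j, ∑ i, ∫ x, A i j x * φ i j x ≤ (∫ x, (∑ i, A i i x) ^ 2) / 2
        + (∑ j, ∑ i, ∫ x, φ i j x ^ 2) / 2 := by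
    intro φ hφ
    have t : Tendsto (fun h : ℝ => ∑ j, ∑ i, - ∫ x, pd w i x * dq (-h) j (φ i j) x)
        (𝓝[≠] 0) (𝓝 (∑ j, ∑ i, - ∫ x, pd w i x * pd (φ i j) j x)) :=
      tendsto_finsetSum _ fun j _ => tendsto_finsetSum _ fun i _ =>
        (tendsto_integral_mul_dq_neg (pd_continuous H.contDiff i) (hφ i j).1 (hφ i j).2.1 j).neg
    simp_rw [fun i j => H.eq i j (φ i j) (hφ i j), neg_neg] at t
    refine le_of_tendsto t ?_
    filter_upwards [self_mem_nhdsWithin] with h hh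
    have b := H.sum_integral_dq_le hh
    have : ∑ j, ∑ i, - ∫ x, pd w i x * dq (-h) j (φ i j) x ≤
        ∑ j, ∑ i, ((∫ x, dq h j (pd w i) x ^ 2) / 2 + (∫ x, φ i j x ^ 2) / 2) := by
      refine sum_le_sum fun j _ => sum_le_sum fun i _ => ?_
      rw [← integral_dq_mul (pd_continuous H.contDiff i) (hφ i j).1.continuous (hφ i j).2.1]
      exact integral_sq_mul_le (memLp_of_test (dq_continuous (pd_continuous H.contDiff i) _ _)
        (dq_cpt (pd_cpt H.cpt i) _ _) 2)
        (memLp_of_test (hφ i j).1.continuous (hφ i j).2.1 2)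
    simp_rw [sum_add_distrib, ← sum_div] at this
    linarith
  have key2 : ∀ ε > 0, ∑ j, ∑ i, ∫ x, A i j x ^ 2 ≤ (∫ x, (∑ i, A i i x) ^ 2)
      + (n * (n * ε)) := by
    intro ε hε
    have ap : ∀ i j, ∃ φ, IsTestFun univ φ ∧ ∫ x, (A i j x - φ x) ^ 2 ≤ ε := by
      intro i j
      obtain ⟨g, hg1, hg2, hg3⟩ := (H.memLp i j).exist_eLpNorm_sub_le (by simp) (by simp)
        (sqrt_pos.2 hε)
      refine ⟨g, ⟨hg2, hg1, subset_univ _⟩, ?_⟩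
      have hm := (H.memLp i j).sub (memLp_of_test hg2.continuous hg1 2)
      rw [hm.eLpNorm_eq_integral_rpow_norm (by simp) (by simp)] at hg3
      rw [ofReal_le_ofReal_iff (by positivity)] at hg3
      simp only [ENNReal.toReal_ofNat, rpow_two, Pi.sub_apply, norm_eq_abs, sq_abs] at hg3
      rw [show ((2:ℝ)⁻¹) = 1 / 2 by norm_num, ← sqrt_eq_rpow] at hg3
      exact (sqrt_le_sqrt_iff hε.le).1 hg3
    choose φ hφ hφε using ap
    have k := key φ hφ
    have mφ : ∀ i j, MemLp (φ i j) 2 := fun i j =>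
      memLp_of_test (hφ i j).1.continuous (hφ i j).2.1 2
    have e : ∀ i j, ∫ x, A i j x ^ 2 ≤
        2 * (∫ x, A i j x * φ i j x) - (∫ x, φ i j x ^ 2) + ε := by
      intro i j
      have i1 := (H.memLp i j).integrable_sq
      have i2 : Integrable fun x => 2 * (A i j x * φ i j x) :=
        ((H.memLp i j).integrable_mul (mφ i j)).const_mul 2
      have i3 := (mφ i j).integrable_sq
      have : ∫ x, (A i j x - φ i j x) ^ 2 = (∫ x, A i j x ^ 2) -
          2 * (∫ x, A i j x * φ i j x) + ∫ x, φ i j x ^ 2 := by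
        have i4 : Integrable fun x => A i j x ^ 2 - 2 * (A i j x * φ i j x) := i1.sub i2
        rw [← integral_const_mul, ← integral_sub i1 i2, ← integral_add i4 i3]
        refine integral_congr_ae (.of_forall fun x => ?_)
        simp only
        ring
      linarith [hφε i j]
    have : ∑ j, ∑ i, ∫ x, A i j x ^ 2 ≤ ∑ j, ∑ i,
        (2 * (∫ x, A i j x * φ i j x) - (∫ x, φ i j x ^ 2) + ε) :=
      sum_le_sum fun j _ => sum_le_sum fun i _ => e i j
    simp_rw [sum_add_distrib, sum_sub_distrib, ← mul_sum] at this
    simp only [sum_const, Finset.card_univ, Fintype.card_fin, nsmul_eq_mul] at this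
    linarith
  refine le_of_forall_pos_le_add fun ε hε => ?_
  refine (key2 (ε / (n * n + 1)) (by positivity)).trans ?_
  gcongr
  rw [← mul_assoc, mul_div_assoc', div_le_iff₀ (by positivity)]
  nlinarith

end HasHess

lemma sq_form_le (a : Fin n → Fin n → ℝ) {ν : Euc n} (hν : ‖ν‖ ≤ 1) :
    (∑ j, ∑ i, a i j * (ν i * ν j)) ^ 2 ≤ ∑ j, ∑ i, a i j ^ 2 := by
  have h1 : ∑ i, ν i ^ 2 ≤ 1 := by
    rw [← EuclideanSpace.real_norm_sq_eq]
    nlinarith [norm_nonneg ν]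
  have h0 : 0 ≤ ∑ i, ν i ^ 2 := sum_nonneg fun i _ => sq_nonneg _
  have h2 := Finset.sum_mul_sq_le_sq_mul_sq (Finset.univ : Finset (Fin n × Fin n))
    (fun q => a q.2 q.1) (fun q => ν q.2 * ν q.1)
  simp only [← Finset.univ_product_univ, Finset.sum_product] at h2
  refine h2.trans ?_
  have h3 : ∑ j, ∑ i, (ν i * ν j) ^ 2 = (∑ i, ν i ^ 2) * ∑ i, ν i ^ 2 := by
    rw [sum_mul_sum, sum_comm]
    simp_rw [mul_pow]
  rw [h3]
  refine mul_le_of_le_one_right (by positivity) ?_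
  nlinarith

/-- A nonnegative radial kernel concentrated on the annulus of radius comparable to `ε`. -/
def kern (ε : ℝ) (x : Euc n) : ℝ :=
  4 * ‖x‖ ^ 2 * deriv (tr ε (-(n:ℝ) / 2)) (‖x‖ ^ 2) + 2 * n * tr ε (-(n:ℝ) / 2) (‖x‖ ^ 2)

/-- A compactly supported radial potential with Laplacian `kern R - kern ε`. -/
def pot (ε R : ℝ) (x : Euc n) : ℝ :=
  ∫ s in (2 * R ^ 2)..(‖x‖ ^ 2), (tr R (-(n:ℝ) / 2) s - tr ε (-(n:ℝ) / 2) s)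

lemma tr_deriv_contDiff (e : ℝ) (hε : 0 < ε) : Smooth (deriv (tr ε e)) :=
  (contDiff_infty_iff_deriv.1 (tr_contDiff e hε)).2

lemma kern_contDiff (hε : 0 < ε) : Smooth (kern (n := n) ε) := by
  have h : Smooth fun x : Euc n => ‖x‖ ^ 2 := contDiff_norm_sq ℝ
  exact ((contDiff_const.mul h).mul ((tr_deriv_contDiff _ hε).comp h)).add
    (contDiff_const.mul ((tr_contDiff _ hε).comp h))

lemma kern_eq_zero_of_lt (hε : 0 < ε) (hx : ‖x‖ ^ 2 < ε ^ 2) :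
    kern ε x = 0 := by
  simp [kern, tr_deriv_zero _ hε hx, tr_zero _ hε hx.le]

lemma kern_eq_zero_of_gt (hε : 0 < ε) (hx : 2 * ε ^ 2 < ‖x‖ ^ 2) :
    kern ε x = 0 := by
  have hpos : 0 < ‖x‖ ^ 2 := by nlinarith [sq_nonneg ε]
  have : (‖x‖ ^ 2) ^ (-(n:ℝ) / 2) = (‖x‖ ^ 2) ^ (-(n:ℝ) / 2 - 1) * ‖x‖ ^ 2 := by
    rw [← rpow_add_one hpos.ne']; simp
  rw [kern, tr_deriv_eq _ hε hx, tr_eq _ hε hx.le, this]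
  ring

lemma kern_nonneg (hε : 0 < ε) (x : Euc n) : 0 ≤ kern ε x := by
  by_cases hx : ‖x‖ ^ 2 < ε ^ 2
  · rw [kern_eq_zero_of_lt hε hx]
  · have hpos : 0 < ‖x‖ ^ 2 := lt_of_lt_of_le (by positivity) (not_lt.1 hx)
    have := tr_deriv_ge (ε := ε) (-(n:ℝ) / 2) hpos
    rw [kern]
    linarith

lemma kern_support (hε : 0 < ε) :
    Function.support (kern (n := n) ε) ⊆ ball 0 (2 * ε) := by
  intro x hx
  by_contra h
  refine hx (kern_eq_zero_of_gt hε ?_)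
  have : 2 * ε ≤ ‖x‖ := by simpa using h
  nlinarith [sq_nonneg ε, norm_nonneg x]

lemma kern_hasCompactSupport (hε : 0 < ε) : HasCompactSupport (kern (n := n) ε) :=
  HasCompactSupport.of_support_subset_isCompact (isCompact_closedBall 0 (2 * ε))
    ((kern_support hε).trans ball_subset_closedBall)

lemma exists_kern_bound : ∃ C, 0 ≤ C ∧ ∀ R, 0 < R → ∀ x : Euc n, kern R x ≤ C * R ^ (-(n:ℝ)) := by
  obtain ⟨C, hC, h⟩ := tr_deriv_bound (-(n:ℝ) / 2)
  refine ⟨4 * C + 2 * n, by positivity, fun R hR x => ?_⟩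
  by_cases hx : ‖x‖ ^ 2 < R ^ 2
  · rw [kern_eq_zero_of_lt hR hx]; positivity
  · have hxR := not_lt.1 hx
    have hpos : 0 < ‖x‖ ^ 2 := lt_of_lt_of_le (by positivity) hxR
    have h1 := h R _ hR hpos
    have h2 := tr_le (ε := R) (-(n:ℝ) / 2) hpos.le
    have h3 : (‖x‖ ^ 2) ^ (-(n:ℝ) / 2) = ‖x‖ ^ 2 * (‖x‖ ^ 2) ^ (-(n:ℝ) / 2 - 1) := by
      rw [mul_comm, ← rpow_add_one hpos.ne']; simp
    have h4 : (‖x‖ ^ 2) ^ (-(n:ℝ) / 2) ≤ R ^ (-(n:ℝ)) := by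
      rw [← sq_rpow_half hR.le (-(n:ℝ))]
      refine rpow_le_rpow_of_nonpos (by positivity) hxR ?_
      have : (0:ℝ) ≤ n := by positivity
      linarith
    calc kern R x ≤ 4 * (‖x‖ ^ 2 * (C * (‖x‖ ^ 2) ^ (-(n:ℝ) / 2 - 1)))
          + 2 * n * (‖x‖ ^ 2) ^ (-(n:ℝ) / 2) := by
          rw [kern, mul_assoc]
          have := (le_abs_self _).trans h1
          gcongr
      _ = (4 * C + 2 * n) * (‖x‖ ^ 2) ^ (-(n:ℝ) / 2) := by rw [h3]; ring
      _ ≤ _ := by gcongr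

section Potential
variable {R : ℝ}

lemma pot_profile_contDiff (e : ℝ) (hε : 0 < ε) (hR : 0 < R) :
    Smooth (fun s => tr R e s - tr ε e s) :=
  (tr_contDiff _ hR).sub (tr_contDiff _ hε)

lemma pot_primitive_hasDerivAt (e : ℝ) (hε : 0 < ε) (hR : 0 < R) (s : ℝ) :
    HasDerivAt (fun s => ∫ t in (2 * R ^ 2)..s, (tr R e t - tr ε e t)) (tr R e s - tr ε e s) s :=
  (pot_profile_contDiff e hε hR).continuous.integral_hasStrictDerivAt _ _ |>.hasDerivAt

lemma pot_primitive_contDiff (e : ℝ) (hε : 0 < ε) (hR : 0 < R) :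
    Smooth (fun s => ∫ t in (2 * R ^ 2)..s, (tr R e t - tr ε e t)) := by
  refine contDiff_infty_iff_deriv.2 ⟨fun s => (pot_primitive_hasDerivAt e hε hR s).differentiableAt, ?_⟩
  rw [show deriv (fun s => ∫ t in (2 * R ^ 2)..s, (tr R e t - tr ε e t))
    = fun s => tr R e s - tr ε e s from funext fun s => (pot_primitive_hasDerivAt e hε hR s).deriv]
  exact pot_profile_contDiff e hε hR

lemma pot_contDiff (hε : 0 < ε) (hR : 0 < R) : Smooth (pot (n := n) ε R) :=
  (pot_primitive_contDiff _ hε hR).comp (contDiff_norm_sq ℝ)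

lemma pot_hasCompactSupport (hε : 0 < ε) (hεR : ε ≤ R) : HasCompactSupport (pot (n := n) ε R) := by
  have hR := hε.trans_le hεR
  refine HasCompactSupport.of_support_subset_isCompact (isCompact_closedBall 0 (2 * R)) ?_
  intro x hx
  by_contra h
  refine hx ?_
  have h' : 2 * R < ‖x‖ := by simpa using h
  have h2 : 2 * R ^ 2 ≤ ‖x‖ ^ 2 := by nlinarith [sq_nonneg R, norm_nonneg x]
  rw [pot]
  rw [intervalIntegral.integral_congr (g := fun _ => (0:ℝ))]
  · simp
  · intro s hs
    rw [uIcc_of_le h2] at hs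
    have h3 : 2 * ε ^ 2 ≤ 2 * R ^ 2 := by gcongr
    simp only
    rw [tr_eq _ hR hs.1, tr_eq _ hε (h3.trans hs.1), sub_self]

lemma hasFDerivAt_comp_norm_sq {h : ℝ → ℝ} {h' : ℝ}
    (hh : HasDerivAt h h' (‖x‖ ^ 2)) :
    HasFDerivAt (fun x => h (‖x‖ ^ 2)) (h' • ((2:ℝ) • innerSL ℝ x)) x := by
  refine hh.comp_hasFDerivAt x ?_
  have h2 : (2:ℝ) • innerSL ℝ x = (2:ℕ) • innerSL ℝ x := by
    rw [two_smul, two_smul]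
  rw [h2]
  exact (hasStrictFDerivAt_norm_sq x).hasFDerivAt

lemma pd_pot (hε : 0 < ε) (hR : 0 < R) (i : Fin n) : pd (pot ε R) i = fun x : Euc n =>
    2 * x i * (tr R (-(n:ℝ) / 2) (‖x‖ ^ 2) - tr ε (-(n:ℝ) / 2) (‖x‖ ^ 2)) := by
  funext x
  have := hasFDerivAt_comp_norm_sq (x := x) (pot_primitive_hasDerivAt (-(n:ℝ) / 2) hε hR _)
  unfold pd pot
  rw [this.fderiv]
  change (_:ℝ) * ((2:ℝ) * ⟪x, ev i⟫_ℝ) = _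
  rw [inner_ev]
  ring

lemma laplacian_pot (hε : 0 < ε) (hR : 0 < R) (x : Euc n) :
    ∑ i, pd (pd (pot ε R) i) i x = kern R x - kern ε x := by
  set e := -(n:ℝ) / 2 with he
  have h : ∀ i, pd (pd (pot ε R) i) i x = 2 * (tr R e (‖x‖ ^ 2) - tr ε e (‖x‖ ^ 2))
      + 4 * (x i) ^ 2 * (deriv (tr R e) (‖x‖ ^ 2) - deriv (tr ε e) (‖x‖ ^ 2)) := by
    intro i
    rw [pd_pot hε hR]
    have h1 := hasFDerivAt_comp_norm_sq (x := x)
      ((tr_hasDerivAt e hR (‖x‖ ^ 2)).sub (tr_hasDerivAt e hε (‖x‖ ^ 2)))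
    have h2 : HasFDerivAt (fun x : Euc n => 2 * x i)
        ((2:ℝ) • (EuclideanSpace.proj (𝕜 := ℝ) i : Euc n →L[ℝ] ℝ)) x :=
      ((EuclideanSpace.proj (𝕜 := ℝ) i : Euc n →L[ℝ] ℝ).hasFDerivAt).const_mul 2
    have h3 := h2.mul h1
    have h4 : pd (fun x : Euc n => 2 * x i * (tr R e (‖x‖ ^ 2) - tr ε e (‖x‖ ^ 2))) i x
      = ((2 * x i) • ((deriv (tr R e) (‖x‖ ^ 2) - deriv (tr ε e) (‖x‖ ^ 2)) • ((2:ℝ) • innerSL ℝ x))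
        + (tr R e (‖x‖ ^ 2) - tr ε e (‖x‖ ^ 2)) •
          ((2:ℝ) • (EuclideanSpace.proj (𝕜 := ℝ) i : Euc n →L[ℝ] ℝ))) (ev i) := by
      unfold pd
      have h3' : HasFDerivAt (fun x : Euc n =>
        2 * x i * (tr R e (‖x‖ ^ 2) - tr ε e (‖x‖ ^ 2))) _ x := h3
      rw [h3'.fderiv]
      rfl
    rw [h4]
    change (2 * x i) * (_ * (2 * ⟪x, ev i⟫_ℝ)) + _ * (2 * (ev i) i) = _
    rw [inner_ev]
    simp [ev]
    ring
  simp_rw [h, sum_add_distrib, ← sum_mul, ← mul_sum,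
    ← EuclideanSpace.real_norm_sq_eq]
  simp only [sum_const, Finset.card_univ, Fintype.card_fin, nsmul_eq_mul, kern, ← he]
  ring

end Potential

section

open scoped Convolution

open ContinuousLinearMap in
def cv (g k : Euc n → ℝ) : Euc n → ℝ := g ⋆[lsmul ℝ ℝ, volume] k

lemma integral_pd_eq_zero (hφ : ContDiff ℝ 1 φ) (hs : HasCompactSupport φ)
    (i : Fin n) : ∫ x, pd φ i x = 0 := by
  have h := integral_mul_fderiv_eq_neg_fderiv_mul_of_integrable (μ := (volume : Measure (Euc n)))
    (f := fun _ : Euc n => (1:ℝ)) (g := φ) (v := EuclideanSpace.single i 1) (by simp)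
    (by
      have := (pd_continuous hφ i).integrable_cpt
        (pd_cpt hs i)
      simp only [one_mul]
      exact this)
    (by simpa using hφ.continuous.integrable_cpt hs)
    (fun x _ => by fun_prop) (fun x _ => hφ.differentiable (by simp) x)
  simpa [pd] using h

lemma integral_kern_eq {R : ℝ} (hε : 0 < ε) (hεR : ε ≤ R) :
    ∫ x, kern (n := n) ε x = ∫ x, kern (n := n) R x := by
  have hR := hε.trans_le hεR
  have hI : ∀ {r : ℝ}, 0 < r → Integrable (kern (n := n) r) := fun hr =>
    (kern_contDiff hr).continuous.integrable_cpt (kern_hasCompactSupport hr)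
  have hp := fun i => pd_contDiff (pot_contDiff (n := n) hε hR) i
  have hps := fun i => pd_cpt (pot_hasCompactSupport (n := n) hε hεR) i
  have h : ∫ x, ∑ i, pd (pd (pot (n := n) ε R) i) i x = 0 := by
    rw [integral_finsetSum]
    · exact sum_eq_zero fun i _ => integral_pd_eq_zero ((hp i).of_le (by simp)) (hps i) i
    · exact fun i _ => (pd_contDiff (hp i) i).continuous.integrable_cpt
        (pd_cpt (hps i) i)
  simp_rw [laplacian_pot hε hR] at h
  rw [integral_sub (hI hR) (hI hε)] at h
  linarith

lemma exists_integral_kern (hn : 0 < n) : ∃ c, 0 < c ∧ ∀ ε, 0 < ε → ∫ x, kern (n := n) ε x = c := by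
  refine ⟨∫ x, kern (n := n) 1 x, ?_, fun ε hε => ?_⟩
  · have hd : ∀ s, HasDerivAt (cutT 1) (deriv (cutT 1) s) s := fun s => cutT_hasDerivAt 1 s
    obtain ⟨s, hs, hs'⟩ := exists_deriv_eq_slope (cutT 1) (a := 1) (b := 2) (by norm_num)
      (fun s _ => (hd s).continuousAt.continuousWithinAt)
      (fun s _ => (hd s).differentiableAt.differentiableWithinAt)
    refine (kern_contDiff one_pos).continuous.integral_pos_of_hasCompactSupport_nonneg_nonzero
      (kern_hasCompactSupport one_pos) (kern_nonneg one_pos) (x := √s • ev ⟨0, hn⟩) ?_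
    · intro h
      have hs0 : 0 < s := by linarith [hs.1]
      have hs1 : deriv (cutT 1) s = 1 := by
        rw [hs', cutT_zero one_pos (s := 1) (by norm_num),
          cutT_one one_pos (s := 2) (by norm_num)]
        norm_num
      have hnorm : ‖√s • (ev ⟨0, hn⟩ : Euc n)‖ ^ 2 = s := by
        rw [norm_smul, norm_ev, mul_one, norm_eq_abs, sq_abs, sq_sqrt hs0.le]
      rw [kern, hnorm, tr_deriv _ hs0, tr, hs1] at h
      have h3 : s * s ^ (-(n:ℝ) / 2 - 1) = s ^ (-(n:ℝ) / 2) := by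
        rw [mul_comm, ← rpow_add_one hs0.ne']; simp
      have h4 : 4 * s * s ^ (-(n:ℝ) / 2) = 0 := by
        rw [← h, mul_add]
        have : 4 * s * (cutT 1 s * (-(n:ℝ) / 2 * s ^ (-(n:ℝ) / 2 - 1)))
          = - (2 * n * (cutT 1 s * (s * s ^ (-(n:ℝ) / 2 - 1)))) := by ring
        rw [this, h3]
        ring
      have : 0 < 4 * s * s ^ (-(n:ℝ) / 2) := by positivity
      linarith
  · rcases le_total ε 1 with h | h
    · exact integral_kern_eq hε h
    · exact (integral_kern_eq one_pos h).symm

section Conv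
variable {k : Euc n → ℝ}

lemma cv_contDiff (hg : Continuous g) (hk : Smooth k) (hks : HasCompactSupport k) :
    Smooth (cv g k) :=
  hks.contDiff_convolution_right _ hg.locallyIntegrable hk

lemma cv_hasCompactSupport (hg : HasCompactSupport g) (hk : HasCompactSupport k) :
    HasCompactSupport (cv g k) := hg.convolution _ hk

lemma pd_cv (hg : Continuous g) (hk : Smooth k) (hks : HasCompactSupport k)
    (i : Fin n) : pd (cv g k) i = cv g (pd k i) := by
  funext x
  unfold pd cv
  rw [(hks.hasFDerivAt_convolution_right (ContinuousLinearMap.lsmul ℝ ℝ) hg.locallyIntegrable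
    (hk.of_le (by simp)) x).fderiv]
  exact convolution_precompR_apply (ContinuousLinearMap.lsmul ℝ ℝ) hg.locallyIntegrable
    (hks.fderiv ℝ) (hk.continuous_fderiv (by simp)) x _

lemma cv_apply (x : Euc n) : cv g k x = ∫ t, g t * k (x - t) := rfl

lemma cv_swap (x : Euc n) : cv g k x = ∫ t, g (x - t) * k t := convolution_lsmul_swap

lemma cv_comm (x : Euc n) : cv g k x = cv k g x := by
  rw [cv_swap, cv_apply]; simp_rw [mul_comm]

lemma laplacian_cv_pot {R : ℝ} (hε : 0 < ε) (hεR : ε ≤ R) (hg : Continuous g)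
    (hgs : HasCompactSupport g) (x : Euc n) :
    ∑ i, pd (pd (cv g (pot ε R)) i) i x = cv g (kern R) x - cv g (kern ε) x := by
  have hR := hε.trans_le hεR
  have hp := pot_contDiff (n := n) hε hR
  have hps := pot_hasCompactSupport (n := n) hε hεR
  have h1 : ∀ i, pd (pd (cv g (pot ε R)) i) i = cv g (pd (pd (pot ε R) i) i) := fun i => by
    rw [pd_cv hg hp hps, pd_cv hg (pd_contDiff hp i) (pd_cpt hps i)]
  have hI : ∀ {κ : Euc n → ℝ}, Continuous κ → Integrable (fun t => g t * κ (x - t)) := fun hκ =>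
    (by fun_prop : Continuous (fun t => g t * _)).integrable_cpt hgs.mul_right
  have h2 : ∀ i, Continuous (pd (pd (pot (n := n) ε R) i) i) := fun i =>
    (pd_contDiff (pd_contDiff hp i) i).continuous
  simp_rw [h1, cv_apply]
  rw [← integral_finsetSum _ (fun i _ => hI (h2 i)), ← integral_sub
    (hI (kern_contDiff hR).continuous) (hI (kern_contDiff hε).continuous)]
  congr 1; ext t
  rw [← mul_sum, laplacian_pot hε hR, mul_sub]

end Conv

end

lemma abs_cv_le {k : Euc n → ℝ} (hg : Integrable g) {B : ℝ} (hk : ∀ x, |k x| ≤ B) (x : Euc n) :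
    |cv g k x| ≤ (∫ t, |g t|) * B := by
  rw [cv_apply, ← integral_mul_const]
  rw [← norm_eq_abs]
  refine (norm_integral_le_of_norm_le (hg.abs.mul_const B) (ae_of_all _ fun t => ?_))
  rw [norm_mul]
  exact mul_le_left (hk _) (abs_nonneg _)

lemma cv_eq_zero {k : Euc n → ℝ} (hg : ∀ x, g x ≠ 0 → ‖x‖ ≤ a)
    (hk : ∀ x, k x ≠ 0 → ‖x‖ ≤ b) (hx : a + b < ‖x‖) : cv g k x = 0 := by
  rw [cv_apply]
  refine integral_eq_zero_of_ae (ae_of_all _ fun t => ?_)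
  by_contra h
  have h1 := hg t (left_ne_zero_of_mul h)
  have h2 := hk (x - t) (right_ne_zero_of_mul h)
  have := norm_add_le t (x - t)
  rw [add_sub_cancel] at this
  linarith

lemma kern_norm_le (hε : 0 < ε) (hx : kern ε x ≠ 0) : ‖x‖ ≤ 2 * ε := by
  simpa using (mem_ball.1 (kern_support hε hx)).le

section
lemma eventually_eLpNorm_cv_sub_le (hg : Continuous g) (hgs : HasCompactSupport g) (hc : 0 < c)
    (hk : ∀ ε, 0 < ε → ∫ x, kern (n := n) ε x = c) {r : ℝ≥0∞} (hr : r ≠ ⊤) (hδ : 0 < δ) :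
    ∀ᶠ ε in 𝓝[>] (0:ℝ), eLpNorm (fun x => c⁻¹ * cv g (kern ε) x - g x) r ≤ ofReal δ := by
  obtain ⟨a, ha⟩ := hgs.isCompact.isBounded.exists_norm_le
  have ha' : ∀ x, g x ≠ 0 → ‖x‖ ≤ a := fun x hx => ha x (subset_tsupport g hx)
  set K := closedBall (0 : Euc n) (a + 2) with hK
  obtain ⟨ω, hω, hωδ⟩ : ∃ ω : ℝ, 0 < ω ∧
      ofReal ω * volume K ^ (1 / r.toReal) ≤ ofReal δ := by
    have hfin : volume K ^ (1 / r.toReal) ≠ ⊤ :=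
      rpow_ne_top_of_nonneg (by positivity) (isCompact_closedBall _ _).measure_lt_top.ne
    set V := volume K ^ (1 / r.toReal)
    refine ⟨δ / (V.toReal + 1), by positivity, ?_⟩
    rw [← ofReal_toReal hfin, ← ofReal_mul (by positivity)]
    refine ofReal_le_ofReal ?_
    have : 0 ≤ V.toReal := toReal_nonneg
    rw [toReal_ofReal this, div_mul_eq_mul_div, div_le_iff₀ (by positivity)]
    nlinarith
  obtain ⟨η, hη, hηω⟩ := uniformContinuous_iff.1 (hgs.uniformContinuous_of_continuous hg) ω hω
  have h0 : ∀ᶠ ε in 𝓝[>] (0:ℝ), 0 < ε := self_mem_nhdsWithin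
  have h1 : ∀ᶠ ε in 𝓝[>] (0:ℝ), ε < min 1 (η / 2) :=
    nhdsWithin_le_nhds (gt_mem_nhds (by positivity))
  filter_upwards [h0, h1] with ε hε hε1
  have hε2 : ε < 1 := hε1.trans_le (min_le_left _ _)
  have hε3 : ε < η / 2 := hε1.trans_le (min_le_right _ _)
  refine (eLpNorm_sub_le_of_dist_bdd (s := K) volume hr isClosed_closedBall.measurableSet
    hω.le (f := fun x => c⁻¹ * cv g (kern ε) x) (g := g) (fun x => ?_) ?_ ?_).trans hωδ
  · have e1 : c⁻¹ * cv g (kern ε) x = cv (fun y => c⁻¹ * kern ε y) g x := by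
      rw [cv_comm, cv_apply, cv_apply, ← integral_const_mul]
      congr 1; ext t; ring
    rw [e1]
    refine dist_convolution_le (R := 2 * ε) hω.le ?_ (fun x => mul_nonneg (by positivity)
      (kern_nonneg hε x)) ?_ hg.aestronglyMeasurable fun y hy => ?_
    · intro y hy
      exact kern_support hε (right_ne_zero_of_mul hy)
    · rw [integral_const_mul, hk ε hε, inv_mul_cancel₀ hc.ne']
    · refine (hηω ?_).le
      have := mem_ball.1 hy
      linarith
  · intro x hx
    by_contra h
    have h' : a + 2 < ‖x‖ := by simpa [hK] using h
    refine right_ne_zero_of_mul hx (cv_eq_zero ha' (fun x => kern_norm_le hε) ?_)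
    linarith
  · intro x hx
    have := ha' x hx
    simp only [hK, mem_closedBall, dist_zero_right]; linarith

lemma eventually_eLpNorm_cv_le (hn : 0 < n) (hg : Continuous g) (hgs : HasCompactSupport g)
    {r : ℝ≥0∞} (hr1 : 1 < r) (hr : r ≠ ⊤) (hδ : 0 < δ) :
    ∀ᶠ R in atTop, eLpNorm (fun x => c⁻¹ * cv g (kern R) x) r ≤ ofReal δ := by
  obtain ⟨a, ha⟩ := hgs.isCompact.isBounded.exists_norm_le
  have ha' : ∀ x, g x ≠ 0 → ‖x‖ ≤ a := fun x hx => ha x (subset_tsupport g hx)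
  obtain ⟨C, hC, hCk⟩ := exists_kern_bound (n := n)
  have : Nonempty (Fin n) := ⟨⟨0, hn⟩⟩
  set v := (volume (ball (0 : Euc n) 1)) with hv
  have hvt : v ≠ ⊤ := measure_ball_lt_top.ne
  set M := |c⁻¹| * ((∫ t, |g t|) * C) with hM
  have hM0 : 0 ≤ M := by positivity
  set s := r.toReal with hs
  have hs1 : 1 < s := by
    rw [hs, ← ENNReal.toReal_one]; exact (ENNReal.toReal_lt_toReal (by simp) hr).2 hr1
  have key : Tendsto (fun R : ℝ => M * ((3 ^ n * v.toReal) ^ (1 / s)) * R ^ (-(n * (1 - 1 / s))))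
      atTop (𝓝 0) := by
    have : 0 < (n:ℝ) * (1 - 1 / s) := by
      have : 1 / s < 1 := by rw [div_lt_one (by linarith)]; exact hs1
      have h2 : (0:ℝ) < n := by exact_mod_cast hn
      have : 0 < 1 - 1 / s := by linarith
      positivity
    simpa using (tendsto_rpow_neg_atTop this).const_mul (M * ((3 ^ n * v.toReal) ^ (1 / s)))
  filter_upwards [eventually_gt_atTop 0, eventually_ge_atTop a,
    key.eventually_le_const hδ] with R hR0 hRa hRδ
  have hRn : M * R ^ (-(n:ℝ)) * ((3 * R) ^ n * v.toReal) ^ (1 / s) ≤ δ := by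
    refine le_of_eq_of_le ?_ hRδ
    rw [show (3 * R) ^ n * v.toReal = (3 ^ n * v.toReal) * R ^ n by ring,
      mul_rpow (x := 3 ^ n * v.toReal) (y := R ^ n) (by positivity) (by positivity),
      show -((n:ℝ) * (1 - 1 / s)) = -n + n * (1 / s) by ring, rpow_add hR0,
      rpow_mul hR0.le, rpow_natCast]
    ring
  have hvol : volume (closedBall (0 : Euc n) (3 * R)) = ofReal ((3 * R) ^ n) * v := by
    rw [Measure.addHaar_closedBall _ _ (by positivity), finrank_euclideanSpace_fin]
  have hb := eLpNorm_sub_le_of_dist_bdd (s := closedBall (0 : Euc n) (3 * R)) volume hr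
    isClosed_closedBall.measurableSet (c := M * R ^ (-(n:ℝ))) (by positivity)
    (f := fun x => c⁻¹ * cv g (kern R) x) (g := fun _ => 0) (fun x => ?_) ?_ ?_
  · simp only [sub_zero, Pi.sub_def] at hb
    refine hb.trans ?_
    rw [hvol, ← ofReal_toReal hvt, ← ofReal_mul (by positivity),
      ofReal_rpow_of_nonneg (by positivity) (by positivity),
      ← ofReal_mul (by positivity)]
    exact ofReal_le_ofReal hRn
  · rw [dist_eq, sub_zero, abs_mul, hM, mul_assoc, mul_assoc]
    refine mul_le_left ?_ (abs_nonneg _)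
    refine abs_cv_le (hg.integrable_cpt hgs) (fun y => ?_) x
    rw [abs_of_nonneg (kern_nonneg hR0 y)]
    exact hCk R hR0 y
  · intro x hx
    by_contra h
    have h' : 3 * R < ‖x‖ := by simpa using h
    refine right_ne_zero_of_mul hx (cv_eq_zero ha' (fun x => kern_norm_le hR0) ?_)
    linarith
  · simp

lemma exists_laplacian_approx_of_continuous (hn : 0 < n) (hg : Continuous g)
    (hgs : HasCompactSupport g) {r r' : ℝ≥0∞} (hr1 : 1 < r) (hr : r ≠ ⊤) (hr1' : 1 < r')
    (hr' : r' ≠ ⊤) (hδ : 0 < δ) :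
    ∃ w : Euc n → ℝ, Smooth w ∧ HasCompactSupport w ∧
      eLpNorm (fun x => ∑ i, pd (pd w i) i x - g x) r ≤ ofReal δ ∧
      eLpNorm (fun x => ∑ i, pd (pd w i) i x - g x) r' ≤ ofReal δ := by
  obtain ⟨c, hc, hk⟩ := exists_integral_kern hn
  have hδ2 : 0 < δ / 2 := by positivity
  have h0 : ∀ᶠ ε in 𝓝[>] (0:ℝ), 0 < ε := self_mem_nhdsWithin
  obtain ⟨ε, hε, h1, h1'⟩ := (h0.and ((eventually_eLpNorm_cv_sub_le hg hgs hc hk hr hδ2).and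
    (eventually_eLpNorm_cv_sub_le hg hgs hc hk hr' hδ2))).exists
  obtain ⟨R, hεR, h2, h2'⟩ := ((eventually_ge_atTop ε).and
    ((eventually_eLpNorm_cv_le (c := c) hn hg hgs hr1 hr hδ2).and
    (eventually_eLpNorm_cv_le (c := c) hn hg hgs hr1' hr' hδ2))).exists
  have hR := hε.trans_le hεR
  have hpc := pot_contDiff (n := n) hε hR
  have hps := pot_hasCompactSupport (n := n) hε hεR
  have hwc := cv_contDiff hg hpc hps
  have hws := cv_hasCompactSupport hgs hps
  have hpd : ∀ (w : Euc n → ℝ), Smooth w → ∀ i, pd (fun x => -c⁻¹ * w x) i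
      = fun x => -c⁻¹ * pd w i x := by
    intro w hw i; funext x
    unfold pd
    rw [fderiv_const_mul (hw.differentiable (by simp) x)]
    rfl
  have hL : (fun x => ∑ i, pd (pd (fun x => -c⁻¹ * cv g (pot ε R) x) i) i x - g x)
      = (fun x => c⁻¹ * cv g (kern ε) x - g x) - fun x => c⁻¹ * cv g (kern R) x := by
    funext x
    simp_rw [hpd _ hwc, fun i => hpd _ (pd_contDiff hwc i) i, ← mul_sum,
      laplacian_cv_pot hε hεR hg hgs, Pi.sub_apply]
    ring
  have hm1 : AEStronglyMeasurable (fun x => c⁻¹ * cv g (kern ε) x - g x) volume :=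
    ((((cv_contDiff hg (kern_contDiff hε) (kern_hasCompactSupport hε)).continuous).const_mul _).sub
      hg).aestronglyMeasurable
  have hm2 : AEStronglyMeasurable (fun x => c⁻¹ * cv g (kern R) x) volume :=
    (((cv_contDiff hg (kern_contDiff hR) (kern_hasCompactSupport hR)).continuous).const_mul
      _).aestronglyMeasurable
  have hsum : ofReal δ = ofReal (δ / 2) + ofReal (δ / 2) := by
    rw [← ofReal_add hδ2.le hδ2.le, add_halves]
  refine ⟨fun x => -c⁻¹ * cv g (pot ε R) x, contDiff_const.mul hwc, hws.mul_left, ?_, ?_⟩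
  · rw [hL, hsum]
    exact (eLpNorm_sub_le hm1 hm2 hr1.le).trans (add_le_add h1 h2)
  · rw [hL, hsum]
    exact (eLpNorm_sub_le hm1 hm2 hr1'.le).trans (add_le_add h1' h2')

end

lemma exists_ofReal_mul_le {V : ℝ≥0∞} (hV : V ≠ ⊤) (hδ : 0 < δ) :
    ∃ ω : ℝ, 0 < ω ∧ ω ≤ δ ∧ ofReal ω * V ≤ ofReal δ := by
  have h0 : 0 ≤ V.toReal := toReal_nonneg
  refine ⟨δ / (V.toReal + 1), by positivity, div_le_self hδ.le (by linarith), ?_⟩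
  rw [← ofReal_toReal hV, ← ofReal_mul (by positivity)]
  refine ofReal_le_ofReal ?_
  rw [toReal_ofReal h0, div_mul_eq_mul_div, div_le_iff₀ (by positivity)]
  nlinarith

lemma exists_continuous_approx {q : ℝ≥0∞} (hq : 2 ≤ q) (hq' : q ≠ ⊤) {H : Euc n → ℝ}
    (hH : MemLp H q) (ha : 0 ≤ a) (hHa : ∀ x, a < ‖x‖ → H x = 0) (hδ : 0 < δ) :
    ∃ g : Euc n → ℝ, Continuous g ∧ HasCompactSupport g ∧
      eLpNorm (fun x => g x - H x) 2 ≤ ofReal δ ∧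
      eLpNorm (fun x => g x - H x) q ≤ ofReal δ := by
  set K := closedBall (0 : Euc n) (a + 2) with hK
  have hKf : volume K < ⊤ := (isCompact_closedBall _ _).measure_lt_top
  have hVf : volume K ^ (1 / (2:ℝ≥0∞).toReal - 1 / q.toReal) ≠ ⊤ := by
    refine rpow_ne_top_of_nonneg (sub_nonneg.2 ?_) hKf.ne
    exact one_div_le_one_div_of_le (by simp) (toReal_mono hq' hq)
  obtain ⟨ω, hω, hωδ, hωV⟩ := exists_ofReal_mul_le hVf hδ
  obtain ⟨g, hgs, hgH, hg, -⟩ := hH.exists_hasCompactSupport_eLpNorm_sub_le hq'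
    (ε := ofReal ω) (by simpa using hω)
  let χ : ContDiffBump (0 : Euc n) := ⟨a + 1, a + 2, by linarith, by linarith⟩
  have hle : ∀ x, ‖χ x * g x - H x‖ ≤ ‖(H - g) x‖ := by
    intro x
    rw [Pi.sub_apply]
    by_cases hx : a < ‖x‖
    · rw [hHa x hx, sub_zero, zero_sub, norm_neg, norm_mul, norm_of_nonneg χ.nonneg]
      exact mul_le_of_le_one_left (norm_nonneg _) χ.le_one
    · rw [χ.one_of_mem_closedBall, one_mul, norm_sub_rev]
      simp only [mem_closedBall, dist_zero_right]
      change ‖x‖ ≤ a + 1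
      linarith
  have hsupp : Function.support (fun x => χ x * g x - H x) ⊆ K := by
    intro x hx
    by_contra h
    have h' : a + 2 < ‖x‖ := by simpa [hK] using h
    refine hx ?_
    simp only
    rw [hHa x (by linarith), χ.zero_of_le_dist (by simpa using h'.le)]
    simp
  have hm : AEStronglyMeasurable (fun x => χ x * g x - H x) volume :=
    ((χ.continuous.mul hg).aestronglyMeasurable).sub hH.1
  have hqn : eLpNorm (fun x => χ x * g x - H x) q ≤ ofReal ω :=
    (eLpNorm_mono hle).trans hgH
  refine ⟨fun x => χ x * g x, χ.continuous.mul hg, hgs.mul_left, ?_, hqn.trans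
    (ofReal_le_ofReal hωδ)⟩
  rw [← eLpNorm_restrict_eq_of_support_subset hsupp]
  have := eLpNorm_le_eLpNorm_mul_rpow_measure_univ hq (hm.restrict (s := K))
  refine this.trans ?_
  rw [eLpNorm_restrict_eq_of_support_subset hsupp, Measure.restrict_apply_univ]
  exact le_trans (by gcongr) hωV

lemma exists_laplacian_approx (hn : 0 < n) {q : ℝ≥0∞} (hq : 2 ≤ q) (hq' : q ≠ ⊤) {H : Euc n → ℝ}
    (hH : MemLp H q) (ha : 0 ≤ a) (hHa : ∀ x, a < ‖x‖ → H x = 0) (hδ : 0 < δ) :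
    ∃ w : Euc n → ℝ, Smooth w ∧ HasCompactSupport w ∧
      eLpNorm (fun x => ∑ i, pd (pd w i) i x - H x) 2 ≤ ofReal δ ∧
      eLpNorm (fun x => ∑ i, pd (pd w i) i x - H x) q ≤ ofReal δ := by
  have hδ2 : 0 < δ / 2 := by positivity
  obtain ⟨g, hg, hgs, h1, h2⟩ := exists_continuous_approx hq hq' hH ha hHa hδ2
  obtain ⟨w, hw, hws, h3, h4⟩ := exists_laplacian_approx_of_continuous hn hg hgs
    (r := 2) (r' := q) (by norm_num) (by simp) (lt_of_lt_of_le (by norm_num) hq) hq' hδ2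
  have hsum : ofReal δ = ofReal (δ / 2) + ofReal (δ / 2) := by
    rw [← ofReal_add hδ2.le hδ2.le, add_halves]
  have he : (fun x => ∑ i, pd (pd w i) i x - H x)
      = (fun x => ∑ i, pd (pd w i) i x - g x) + fun x => g x - H x := by
    funext x; simp
  have hm1 : AEStronglyMeasurable (fun x => ∑ i, pd (pd w i) i x - g x) volume :=
    ((continuous_finsetSum _ fun i _ => (pd_contDiff (pd_contDiff hw i) i).continuous).sub
      hg).aestronglyMeasurable
  have hm2 : AEStronglyMeasurable (fun x => g x - H x) volume := hg.aestronglyMeasurable.sub hH.1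
  refine ⟨w, hw, hws, ?_, ?_⟩
  · rw [he, hsum]
    exact (eLpNorm_add_le hm1 hm2 (by norm_num)).trans (add_le_add h3 h1)
  · rw [he, hsum]
    exact (eLpNorm_add_le hm1 hm2 (le_trans (by norm_num) hq)).trans (add_le_add h4 h2)

def lap (w : Euc n → ℝ) (x : Euc n) : ℝ := ∑ i, pd (pd w i) i x

/-- The Calderón–Zygmund inequality for smooth functions with compact support. -/
def HessBound (n : ℕ) (C q : ℝ) : Prop :=
  ∀ w : Euc n → ℝ, Smooth w → HasCompactSupport w →
    eLpNorm (fun x => ‖iteratedFDeriv ℝ 2 w x‖) (ofReal q)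
      ≤ ofReal C * eLpNorm (lap w) (ofReal q)

lemma fderiv_apply_contDiff (hw : Smooth w) (x : Euc n) (i j : Fin n) :
    pd (pd w i) j x = iteratedFDeriv ℝ 2 w x ![ev j, ev i] := by
  rw [iteratedFDeriv_two_apply]
  have h : DifferentiableAt ℝ (fderiv ℝ w) x :=
    (hw.fderiv_right (m := ((1:ℕ∞) : WithTop ℕ∞)) (by exact_mod_cast le_top)).differentiable (by simp) x
  unfold pd
  rw [fderiv_clm_apply h (differentiableAt_const _)]
  simp [ev]

lemma lapl_eq_lap (hw : Smooth w) : lapl w = lap w := by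
  funext x
  unfold lapl lap
  simp_rw [fderiv_apply_contDiff hw]
  rfl

lemma abs_pd_pd_le (hw : Smooth w) (x : Euc n) (i j : Fin n) :
    |pd (pd w i) j x| ≤ ‖iteratedFDeriv ℝ 2 w x‖ := by
  rw [fderiv_apply_contDiff hw, ← norm_eq_abs]
  refine ((iteratedFDeriv ℝ 2 w x).le_opNorm _).trans ?_
  simp

lemma abs_form_le (hw : Smooth w) (x : Euc n) {ν : Euc n}
    (hν : ‖ν‖ ≤ 1) :
    |∑ j, ∑ i, pd (pd w i) j x * (ν i * ν j)| ≤ ‖iteratedFDeriv ℝ 2 w x‖ := by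
  have h : ∑ j, ∑ i, pd (pd w i) j x * (ν i * ν j) = iteratedFDeriv ℝ 2 w x ![ν, ν] := by
    have hν' : ν = ∑ i, ν i • ev i := by
      ext k
      simp [ev, Finset.sum_apply, Pi.single_apply]
    rw [iteratedFDeriv_two_apply]
    simp only [Matrix.cons_val_zero, Matrix.cons_val_one]
    conv_rhs => rw [hν']
    simp only [map_sum, map_smul, _root_.sum_apply, _root_.smul_apply]
    simp only [fderiv_apply_contDiff hw, iteratedFDeriv_two_apply, Matrix.cons_val_zero,
      Matrix.cons_val_one, smul_eq_mul, mul_sum]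
    rw [sum_comm]
    refine sum_congr rfl fun j _ => sum_congr rfl fun i _ => ?_
    ring
  rw [h, ← norm_eq_abs]
  refine ((iteratedFDeriv ℝ 2 w x).le_opNorm _).trans ?_
  refine mul_le_of_le_one_right (norm_nonneg _) ?_
  simp only [Fin.prod_univ_two, Matrix.cons_val_zero, Matrix.cons_val_one]
  nlinarith [norm_nonneg ν]

lemma eLpNorm_two_eq (hf : MemLp f 2) :
    eLpNorm f 2 = ofReal √(∫ x, f x ^ 2) := by
  rw [hf.eLpNorm_eq_integral_rpow_norm (by simp) (by simp), sqrt_eq_rpow]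
  simp

lemma HasHess.form_memLp (H : HasHess w A)
    {ν : Euc n → Euc n} (hνm : Measurable ν) (hν : ∀ x, ‖ν x‖ ≤ 1) :
    MemLp (fun x => ∑ j, ∑ i, A i j x * (ν x i * ν x j)) 2 := by
  refine memLp_finsetSum _ fun j _ => memLp_finsetSum _ fun i _ => ?_
  have hm : ∀ i, Measurable fun x => ν x i := fun i =>
    (EuclideanSpace.proj (𝕜 := ℝ) i : Euc n →L[ℝ] ℝ).continuous.measurable.comp hνm
  refine (H.memLp i j).of_le_mul (c := 1)
    ((H.memLp i j).1.mul ((hm i).mul (hm j)).aestronglyMeasurable) (ae_of_all _ fun x => ?_)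
  rw [norm_mul, norm_mul, one_mul]
  refine mul_le_of_le_one_right (norm_nonneg _) (mul_le_one₀ ?_ (norm_nonneg _) ?_)
  · exact (abs_apply_le_norm _ _).trans (hν x)
  · exact (abs_apply_le_norm _ _).trans (hν x)

lemma HasHess.eLpNorm_form_le (H : HasHess w A)
    {ν : Euc n → Euc n} (hνm : Measurable ν) (hν : ∀ x, ‖ν x‖ ≤ 1) :
    eLpNorm (fun x => ∑ j, ∑ i, A i j x * (ν x i * ν x j)) 2 ≤ eLpNorm (fun x => ∑ i, A i i x) 2 := by
  rw [eLpNorm_two_eq (H.form_memLp hνm hν), eLpNorm_two_eq H.trace_memLp]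
  refine ofReal_le_ofReal (sqrt_le_sqrt ?_)
  refine le_trans ?_ H.sum_integral_sq_le
  have hI : ∀ i j, Integrable fun x => A i j x ^ 2 := fun i j => (H.memLp i j).integrable_sq
  simp_rw [← integral_finsetSum _ fun i _ => hI i _]
  rw [← integral_finsetSum _ fun j _ => integrable_finsetSum _ fun i _ => hI i j]
  exact integral_mono (H.form_memLp hνm hν).integrable_sq
    (integrable_finsetSum _ fun j _ => integrable_finsetSum _ fun i _ => hI i j)
    fun x => sq_form_le (fun i j => A i j x) (hν x)

lemma eLpNorm_pd_dq_le (hg : ContDiff ℝ 1 g) (hs : HasCompactSupport g)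
    (hq : 1 ≤ q) (hh : h ≠ 0) (k : Fin n) :
    eLpNorm (dq h k g) (ofReal q) ≤ eLpNorm (pd g k) (ofReal q) := by
  have hq0 : ofReal q ≠ 0 := by simpa using by linarith
  have h1 := integral_dq_le (fun x => (hg.differentiable (by simp) x).hasFDerivAt)
    (hg.continuous_fderiv (by simp)) hs hq hh k
  rw [(memLp_of_test (dq_continuous hg.continuous h k) (dq_cpt hs h k)
    _).eLpNorm_eq_integral_rpow_norm hq0 (by simp), (memLp_of_test (pd_continuous hg k)
    (pd_cpt hs k) _).eLpNorm_eq_integral_rpow_norm hq0 (by simp),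
    toReal_ofReal (by linarith)]
  refine ofReal_le_ofReal (rpow_le_rpow ?_ h1 (by positivity))
  exact integral_nonneg fun x => by positivity

lemma lap_continuous (hw : Smooth w) : Continuous (lap w) :=
  continuous_finsetSum _ fun i _ => (pd_contDiff (pd_contDiff hw i) i).continuous

section Iteration
variable {ν : Euc n → Euc n} {G : Euc n → ℝ} {W : Fin n → Fin n → Euc n → ℝ}

lemma exists_iterate (hn : 0 < n) (hq : 2 ≤ q) (hC0 : 0 ≤ C)
    (hC : HessBound n C q)
    (hνm : Measurable ν) (hν : ∀ x, ‖ν x‖ ≤ 1)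
    (H : HasHess w W) (hG : MemLp G (ofReal q)) (hGa : ∀ x, a < ‖x‖ → G x = 0)
    (hEq : ∀ᵐ x, ∑ i, W i i x + s * ∑ j, ∑ i, W i j x * (ν x i * ν x j) = G x)
    (hL : (eLpNorm G (ofReal q)).toReal + 1 + |s| * C * L ≤ L) (hL0 : 0 ≤ L)
    (hr : 0 ≤ r) (hδ : 0 < δ) (hδ1 : δ ≤ 1) (hv : Smooth v)
    (hvs : HasCompactSupport v)
    (hvL : eLpNorm (lap v) (ofReal q) ≤ ofReal L)
    (hvr : eLpNorm (fun x => ∑ i, W i i x - lap v x) 2 ≤ ofReal r) :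
    ∃ v' : Euc n → ℝ, Smooth v' ∧ HasCompactSupport v' ∧
      eLpNorm (lap v') (ofReal q) ≤ ofReal L ∧
      eLpNorm (fun x => ∑ i, W i i x - lap v' x) 2 ≤ ofReal (|s| * r + δ) := by
  set Q := ofReal q with hQ
  have hQ2 : (2:ℝ≥0∞) ≤ Q := by
    rw [hQ, ← ofReal_ofNat]; exact ofReal_le_ofReal hq
  have hQ1 : (1:ℝ≥0∞) ≤ Q := le_trans (by norm_num) hQ2
  set b : Euc n → ℝ := fun x => ∑ j, ∑ i, pd (pd v i) j x * (ν x i * ν x j) with hb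
  have hm : ∀ i, Measurable fun x => ν x i := fun i =>
    (EuclideanSpace.proj (𝕜 := ℝ) i : Euc n →L[ℝ] ℝ).continuous.measurable.comp hνm
  have hpp : ∀ i j, Continuous (pd (pd v i) j) := fun i j =>
    (pd_contDiff (pd_contDiff hv i) j).continuous
  have hbm : AEStronglyMeasurable b volume := by
    refine Measurable.aestronglyMeasurable ?_
    exact measurable_fun_sum _ fun j _ => measurable_fun_sum _ fun i _ =>
      (hpp i j).measurable.mul ((hm i).mul (hm j))
  have hD : Continuous (fun x => ‖iteratedFDeriv ℝ 2 v x‖) :=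
    (hv.continuous_iteratedFDeriv (m := 2) (WithTop.coe_le_coe.2 (le_top (a := (2:ℕ∞))))).norm
  have hDs : HasCompactSupport (fun x => ‖iteratedFDeriv ℝ 2 v x‖) := (hvs.iteratedFDeriv 2).norm
  have hbL : MemLp b Q := (memLp_of_test hD hDs Q).of_le hbm (ae_of_all _ fun x => by
    rw [norm_norm]; exact abs_form_le hv x (hν x))
  have hbq : eLpNorm b Q ≤ ofReal (C * L) := by
    rw [ofReal_mul hC0]
    refine (eLpNorm_mono (fun x => ?_)).trans ((hC v hv hvs).trans (by gcongr))
    rw [norm_norm]; exact abs_form_le hv x (hν x)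
  obtain ⟨a', ha'⟩ := hvs.isCompact.isBounded.exists_norm_le
  have hHL : MemLp (fun x => G x - s * b x) Q := hG.sub (hbL.const_mul s)
  have hv0 : ∀ x, a' < ‖x‖ → ∀ i j, pd (pd v i) j x = 0 := fun x hx i j => by
    refine eq_zero_of_tsupport ((tsupport_pd_subset _ _).trans (tsupport_pd_subset v i)) fun h => ?_
    exact absurd (ha' x h) (by linarith)
  obtain ⟨v', hv', hvs', h2, h3⟩ := exists_laplacian_approx hn hQ2 (by simp [hQ]) hHL
    (a := max 0 (max a a')) (le_max_left _ _) (fun x hx => by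
      have h1 : a < ‖x‖ := lt_of_le_of_lt ((le_max_left _ _).trans (le_max_right _ _)) hx
      have h2 : a' < ‖x‖ := lt_of_le_of_lt ((le_max_right _ _).trans (le_max_right _ _)) hx
      simp [hGa x h1, hb, hv0 x h2]) hδ
  have hlm : ∀ {v : Euc n → ℝ}, Smooth v → AEStronglyMeasurable (lap v) volume :=
    fun h => (lap_continuous h).aestronglyMeasurable
  refine ⟨v', hv', hvs', ?_, ?_⟩
  · have e1 : lap v' = (fun x => lap v' x - (G x - s * b x)) + (G - s • b) := by
      funext x; simp
    rw [e1]
    have hGr : eLpNorm G Q = ofReal (eLpNorm G Q).toReal :=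
      (ofReal_toReal hG.2.ne).symm
    have hsb : eLpNorm (s • b) Q ≤ ofReal (|s| * C * L) := by
      rw [eLpNorm_const_smul, mul_assoc, ofReal_mul (abs_nonneg s)]
      rw [enorm_eq_ofReal_abs]
      gcongr
    refine (eLpNorm_add_le ((hlm hv').sub hHL.1) hHL.1 hQ1).trans ?_
    refine (add_le_add h3 ((eLpNorm_sub_le hG.1 (hbm.const_smul s) hQ1).trans
      (add_le_add hGr.le hsb))).trans ?_
    have hsC : 0 ≤ |s| * C * L := by positivity
    rw [← ofReal_add toReal_nonneg hsC, ← ofReal_add hδ.le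
      (add_nonneg toReal_nonneg hsC)]
    exact ofReal_le_ofReal (by linarith)
  · have H' := H.sub (HasHess.of_test hv hvs)
    have e2 : (fun x => ∑ i, W i i x - lap v' x) =ᵐ[volume]
        (fun x => (-s) • ∑ j, ∑ i, (W i j x - pd (pd v i) j x) * (ν x i * ν x j))
          - (fun x => lap v' x - (G x - s * b x)) := by
      filter_upwards [hEq] with x hx
      simp only [Pi.sub_apply, sub_mul, sum_sub_distrib, ← hx, hb, smul_eq_mul]
      ring
    rw [eLpNorm_congr_ae e2]
    have hf := H'.form_memLp hνm hν
    refine (eLpNorm_sub_le (hf.1.const_smul (-s)) ((hlm hv').sub hHL.1) (by norm_num)).trans ?_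
    rw [ofReal_add (by positivity) hδ.le]
    refine add_le_add ?_ h2
    have := eLpNorm_const_smul (-s) (fun x => ∑ j, ∑ i, (W i j x - pd (pd v i) j x)
      * (ν x i * ν x j)) 2 volume
    refine this.le.trans ?_
    rw [ofReal_mul (abs_nonneg s), enorm_neg, enorm_eq_ofReal_abs]
    refine mul_le_mul_right ?_ _
    refine (H'.eLpNorm_form_le hνm hν).trans ?_
    refine le_of_eq_of_le ?_ hvr
    congr 1; funext x
    rw [sum_sub_distrib, lap]

lemma exists_seq_iterate (hn : 0 < n) (hq : 2 ≤ q) (hC0 : 0 ≤ C)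
    (hC : HessBound n C q)
    (hs : |s| < 1) (hsC : |s| * C < 1) (hνm : Measurable ν) (hν : ∀ x, ‖ν x‖ ≤ 1)
    (H : HasHess w W) (hG : MemLp G (ofReal q)) (hGa : ∀ x, a < ‖x‖ → G x = 0)
    (hEq : ∀ᵐ x, ∑ i, W i i x + s * ∑ j, ∑ i, W i j x * (ν x i * ν x j) = G x) :
    ∃ (L : ℝ) (v : ℕ → Euc n → ℝ), 0 ≤ L ∧ (∀ m, Smooth (v m)) ∧
      (∀ m, HasCompactSupport (v m)) ∧
      (∀ m, eLpNorm (lap (v m)) (ofReal q) ≤ ofReal L) ∧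
      Tendsto (fun m => eLpNorm (fun x => ∑ i, W i i x - lap (v m) x) 2) atTop
        (𝓝 0) := by
  set g := (eLpNorm G (ofReal q)).toReal with hg
  have hg0 : 0 ≤ g := toReal_nonneg
  obtain ⟨L, hL0, hL⟩ : ∃ L, 0 ≤ L ∧ g + 1 + |s| * C * L ≤ L := by
    refine ⟨(g + 1) / (1 - |s| * C), div_nonneg (by linarith) (by linarith), ?_⟩
    have : (g + 1) = (g + 1) / (1 - |s| * C) * (1 - |s| * C) :=
      (div_mul_cancel₀ _ (by linarith)).symm
    linarith
  set μ := (1 + |s|) / 2 with hμ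
  have hμ0 : 0 < μ := by have := abs_nonneg s; linarith
  have hμ1 : μ < 1 := by linarith
  set r0 := (eLpNorm (fun x => ∑ i, W i i x) 2).toReal + 1 with hr0
  have hr00 : 0 < r0 := by have : 0 ≤ (eLpNorm (fun x => ∑ i, W i i x) 2).toReal := toReal_nonneg
                           linarith
  let P : ℕ → (Euc n → ℝ) → Prop := fun m v => Smooth v ∧ HasCompactSupport v ∧
    eLpNorm (lap v) (ofReal q) ≤ ofReal L ∧
      eLpNorm (fun x => ∑ i, W i i x - lap v x) 2 ≤ ofReal (r0 * μ ^ m)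
  have hlap0 : lap (fun _ : Euc n => (0:ℝ)) = 0 := by
    have : ∀ i, pd (fun _ : Euc n => (0:ℝ)) i = fun _ => 0 := fun i => by
      funext x; simp [pd]
    funext x; simp [lap, this]
  have h0 : P 0 (fun _ => 0) := by
    refine ⟨contDiff_const, HasCompactSupport.zero, ?_, ?_⟩
    · rw [hlap0]; simp
    · rw [hlap0]
      simp only [Pi.zero_apply, sub_zero, pow_zero, mul_one]
      rw [← ofReal_toReal H.trace_memLp.2.ne]
      exact ofReal_le_ofReal (by linarith)
  have hstep : ∀ m v, P m v → ∃ v', P (m + 1) v' := by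
    rintro m v ⟨hv, hvs, h1, h2⟩
    have hrm : 0 < r0 * μ ^ m := by positivity
    have hsμ : 0 < μ - |s| := by linarith
    obtain ⟨v', hv', hvs', h1', h2'⟩ := exists_iterate hn hq hC0 hC hνm hν H hG hGa hEq
      (δ := min 1 ((μ - |s|) * (r0 * μ ^ m))) hL hL0 hrm.le (by positivity) (min_le_left _ _)
      hv hvs h1 h2
    refine ⟨v', hv', hvs', h1', h2'.trans (ofReal_le_ofReal ?_)⟩
    have := min_le_right 1 ((μ - |s|) * (r0 * μ ^ m))
    rw [pow_succ]
    linarith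
  choose! nxt hnxt using hstep
  let v : ℕ → Euc n → ℝ := fun m => Nat.rec (fun _ => 0) (fun m v => nxt m v) m
  have hP : ∀ m, P m (v m) := by
    intro m
    induction m with
    | zero => exact h0
    | succ m ih => exact hnxt m _ ih
  refine ⟨L, v, hL0, fun m => (hP m).1, fun m => (hP m).2.1, fun m => (hP m).2.2.1, ?_⟩
  refine tendsto_of_tendsto_of_tendsto_of_le_of_le tendsto_const_nhds ?_ (fun _ => zero_le)
    (fun m => (hP m).2.2.2)
  rw [← ENNReal.ofReal_zero]
  refine ENNReal.tendsto_ofReal ?_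
  simpa using (tendsto_pow_atTop_nhds_zero_of_lt_one hμ0.le hμ1).const_mul r0

lemma HasHess.exists_eLpNorm_dq_le (hn : 0 < n) (hq : 2 ≤ q) (hC0 : 0 ≤ C)
    (hC : HessBound n C q)
    (hs : |s| < 1) (hsC : |s| * C < 1) (hνm : Measurable ν) (hν : ∀ x, ‖ν x‖ ≤ 1)
    (H : HasHess w W) (hG : MemLp G (ofReal q)) (hGa : ∀ x, a < ‖x‖ → G x = 0)
    (hEq : ∀ᵐ x, ∑ i, W i i x + s * ∑ j, ∑ i, W i j x * (ν x i * ν x j) = G x) :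
    ∃ B : ℝ, 0 ≤ B ∧ ∀ h, h ≠ 0 → ∀ k i,
      eLpNorm (dq h k (pd w i)) (ofReal q) ≤ ofReal B := by
  obtain ⟨L, v, hL0, hv, hvs, hvL, hvt⟩ :=
    exists_seq_iterate hn hq hC0 hC hs hsC hνm hν H hG hGa hEq
  refine ⟨C * L, by positivity, fun h hh k i => ?_⟩
  have hb : ∀ m, eLpNorm (dq h k (pd (v m) i)) (ofReal q) ≤ ofReal (C * L) := by
    intro m
    rw [ofReal_mul hC0]
    refine (eLpNorm_pd_dq_le ((pd_contDiff (hv m) i).of_le (by simp))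
      (pd_cpt (hvs m) i) (by linarith) hh k).trans ?_
    refine (eLpNorm_mono fun x => ?_).trans ((hC _ (hv m) (hvs m)).trans ?_)
    · rw [norm_norm]; exact abs_pd_pd_le (hv m) x i k
    · gcongr; exact hvL m
  have hmeas : ∀ m, AEStronglyMeasurable (dq h k (pd (v m) i)) volume := fun m =>
    (dq_continuous (pd_contDiff (hv m) i).continuous h k).aestronglyMeasurable
  have hmeas' : AEStronglyMeasurable (dq h k (pd w i)) volume :=
    (dq_continuous (pd_continuous H.contDiff i) h k).aestronglyMeasurable
  have hlim : Tendsto (fun m => eLpNorm (dq h k (pd (v m) i) - dq h k (pd w i)) 2)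
      atTop (𝓝 0) := by
    refine tendsto_of_tendsto_of_tendsto_of_le_of_le tendsto_const_nhds hvt (fun _ => zero_le)
      fun m => ?_
    have H' := H.sub (HasHess.of_test (hv m) (hvs m))
    have hd := H'.sum_integral_dq_le hh
    set w' : Euc n → ℝ := fun x => w x - v m x with hw'
    have hpc : Continuous (pd w' i) := pd_continuous H'.contDiff i
    have hmem : MemLp (dq h k (pd w' i)) 2 :=
      memLp_of_test (dq_continuous hpc h k)
        (dq_cpt (pd_cpt H'.cpt i) h k) 2
    have e1 : dq h k (pd (v m) i) - dq h k (pd w i) = - dq h k (pd w' i) := by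
      have : pd w' i = fun x => pd w i x - pd (v m) i x := by
        funext x
        unfold pd
        rw [hw', fderiv_fun_sub (H.contDiff.differentiable (by simp) x)
          ((hv m).differentiable (by simp) x)]
        rfl
      funext x
      rw [this, Pi.sub_apply, Pi.neg_apply, dq_sub]
      ring
    have e2 : (fun x => ∑ i, W i i x - lap (v m) x)
        = fun x => ∑ i, (W i i x - pd (pd (v m) i) i x) := by
      funext x; rw [sum_sub_distrib, lap]
    rw [e1, eLpNorm_neg, e2, eLpNorm_two_eq hmem, eLpNorm_two_eq H'.trace_memLp]
    refine ofReal_le_ofReal (sqrt_le_sqrt (le_trans ?_ hd))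
    have hnn : ∀ j i, 0 ≤ ∫ x, dq h j (pd w' i) x ^ 2 := fun j i =>
      integral_nonneg fun x => sq_nonneg _
    exact (single_le_sum (f := fun i => ∫ x, dq h k (pd w' i) x ^ 2)
      (fun i _ => hnn k i) (Finset.mem_univ i)).trans
      (single_le_sum (f := fun j => ∑ i, ∫ x, dq h j (pd w' i) x ^ 2)
        (fun j _ => sum_nonneg fun i _ => hnn j i) (Finset.mem_univ k))
  obtain ⟨ns, -, hae⟩ := (tendstoInMeasure_of_tendsto_eLpNorm (by norm_num) hmeas hmeas'
    hlim).exists_seq_tendsto_ae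
  refine (Lp.eLpNorm_lim_le_liminf_eLpNorm (fun m => hmeas (ns m)) _ hae).trans ?_
  refine Filter.liminf_le_of_frequently_le' (Frequently.of_forall fun m => hb (ns m))

end Iteration

lemma exists_lower_bound_norm (hX : Continuous X) {L : Set (Euc n)}
    (hL : IsCompact L) (h0 : ∀ x ∈ L, X x ≠ 0) : ∃ ε, 0 < ε ∧ ∀ x ∈ L, ε ≤ ‖X x‖ := by
  rcases L.eq_empty_or_nonempty with rfl | hne
  · exact ⟨1, one_pos, by simp⟩
  · obtain ⟨x, hx, hm⟩ := hL.exists_isMinOn hne hX.norm.continuousOn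
    exact ⟨‖X x‖, norm_pos_iff.2 (h0 x hx), fun y hy => hm hy⟩

namespace PData

include P

lemma exists_hessian (hK : IsCompact K) (hKO : K ⊆ O) :
    ∃ H : Fin n → Fin n → Euc n → ℝ, (∀ i j, MemLp (H i j) 2) ∧
      ∀ i j φ, IsTestFun K φ → ∫ x, X x i * pd φ j x = - ∫ x, H i j x * φ x := by
  obtain ⟨C, hC⟩ := P.first_deriv_bound le_rfl hK hKO
  have hi : ∀ i, Continuous fun z : Euc n => z i := fun i => by fun_prop
  have hrep : ∀ i j, ∃ G : Euc n → ℝ, MemLp G 2 ∧ ∀ φ, IsTestFun K φ →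
      ∫ x, X x i * pd φ j x = - ∫ x, G x * φ x := fun i j => by
    have hint : ∀ φ, IsTestFun K φ → Integrable fun x => X x i * pd φ j x := fun φ hφ =>
      (((hi i).comp P.cont).mul (pd_contDiff hφ.1 j).continuous).integrable_cpt
        (pd_cpt hφ.2.1 j).mul_left
    have hd : ∀ φ, IsTestFun K φ → ∀ x, DifferentiableAt ℝ φ x := fun φ hφ x =>
      hφ.1.differentiable (by simp) x
    obtain ⟨G, hG, hGe⟩ := exists_representation (K := K) (w := K.indicator 1) (C := C)
      ((integrable_indicator_iff hK.measurableSet).2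
        (integrableOn_const (μ := volume) (C := (1:ℝ)) hK.measure_lt_top.ne))
      (fun x => indicator_nonneg (fun _ _ => zero_le_one) x)
      (fun φ => - ∫ x, X x i * pd φ j x) (fun φ ψ hφ hψ => by
        rw [← neg_add, ← integral_add (hint φ hφ) (hint ψ hψ)]
        congr 2; funext x
        have : pd (fun x => φ x + ψ x) j x = pd φ j x + pd ψ j x := by
          unfold pd; rw [fderiv_fun_add (hd φ hφ x) (hd ψ hψ x)]; rfl
        rw [this]; ring) (fun c φ hφ => by
        rw [mul_neg, ← integral_const_mul]
        congr 2; funext x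
        have : pd (fun x => c * φ x) j x = c * pd φ j x := by
          unfold pd; rw [fderiv_const_mul (hd φ hφ x)]; rfl
        rw [this]; ring) (fun φ hφ => by
        rw [abs_neg]
        have := hC φ hφ i j
        simp only [pv, rpow_zero, one_smul] at this
        refine this.trans_eq ?_
        congr 3; funext x
        by_cases hx : x ∈ K
        · simp [hx]
        · simp [eq_zero_of_tsupport hφ.2.2 hx])
    refine ⟨G, hG, fun φ hφ => ?_⟩
    have := hGe φ hφ
    rw [neg_eq_iff_eq_neg] at this
    rw [this]
    congr 2; funext x
    by_cases hx : x ∈ K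
    · simp [hx]
    · simp [eq_zero_of_tsupport hφ.2.2 hx]
  choose H h1 h2 using hrep
  exact ⟨H, h1, h2⟩

lemma tendsto_integral_dq_mul (hK : IsCompact K)
    (hKO : K ⊆ O) {m : Fin n} {H : Euc n → ℝ} (hH : MemLp H 2)
    (hHe : ∀ φ, IsTestFun K φ → ∫ x, X x m * pd φ l x = - ∫ x, H x * φ x)
    {c : Euc n → ℝ} (hc : Continuous c) (hcs : HasCompactSupport c)
    (hcK : tsupport c ⊆ K) (hc0 : ∀ x ∈ tsupport c, X x ≠ 0) :
    Tendsto (fun h => ∫ x, dq h l X x m * c x) (𝓝[≠] 0) (𝓝 (∫ x, H x * c x)) := by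
  have hi : Continuous fun z : Euc n => z m := by fun_prop
  have hXm : Continuous fun x => X x m := hi.comp P.cont
  set L := tsupport c with hL
  have hLc : IsCompact L := hcs
  obtain ⟨ε, hε, hεL⟩ := exists_lower_bound_norm P.cont hLc hc0
  obtain ⟨C, hC⟩ := P.local_bound hK hKO hε
  have hLH : IntegrableOn H L := (hH.locallyIntegrable (by norm_num)).integrableOn_isCompact hLc
  set D := (volume.real L + |C|) + ∫ x in L, |H x| with hD
  have hD0 : 0 ≤ D := add_nonneg (add_nonneg measureReal_nonneg (abs_nonneg _))
    (setIntegral_nonneg hLc.measurableSet fun x _ => abs_nonneg _)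
  rw [Metric.tendsto_nhds]
  intro δ hδ
  set r := δ / (2 * (D + 1)) with hr
  have hr0 : 0 < r := by positivity
  obtain ⟨g, hg, hgd, hgs⟩ := hc.exists_contDiff_approx ⊤ (ε := fun _ => r)
    continuous_const (fun _ => hr0)
  have hgL : tsupport g ⊆ L := closure_mono hgs
  have hgcs : HasCompactSupport g := hLc.of_isClosed_subset isClosed_closure hgL
  have hgt : IsTestFun K g := ⟨hg, hgcs, hgL.trans hcK⟩
  have ht := tendsto_integral_mul_dq_neg hXm hg hgcs l
  rw [hHe g hgt] at ht
  have ht' := (tendsto_nhds.1 ht (δ / 2) (half_pos hδ))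
  filter_upwards [ht', hC, self_mem_nhdsWithin] with h h1 h2 h0
  have hdqc : Continuous (dq h l X) := P.dqX_continuous h l
  have hdqm : Continuous fun x => dq h l X x m := hi.comp hdqc
  have e1 : ∫ x, X x m * dq (-h) l g x = - ∫ x, dq h l X x m * g x := by
    rw [← neg_eq_iff_eq_neg, ← integral_dq_mul hXm hg.continuous hgcs h l]
    rfl
  rw [e1, dist_neg_neg] at h1
  have z1 : ∀ x ∉ L, c x - g x = 0 := fun x hx => by
    rw [eq_zero_of_tsupport hL.ge hx, eq_zero_of_tsupport hgL hx, sub_zero]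
  have b1 : ∀ x, |c x - g x| ≤ r := fun x => by
    rw [abs_sub_comm, ← dist_eq]; exact (hgd x).le
  have bnd : ∀ A : Euc n → ℝ, IntegrableOn A L → ∀ R, ∫ x in L, |A x| ≤ R →
      |∫ x, A x * (c x - g x)| ≤ r * R := fun A hA R hR => by
    rw [← setIntegral_eq_of_off (s := L)
      fun x hx => by rw [z1 x hx, mul_zero]]
    calc |∫ x in L, A x * (c x - g x)| ≤ ∫ x in L, |A x * (c x - g x)| :=
          abs_integral_le_integral_abs
      _ ≤ ∫ x in L, r * |A x| := by
          refine integral_mono_of_nonneg (.of_forall fun x => abs_nonneg _)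
            (hA.abs.const_mul r) (.of_forall fun x => ?_)
          simp only
          rw [abs_mul, mul_comm]
          exact mul_le_right (b1 x) (abs_nonneg _)
      _ = r * ∫ x in L, |A x| := integral_const_mul _ _
      _ ≤ r * R := mul_le_left hR hr0.le
  have hLB : L ⊆ bset X K ε := fun x hx => ⟨hcK hx, hεL x hx⟩
  have hBc := bset_compact P.cont hK ε
  have dI : IntegrableOn (fun x => dq h l X x m) L := hdqm.continuousOn.integrableOn_compact hLc
  have dB : ∫ x in L, |dq h l X x m| ≤ volume.real L + |C| := by
    calc ∫ x in L, |dq h l X x m| ≤ ∫ x in L, (1 + ‖dq h l X x‖ ^ 2) := by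
          refine setIntegral_mono_on dI.abs
            ((continuous_const.add (hdqc.norm.pow 2)).continuousOn.integrableOn_compact hLc)
            hLc.measurableSet fun x _ => ?_
          have := abs_apply_le_norm (dq h l X x) m
          nlinarith [sq_nonneg (‖dq h l X x‖ - 1), norm_nonneg (dq h l X x)]
      _ = volume.real L + ∫ x in L, ‖dq h l X x‖ ^ 2 := by
          have i1 : Integrable (fun _ : Euc n => (1:ℝ)) (volume.restrict L) :=
            integrableOn_const hLc.measure_lt_top.ne
          have i2 : Integrable (fun x => ‖dq h l X x‖ ^ 2) (volume.restrict L) :=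
            (hdqc.norm.pow 2).continuousOn.integrableOn_compact hLc
          rw [integral_add i1 i2]
          simp
      _ ≤ volume.real L + |C| := by
          have : ∫ x in L, ‖dq h l X x‖ ^ 2 ≤ ∫ x in bset X K ε, ‖dq h l X x‖ ^ 2 :=
            setIntegral_mono_set ((hdqc.norm.pow 2).continuousOn.integrableOn_compact hBc)
              (.of_forall fun x => by positivity)
              (.of_forall hLB)
          linarith [h2 l, le_abs_self C]
  have a1 := bnd _ dI _ dB
  have a2 := bnd _ hLH _ le_rfl
  have cI : ∀ A : Euc n → ℝ, LocallyIntegrable A → ∀ g : Euc n → ℝ, Continuous g →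
      HasCompactSupport g → Integrable fun x => A x * g x := fun A hA g hg hs => by
    have := hA.integrable_smul_left_of_hasCompactSupport hg hs
    simpa [mul_comm] using this
  have s1 : ∫ x, dq h l X x m * (c x - g x)
      = (∫ x, dq h l X x m * c x) - ∫ x, dq h l X x m * g x := by
    rw [← integral_sub (cI _ hdqm.locallyIntegrable _ hc hcs)
      (cI _ hdqm.locallyIntegrable _ hg.continuous hgcs)]
    congr 1; funext x; ring
  have s2 : ∫ x, H x * (c x - g x) = (∫ x, H x * c x) - ∫ x, H x * g x := by
    rw [← integral_sub (cI _ (hH.locallyIntegrable (by norm_num)) _ hc hcs)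
      (cI _ (hH.locallyIntegrable (by norm_num)) _ hg.continuous hgcs)]
    congr 1; funext x; ring
  rw [s1] at a1
  rw [s2] at a2
  rw [dist_eq] at h1 ⊢
  have hrD : r * (volume.real L + |C|) + r * ∫ x in L, |H x| < δ / 2 := by
    rw [← mul_add, ← hD, hr, div_mul_eq_mul_div, div_lt_div_iff₀ (by positivity) two_pos]
    nlinarith
  have t1 := abs_lt.1 h1
  have t2 := abs_le.1 a1
  have t3 := abs_le.1 a2
  rw [abs_lt]
  constructor <;> linarith [t1.1, t1.2, t2.1, t2.2, t3.1, t3.2]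

end PData

lemma continuous_mul_of_tsupport {U : Set (Euc n)} (hU : IsOpen U)
    (hg : ContinuousOn g U) (hφ : Continuous φ) (hs : tsupport φ ⊆ U) :
    Continuous fun x => g x * φ x :=
  (hg.mul hφ.continuousOn).continuous_of_tsupport_subset hU
    ((closure_mono fun x hx => right_ne_zero_of_mul hx).trans hs)

lemma fderiv_apply_eq_sum (φ : Euc n → ℝ) (x z : Euc n) :
    fderiv ℝ φ x z = ∑ l, z l * pd φ l x := by
  have : z = ∑ k, z k • ev k := by
    ext j
    simp [ev, Pi.single_apply]
  conv_lhs => rw [this]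
  rw [map_sum]
  exact sum_congr rfl fun l _ => by rw [map_smul]; rfl

namespace PData

include P

lemma eventually_integral_norm_dq_le {L : Set (Euc n)} (hL : IsCompact L)
    (hLO : L ⊆ O) (h0 : ∀ x ∈ L, X x ≠ 0) :
    ∃ C, ∀₀ h, ∀ l, ∫ x in L, ‖dq h l X x‖ ≤ C := by
  obtain ⟨ε, hε, hεL⟩ := exists_lower_bound_norm P.cont hL h0
  obtain ⟨C, hC⟩ := P.local_bound hL hLO hε
  have hLB : bset X L ε = L := inter_eq_left.2 hεL
  refine ⟨volume.real L + C, ?_⟩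
  filter_upwards [hC] with h h1 l
  have hd := (P.dqX_continuous h l).norm
  have i1 : Integrable (fun _ : Euc n => (1:ℝ)) (volume.restrict L) :=
    integrableOn_const hL.measure_lt_top.ne
  have i2 : Integrable (fun x => ‖dq h l X x‖ ^ 2) (volume.restrict L) :=
    (hd.pow 2).continuousOn.integrableOn_compact hL
  calc ∫ x in L, ‖dq h l X x‖ ≤ ∫ x in L, (1 + ‖dq h l X x‖ ^ 2) := by
        refine setIntegral_mono_on (hd.continuousOn.integrableOn_compact hL) (i1.add i2)
          hL.measurableSet fun x _ => ?_
        nlinarith [sq_nonneg (‖dq h l X x‖ - 1), norm_nonneg (dq h l X x)]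
    _ = volume.real L + ∫ x in L, ‖dq h l X x‖ ^ 2 := by
        rw [integral_add i1 i2]
        simp
    _ ≤ volume.real L + C := by
        have := h1 l
        rw [hLB] at this
        linarith

lemma tendsto_integral_remainder (hφ : Continuous φ)
    (hφs : HasCompactSupport φ) (hφO : tsupport φ ⊆ O) (h0 : ∀ x ∈ tsupport φ, X x ≠ 0)
    (l : Fin n) :
    Tendsto (fun h => ∫ x, (dq h l flux x
      - pvD (p - 2) (X x) (dq h l X x)) l * φ x) (𝓝[≠] 0) (𝓝 0) := by
  obtain ⟨C, hC, c, hc, δ, hδ, -, hS⟩ := exists_dqS (n := n) P.one_lt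
  set L := tsupport φ with hL
  have hLc : IsCompact L := hφs
  obtain ⟨ε, hε, hεL⟩ := exists_lower_bound_norm P.cont hLc h0
  obtain ⟨D, hD⟩ := P.eventually_integral_norm_dq_le hLc hφO h0
  obtain ⟨M, hM⟩ := hLc.exists_bound_of_continuousOn (f := fun x => ‖X x‖ ^ (p - 3) * φ x)
    ((P.cont.norm.continuousOn.rpow_const fun x hx => Or.inl (norm_pos_iff.2 (h0 x hx)).ne').mul
      hφ.continuousOn)
  rw [Metric.tendsto_nhds]
  intro r hr
  obtain ⟨η, hη, hη1, hη2⟩ : ∃ η : ℝ, 0 < η ∧ η ≤ δ * ε ∧ η * (C * |M| * |D|) < r := by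
    refine ⟨min (δ * ε) (r / (C * |M| * |D| + 1)), by positivity, min_le_left _ _, ?_⟩
    calc _ ≤ r / (C * |M| * |D| + 1) * (C * |M| * |D|) :=
          mul_le_right (min_le_right _ _) (by positivity)
      _ < r := by
          rw [div_mul_eq_mul_div, div_lt_iff₀ (by positivity)]
          nlinarith
  filter_upwards [P.eventually_good hη, hD] with h hg hDh
  rw [dist_zero_right, norm_eq_abs]
  rw [← setIntegral_eq_of_off (s := L)
      fun x hx => by rw [eq_zero_of_tsupport hL.ge hx, mul_zero]]
  have hd := (P.dqX_continuous h l).norm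
  calc _ ≤ ∫ x in L, |(dq h l flux x
      - pvD (p - 2) (X x) (dq h l X x)) l * φ x| := abs_integral_le_integral_abs
    _ ≤ ∫ x in L, η * (C * |M|) * ‖dq h l X x‖ := by
        refine integral_mono_of_nonneg (.of_forall fun x => abs_nonneg _)
          ((hd.continuousOn.integrableOn_compact hLc).const_mul _) ?_
        filter_upwards [ae_restrict_mem hLc.measurableSet] with x hx
        have h1 := (hS X u η h x l hg (h0 x hx)
          (hη1.trans (mul_le_left (hεL x hx) hδ.le))).1
        have h2 := (abs_apply_le_norm (dq h l flux x
          - pvD (p - 2) (X x) (dq h l X x)) l).trans h1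
        have h3 := (hM x hx).trans (le_abs_self M)
        rw [norm_mul, norm_eq_abs, norm_eq_abs,
          abs_of_nonneg (rpow_nonneg (norm_nonneg _) _)] at h3
        rw [abs_mul]
        calc _ ≤ C * ‖X x‖ ^ (p - 3) * η * ‖dq h l X x‖ * |φ x| :=
              mul_le_right h2 (abs_nonneg _)
          _ = (η * C * ‖dq h l X x‖) * (‖X x‖ ^ (p - 3) * |φ x|) := by ring
          _ ≤ (η * C * ‖dq h l X x‖) * |M| := mul_le_left h3 (by positivity)
          _ = _ := by ring
    _ = η * (C * |M|) * ∫ x in L, ‖dq h l X x‖ := integral_const_mul _ _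
    _ ≤ η * (C * |M|) * |D| :=
        mul_le_left ((hDh l).trans (le_abs_self D)) (by positivity)
    _ = η * (C * |M| * |D|) := by ring
    _ < r := hη2

lemma integral_nondivergence (hK : IsCompact K)
    (hKO : K ⊆ O) (hH : ∀ i j, MemLp (H i j) 2)
    (hHe : ∀ i j φ, IsTestFun K φ → ∫ x, X x i * pd φ j x = - ∫ x, H i j x * φ x)
    (hφ : IsTestFun K φ) (h0 : ∀ x ∈ tsupport φ, X x ≠ 0) :
    ∫ x, (‖X x‖ ^ (p - 2) * ∑ l, H l l x + (p - 2) * ‖X x‖ ^ (p - 2 - 2)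
      * ∑ l, ∑ m, H m l x * (X x m * X x l)) * φ x = - ∫ x, f x * φ x := by
  have hi : ∀ i, Continuous fun z : Euc n => z i := fun i => by fun_prop
  have hXi : ∀ i, Continuous fun x => X x i := fun i => (hi i).comp P.cont
  have hφc := hφ.1.continuous
  have hU : IsOpen {x | X x ≠ 0} := isOpen_ne_fun P.cont continuous_const
  have hr : ∀ e : ℝ, ContinuousOn (fun x => ‖X x‖ ^ e) {x | X x ≠ 0} := fun e =>
    P.cont.norm.continuousOn.rpow_const fun x hx => Or.inl (norm_pos_iff.2 hx).ne'
  have key : ∀ g : Euc n → ℝ, ContinuousOn g {x | X x ≠ 0} → ∀ m l,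
      Tendsto (fun h => ∫ x, dq h l X x m * (g x * φ x)) (𝓝[≠] 0)
        (𝓝 (∫ x, H m l x * (g x * φ x))) ∧ (∀ h, Integrable fun x => dq h l X x m * (g x * φ x)) ∧
        Integrable fun x => H m l x * (g x * φ x) := fun g hg m l => by
    have hc := continuous_mul_of_tsupport hU hg hφc h0
    have hcs : HasCompactSupport fun x => g x * φ x := hφ.2.1.mul_left
    have hsub : tsupport (fun x => g x * φ x) ⊆ tsupport φ :=
      closure_mono fun x hx => right_ne_zero_of_mul hx
    refine ⟨P.tendsto_integral_dq_mul hK hKO (hH m l) (hHe m l) hc hcs (hsub.trans hφ.2.2)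
      fun x hx => h0 x (hsub hx), fun h => ?_, ?_⟩
    · exact (((hi m).comp (P.dqX_continuous h l)).mul hc).integrable_cpt
        hcs.mul_left
    · have := ((hH m l).locallyIntegrable (by norm_num)).integrable_smul_left_of_hasCompactSupport
        hc hcs
      simpa [mul_comm] using this
  have k1 := key _ (hr (p - 2))
  have k2 : ∀ m l, _ := fun m l => key (fun x => (p - 2) * ‖X x‖ ^ (p - 2 - 2) * (X x m * X x l))
    (((hr (p - 2 - 2)).const_smul (p - 2)).mul
      ((hXi m).mul (hXi l)).continuousOn) m l
  have hl : ∀ l, Tendsto (fun h => ∫ x, (pvD (p - 2) (X x) (dq h l X x)) l * φ x) (𝓝[≠] 0)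
      (𝓝 ((∫ x, H l l x * (‖X x‖ ^ (p - 2) * φ x))
        + ∑ m, ∫ x, H m l x * ((p - 2) * ‖X x‖ ^ (p - 2 - 2) * (X x m * X x l) * φ x))) := fun l => by
    refine ((k1 l l).1.add (tendsto_finsetSum _ fun m _ => (k2 m l).1)).congr fun h => ?_
    rw [← integral_finsetSum _ fun m _ => (k2 m l).2.1 h, ← integral_add ((k1 l l).2.1 h)
      (integrable_finsetSum _ fun m _ => (k2 m l).2.1 h)]
    refine integral_congr_ae (.of_forall fun x => ?_)
    simp only [pvD_apply, PiLp.add_apply, PiLp.smul_apply, smul_eq_mul]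
    have : ⟪X x, dq h l X x⟫_ℝ = ∑ m, X x m * dq h l X x m := by
      simp [PiLp.inner_apply, mul_comm]
    rw [this, sum_mul, mul_sum, add_mul, sum_mul]
    congr 1
    · ring
    · exact sum_congr rfl fun m _ => by ring
  have hSc : ∀ l, Continuous fun x => pv (p - 2) (X x) l := fun l => (hi l).comp P.S_continuous
  have hb : ∀ l, (∫ x, H l l x * (‖X x‖ ^ (p - 2) * φ x))
        + ∑ m, ∫ x, H m l x * ((p - 2) * ‖X x‖ ^ (p - 2 - 2) * (X x m * X x l) * φ x)
        = - ∫ x, pv (p - 2) (X x) l * pd φ l x := fun l => by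
    have t1 := (P.tendsto_integral_remainder hφc hφ.2.1 (hφ.2.2.trans hKO) h0 l).add (hl l)
    have t2 := (tendsto_integral_mul_dq_neg (hSc l) hφ.1 hφ.2.1 l).neg
    rw [zero_add] at t1
    refine tendsto_nhds_unique t1 (t2.congr fun h => ?_)
    rw [← integral_dq_mul (hSc l) hφc hφ.2.1 h l]
    have hS : Continuous fun x => dq h l flux x l :=
      (hi l).comp (dq_continuous P.S_continuous h l)
    have i1 : Integrable fun x => dq h l flux x l * φ x :=
      (hS.mul hφc).integrable_cpt hφ.2.1.mul_left
    have hA : Continuous fun x => (pvD (p - 2) (X x) (dq h l X x)) l * φ x := by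
      refine continuous_mul_of_tsupport hU ?_ hφc h0
      simp only [pvD_apply, PiLp.add_apply, PiLp.smul_apply, smul_eq_mul]
      have hdl : Continuous fun x => dq h l X x l := (hi l).comp (P.dqX_continuous h l)
      exact ((hr (p - 2)).mul hdl.continuousOn).add (((hr (p - 2 - 2)).const_smul (p - 2)).mul
        ((P.cont.inner (P.dqX_continuous h l)).mul (hXi l)).continuousOn)
    have i2 := hA.integrable_cpt hφ.2.1.mul_left
    have i3 : Integrable fun x => (dq h l flux x
      - pvD (p - 2) (X x) (dq h l X x)) l * φ x := by
      refine (i1.sub i2).congr (.of_forall fun x => ?_)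
      simp only [Pi.sub_apply, PiLp.sub_apply, sub_mul]
    rw [← integral_add i3 i2]
    refine integral_congr_ae (.of_forall fun x => ?_)
    simp only [PiLp.sub_apply]
    rw [← dq_coord]
    ring
  have heq := P.eq φ (hφ.1.of_le (by simp)) hφ.2.1 (hφ.2.2.trans hKO)
  have hint : ∀ l, Integrable fun x => pv (p - 2) (X x) l * pd φ l x := fun l =>
    ((hSc l).mul (pd_contDiff hφ.1 l).continuous).integrable_cpt
      (pd_cpt hφ.2.1 l).mul_left
  simp only [fderiv_apply_eq_sum] at heq
  rw [integral_finsetSum _ fun l _ => hint l] at heq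
  rw [← heq, ← sum_neg_distrib, ← sum_congr rfl fun l _ => hb l,
    sum_add_distrib, ← integral_finsetSum _ fun l _ => (k1 l l).2.2]
  rw [sum_congr rfl fun l _ => (integral_finsetSum _ fun m _ => (k2 m l).2.2).symm,
    ← integral_finsetSum _ fun l _ => integrable_finsetSum _ fun m _ => (k2 m l).2.2,
    ← integral_add (integrable_finsetSum _ fun l _ => (k1 l l).2.2)
      (integrable_finsetSum _ fun l _ => integrable_finsetSum _ fun m _ => (k2 m l).2.2)]
  refine integral_congr_ae (.of_forall fun x => ?_)
  simp only
  rw [add_mul, mul_sum, mul_sum, sum_mul, sum_mul]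
  congr 1
  · exact sum_congr rfl fun l _ => by ring
  · refine sum_congr rfl fun l _ => ?_
    rw [mul_sum, sum_mul]
    exact sum_congr rfl fun m _ => by ring

lemma ae_nondivergence (hK : IsCompact K)
    (hKO : K ⊆ O) (hH : ∀ i j, MemLp (H i j) 2)
    (hHe : ∀ i j φ, IsTestFun K φ → ∫ x, X x i * pd φ j x = - ∫ x, H i j x * φ x) :
    ∀ᵐ x, x ∈ interior K → X x ≠ 0 →
      ∑ l, H l l x + (p - 2) * ∑ l, ∑ m, H m l x * (X x m / ‖X x‖ * (X x l / ‖X x‖))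
        = - f x * ‖X x‖ ^ (2 - p) := by
  have hi : ∀ i, Continuous fun z : Euc n => z i := fun i => by fun_prop
  have hXi : ∀ i, Continuous fun x => X x i := fun i => (hi i).comp P.cont
  have hU : IsOpen {x | X x ≠ 0} := isOpen_ne_fun P.cont continuous_const
  have hr : ∀ e : ℝ, ContinuousOn (fun x => ‖X x‖ ^ e) {x | X x ≠ 0} := fun e =>
    P.cont.norm.continuousOn.rpow_const fun x hx => Or.inl (norm_pos_iff.2 hx).ne'
  have hV : IsOpen (interior K ∩ {x | X x ≠ 0}) := isOpen_interior.inter hU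
  have hHl : ∀ i j, LocallyIntegrableOn (H i j) (interior K ∩ {x | X x ≠ 0}) := fun i j =>
    ((hH i j).locallyIntegrable (by norm_num)).locallyIntegrableOn _
  have hmulc : ∀ g h : Euc n → ℝ, ContinuousOn g {x | X x ≠ 0} →
      LocallyIntegrableOn h (interior K ∩ {x | X x ≠ 0}) →
      LocallyIntegrableOn (fun x => g x * h x) (interior K ∩ {x | X x ≠ 0}) := fun g h hg hh =>
    hh.continuousOn_mul (hg.mono inter_subset_right) hV.isLocallyClosed
  have hsum : ∀ F : Fin n → Euc n → ℝ,
      (∀ l, LocallyIntegrableOn (F l) (interior K ∩ {x | X x ≠ 0})) →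
      LocallyIntegrableOn (fun x => ∑ l, F l x) (interior K ∩ {x | X x ≠ 0}) := fun F hF => by
    rw [locallyIntegrableOn_iff hV.isLocallyClosed]
    intro k hk hkc
    exact integrable_finsetSum _ fun l _ =>
      ((locallyIntegrableOn_iff hV.isLocallyClosed).1 (hF l)) k hk hkc
  have hloc : LocallyIntegrableOn (fun x => (‖X x‖ ^ (p - 2) * ∑ l, H l l x
      + (p - 2) * ‖X x‖ ^ (p - 2 - 2) * ∑ l, ∑ m, H m l x * (X x m * X x l)) + f x)
      (interior K ∩ {x | X x ≠ 0}) := by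
    refine LocallyIntegrableOn.add (LocallyIntegrableOn.add ?_ ?_) ?_
    · exact hmulc _ _ (hr _) (hsum _ fun l => hHl l l)
    · refine hmulc _ _ ((hr _).const_smul (p - 2)) (hsum _ fun l => hsum _ fun m => ?_)
      simp only [mul_comm (H m l _)]
      exact hmulc _ _ ((hXi m).mul (hXi l)).continuousOn (hHl m l)
    · exact P.f_contDiff.continuous.locallyIntegrable.locallyIntegrableOn _
  have := hV.ae_eq_zero_of_integral_contDiff_smul_eq_zero hloc fun g hg hgs hgV => by
    have hgt : IsTestFun K g := ⟨hg, hgs, (hgV.trans inter_subset_left).trans interior_subset⟩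
    have h1 := P.integral_nondivergence hK hKO hH hHe hgt fun x hx => (hgV hx).2
    have i1 : Integrable fun x => f x * g x :=
      (P.f_contDiff.continuous.mul hg.continuous).integrable_cpt hgs.mul_left
    have hall : Integrable fun x => g x * ((‖X x‖ ^ (p - 2) * ∑ l, H l l x
      + (p - 2) * ‖X x‖ ^ (p - 2 - 2) * ∑ l, ∑ m, H m l x * (X x m * X x l)) + f x) := by
      have := ((locallyIntegrableOn_iff hV.isLocallyClosed).1 hloc) (tsupport g) hgV hgs
      have h2 := this.continuousOn_mul hg.continuous.continuousOn hgs
      refine (integrableOn_iff_integrable_of_support_subset ?_).1 h2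
      intro x hx
      exact subset_tsupport _ (left_ne_zero_of_mul hx)
    have i2 : Integrable fun x => (‖X x‖ ^ (p - 2) * ∑ l, H l l x + (p - 2) * ‖X x‖ ^ (p - 2 - 2)
      * ∑ l, ∑ m, H m l x * (X x m * X x l)) * g x := by
      refine (hall.sub i1).congr (.of_forall fun x => ?_)
      simp only [Pi.sub_apply]; ring
    have h3 := integral_add i2 i1
    rw [h1, neg_add_cancel] at h3
    rw [← h3]
    congr 1; funext x; simp only [smul_eq_mul]; ring
  filter_upwards [this] with x hx hxK hx0
  have hz := hx ⟨hxK, hx0⟩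
  have ht : 0 < ‖X x‖ := norm_pos_iff.2 hx0
  have e1 : ‖X x‖ ^ (2 - p) * ‖X x‖ ^ (p - 2) = 1 := by
    rw [← rpow_add ht]; simp
  have e2 : ‖X x‖ ^ (p - 2 - 2) = ‖X x‖ ^ (p - 2) / ‖X x‖ ^ 2 := by
    rw [rpow_sub ht, rpow_two]
  have e3 : ∑ l, ∑ m, H m l x * (X x m / ‖X x‖ * (X x l / ‖X x‖))
      = (∑ l, ∑ m, H m l x * (X x m * X x l)) / ‖X x‖ ^ 2 := by
    rw [sum_div]
    refine sum_congr rfl fun l _ => ?_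
    rw [sum_div]
    refine sum_congr rfl fun m _ => ?_
    field_simp
  rw [e2] at hz
  rw [e3]
  linear_combination (‖X x‖ ^ (2 - p)) * hz - (∑ l, H l l x + (p - 2)
    * ((∑ l, ∑ m, H m l x * (X x m * X x l)) / ‖X x‖ ^ 2)) * e1

end PData

lemma pd_mul (hf : DifferentiableAt ℝ f x)
    (hg : DifferentiableAt ℝ g x) (i : Fin n) :
    pd (fun x => f x * g x) i x = f x * pd g i x + g x * pd f i x := by
  unfold pd
  rw [fderiv_fun_mul hf hg]
  simp

namespace PData

include P

lemma pd_u (i : Fin n) (x : Euc n) : pd u i x = X x i := by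
  unfold pd
  rw [(P.hasFDerivAt x).fderiv, innerSL_apply_apply]
  exact inner_ev _ _

lemma hasHess_mul (hH : ∀ i j, MemLp (H i j) 2)
    (hHe : ∀ i j φ, IsTestFun K φ → ∫ x, X x i * pd φ j x = - ∫ x, H i j x * φ x)
    (hζ : IsTestFun K ζ) :
    HasHess (fun x => ζ x * u x) (fun i j x => ζ x * H i j x +
      (X x i * pd ζ j x + X x j * pd ζ i x + u x * pd (pd ζ i) j x)) := by
  have hi : ∀ i, Continuous fun z : Euc n => z i := fun i => by fun_prop
  have hXi : ∀ i, Continuous fun x => X x i := fun i => (hi i).comp P.cont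
  have hζd : ∀ x, DifferentiableAt ℝ ζ x := hζ.1.differentiable (by simp)
  have hud : ∀ x, DifferentiableAt ℝ u x := fun x => (P.hasFDerivAt x).differentiableAt
  have hζc := hζ.1.continuous
  have huc := P.u_contDiff.continuous
  have hd1 : ∀ i, Smooth (pd ζ i) := fun i => pd_contDiff hζ.1 i
  have hd2 : ∀ i j, Smooth (pd (pd ζ i) j) := fun i j => pd_contDiff (hd1 i) j
  have hs1 : ∀ i, HasCompactSupport (pd ζ i) := fun i => pd_cpt hζ.2.1 i
  have hs2 : ∀ i j, HasCompactSupport (pd (pd ζ i) j) := fun i j => pd_cpt (hs1 i) j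
  have hRc : ∀ i j, Continuous fun x =>
      X x i * pd ζ j x + X x j * pd ζ i x + u x * pd (pd ζ i) j x := fun i j =>
    (((hXi i).mul (hd1 j).continuous).add ((hXi j).mul (hd1 i).continuous)).add
      (huc.mul (hd2 i j).continuous)
  have hRs : ∀ i j, HasCompactSupport fun x =>
      X x i * pd ζ j x + X x j * pd ζ i x + u x * pd (pd ζ i) j x := fun i j =>
    ((hs1 j).mul_left.add (hs1 i).mul_left).add (hs2 i j).mul_left
  refine ⟨(hζ.1.of_le (by simp)).mul P.u_contDiff, hζ.2.1.mul_right, fun i j => ?_,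
    fun i j φ hφ => ?_⟩
  · obtain ⟨M, hM⟩ := hζ.2.1.exists_bound_of_continuous hζc
    have h1 : MemLp (fun x => ζ x * H i j x) 2 := by
      refine (hH i j).of_le_mul (c := M) (hζc.aestronglyMeasurable.mul (hH i j).1)
        (.of_forall fun x => ?_)
      rw [norm_mul]
      exact mul_le_right (hM x) (norm_nonneg _)
    exact h1.add (memLp_of_test (hRc i j) (hRs i j) 2)
  · have hφd : ∀ x, DifferentiableAt ℝ φ x := hφ.1.differentiable (by simp)
    have hφc := hφ.1.continuous
    have ht : IsTestFun K (fun x => ζ x * φ x) := ⟨hζ.1.mul hφ.1, hζ.2.1.mul_right,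
      (closure_mono fun x hx => left_ne_zero_of_mul hx).trans hζ.2.2⟩
    have e1 := hHe i j _ ht
    have hprod : ContDiff ℝ 1 fun x => (u x * pd ζ i x) * φ x :=
      (P.u_contDiff.mul ((hd1 i).of_le (by simp))).mul (hφ.1.of_le (by simp))
    have e2 := integral_pd_eq_zero hprod hφ.2.1.mul_left j
    have hu1 : ∀ x, DifferentiableAt ℝ (fun x => u x * pd ζ i x) x := fun x =>
      (hud x).mul ((hd1 i).differentiable (by simp) x)
    have p1 : ∀ x, pd (fun x => ζ x * φ x) j x = ζ x * pd φ j x + φ x * pd ζ j x := fun x =>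
      pd_mul (hζd x) (hφd x) j
    have p2 : ∀ x, pd (fun x => (u x * pd ζ i x) * φ x) j x
        = (u x * pd ζ i x) * pd φ j x + φ x * (u x * pd (pd ζ i) j x + pd ζ i x * X x j) :=
      fun x => by
      rw [pd_mul (hu1 x) (hφd x) j, pd_mul (hud x) ((hd1 i).differentiable (by simp) x) j, P.pd_u]
    have p3 : ∀ x, pd (fun x => ζ x * u x) i x = ζ x * X x i + u x * pd ζ i x := fun x => by
      rw [pd_mul (hζd x) (hud x) i, P.pd_u]
    have I1 : Integrable fun x => X x i * pd (fun x => ζ x * φ x) j x :=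
      ((hXi i).mul (pd_contDiff ht.1 j).continuous).integrable_cpt
        (pd_cpt ht.2.1 j).mul_left
    have I2 : Integrable fun x => pd (fun x => (u x * pd ζ i x) * φ x) j x := by
      refine (pd_continuous hprod j).integrable_cpt ?_
      exact hφ.2.1.mul_left.fderiv_apply (𝕜 := ℝ) (ev j)
    have I3 : Integrable fun x =>
        (X x i * pd ζ j x + X x j * pd ζ i x + u x * pd (pd ζ i) j x) * φ x :=
      ((hRc i j).mul hφc).integrable_cpt hφ.2.1.mul_left
    have I4 : Integrable fun x => H i j x * (ζ x * φ x) := by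
      have := ((hH i j).locallyIntegrable (by norm_num)).integrable_smul_left_of_hasCompactSupport
        (hζc.mul hφc) hφ.2.1.mul_left
      simpa [mul_comm] using this
    have I12 : Integrable fun x => X x i * pd (fun x => ζ x * φ x) j x
        + pd (fun x => (u x * pd ζ i x) * φ x) j x := I1.add I2
    calc _ = ∫ x, ((X x i * pd (fun x => ζ x * φ x) j x
          + pd (fun x => (u x * pd ζ i x) * φ x) j x)
          - (X x i * pd ζ j x + X x j * pd ζ i x + u x * pd (pd ζ i) j x) * φ x) := by
          congr 1; funext x
          rw [p1, p2, p3]; ring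
      _ = - (∫ x, H i j x * (ζ x * φ x))
          - ∫ x, (X x i * pd ζ j x + X x j * pd ζ i x + u x * pd (pd ζ i) j x) * φ x := by
          rw [integral_sub I12 I3, integral_add I1 I2, e1, e2, add_zero]
      _ = _ := by
          have I4n : Integrable fun x => -(H i j x * (ζ x * φ x)) := I4.neg
          rw [← integral_neg, ← integral_sub I4n I3, ← integral_neg]
          congr 1; funext x; ring

lemma memLp_indicator_rpow (hq : 1 ≤ q) (hb : -b ≤ e * q)
    {L : Set (Euc n)} (hL : IsCompact L) (hint : IntegrableOn (fun x => ‖X x‖ ^ (-b)) L)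
    (hne : ∀ᵐ x ∂(volume.restrict L), X x ≠ 0) :
    MemLp (L.indicator fun x => ‖X x‖ ^ e) (ofReal q) := by
  obtain ⟨M, hM, hXM⟩ := P.exists_bound
  have hm : Measurable fun x => ‖X x‖ ^ e := P.cont.norm.measurable.pow_const e
  rw [memLp_indicator_iff_restrict hL.measurableSet]
  have hq0 : 0 < q := by linarith
  rw [← integrable_norm_rpow_iff hm.aestronglyMeasurable (by simpa using hq0)
    ofReal_ne_top]
  rw [toReal_ofReal hq0.le]
  refine (hint.const_mul (M ^ (e * q + b))).mono' ((hm.norm.pow_const q).aestronglyMeasurable) ?_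
  filter_upwards [hne] with x hx
  have h0 : 0 < ‖X x‖ := norm_pos_iff.2 hx
  rw [norm_eq_abs, abs_of_nonneg (by positivity), norm_eq_abs,
    abs_of_nonneg (by positivity), ← rpow_mul h0.le]
  calc ‖X x‖ ^ (e * q) = ‖X x‖ ^ (e * q + b) * ‖X x‖ ^ (-b) := by
        rw [← rpow_add h0]; congr 1; ring
    _ ≤ _ := mul_le_right
        (rpow_le_rpow h0.le (hXM x) (by linarith)) (by positivity)

end PData

lemma integral_rpow_le_of_eLpNorm (hg : Continuous g) (hs : HasCompactSupport g)
    {B : ℝ} (hq : 1 ≤ q) (hB : 0 ≤ B)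
    (h : eLpNorm g (ofReal q) ≤ ofReal B) : ∫ x, |g x| ^ q ≤ B ^ q := by
  have hq0 : 0 < q := by linarith
  have hm : MemLp g (ofReal q) := memLp_of_test hg hs _
  rw [hm.eLpNorm_eq_integral_rpow_norm (by simpa using hq0) ofReal_ne_top,
    toReal_ofReal hq0.le, ofReal_le_ofReal_iff hB] at h
  have h0 : 0 ≤ ∫ x, |g x| ^ q := integral_nonneg fun x => by positivity
  calc ∫ x, |g x| ^ q = ((∫ x, |g x| ^ q) ^ q⁻¹) ^ q := (rpow_inv_rpow h0 hq0.ne').symm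
    _ ≤ B ^ q := rpow_le_rpow (by positivity) h hq0.le

lemma abs_trace_form_le (a : Fin n → Fin n → ℝ) (s : ℝ) {ν : Euc n} (hν : ‖ν‖ ≤ 1) :
    |∑ i, a i i + s * ∑ j, ∑ i, a i j * (ν i * ν j)|
      ≤ ∑ i, |a i i| + |s| * ∑ j, ∑ i, |a i j| := by
  refine (abs_add_le _ _).trans (add_le_add (abs_sum_le_sum_abs _ _) ?_)
  rw [abs_mul]
  refine mul_le_left ?_ (abs_nonneg s)
  refine (abs_sum_le_sum_abs _ _).trans (sum_le_sum fun j _ => ?_)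
  refine (abs_sum_le_sum_abs _ _).trans (sum_le_sum fun i _ => ?_)
  rw [abs_mul, abs_mul]
  have h1 := (abs_apply_le_norm ν i).trans hν
  have h2 := (abs_apply_le_norm ν j).trans hν
  exact mul_le_of_le_one_right (abs_nonneg _) (mul_le_one₀ h1 (abs_nonneg _) h2)

lemma norm_rpow_le_sum_rpow (z : Euc n) (hq : 1 ≤ q) :
    ‖z‖ ^ q ≤ (n : ℝ) ^ (q - 1) * ∑ i, |z i| ^ q := by
  have := rpow_sum_le_const_mul_sum_rpow Finset.univ (fun i => z i) hq
  simp only [Finset.card_univ, Fintype.card_fin] at this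
  exact (rpow_le_rpow (norm_nonneg _) (norm_le_sum_abs z) (by linarith)).trans this

namespace PData

include P

lemma eventually_integral_dq_rpow_le (hn : 0 < n) (hq : 2 ≤ q)
    (hC0 : 0 ≤ C)
    (hC : HessBound n C q)
    (hs : |p - 2| < 1) (hsC : |p - 2| * C < 1) (hκq : (p - 2) * q ≤ p - 1 - κ)
    (hK : IsCompact K) (hKO : K ⊆ O)
    (hneg : ∀ L, IsCompact L → L ⊆ O → IntegrableOn (fun x => ‖X x‖ ^ (-(p - 1 - κ))) L ∧
      ∀ᵐ x ∂(volume.restrict L), X x ≠ 0) :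
    ∃ B : ℝ, 0 ≤ B ∧ ∀₀ h, ∀ k, ∫ x in K, ‖dq h k X x‖ ^ q ≤ B := by
  obtain ⟨L, hL, hKL, hLO⟩ := exists_compact_between hK P.isOpen hKO
  obtain ⟨H, hH, hHe⟩ := P.exists_hessian hL hLO
  obtain ⟨ζ, hζ⟩ := exists_cutoff isOpen_interior hK hKL
  have hζt : IsTestFun L ζ := ⟨hζ.contDiff, hζ.cpt, hζ.sub.trans interior_subset⟩
  have HW := P.hasHess_mul hH hHe hζt
  have hi : ∀ i, Continuous fun z : Euc n => z i := fun i => by fun_prop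
  have hXi : ∀ i, Continuous fun x => X x i := fun i => (hi i).comp P.cont
  obtain ⟨R, hR⟩ : ∃ R : Fin n → Fin n → Euc n → ℝ, R = fun i j x =>
    X x i * pd ζ j x + X x j * pd ζ i x + u x * pd (pd ζ i) j x := ⟨_, rfl⟩
  have hRc : ∀ i j, Continuous (R i j) := fun i j => by
    rw [hR]
    exact (((hXi i).mul (pd_contDiff hζ.contDiff j).continuous).add
      ((hXi j).mul (pd_contDiff hζ.contDiff i).continuous)).add
      (P.u_contDiff.continuous.mul (pd_contDiff (pd_contDiff hζ.contDiff i) j).continuous)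
  have hR0 : ∀ i j x, x ∉ tsupport ζ → R i j x = 0 := fun i j x hx => by
    have h1 : ∀ i, pd ζ i x = 0 := fun i =>
      zero_off_tsupport fun h => hx (tsupport_pd_subset _ _ h)
    have h2 : pd (pd ζ i) j x = 0 := zero_off_tsupport fun h =>
      hx (tsupport_pd_subset _ _ (tsupport_pd_subset _ _ h))
    simp [hR, h1, h2]
  have hRs : ∀ i j, HasCompactSupport (R i j) := fun i j => hζ.cpt.mono' fun x hx => by
    by_contra h; exact hx (hR0 i j x h)
  replace HW : HasHess (fun x => ζ x * u x) (fun i j x => ζ x * H i j x + R i j x) := by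
    rw [hR]; exact HW
  obtain ⟨ν, hν⟩ : ∃ ν : Euc n → Euc n, ν = fun x => ‖X x‖⁻¹ • X x := ⟨_, rfl⟩
  have hνm : Measurable ν := by
    rw [hν]; exact P.cont.norm.measurable.inv.smul P.cont.measurable
  have hν1 : ∀ x, ‖ν x‖ ≤ 1 := fun x => by
    rw [hν, norm_smul, norm_inv, norm_norm]; exact inv_mul_le_one
  have hνi : ∀ x i, ν x i = X x i / ‖X x‖ := fun x i => by
    rw [hν]; simp [div_eq_inv_mul]
  obtain ⟨W, hW⟩ : ∃ W : Fin n → Fin n → Euc n → ℝ, W = fun i j x => ζ x * H i j x + R i j x :=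
    ⟨_, rfl⟩
  rw [← hW] at HW
  obtain ⟨G, hG⟩ : ∃ G : Euc n → ℝ, G = fun x =>
    ∑ i, W i i x + (p - 2) * ∑ j, ∑ i, W i j x * (ν x i * ν x j) := ⟨_, rfl⟩
  have hW0 : ∀ i j x, x ∉ tsupport ζ → W i j x = 0 := fun i j x hx => by
    simp [hW, hR0 i j x hx, zero_off_tsupport hx]
  have hG0 : ∀ x, x ∉ tsupport ζ → G x = 0 := fun x hx => by
    simp [hG, hW0 _ _ x hx]
  obtain ⟨Rb, hRb⟩ : ∃ Rb : Euc n → ℝ, Rb = fun x =>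
    ∑ i, |R i i x| + |p - 2| * ∑ j, ∑ i, |R i j x| := ⟨_, rfl⟩
  have hRbc : Continuous Rb := by
    rw [hRb]
    exact (continuous_finsetSum _ fun i _ => (hRc i i).abs).add (continuous_const.mul
      (continuous_finsetSum _ fun j _ => continuous_finsetSum _ fun i _ => (hRc i j).abs))
  have hRbs : HasCompactSupport Rb := hζ.cpt.mono' fun x hx => by
    by_contra h; exact hx (by simp [hRb, hR0 _ _ x h])
  obtain ⟨M, hM⟩ : ∃ M, ∀ x, |f x| ≤ M :=
    P.f_contDiff.continuous.bounded_above_of_compact_support P.f_cpt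
  have hdom : MemLp (fun x => M * L.indicator (fun x => ‖X x‖ ^ (2 - p)) x + Rb x)
      (ofReal q) :=
    ((P.memLp_indicator_rpow (b := p - 1 - κ) (by linarith) (by nlinarith) hL (hneg L hL hLO).1
      (hneg L hL hLO).2).const_mul M).add (memLp_of_test hRbc hRbs _)
  have hGm : AEStronglyMeasurable G volume := by
    rw [hG]
    exact HW.trace_memLp.1.add ((HW.form_memLp hνm hν1).1.const_mul _)
  have hGq : MemLp G (ofReal q) := by
    refine hdom.mono hGm ?_
    have hne := (ae_restrict_iff' hL.measurableSet).1 (hneg L hL hLO).2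
    filter_upwards [P.ae_nondivergence hL hLO hH hHe, hne] with x hx hxne
    have hRb0 : 0 ≤ Rb x := by rw [hRb]; positivity
    by_cases hxs : x ∈ tsupport ζ
    · have hxL := hζ.sub hxs
      have hX := hxne (interior_subset hxL)
      have e1 : G x = ζ x * (- f x * ‖X x‖ ^ (2 - p)) + (∑ i, R i i x
          + (p - 2) * ∑ j, ∑ i, R i j x * (ν x i * ν x j)) := by
        rw [← hx hxL hX, hG, hW]
        simp only [hνi, add_mul, sum_add_distrib, mul_add, mul_sum]
        have : ∀ i j, ζ x * H i j x * (X x i / ‖X x‖ * (X x j / ‖X x‖))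
          = ζ x * (H i j x * (X x i / ‖X x‖ * (X x j / ‖X x‖))) := fun i j => by ring
        simp only [this, mul_left_comm (p - 2) (ζ x)]
        ring
      have e2 := abs_trace_form_le (fun i j => R i j x) (p - 2) (hν1 x)
      rw [indicator_of_mem (interior_subset hxL), e1]
      have h0 : 0 ≤ ‖X x‖ ^ (2 - p) := by positivity
      have e3 : |ζ x * (- f x * ‖X x‖ ^ (2 - p))| ≤ M * ‖X x‖ ^ (2 - p) := by
        rw [abs_mul, abs_mul, abs_neg, abs_of_nonneg h0, abs_of_nonneg (hζ.nonneg x)]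
        exact (mul_le_of_le_one_left (by positivity) (hζ.le_one x)).trans
          (mul_le_right (hM x) h0)
      have e4 : Rb x = ∑ i, |R i i x| + |p - 2| * ∑ j, ∑ i, |R i j x| := by rw [hRb]
      rw [norm_eq_abs, norm_eq_abs]
      refine (abs_add_le _ _).trans ((add_le_add e3 (e2.trans e4.ge)).trans (le_abs_self _))
    · rw [hG0 x hxs]; simp
  obtain ⟨a, ha⟩ := hζ.cpt.isBounded.subset_closedBall 0
  have hGa : ∀ x, a < ‖x‖ → G x = 0 := fun x hx => hG0 x fun h => by
    have := ha h
    rw [mem_closedBall_zero_iff] at this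
    linarith
  obtain ⟨B, hB0, hB⟩ := HW.exists_eLpNorm_dq_le hn hq hC0 hC hs hsC hνm hν1 hGq hGa
    (.of_forall fun x => by rw [hG])
  obtain ⟨U, hU, hKU, hU1⟩ := mem_nhdsSet_iff_exists.1 hζ.one_nhds
  refine ⟨(n : ℝ) ^ (q - 1) * (n * B ^ q), by positivity, ?_⟩
  filter_upwards [eventually_add_mem hU hK hKU, self_mem_nhdsWithin] with h hh hne k
  have hpd : ∀ x ∈ U, ∀ i, pd (fun x => ζ x * u x) i x = X x i := fun x hx i => by
    rw [← P.pd_u]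
    unfold pd
    rw [EventuallyEq.fderiv_eq]
    filter_upwards [hU.mem_nhds hx] with y hy
    rw [hU1 hy, one_mul]
  have hdq : ∀ x ∈ K, ∀ i, dq h k X x i = dq h k (pd (fun x => ζ x * u x) i) x := fun x hx i => by
    have h1 : x + h • ev k ∈ U := hh x hx _ (by rw [norm_smul_ev]; linarith [abs_nonneg h])
    simp only [dq, hpd _ h1 i, hpd _ (hKU hx) i]
    simp
  have hwc : ContDiff ℝ 1 fun x => ζ x * u x := HW.contDiff
  have hgc : ∀ i, Continuous (dq h k (pd (fun x => ζ x * u x) i)) := fun i =>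
    dq_continuous (pd_continuous hwc i) h k
  have hgs : ∀ i, HasCompactSupport (dq h k (pd (fun x => ζ x * u x) i)) := fun i =>
    dq_cpt (HW.cpt.fderiv_apply (𝕜 := ℝ) (ev i)) h k
  have hq0 : 0 ≤ q := by linarith
  have hic : ∀ i, Integrable fun x => |dq h k (pd (fun x => ζ x * u x) i) x| ^ q := fun i =>
    ((hgc i).abs.rpow_const fun _ => Or.inr hq0).integrable_cpt
      ((hgs i).mono fun x hx h0 => hx (by simp [h0, zero_rpow (by linarith : q ≠ 0)]))
  have hsum : Integrable fun x => ∑ i, |dq h k (pd (fun x => ζ x * u x) i) x| ^ q :=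
    integrable_finsetSum _ fun i _ => hic i
  calc ∫ x in K, ‖dq h k X x‖ ^ q
      ≤ ∫ x in K, (n : ℝ) ^ (q - 1) * ∑ i, |dq h k (pd (fun x => ζ x * u x) i) x| ^ q := by
        refine setIntegral_mono_on ?_ (hsum.const_mul _).integrableOn hK.measurableSet
          fun x hx => ?_
        · exact ((P.dqX_continuous h k).norm.rpow_const fun _ => Or.inr hq0).continuousOn.integrableOn_compact hK
        · refine (norm_rpow_le_sum_rpow _ (by linarith)).trans_eq ?_
          simp only [hdq x hx]
    _ ≤ ∫ x, (n : ℝ) ^ (q - 1) * ∑ i, |dq h k (pd (fun x => ζ x * u x) i) x| ^ q :=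
        setIntegral_le_integral (hsum.const_mul _) (.of_forall fun x => by
          simp only [Pi.zero_apply]; positivity)
    _ = (n : ℝ) ^ (q - 1) * ∑ i, ∫ x, |dq h k (pd (fun x => ζ x * u x) i) x| ^ q := by
        rw [integral_const_mul, integral_finsetSum _ fun i _ => hic i]
    _ ≤ (n : ℝ) ^ (q - 1) * ∑ _i : Fin n, B ^ q := by
        refine mul_le_left (sum_le_sum fun i _ => ?_) (by positivity)
        exact integral_rpow_le_of_eLpNorm (hgc i) (hgs i) (by linarith) hB0 (hB h hne k i)
    _ = _ := by simp

end PData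

lemma exists_rpow_mul_pow_four_le {l₁ l₂ l₃ : ℝ} (h1 : 0 ≤ l₁) (h2 : 0 ≤ l₂)
    (h3 : 0 ≤ l₃) (hsum : l₁ + l₂ + l₃ = 1) (hq : 0 ≤ q) (h4 : l₁ * q + 2 * l₂ = 4)
    (ha : l₂ * e - l₃ * b ≤ a) (hM : 0 < M) : ∃ C, 0 < C ∧ ∀ t d : ℝ, 0 < t → t ≤ M → 0 ≤ d →
      t ^ a * d ^ (4:ℝ) ≤ C * (d ^ q + t ^ e * d ^ 2 + t ^ (-b)) := by
  refine ⟨M ^ (a - (l₂ * e - l₃ * b)), by positivity, fun t d ht htM hd => ?_⟩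
  have hg := geom_mean_le_arith_mean3_weighted h1 h2 h3 (p₁ := d ^ q) (p₂ := t ^ e * d ^ 2)
    (p₃ := t ^ (-b)) (by positivity) (by positivity) (by positivity) hsum
  have e1 : t ^ (l₂ * e - l₃ * b) * d ^ (4:ℝ)
      = (d ^ q) ^ l₁ * (t ^ e * d ^ 2) ^ l₂ * (t ^ (-b)) ^ l₃ := by
    rw [← h4, rpow_add_of_nonneg hd (by positivity) (by positivity),
      mul_rpow (by positivity) (by positivity), ← rpow_natCast d 2,
      ← rpow_mul hd, ← rpow_mul hd, ← rpow_mul ht.le, ← rpow_mul ht.le,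
      sub_eq_add_neg, rpow_add ht]
    push_cast
    rw [mul_comm l₁ q, mul_comm l₂ e, show -(l₃ * b) = -b * l₃ by ring]
    ring
  have p1 : 0 ≤ d ^ q := by positivity
  have p2 : 0 ≤ t ^ e * d ^ 2 := by positivity
  have p3 : 0 ≤ t ^ (-b) := by positivity
  have e2 : l₁ * d ^ q + l₂ * (t ^ e * d ^ 2) + l₃ * t ^ (-b) ≤ d ^ q + t ^ e * d ^ 2 + t ^ (-b) :=
    add_le_add (add_le_add (mul_le_of_le_one_left p1 (by linarith))
      (mul_le_of_le_one_left p2 (by linarith))) (mul_le_of_le_one_left p3 (by linarith))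
  calc t ^ a * d ^ (4:ℝ)
      = t ^ (a - (l₂ * e - l₃ * b)) * (t ^ (l₂ * e - l₃ * b) * d ^ (4:ℝ)) := by
        rw [← mul_assoc, ← rpow_add ht]; congr 2; ring
    _ ≤ M ^ (a - (l₂ * e - l₃ * b)) * (d ^ q + t ^ e * d ^ 2 + t ^ (-b)) := by
        refine mul_le_mul (rpow_le_rpow ht.le htM (by linarith)) ?_ (by positivity)
          (by positivity)
        rw [e1]; exact hg.trans e2

lemma rpow_le_shift {v : Euc n}
    (hv : ‖X (x + v) - X x‖ ≤ η) (hη : 2 * η ≤ ‖X x‖) (hx : 0 < ‖X x‖) :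
    ‖X x‖ / 2 ≤ ‖X (x + v)‖ ∧ ‖X x‖ ^ a ≤ 2 ^ |a| * ‖X (x + v)‖ ^ a := by
  have h1 : ‖X x‖ ≤ ‖X (x + v)‖ + η := by
    have := norm_sub_le (X (x + v)) (X (x + v) - X x)
    rw [sub_sub_cancel] at this
    linarith
  have h2 : ‖X (x + v)‖ ≤ ‖X x‖ + η := by
    have := norm_add_le (X x) (X (x + v) - X x)
    rw [add_sub_cancel] at this
    linarith
  exact ⟨by linarith, rpow_comparable a (by linarith) (by linarith) (by linarith)⟩

lemma bset_pos (hε : 0 < ε)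
    (hx : x ∈ bset X K ε) : 0 < ‖X x‖ := hε.trans_le hx.2

lemma rpow_continuousOn_bset (hX : Continuous X) (K : Set (Euc n))
    (hε : 0 < ε) (a : ℝ) : ContinuousOn (fun x => ‖X x‖ ^ a) (bset X K ε) :=
  hX.norm.continuousOn.rpow_const fun _ hx => Or.inl (bset_pos hε hx).ne'

namespace PData

include P

lemma weighted_four_bound {l₁ l₂ l₃ : ℝ} (hκ : 0 < κ) (hκ1 : κ ≤ 1)
    (h1 : 0 ≤ l₁) (h2 : 0 ≤ l₂) (h3 : 0 ≤ l₃) (hsum : l₁ + l₂ + l₃ = 1) (hq : 0 ≤ q)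
    (h4 : l₁ * q + 2 * l₂ = 4) (ha : l₂ * (p - 3 + κ) - l₃ * (p - 1 - κ) ≤ a)
    (hK : IsCompact K) (hKO : K ⊆ O)
    (hneg : IntegrableOn (fun x => ‖X x‖ ^ (-(p - 1 - κ))) K)
    (hqb : ∃ B : ℝ, 0 ≤ B ∧ ∀₀ h, ∀ k, ∫ x in K, ‖dq h k X x‖ ^ q ≤ B) :
    ∃ B, ∀ ε, 0 < ε → ∀₀ h, ∀ k,
      ∫ x in bset X K ε, ‖X x‖ ^ a * ‖dq h k X x‖ ^ (4:ℝ) ≤ B := by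
  obtain ⟨M, hM, hXM⟩ := P.exists_bound
  obtain ⟨C, hC, hle⟩ := exists_rpow_mul_pow_four_le h1 h2 h3 hsum hq h4 ha hM
  obtain ⟨B₁, -, hB₁⟩ := hqb
  obtain ⟨B₂, hB₂⟩ := P.weighted_bound hκ hκ1 hK hKO
  refine ⟨C * (B₁ + B₂ + ∫ x in K, ‖X x‖ ^ (-(p - 1 - κ))), fun ε hε => ?_⟩
  filter_upwards [hB₁, hB₂ ε hε] with h hh1 hh2 k
  have hc := bset_compact P.cont hK ε
  have hsub : bset X K ε ⊆ K := inter_subset_left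
  have hd := (P.dqX_continuous h k).norm
  have hdq : Continuous fun x => ‖dq h k X x‖ ^ q := hd.rpow_const fun _ => Or.inr hq
  have hd4 : Continuous fun x => ‖dq h k X x‖ ^ (4:ℝ) :=
    hd.rpow_const fun _ => Or.inr (by norm_num)
  have I1 : IntegrableOn (fun x => ‖dq h k X x‖ ^ q) (bset X K ε) :=
    hdq.continuousOn.integrableOn_compact hc
  have I2 : IntegrableOn (fun x => ‖X x‖ ^ (p - 3 + κ) * ‖dq h k X x‖ ^ 2) (bset X K ε) :=
    ((rpow_continuousOn_bset P.cont K hε _).mul (hd.pow 2).continuousOn).integrableOn_compact hc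
  have I2' : IntegrableOn (fun x => ‖X x‖ ^ (p - 3 + κ) * sqn h X x) (bset X K ε) :=
    ((rpow_continuousOn_bset P.cont K hε _).mul
      (sqn_continuous P.cont h).continuousOn).integrableOn_compact hc
  have I3 := hneg.mono_set hsub
  have I12 : IntegrableOn (fun x => ‖dq h k X x‖ ^ q
    + ‖X x‖ ^ (p - 3 + κ) * ‖dq h k X x‖ ^ 2) (bset X K ε) := I1.add I2
  have I4 : IntegrableOn (fun x => ‖X x‖ ^ a * ‖dq h k X x‖ ^ (4:ℝ)) (bset X K ε) :=
    ((rpow_continuousOn_bset P.cont K hε _).mul hd4.continuousOn).integrableOn_compact hc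
  have I123 : IntegrableOn (fun x => C * (‖dq h k X x‖ ^ q
    + ‖X x‖ ^ (p - 3 + κ) * ‖dq h k X x‖ ^ 2 + ‖X x‖ ^ (-(p - 1 - κ)))) (bset X K ε) :=
    (I12.add I3).const_mul C
  refine (setIntegral_mono_on I4 I123 hc.measurableSet fun x hx =>
    hle _ _ (bset_pos hε hx) (hXM x) (norm_nonneg _)).trans ?_
  rw [integral_const_mul, integral_add I12 I3, integral_add I1 I2]
  refine mul_le_left (add_le_add (add_le_add ?_ ?_) ?_) hC.le
  · exact (setIntegral_mono_set (hdq.continuousOn.integrableOn_compact hK)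
      (.of_forall fun x => by simp only [Pi.zero_apply]; positivity)
      (.of_forall hsub)).trans (hh1 k)
  · refine (setIntegral_mono_on I2 I2' hc.measurableSet fun x hx => ?_).trans hh2
    exact mul_le_left (sq_le_sqn h X x k) (by positivity)
  · exact setIntegral_mono_set hneg
      (.of_forall fun x => by simp only [Pi.zero_apply]; positivity)
      (.of_forall hsub)

lemma weighted_four_dq_dq
    (h4 : ∀ K, IsCompact K → K ⊆ O → ∃ B, ∀ ε, 0 < ε → ∀₀ h, ∀ k,
      ∫ x in bset X K ε, ‖X x‖ ^ a * ‖dq h k X x‖ ^ (4:ℝ) ≤ B)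
    (hK : IsCompact K) (hKO : K ⊆ O) :
    ∃ B, ∀ ε, 0 < ε → ∀₀ h, ∀ l k,
      ∫ x in bset X K ε, ‖X x‖ ^ a * |dq h l (dq h k u) x| ^ (4:ℝ) ≤ B := by
  obtain ⟨L, hL, hKL, hLO⟩ := exists_compact_between hK P.isOpen hKO
  obtain ⟨B, hB⟩ := h4 L hL hLO
  refine ⟨2 ^ |a| * B, fun ε hε => ?_⟩
  filter_upwards [hB (ε / 2) (by linarith), P.eventually_good (η := ε / 2) (by linarith),
    eventually_add_mem isOpen_interior hK hKL, self_mem_nhdsWithin] with h hh hg hadd hne l k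
  have hGc : Continuous fun x => innerSL ℝ (dq h k X x) :=
    (innerSL ℝ).continuous.comp (P.dqX_continuous h k)
  have hd4 : Continuous fun x => ‖dq h k X x‖ ^ (4:ℝ) :=
    (P.dqX_continuous h k).norm.rpow_const fun _ => Or.inr (by norm_num)
  have hcB := bset_compact P.cont hL (ε / 2)
  have key := setIntegral_dq_le (P.dqu_hasFDerivAt h k) hGc (r := 4) (by norm_num) hne l
    (bset_compact P.cont hK ε) hcB (ω := fun x => ‖X x‖ ^ a)
    (fun x _ => by positivity) (rpow_continuousOn_bset P.cont L (by linarith) a)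
    (c := 2 ^ |a|) (by positivity) (fun x hx v hv => by
      have hv2 : ‖v‖ ≤ 2 * |h| := hv.trans (by linarith [abs_nonneg h])
      have hxe : ε ≤ ‖X x‖ := hx.2
      have := rpow_le_shift (a := a) (hg.osc x v hv2) (by linarith) (bset_pos hε hx)
      exact ⟨⟨interior_subset (hadd x hx.1 v hv2), show ε / 2 ≤ ‖X (x + v)‖ by linarith [this.1]⟩,
        this.2⟩)
  refine key.trans (mul_le_left (le_trans ?_ (hh k)) (by positivity))
  refine setIntegral_mono_on ?_ ?_ hcB.measurableSet fun x hx => ?_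
  · exact ((rpow_continuousOn_bset P.cont L (by linarith) a).mul
      ((hGc.clm_apply continuous_const).norm.rpow_const
        fun _ => Or.inr (by norm_num)).continuousOn).integrableOn_compact hcB
  · exact ((rpow_continuousOn_bset P.cont L (by linarith) a).mul
      hd4.continuousOn).integrableOn_compact hcB
  · refine mul_le_left (rpow_le_rpow (norm_nonneg _) ?_ (by norm_num))
      (by positivity)
    rw [innerSL_apply_apply, inner_ev]
    exact abs_apply_le_norm _ _

end PData

lemma exists_dq_dqS (hp1 : 1 < p) : ∃ C > 0, ∃ c > 0, ∃ δ > 0,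
    ∀ (X : Euc n → Euc n) (u : Euc n → ℝ) (η h : ℝ) (x : Euc n) (k l : Fin n),
      GoodStep X u η h → X x ≠ 0 → η ≤ δ * ‖X x‖ →
      ‖dq h l (dq h k fun x => pv (p - 2) (X x)) x‖ ≤ C * (‖X x‖ ^ (p - 2) *
          ‖dq h l (dq h k X) x‖ + ‖X x‖ ^ (p - 3) * (‖dq h k X x‖ * ‖dq h l X x‖)) ∧
      c * (‖X x‖ ^ (p - 2) * ‖dq h l (dq h k X) x‖ ^ 2) - C * (‖X x‖ ^ (p - 3) *
          (‖dq h k X x‖ * ‖dq h l X x‖) * ‖dq h l (dq h k X) x‖)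
        ≤ ⟪dq h l (dq h k X) x, dq h l (dq h k fun x => pv (p - 2) (X x)) x⟫_ℝ := by
  obtain ⟨C, hC0, hC⟩ := pv_second_taylor (n := n) (p - 2)
  set c := min 1 (p - 1) with hc
  have hc0 : 0 < c := lt_min one_pos (by linarith)
  have hδ : 0 < min (1 / 16) (c / (2 * (C + 1))) := by positivity
  refine ⟨C + 2 + |p - 2|, by positivity, c / 2, by positivity, _, hδ, ?_⟩
  intro X u η h x k l hg hx hη
  have hη0 : 0 ≤ η := (norm_nonneg _).trans (hg.dvec x)
  have ht : 0 < ‖X x‖ := norm_pos_iff.2 hx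
  have hη1 : η ≤ ‖X x‖ / 8 := hη.trans (by
    have := mul_le_right (min_le_left (1 / 16) (c / (2 * (C + 1)))) ht.le
    linarith)
  have hη2 : C * η ≤ c / 2 * ‖X x‖ := by
    have h1 := hη.trans (mul_le_right (min_le_right (1 / 16) (c / (2 * (C + 1)))) ht.le)
    calc C * η ≤ (C + 1) * η := by linarith
      _ ≤ (C + 1) * (c / (2 * (C + 1)) * ‖X x‖) := by gcongr
      _ = c / 2 * ‖X x‖ := by field_simp
  have habs := abs_nonneg h
  have hosc : ∀ k, ‖X (x + h • ev k) - X x‖ ≤ η := fun k =>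
    hg.osc x _ (by rw [norm_smul_ev]; linarith)
  have hosc2 : ‖X (x + h • ev l + h • ev k) - X x‖ ≤ η := by
    rw [add_assoc]
    refine hg.osc x _ ((norm_add_le _ _).trans ?_)
    rw [norm_smul_ev, norm_smul_ev]; linarith
  have h1 := hC (X x) (X (x + h • ev k)) (X (x + h • ev l)) (X (x + h • ev l + h • ev k)) η hx hη1
    (hosc k) (hosc l) hosc2
  have eY : dq h l (dq h k X) x = (h⁻¹ * h⁻¹) • (X (x + h • ev l + h • ev k) - X (x + h • ev l)
      - (X (x + h • ev k) - X x)) := by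
    simp only [dq, ← smul_sub, smul_smul]
  have eV : dq h l (dq h k fun x => pv (p - 2) (X x)) x = (h⁻¹ * h⁻¹) •
      (pv (p - 2) (X (x + h • ev l + h • ev k)) - pv (p - 2) (X (x + h • ev l))
      - (pv (p - 2) (X (x + h • ev k)) - pv (p - 2) (X x))) := by
    simp only [dq, ← smul_sub, smul_smul]
  set V := dq h l (dq h k fun x => pv (p - 2) (X x)) x
  set Y := dq h l (dq h k X) x
  have hR : ‖V - pvD (p - 2) (X x) Y‖ ≤ C * ‖X x‖ ^ (p - 3) * (η * ‖Y‖ +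
      ‖dq h k X x‖ * ‖dq h l X x‖) := by
    have e : V - pvD (p - 2) (X x) Y = (h⁻¹ * h⁻¹) •
        (pv (p - 2) (X (x + h • ev l + h • ev k)) - pv (p - 2) (X (x + h • ev l))
        - (pv (p - 2) (X (x + h • ev k)) - pv (p - 2) (X x)) - pvD (p - 2) (X x)
        (X (x + h • ev l + h • ev k) - X (x + h • ev l) - (X (x + h • ev k) - X x))) := by
      rw [eV, eY, map_smul, ← smul_sub]
    rw [e, norm_smul, eY, norm_smul, dq, dq, norm_smul, norm_smul, norm_mul]
    refine (mul_le_left h1 (by positivity)).trans_eq ?_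
    rw [show p - 2 - 1 = p - 3 by ring]; ring
  clear_value V Y
  have hpow : ‖X x‖ ^ (p - 3) * ‖X x‖ = ‖X x‖ ^ (p - 2) := by
    rw [← rpow_add_one ht.ne']; congr 1; ring
  have hA := pvD_norm_le (p - 2) hx Y
  have h2 := pvD_coercive (p - 2) hx Y
  have hT : 0 < ‖X x‖ ^ (p - 2) := rpow_pos_of_pos ht _
  have hT3 : 0 < ‖X x‖ ^ (p - 3) := rpow_pos_of_pos ht _
  have hcl : c ≤ 1 := min_le_left _ _
  rw [show min 1 (1 + (p - 2)) = c by rw [hc]; congr 1; ring] at h2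
  set D := ‖dq h k X x‖ * ‖dq h l X x‖
  have hD : 0 ≤ D := by positivity
  clear_value D
  have hR2 : ‖V - pvD (p - 2) (X x) Y‖ ≤ c / 2 * ‖X x‖ ^ (p - 2) * ‖Y‖
      + C * (‖X x‖ ^ (p - 3) * D) := by
    refine hR.trans ?_
    calc _ = ‖X x‖ ^ (p - 3) * ‖Y‖ * (C * η) + C * (‖X x‖ ^ (p - 3) * D) := by ring
      _ ≤ ‖X x‖ ^ (p - 3) * ‖Y‖ * (c / 2 * ‖X x‖) + C * (‖X x‖ ^ (p - 3) * D) :=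
        add_le_add_left (mul_le_left hη2 (by positivity)) _
      _ = _ := by rw [← hpow]; ring
  have hTD : 0 ≤ ‖X x‖ ^ (p - 3) * D := by positivity
  have hTY : 0 ≤ ‖X x‖ ^ (p - 2) * ‖Y‖ := by positivity
  have hap := abs_nonneg (p - 2)
  constructor
  · have h3 : ‖V‖ ≤ ‖V - pvD (p - 2) (X x) Y‖ + ‖pvD (p - 2) (X x) Y‖ := by
      simpa using norm_add_le (V - pvD (p - 2) (X x) Y) (pvD (p - 2) (X x) Y)
    have h4 : (c / 2 + 1 + |p - 2|) * (‖X x‖ ^ (p - 2) * ‖Y‖)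
        ≤ (C + 2 + |p - 2|) * (‖X x‖ ^ (p - 2) * ‖Y‖) :=
      mul_le_right (by linarith) hTY
    have h5 : C * (‖X x‖ ^ (p - 3) * D) ≤ (C + 2 + |p - 2|) * (‖X x‖ ^ (p - 3) * D) :=
      mul_le_right (by linarith) hTD
    linarith
  · have h3 : ⟪Y, V⟫_ℝ = ⟪pvD (p - 2) (X x) Y, Y⟫_ℝ + ⟪Y, V - pvD (p - 2) (X x) Y⟫_ℝ := by
      rw [inner_sub_right, real_inner_comm Y (pvD (p - 2) (X x) Y)]; ring
    have h4 := (abs_le.1 (abs_real_inner_le_norm Y (V - pvD (p - 2) (X x) Y))).1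
    have h5 := mul_le_left hR2 (norm_nonneg Y)
    have h6 : C * (‖X x‖ ^ (p - 3) * D * ‖Y‖) ≤ (C + 2 + |p - 2|) * (‖X x‖ ^ (p - 3) * D * ‖Y‖) :=
      mul_le_right (by linarith) (by positivity)
    rw [h3]
    linarith

lemma absorb_products {W y b' e' : ℝ} (hc : 0 < c) (hW : 0 ≤ W)
    (hr : r ≤ W * (y * (b + b' + e + e')) + W * (b + b' + e + e') ^ 2) :
    r ≤ 3 * c / 4 * y ^ 2 + 4 * (W ^ 2 / (3 * c) + W) * (b ^ 2 + b' ^ 2 + e ^ 2 + e' ^ 2) := by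
  have hσ : (b + b' + e + e') ^ 2 ≤ 4 * (b ^ 2 + b' ^ 2 + e ^ 2 + e' ^ 2) := by
    nlinarith [sq_nonneg (b - b'), sq_nonneg (b - e), sq_nonneg (b - e'), sq_nonneg (b' - e),
      sq_nonneg (b' - e'), sq_nonneg (e - e')]
  have h1 := young (a := y) (b := W * (b + b' + e + e')) (δ := 3 * c / 4) (by positivity)
  have h2 : (W * (b + b' + e + e')) ^ 2 / (4 * (3 * c / 4)) = W ^ 2 / (3 * c) * (b + b' + e + e') ^ 2 := by
    rw [mul_pow]; field_simp
  have h3 := mul_le_left hσ (by positivity : 0 ≤ W ^ 2 / (3 * c) + W)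
  rw [h2] at h1
  linarith

lemma exists_second_order_arith {N : ℝ} (hC : 1 ≤ C) (hc : 0 < c) (hN : 0 ≤ N) :
    ∃ K, 0 < K ∧ ∀ P A T ψ f y d Q s₁ s₂ ip r₁ r₂ r : ℝ, 0 < P → 0 < A → 0 < T → 0 ≤ ψ → ψ ≤ 1 →
      0 ≤ f → f ≤ C * A → 0 ≤ y → 0 ≤ d →
      |s₁| ≤ C * (C * (P ^ 2 * y + P ^ 2 / T * d ^ 2)) →
      |s₂| ≤ C * (A / T) * d * (C * (P ^ 2 * y + P ^ 2 / T * d ^ 2)) →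
      c * (P ^ 2 * y ^ 2) - C * (P ^ 2 / T * d ^ 2 * y) ≤ ip →
      |r₁| ≤ C → |r₂| ≤ C * (A / T) * d → |r| ≤ y →
      c / 4 * (ψ * f * P * y) ^ 2 ≤
        (2 * ψ * (f ^ 2 * Q) * s₁ + ψ ^ 2 * (f ^ 2 * ip + Q * (2 * f * s₂)))
        - N * |2 * ψ * (f ^ 2 * Q) * r₁ + ψ ^ 2 * (f ^ 2 * r + Q * (2 * f * r₂))|
        + K * ((P * A * (d ^ 2 / T)) ^ 2 + (P * A * (|Q| * d / T)) ^ 2 + (P * A * |Q|) ^ 2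
          + (A / P) ^ 2) := by
  have hC0 : 0 < C := by linarith
  obtain ⟨W, hW⟩ : ∃ W, W = (2 + 2 * N) * C ^ 4 := ⟨_, rfl⟩
  have hW0 : 0 < W := by rw [hW]; positivity
  refine ⟨4 * (W ^ 2 / (3 * c) + W), by positivity, ?_⟩
  intro P A T ψ f y d Q s₁ s₂ ip r₁ r₂ r hP hA hT hψ hψ1 hf hfA hy hd h1 h2 h3 h4 h5 h6
  obtain ⟨z, hz⟩ : ∃ z, z = ψ * f * P * y := ⟨_, rfl⟩
  obtain ⟨b, hb⟩ : ∃ b, b = P * A * (d ^ 2 / T) := ⟨_, rfl⟩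
  obtain ⟨b', hb'⟩ : ∃ b', b' = P * A * (|Q| * d / T) := ⟨_, rfl⟩
  obtain ⟨e, he⟩ : ∃ e, e = P * A * |Q| := ⟨_, rfl⟩
  obtain ⟨e', he'⟩ : ∃ e', e' = A / P := ⟨_, rfl⟩
  have hz0 : 0 ≤ z := by rw [hz]; positivity
  have hb0 : 0 ≤ b := by rw [hb]; positivity
  have hb'0 : 0 ≤ b' := by rw [hb']; positivity
  have he0 : 0 ≤ e := by rw [he]; positivity
  have he'0 : 0 ≤ e' := by rw [he']; positivity
  have hψf : ψ * f ≤ C * A := (mul_le_of_le_one_left hf hψ1).trans hfA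
  have g2 : ψ * f * P * (d ^ 2 / T) ≤ C * b := by
    calc _ = ψ * f * (P * (d ^ 2 / T)) := by ring
      _ ≤ C * A * (P * (d ^ 2 / T)) := by gcongr
      _ = C * b := by rw [hb]; ring
  have g3 : ψ * f * P * (y + d ^ 2 / T) ≤ z + C * b := by
    rw [mul_add, ← hz]; linarith
  have g30 : 0 ≤ ψ * f * P * (y + d ^ 2 / T) := by positivity
  have t1 : |2 * ψ * (f ^ 2 * Q) * s₁| ≤ 2 * C ^ 3 * e * (z + C * b) := by
    calc _ = 2 * ψ * (f ^ 2 * |Q|) * |s₁| := by simp only [abs_mul, abs_of_nonneg hψ, abs_pow, abs_of_nonneg hf, abs_two]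
      _ ≤ 2 * ψ * (f ^ 2 * |Q|) * (C * (C * (P ^ 2 * y + P ^ 2 / T * d ^ 2))) := by gcongr
      _ = 2 * C ^ 2 * (f * (P * |Q|)) * (ψ * f * P * (y + d ^ 2 / T)) := by ring
      _ ≤ 2 * C ^ 2 * (C * A * (P * |Q|)) * (z + C * b) := by gcongr
      _ = _ := by rw [he]; ring
  have t2 : |ψ ^ 2 * (Q * (2 * f * s₂))| ≤ 2 * C ^ 2 * b' * (z + C * b) := by
    calc _ = 2 * ψ * ψ * (f * |Q|) * |s₂| := by
          simp only [abs_mul, abs_of_nonneg hψ, abs_pow, abs_of_nonneg hf, abs_two]; ring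
      _ ≤ 2 * ψ * ψ * (f * |Q|) * (C * (A / T) * d * (C * (P ^ 2 * y + P ^ 2 / T * d ^ 2))) := by
          gcongr
      _ = ψ * (2 * C ^ 2 * (P * A * (|Q| * d / T))) * (ψ * f * P * (y + d ^ 2 / T)) := by ring
      _ ≤ (2 * C ^ 2 * (P * A * (|Q| * d / T))) * (z + C * b) :=
          mul_le_mul (mul_le_of_le_one_left (by positivity) hψ1) g3 g30 (by positivity)
      _ = _ := by rw [hb']
  have t3 : c * z ^ 2 - C ^ 2 * z * b ≤ ψ ^ 2 * (f ^ 2 * ip) := by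
    have e1 : ψ ^ 2 * f ^ 2 * (c * (P ^ 2 * y ^ 2) - C * (P ^ 2 / T * d ^ 2 * y))
        = c * z ^ 2 - C * z * (ψ * f * P * (d ^ 2 / T)) := by rw [hz]; ring
    have e2 := mul_le_left h3 (by positivity : 0 ≤ ψ ^ 2 * f ^ 2)
    have e3 := mul_le_left g2 (by positivity : 0 ≤ C * z)
    rw [e1] at e2
    linarith
  have hAA : A ^ 2 * |Q| = e * e' := by rw [he, he']; field_simp
  have t4 : |2 * ψ * (f ^ 2 * Q) * r₁| ≤ 2 * C ^ 3 * e * e' := by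
    calc _ = 2 * ψ * (f ^ 2 * |Q|) * |r₁| := by
          simp only [abs_mul, abs_of_nonneg hψ, abs_pow, abs_of_nonneg hf, abs_two]
      _ ≤ 2 * 1 * ((C * A) ^ 2 * |Q|) * C := by gcongr
      _ = 2 * C ^ 3 * (A ^ 2 * |Q|) := by ring
      _ = _ := by rw [hAA]; ring
  have t5 : |ψ ^ 2 * (Q * (2 * f * r₂))| ≤ 2 * C ^ 2 * b' * e' := by
    calc _ = ψ ^ 2 * (|Q| * (2 * f * |r₂|)) := by
          simp only [abs_mul, abs_of_nonneg hψ, abs_pow, abs_of_nonneg hf, abs_two]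
      _ ≤ 1 ^ 2 * (|Q| * (2 * (C * A) * (C * (A / T) * d))) := by gcongr
      _ = _ := by rw [hb', he']; field_simp
  have t6 : |ψ ^ 2 * (f ^ 2 * r)| ≤ C * z * e' := by
    calc _ = ψ ^ 2 * (f ^ 2 * |r|) := by
          simp only [abs_mul, abs_of_nonneg hψ, abs_pow, abs_of_nonneg hf]
      _ ≤ ψ ^ 2 * (f ^ 2 * y) := by gcongr
      _ = z * (ψ * f / P) := by rw [hz]; field_simp
      _ ≤ z * (C * A / P) := by gcongr
      _ = _ := by rw [he']; ring
  rw [← hz, ← hb, ← hb', ← he, ← he']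
  have t7 : |2 * ψ * (f ^ 2 * Q) * r₁ + ψ ^ 2 * (f ^ 2 * r + Q * (2 * f * r₂))|
      ≤ 2 * C ^ 3 * e * e' + 2 * C ^ 2 * b' * e' + C * z * e' := by
    have e1 := abs_add_le (2 * ψ * (f ^ 2 * Q) * r₁) (ψ ^ 2 * (f ^ 2 * r + Q * (2 * f * r₂)))
    have e2 := abs_add_le (ψ ^ 2 * (f ^ 2 * r)) (ψ ^ 2 * (Q * (2 * f * r₂)))
    rw [← mul_add] at e2
    linarith
  have t8 := mul_le_left t7 hN
  have t1' := (abs_le.1 t1).1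
  have t2' := (abs_le.1 t2).1
  have key := absorb_products (r := 2 * C ^ 3 * e * (z + C * b) + 2 * C ^ 2 * b' * (z + C * b)
    + C ^ 2 * z * b + N * (2 * C ^ 3 * e * e' + 2 * C ^ 2 * b' * e' + C * z * e'))
    (W := W) (y := z) (b := b) (b' := b') (e := e) (e' := e') hc hW0.le ?_
  · linarith [mul_add (ψ ^ 2) (f ^ 2 * ip) (Q * (2 * f * s₂))]
  · have i1 : 2 * C ^ 3 * e * (z + C * b) + 2 * C ^ 2 * b' * (z + C * b) + C ^ 2 * z * b
        ≤ 2 * C ^ 4 * (z * (b + b' + e + e') + (b + b' + e + e') ^ 2) := by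
      calc _ = C ^ 3 * (2 * (z * e) + 2 * (b' * b)) + C ^ 4 * (2 * (e * b))
            + C ^ 2 * (2 * (z * b') + z * b) := by ring
        _ ≤ C ^ 4 * (2 * (z * e) + 2 * (b' * b)) + C ^ 4 * (2 * (e * b))
            + C ^ 4 * (2 * (z * b') + z * b) := by gcongr <;> norm_num
        _ ≤ _ := by rw [← sub_nonneg]; ring_nf; positivity
    have i2 : 2 * C ^ 3 * e * e' + 2 * C ^ 2 * b' * e' + C * z * e'
        ≤ 2 * C ^ 4 * (z * (b + b' + e + e') + (b + b' + e + e') ^ 2) := by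
      calc _ = C ^ 3 * (2 * (e * e')) + C ^ 2 * (2 * (b' * e')) + C ^ 1 * (z * e') := by ring
        _ ≤ C ^ 4 * (2 * (e * e')) + C ^ 4 * (2 * (b' * e')) + C ^ 4 * (z * e') := by
          gcongr <;> norm_num
        _ ≤ _ := by rw [← sub_nonneg]; ring_nf; positivity
    rw [hW]
    linarith [mul_le_left i2 hN]

lemma second_order_rhs_le {T Q : ℝ} (hT : 0 < T) (hTM : T ≤ M)
    (hpα : 0 ≤ p + α) (hαp : 0 ≤ α + 2 - p) :
    (T ^ ((p - 2) / 2) * T ^ (α / 2) * (d ^ 2 / T)) ^ 2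
      + (T ^ ((p - 2) / 2) * T ^ (α / 2) * (|Q| * d / T)) ^ 2
      + (T ^ ((p - 2) / 2) * T ^ (α / 2) * |Q|) ^ 2 + (T ^ (α / 2) / T ^ ((p - 2) / 2)) ^ 2
    ≤ 2 * (T ^ (p - 4 + α) * d ^ 4) + 2 * (T ^ (p - 4 + α) * Q ^ 4)
      + (M ^ (p + α) + M ^ (α + 2 - p)) := by
  obtain ⟨W, hW⟩ : ∃ W, W = T ^ (p - 4 + α) := ⟨_, rfl⟩
  have hW0 : 0 < W := hW ▸ rpow_pos_of_pos hT _
  have e0 : (T ^ ((p - 2) / 2) * T ^ (α / 2)) ^ 2 = W * T ^ 2 := by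
    rw [hW, ← rpow_add hT, ← rpow_natCast, ← rpow_mul hT.le, ← rpow_natCast T,
      ← rpow_add hT]
    congr 1; push_cast; ring
  have e1 : (T ^ (α / 2) / T ^ ((p - 2) / 2)) ^ 2 = T ^ (α + 2 - p) := by
    rw [← rpow_sub hT, ← rpow_natCast, ← rpow_mul hT.le]
    congr 1; push_cast; ring
  have e2 : W * T ^ 4 = T ^ (p + α) := by
    rw [hW, ← rpow_natCast T, ← rpow_add hT]; congr 1; push_cast; ring
  have h1 : T ^ (α + 2 - p) ≤ M ^ (α + 2 - p) := rpow_le_rpow hT.le hTM hαp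
  have h2 : T ^ (p + α) ≤ M ^ (p + α) := rpow_le_rpow hT.le hTM hpα
  rw [mul_pow (_ * _) (d ^ 2 / T), mul_pow (_ * _) (|Q| * d / T), mul_pow (_ * _) |Q|, e0, e1, ← hW]
  have e3 : W * T ^ 2 * (d ^ 2 / T) ^ 2 = W * d ^ 4 := by field_simp
  have e4 : W * T ^ 2 * (|Q| * d / T) ^ 2 = W * (Q ^ 2 * d ^ 2) := by
    rw [div_pow, mul_pow, sq_abs]; field_simp
  rw [e3, e4, sq_abs]
  have h3 : W * (Q ^ 2 * d ^ 2) ≤ W * d ^ 4 + W * Q ^ 4 := by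
    rw [← mul_add]
    exact mul_le_left (by nlinarith [sq_nonneg (Q ^ 2 - d ^ 2), sq_nonneg (Q * d)])
      hW0.le
  have h4 : W * T ^ 2 * Q ^ 2 ≤ W * T ^ 4 + W * Q ^ 4 := by
    rw [mul_assoc, ← mul_add]
    exact mul_le_left (by nlinarith [sq_nonneg (Q ^ 2 - T ^ 2), sq_nonneg (Q * T)])
      hW0.le
  linarith

lemma sum_sq_pow_four_le (Y : Fin n → ℝ) : √(∑ k, Y k ^ 2) ^ 4 ≤ n * ∑ k, Y k ^ 4 := by
  have h0 : 0 ≤ ∑ k, Y k ^ 2 := sum_nonneg fun k _ => sq_nonneg _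
  calc √(∑ k, Y k ^ 2) ^ 4 = (∑ k, Y k ^ 2) ^ 2 := by
        rw [show (4:ℕ) = 2 * 2 from rfl, pow_mul, sq_sqrt h0]
    _ ≤ (Finset.univ : Finset (Fin n)).card * ∑ k, (Y k ^ 2) ^ 2 := sq_sum_le_card_mul_sum_sq
    _ = _ := by simp [← pow_mul]

namespace PData

include P

omit P in
lemma exists_weight_bounds (α : ℝ) : ∃ C, 0 < C ∧
    ∀ (X : Euc n → Euc n) (u : Euc n → ℝ) (ε η h : ℝ) (x : Euc n), 0 < ε → η ≤ ε / 4 →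
      GoodStep X u η h → ε ≤ ‖dvec h u x‖ →
      tr ε (α / 4) (‖dvec h u x‖ ^ 2) ≤ C * ‖X x‖ ^ (α / 2) ∧
      ∀ v, |deriv (tr ε (α / 4)) (‖dvec h u x‖ ^ 2) * ⟪(2:ℝ) • nvec h u X x, v⟫_ℝ|
        ≤ C * (‖X x‖ ^ (α / 2) / ‖X x‖) * √(sqn h X x) * ‖v‖ := by
  obtain ⟨C1, hC1, hd⟩ := tr_deriv_bound (α / 4)
  have ha1 : 0 ≤ C1 * 2 ^ |α / 2 - 1| * (2 * n) := by positivity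
  have ha2 : 0 < (2:ℝ) ^ |α / 2| := by positivity
  refine ⟨2 ^ |α / 2| + C1 * 2 ^ |α / 2 - 1| * (2 * n), by positivity, ?_⟩
  intro X u ε η h x hε hη hg hx
  obtain ⟨b1, b2, b3⟩ := hg.comparable hη hx hε
  have hD : 0 < ‖dvec h u x‖ := hε.trans_le hx
  have ht : 0 < ‖X x‖ := by linarith
  constructor
  · refine (tr_le _ (sq_nonneg _)).trans ?_
    rw [show α / 4 = α / 2 / 2 by ring, sq_rpow_half hD.le]
    refine (rpow_comparable (α / 2) ht b2 b3).trans ?_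
    exact mul_le_right (by linarith) (by positivity)
  · intro v
    have h1 := hd ε (‖dvec h u x‖ ^ 2) hε (by positivity)
    rw [show α / 4 - 1 = (α / 2 - 2) / 2 by ring, sq_rpow_half hD.le] at h1
    have h2 : |⟪(2:ℝ) • nvec h u X x, v⟫_ℝ| ≤ 2 * (‖dvec h u x‖ * (n * √(sqn h X x))) * ‖v‖ := by
      refine (abs_real_inner_le_norm _ _).trans (mul_le_right ?_ (norm_nonneg _))
      rw [norm_smul, norm_two]
      exact mul_le_left (nvec_norm_le u X h x) zero_le_two
    have h3 := rpow_comparable (α / 2 - 1) ht b2 b3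
    rw [abs_mul]
    refine (mul_le_mul h1 h2 (abs_nonneg _) (by positivity)).trans ?_
    have e1 : ‖dvec h u x‖ ^ (α / 2 - 2) * ‖dvec h u x‖ = ‖dvec h u x‖ ^ (α / 2 - 1) := by
      rw [← rpow_add_one hD.ne']; congr 1; ring
    have e2 : ‖X x‖ ^ (α / 2) / ‖X x‖ = ‖X x‖ ^ (α / 2 - 1) := by
      rw [rpow_sub_one ht.ne']
    have hs := sqrt_nonneg (sqn h X x)
    rw [e2]
    calc _ = C1 * (2 * n) * (‖dvec h u x‖ ^ (α / 2 - 2) * ‖dvec h u x‖)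
            * (√(sqn h X x) * ‖v‖) := by ring
      _ ≤ C1 * (2 * n) * (2 ^ |α / 2 - 1| * ‖X x‖ ^ (α / 2 - 1)) * (√(sqn h X x) * ‖v‖) := by
          rw [e1]
          exact mul_le_right (mul_le_left h3 (by positivity))
            (by positivity)
      _ = C1 * 2 ^ |α / 2 - 1| * (2 * n) * (‖X x‖ ^ (α / 2 - 1) * √(sqn h X x) * ‖v‖) := by ring
      _ ≤ (2 ^ |α / 2| + C1 * 2 ^ |α / 2 - 1| * (2 * n)) *
            (‖X x‖ ^ (α / 2 - 1) * √(sqn h X x) * ‖v‖) :=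
          mul_le_right (by linarith) (by positivity)
      _ = _ := by ring

lemma second_weight_hasFDerivAt (hε : 0 < ε) (h : ℝ) (k l : Fin n)
    (x : Euc n) :
    HasFDerivAt (fun x => tr ε e (‖dvec h u x‖ ^ 2) ^ 2 * dq h l (dq h k u) x)
      (tr ε e (‖dvec h u x‖ ^ 2) ^ 2 • innerSL ℝ (dq h l (dq h k X) x)
        + dq h l (dq h k u) x • ((2 * tr ε e (‖dvec h u x‖ ^ 2)) •
          (deriv (tr ε e) (‖dvec h u x‖ ^ 2) • innerSL ℝ ((2:ℝ) • nvec h u X x)))) x := by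
  have h1 := dq_hasFDerivAt (P.dqu_hasFDerivAt h k) h l x
  rw [dq_clm (innerSL ℝ)] at h1
  have h2 := ((tr_hasDerivAt (ε := ε) e hε _).comp_hasFDerivAt x (P.dvec_normsq_hasFDerivAt h x)).pow 2
  refine (h2.mul h1).congr_fderiv ?_
  ext v
  simp [smul_smul]
  exact Or.inl rfl

lemma second_weight_contDiff (hε : 0 < ε) (h : ℝ) (k l : Fin n) :
    ContDiff ℝ 1 (fun x => tr ε e (‖dvec h u x‖ ^ 2) ^ 2 * dq h l (dq h k u) x) :=
  ((((tr_contDiff e hε).of_le (by simp)).comp ((P.dvec_contDiff h).norm_sq ℝ)).pow 2).mul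
    (dq_contDiff (dq_contDiff P.u_contDiff h k) h l)

omit P in
set_option maxHeartbeats 1000000 in
lemma exists_second_pointwise {N : ℝ} (hp1 : 1 < p) (hpα : 0 ≤ p + α) (hαp : 0 ≤ α + 2 - p)
    (hL : 0 ≤ L) (hN : 0 ≤ N) (hM : 0 ≤ M) : ∃ c > 0, ∃ K > 0, ∃ δ > 0,
    ∀ (X : Euc n → Euc n) (u : Euc n → ℝ) (ε η h : ℝ) (x : Euc n) (k l : Fin n) (ψ : ℝ)
      (ψ' : Euc n →L[ℝ] ℝ), 0 < ε → η ≤ ε / 4 → η ≤ δ * (ε / 2) → GoodStep X u η h →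
      ε ≤ ‖dvec h u x‖ → ‖X x‖ ≤ M → 0 ≤ ψ → ψ ≤ 1 → (∀ v, |ψ' v| ≤ L * ‖v‖) →
      c * (ψ * tr ε (α / 4) (‖dvec h u x‖ ^ 2) * ‖X x‖ ^ ((p - 2) / 2) *
          ‖dq h l (dq h k X) x‖) ^ 2 ≤
        (2 * ψ * (tr ε (α / 4) (‖dvec h u x‖ ^ 2) ^ 2 * dq h l (dq h k u) x)
            * ψ' (dq h l (dq h k fun x => pv (p - 2) (X x)) x)
          + ψ ^ 2 * (tr ε (α / 4) (‖dvec h u x‖ ^ 2) ^ 2 *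
              ⟪dq h l (dq h k X) x, dq h l (dq h k fun x => pv (p - 2) (X x)) x⟫_ℝ
            + dq h l (dq h k u) x * (2 * tr ε (α / 4) (‖dvec h u x‖ ^ 2) *
              (deriv (tr ε (α / 4)) (‖dvec h u x‖ ^ 2) * ⟪(2:ℝ) • nvec h u X x,
                dq h l (dq h k fun x => pv (p - 2) (X x)) x⟫_ℝ))))
        - N * |2 * ψ * (tr ε (α / 4) (‖dvec h u x‖ ^ 2) ^ 2 * dq h l (dq h k u) x) * ψ' (ev l)
          + ψ ^ 2 * (tr ε (α / 4) (‖dvec h u x‖ ^ 2) ^ 2 * ⟪dq h l (dq h k X) x, ev l⟫_ℝ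
            + dq h l (dq h k u) x * (2 * tr ε (α / 4) (‖dvec h u x‖ ^ 2) *
              (deriv (tr ε (α / 4)) (‖dvec h u x‖ ^ 2) * ⟪(2:ℝ) • nvec h u X x, ev l⟫_ℝ)))|
        + K * (‖X x‖ ^ (p - 4 + α) * ∑ i, ‖dq h i X x‖ ^ 4
          + ‖X x‖ ^ (p - 4 + α) * dq h l (dq h k u) x ^ 4 + 1) := by
  obtain ⟨C1, hC1, c, hc, δ, hδ, hS⟩ := exists_dq_dqS (n := n) hp1
  obtain ⟨C2, hC2, hW⟩ := exists_weight_bounds (n := n) α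
  obtain ⟨K, hK, hA⟩ := exists_second_order_arith (C := C1 + C2 + L + 1) (c := c) (by linarith) hc hN
  obtain ⟨C, hC⟩ : ∃ C, C = C1 + C2 + L + 1 := ⟨_, rfl⟩
  rw [← hC] at hA
  obtain ⟨R, hR⟩ : ∃ R, R = M ^ (p + α) + M ^ (α + 2 - p) := ⟨_, rfl⟩
  have hR0 : 0 ≤ R := by rw [hR]; positivity
  refine ⟨c / 4, by positivity, K * (2 * n + 2 + R), by positivity, δ, hδ, ?_⟩
  intro X u ε η h x k l ψ ψ' hε hη hηδ hg hx hXM hψ hψ1 hψ'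
  obtain ⟨b1, b2, b3⟩ := hg.comparable hη hx hε
  have hT : 0 < ‖X x‖ := by linarith
  obtain ⟨s1, s2⟩ := hS X u η h x k l hg (norm_pos_iff.1 hT)
    (hηδ.trans (mul_le_left b1 hδ.le))
  obtain ⟨w1, w2⟩ := hW X u ε η h x hε hη hg hx
  have hf0 := tr_nonneg (ε := ε) (α / 4) (sq_nonneg ‖dvec h u x‖)
  have hrhs := second_order_rhs_le (d := √(sqn h X x)) (Q := dq h l (dq h k u) x) hT hXM hpα hαp
  have hd4 := sum_sq_pow_four_le (fun i => ‖dq h i X x‖)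
  have hdd : ‖dq h k X x‖ * ‖dq h l X x‖ ≤ √(sqn h X x) ^ 2 := by
    rw [sq]
    exact mul_le_mul (norm_le_sqrt_sqn _ _ _ _) (norm_le_sqrt_sqn _ _ _ _) (norm_nonneg _)
      (sqrt_nonneg _)
  have hD0 : 0 ≤ ‖dq h k X x‖ * ‖dq h l X x‖ := by positivity
  have hev : |⟪dq h l (dq h k X) x, ev l⟫_ℝ| ≤ ‖dq h l (dq h k X) x‖ := by
    simpa [norm_ev] using abs_real_inner_le_norm (dq h l (dq h k X) x) (ev l)
  have hp' := hψ' (ev l)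
  have hw2' := w2 (ev l)
  rw [norm_ev, mul_one] at hp' hw2'
  have hd0 := sqrt_nonneg (sqn h X x)
  have hpV := hψ' (dq h l (dq h k fun x => pv (p - 2) (X x)) x)
  have hwV := w2 (dq h l (dq h k fun x => pv (p - 2) (X x)) x)
  change √(sqn h X x) ^ 4 ≤ _ at hd4
  have hP2 : (‖X x‖ ^ ((p - 2) / 2)) ^ 2 = ‖X x‖ ^ (p - 2) := by
    rw [← rpow_natCast, ← rpow_mul hT.le]; congr 1; push_cast; ring
  have hP3 : (‖X x‖ ^ ((p - 2) / 2)) ^ 2 / ‖X x‖ = ‖X x‖ ^ (p - 3) := by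
    rw [hP2, ← rpow_sub_one hT.ne']; congr 1; ring
  have hA0 : 0 < ‖X x‖ ^ (α / 2) := rpow_pos_of_pos hT _
  have hP0 : 0 < ‖X x‖ ^ ((p - 2) / 2) := rpow_pos_of_pos hT _
  have hT2 : 0 < ‖X x‖ ^ (p - 2) := rpow_pos_of_pos hT _
  have hT3 : 0 < ‖X x‖ ^ (p - 3) := rpow_pos_of_pos hT _
  have hTa : 0 < ‖X x‖ ^ (p - 4 + α) := rpow_pos_of_pos hT _
  have hsum : 0 ≤ ∑ i, ‖dq h i X x‖ ^ 4 := sum_nonneg fun i _ => by positivity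
  have hy := norm_nonneg (dq h l (dq h k X) x)
  clear hS hW
  generalize ‖dq h k X x‖ * ‖dq h l X x‖ = D at *
  generalize hV : dq h l (dq h k fun x => pv (p - 2) (X x)) x = V at *
  generalize dq h l (dq h k X) x = Y at *
  generalize dq h l (dq h k u) x = Q at *
  generalize √(sqn h X x) = d at *
  generalize ∑ i, ‖dq h i X x‖ ^ 4 = S4 at *
  generalize tr ε (α / 4) (‖dvec h u x‖ ^ 2) = F at *
  have hVn : ‖V‖ ≤ C * (‖X x‖ ^ (p - 2) * ‖Y‖ + ‖X x‖ ^ (p - 3) * d ^ 2) := by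
    refine s1.trans (mul_le_mul (by linarith) ?_ ?_ (by linarith))
    · exact add_le_add_right (mul_le_left hdd hT3.le) _
    · positivity
  have hC0 : 0 ≤ C := by linarith
  have h2 : (0:ℝ) ≤ ‖X x‖ ^ (α / 2) / ‖X x‖ := by positivity
  have key := hA (‖X x‖ ^ ((p - 2) / 2)) (‖X x‖ ^ (α / 2)) ‖X x‖ ψ F ‖Y‖ d Q (ψ' V)
    (deriv (tr ε (α / 4)) (‖dvec h u x‖ ^ 2) * ⟪(2:ℝ) • nvec h u X x, V⟫_ℝ) ⟪Y, V⟫_ℝ (ψ' (ev l))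
    (deriv (tr ε (α / 4)) (‖dvec h u x‖ ^ 2) * ⟪(2:ℝ) • nvec h u X x, ev l⟫_ℝ) ⟪Y, ev l⟫_ℝ
    hP0 hA0 hT hψ hψ1 hf0 ?_ hy hd0 ?_ ?_ ?_ ?_ ?_ hev
  · refine key.trans (add_le_add_right ?_ _)
    rw [mul_assoc K]
    refine mul_le_left (hrhs.trans ?_) hK.le
    rw [← hR]
    have i1 := mul_le_left hd4 hTa.le
    have i2 : 0 ≤ ‖X x‖ ^ (p - 4 + α) * S4 := by positivity
    have i3 : 0 ≤ ‖X x‖ ^ (p - 4 + α) * Q ^ 4 := by positivity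
    have i4 : 0 ≤ (n:ℝ) := n.cast_nonneg
    have i5 := mul_nonneg hR0 i2
    have i6 := mul_nonneg hR0 i3
    have i7 := mul_nonneg i4 i3
    linarith
  · exact w1.trans (mul_le_right (by linarith) hA0.le)
  · rw [hP3, hP2]
    exact hpV.trans (mul_le_mul (by linarith) hVn (norm_nonneg _) hC0)
  · rw [hP3, hP2]
    refine hwV.trans (mul_le_mul ?_ hVn (norm_nonneg _) (by positivity))
    exact mul_le_right (mul_le_right (by linarith) h2) hd0
  · rw [hP3, hP2]
    refine le_trans (sub_le_sub_left ?_ _) s2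
    refine mul_le_mul (by linarith) ?_ ?_ hC0
    · exact mul_le_right (mul_le_left hdd hT3.le) hy
    · positivity
  · linarith
  · exact hw2'.trans (mul_le_right (mul_le_right (by linarith) h2) hd0)

lemma integral_pairing_dq_dq_le {N : ℝ} (hh : h ≠ 0)
    (hK : ∀ x ∈ K, ∀ v, ‖v‖ ≤ 2 * |h| → x + v ∈ O) (hN : ∀ x, |dq h k f x| ≤ N)
    (l : Fin n) (hφ : ContDiff ℝ 1 φ) (hφs : HasCompactSupport φ)
    (hφK : tsupport φ ⊆ K) :
    ∫ x, fderiv ℝ φ x (dq h l (dq h k flux) x)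
      ≤ N * ∫ x, |fderiv ℝ φ x (ev l)| := by
  rw [P.weakEq_dq_dq hK k l φ hφ hφs hφK,
    integral_dq_mul (dq_continuous P.f_contDiff.continuous h k) hφ.continuous hφs]
  have h1 := integral_dq_le (fun x => (hφ.differentiable (by simp) x).hasFDerivAt)
    (hφ.continuous_fderiv (by simp)) hφs (le_refl 1) (neg_ne_zero.2 hh) l
  simp only [rpow_one, norm_eq_abs] at h1
  have hN0 : 0 ≤ N := (abs_nonneg _).trans (hN 0)
  have hc := dq_continuous hφ.continuous (-h) l
  have hs := dq_cpt hφs (-h) l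
  refine (neg_le_abs _).trans ((abs_integral_le_integral_abs).trans ?_)
  refine le_trans ?_ (mul_le_left h1 hN0)
  rw [← integral_const_mul]
  refine integral_mono ?_ ?_ fun x => ?_
  · exact (((dq_continuous P.f_contDiff.continuous h k).mul hc).abs).integrable_cpt
      hs.mul_left.norm
  · exact (hc.abs.const_mul N |>.integrable_cpt hs.norm.mul_left)
  · simp only [abs_mul]
    exact mul_le_right (hN x) (abs_nonneg _)

set_option maxHeartbeats 1000000 in
lemma weighted_second_bound (hpα : 0 ≤ p + α) (hαp : 0 ≤ α + 2 - p)
    (h4 : ∀ K, IsCompact K → K ⊆ O → ∃ B, ∀ ε, 0 < ε → ∀₀ h, ∀ k,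
      ∫ x in bset X K ε, ‖X x‖ ^ (p - 4 + α) * ‖dq h k X x‖ ^ (4:ℝ) ≤ B)
    (hK : IsCompact K) (hKO : K ⊆ O) :
    ∃ B, ∀ ε, 0 < ε → ∀₀ h, ∀ k l,
      ∫ x in bset X K ε, ‖X x‖ ^ (α + p - 2) * ‖dq h l (dq h k X) x‖ ^ 2 ≤ B := by
  obtain ⟨M, hM, hXM⟩ := P.exists_bound
  obtain ⟨N, hN, hdf⟩ := P.dqf_bound
  obtain ⟨ψ, hψ⟩ := exists_cutoff P.isOpen hK hKO
  obtain ⟨L, hL, hψL⟩ := hψ.fderiv_bound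
  obtain ⟨c, hc, C, hC, δ, hδ, hpt⟩ := exists_second_pointwise (n := n) P.one_lt hpα hαp hL.le
    hN.le hM.le
  have hK'c : IsCompact (tsupport ψ) := hψ.cpt
  obtain ⟨B1, hB1⟩ := h4 _ hK'c hψ.sub
  obtain ⟨B2, hB2⟩ := P.weighted_four_dq_dq h4 hK'c hψ.sub
  have h2 : 0 < (2:ℝ) ^ |α / 2| := by positivity
  refine ⟨C * (n * B1 + B2 + volume.real (tsupport ψ)) / (c / ((2:ℝ) ^ |α / 2|) ^ 2),
    fun ε0 hε0 => ?_⟩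
  obtain ⟨ε, hεd⟩ : ∃ ε, ε = ε0 / 2 := ⟨_, rfl⟩
  have hε : 0 < ε := by rw [hεd]; positivity
  obtain ⟨η, hη⟩ : ∃ η, η = min (ε / 4) (δ * (ε / 2)) := ⟨_, rfl⟩
  have hη0 : 0 < η := by rw [hη]; positivity
  have hη1 : η ≤ ε / 4 := hη ▸ min_le_left _ _
  have hη2 : η ≤ δ * (ε / 2) := hη ▸ min_le_right _ _
  clear hη
  filter_upwards [P.eventually_good hη0, hB1 _ (half_pos hε), hB2 _ (half_pos hε),
    eventually_add_mem P.isOpen hK'c hψ.sub] with h hg hB1 hB2 hadd k l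
  obtain ⟨φ, hφd⟩ : ∃ φ : Euc n → ℝ, φ = fun x => ψ x ^ 2 *
    (tr ε (α / 4) (‖dvec h u x‖ ^ 2) ^ 2 * dq h l (dq h k u) x) := ⟨_, rfl⟩
  have hφ : ContDiff ℝ 1 φ := hφd ▸ ((hψ.contDiff.of_le (by simp)).pow 2).mul
    (P.second_weight_contDiff hε h k l)
  have hφs : HasCompactSupport φ := hφd ▸ hasCompactSupport_sq_mul hψ.cpt _
  have hφK : tsupport φ ⊆ tsupport ψ := hφd ▸ tsupport_sq_mul_subset _ _
  have hVc := dq_continuous (dq_continuous P.S_continuous h k) h l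
  have hYc := dq_continuous (P.dqX_continuous h k) h l
  have hQc := dq_continuous (dq_continuous P.u_contDiff.continuous h k) h l
  have hE1 : Continuous fun x => fderiv ℝ φ x (dq h l (dq h k flux) x) :=
    (hφ.continuous_fderiv (by simp)).clm_apply hVc
  have hE2 : Continuous fun x => fderiv ℝ φ x (ev l) :=
    (hφ.continuous_fderiv (by simp)).clm_apply continuous_const
  have hS1 := fderiv_pairing_hasCompactSupport hφs
    (dq h l (dq h k flux))
  have hS2 := fderiv_pairing_hasCompactSupport hφs (fun _ => ev l)
  have hS3 : HasCompactSupport fun x => N * |fderiv ℝ φ x (ev l)| := hS2.norm.mul_left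
  have hint := P.integral_pairing_dq_dq_le hg.ne hadd (hdf h hg.ne k) l hφ hφs hφK
  have hEx : ∀ x v, fderiv ℝ φ x v = 2 * ψ x *
      (tr ε (α / 4) (‖dvec h u x‖ ^ 2) ^ 2 * dq h l (dq h k u) x) * fderiv ℝ ψ x v
      + ψ x ^ 2 * (tr ε (α / 4) (‖dvec h u x‖ ^ 2) ^ 2 * ⟪dq h l (dq h k X) x, v⟫_ℝ
        + dq h l (dq h k u) x * (2 * tr ε (α / 4) (‖dvec h u x‖ ^ 2) *
          (deriv (tr ε (α / 4)) (‖dvec h u x‖ ^ 2) * ⟪(2:ℝ) • nvec h u X x, v⟫_ℝ))) := by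
    intro x v
    rw [hφd, fderiv_sq_mul (hψ.hasFDerivAt x) (P.second_weight_hasFDerivAt hε h k l x) v]
    rfl
  clear hφd
  have hA := bset_compact P.cont hK ε0
  have hB := bset_compact P.cont hK'c (ε / 2)
  have c4 : ∀ i, ContinuousOn (fun x => ‖X x‖ ^ (p - 4 + α) * ‖dq h i X x‖ ^ 4)
      (bset X (tsupport ψ) (ε / 2)) := fun i =>
    (rpow_continuousOn_bset P.cont _ (half_pos hε) _).mul
      ((P.dqX_continuous h i).norm.pow 4).continuousOn
  have cQ : ContinuousOn (fun x => ‖X x‖ ^ (p - 4 + α) * dq h l (dq h k u) x ^ 4)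
      (bset X (tsupport ψ) (ε / 2)) :=
    (rpow_continuousOn_bset P.cont _ (half_pos hε) _).mul (hQc.pow 4).continuousOn
  have cS : ContinuousOn (fun x => ‖X x‖ ^ (p - 4 + α) * ∑ i, ‖dq h i X x‖ ^ 4)
      (bset X (tsupport ψ) (ε / 2)) := by
    simp only [mul_sum]
    exact continuousOn_finsetSum _ fun i _ => c4 i
  have hlow := integral_lower hA hB
    (E := fun x => fderiv ℝ φ x (dq h l (dq h k flux) x)
      - N * |fderiv ℝ φ x (ev l)|)
    (F₁ := fun x => c / ((2:ℝ) ^ |α / 2|) ^ 2 * (‖X x‖ ^ (α + p - 2) *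
      ‖dq h l (dq h k X) x‖ ^ 2))
    (F₂ := fun x => C * (‖X x‖ ^ (p - 4 + α) * ∑ i, ‖dq h i X x‖ ^ 4
          + ‖X x‖ ^ (p - 4 + α) * dq h l (dq h k u) x ^ 4 + 1))
    (hE1.sub (hE2.abs.const_mul N)) (hS1.sub hS3)
    (((rpow_continuousOn_bset P.cont _ hε0 _).mul (hYc.norm.pow 2).continuousOn).const_smul
      (c / ((2:ℝ) ^ |α / 2|) ^ 2))
    (((cS.add cQ).add continuousOn_const).const_smul C) ?_
  · have i0 : ∫ x, (fderiv ℝ φ x (dq h l (dq h k flux) x)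
        - N * |fderiv ℝ φ x (ev l)|) ≤ 0 := by
      rw [integral_sub (hE1.integrable_cpt hS1)
        ((hE2.abs.const_mul N).integrable_cpt hS3), integral_const_mul]
      linarith
    have i1 : ∫ x in bset X (tsupport ψ) (ε / 2), ‖X x‖ ^ (p - 4 + α) * ∑ i, ‖dq h i X x‖ ^ 4
        ≤ n * B1 := by
      simp only [mul_sum]
      rw [integral_finsetSum _ fun i _ => (c4 i).integrableOn_compact hB]
      refine (sum_le_sum (g := fun _ => B1) fun i _ => ?_).trans_eq (by simp)
      refine le_trans (le_of_eq ?_) (hB1 i)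
      simp_rw [← rpow_natCast]
      norm_num
    have i2 : ∫ x in bset X (tsupport ψ) (ε / 2), ‖X x‖ ^ (p - 4 + α) * dq h l (dq h k u) x ^ 4
        ≤ B2 := by
      refine le_trans (le_of_eq ?_) (hB2 l k)
      congr 1 with x
      rw [show (4:ℝ) = ((4:ℕ):ℝ) by norm_num, rpow_natCast, Even.pow_abs (by decide)]
    have i3 : volume.real (bset X (tsupport ψ) (ε / 2)) ≤ volume.real (tsupport ψ) :=
      measureReal_mono inter_subset_left hK'c.measure_lt_top.ne
    have I1 := cS.integrableOn_compact (μ := volume) hB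
    have I2 := cQ.integrableOn_compact (μ := volume) hB
    have I12 : IntegrableOn (fun x => ‖X x‖ ^ (p - 4 + α) * ∑ i, ‖dq h i X x‖ ^ 4
      + ‖X x‖ ^ (p - 4 + α) * dq h l (dq h k u) x ^ 4) (bset X (tsupport ψ) (ε / 2)) := I1.add I2
    rw [integral_const_mul, integral_const_mul, integral_add I12
      (continuousOn_const.integrableOn_compact hB), integral_add I1 I2, setIntegral_const,
      smul_eq_mul, mul_one] at hlow
    rw [le_div_iff₀ (by positivity)]
    have := mul_le_left (add_le_add (add_le_add i1 i2) i3) hC.le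
    linarith
  · intro x
    have hF0 : ∀ x, 0 ≤ C * (‖X x‖ ^ (p - 4 + α) * ∑ i, ‖dq h i X x‖ ^ 4
          + ‖X x‖ ^ (p - 4 + α) * dq h l (dq h k u) x ^ 4 + 1) := fun x => by positivity
    by_cases hx : x ∈ tsupport ψ ∧ ε ≤ ‖dvec h u x‖
    · obtain ⟨a1, a2, a3⟩ := hg.comparable hη1 hx.2 hε
      rw [indicator_of_mem (show x ∈ bset X (tsupport ψ) (ε / 2) from ⟨hx.1, a1⟩), hEx, hEx]
      have key := hpt X u ε η h x k l (ψ x) (fderiv ℝ ψ x) hε hη1 hη2 hg hx.2 (hXM x)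
        (hψ.nonneg x) (hψ.le_one x) (hψL x)
      refine le_trans ?_ key
      by_cases hxA : x ∈ bset X K ε0
      · rw [indicator_of_mem hxA, hψ.one hxA.1]
        obtain ⟨hD, hD2⟩ := hg.large hη1 (by have hx1 : ε0 ≤ ‖X x‖ := hxA.2; linarith) hε
        have ht : 0 < ‖X x‖ := by linarith
        have hD0 : 0 < ‖dvec h u x‖ := by linarith
        rw [tr_eq _ hε hD2, show α / 4 = α / 2 / 2 by ring, sq_rpow_half hD0.le]
        have htri : |‖dvec h u x‖ - ‖X x‖| ≤ η := (abs_norm_sub_norm_le _ _).trans (hg.dvec x)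
        have hx0 : ε0 ≤ ‖X x‖ := hxA.2
        obtain ⟨htri1, htri2⟩ := abs_le.1 htri
        have h3 := rpow_comparable (α / 2) (s := ‖X x‖) hD0 (by linarith) (by linarith)
        have h4 := pow_le_pow_left₀ (rpow_nonneg ht.le _) h3 2
        have e1 : ‖X x‖ ^ (α + p - 2) = (‖X x‖ ^ (α / 2)) ^ 2 * (‖X x‖ ^ ((p - 2) / 2)) ^ 2 := by
          rw [← mul_pow, ← rpow_add ht, ← rpow_natCast, ← rpow_mul ht.le]
          congr 1; push_cast; ring
        rw [e1, mul_pow] at *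
        calc _ = c / ((2:ℝ) ^ |α / 2|) ^ 2 * ((‖X x‖ ^ ((p - 2) / 2)) ^ 2 *
              ‖dq h l (dq h k X) x‖ ^ 2) * (‖X x‖ ^ (α / 2)) ^ 2 := by ring
          _ ≤ c / ((2:ℝ) ^ |α / 2|) ^ 2 * ((‖X x‖ ^ ((p - 2) / 2)) ^ 2 *
              ‖dq h l (dq h k X) x‖ ^ 2) * (((2:ℝ) ^ |α / 2|) ^ 2 *
                (‖dvec h u x‖ ^ (α / 2)) ^ 2) :=
              mul_le_left h4 (by positivity)
          _ = _ := by field_simp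
      · rw [indicator_of_notMem hxA]
        positivity
    · have hxE : ∀ v, fderiv ℝ φ x v = 0 := fun v => by
        by_cases hxK : x ∈ tsupport ψ
        · have hd : ‖dvec h u x‖ < ε := not_le.1 fun hh => hx ⟨hxK, hh⟩
          rw [hEx, tr_zero _ hε (by gcongr : ‖dvec h u x‖ ^ 2 ≤ ε ^ 2)]
          simp
        · rw [hEx]; simp [zero_off_tsupport hxK]
      have hxA : x ∉ bset X K ε0 := fun hxA => hx
        ⟨subset_tsupport ψ (by simp [hψ.one hxA.1]),
          (hg.large hη1 (by have hx1 : ε0 ≤ ‖X x‖ := hxA.2; linarith) hε).1⟩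
      rw [indicator_of_notMem hxA, hxE, hxE]
      simp only [abs_zero, mul_zero, sub_zero, zero_add]
      exact indicator_nonneg (fun x _ => hF0 x) x

end PData

lemma exists_Phi_dq_dq (m : ℝ) : ∃ C, 0 ≤ C ∧ ∀ (X : Euc n → Euc n) (u : Euc n → ℝ) (ε η h : ℝ)
    (x : Euc n) (j l : Fin n), 0 < ε → GoodStep X u η h → η ≤ ε / 16 →
      (ε / 2 ≤ ‖X x‖ → ‖dq h j (dq h l fun x => Phi ε m (X x)) x‖
        ≤ C * (‖X x‖ ^ m * ‖dq h j (dq h l X) x‖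
          + ‖X x‖ ^ (m - 1) * (‖dq h l X x‖ * ‖dq h j X x‖))) ∧
      (‖X x‖ < ε / 2 → dq h j (dq h l fun x => Phi ε m (X x)) x = 0) := by
  obtain ⟨C, hC, hCb⟩ := Phi_second_taylor (n := n) m
  obtain ⟨D, hD, hDb⟩ := Phi_fderiv_bound (n := n) m
  refine ⟨D + C, by positivity, fun X u ε η h x j l hε hg hη => ?_⟩
  have hjl : ‖h • ev j + h • ev l‖ ≤ 2 * |h| := (norm_add_le _ _).trans (by
    rw [norm_smul_ev, norm_smul_ev]; linarith)
  have o1 : ‖X (x + h • ev l) - X x‖ ≤ η := hg.osc x _ (by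
    rw [norm_smul_ev]; linarith [abs_nonneg h])
  have o2 : ‖X (x + h • ev j) - X x‖ ≤ η := hg.osc x _ (by
    rw [norm_smul_ev]; linarith [abs_nonneg h])
  have o3 : ‖X (x + h • ev j + h • ev l) - X x‖ ≤ η := by
    rw [add_assoc]; exact hg.osc x _ hjl
  refine ⟨fun hx => ?_, fun hx => ?_⟩
  · have hx0 : X x ≠ 0 := fun h0 => by rw [h0, norm_zero] at hx; linarith
    have ht : 0 < ‖X x‖ := norm_pos_iff.2 hx0
    have key := hCb ε hε (X x) (X (x + h • ev l)) (X (x + h • ev j)) (X (x + h • ev j + h • ev l))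
      (‖X x‖ / 8) hx0 le_rfl (o1.trans (by linarith)) (o2.trans (by linarith))
      (o3.trans (by linarith))
    obtain ⟨ξ, hξ⟩ : ∃ ξ, ξ = X (x + h • ev j + h • ev l) - X (x + h • ev j)
      - (X (x + h • ev l) - X x) := ⟨_, rfl⟩
    have eξ : dq h j (dq h l X) x = h⁻¹ • h⁻¹ • ξ := by
      simp only [dq, hξ, smul_sub]
    have eP : dq h j (dq h l fun x => Phi ε m (X x)) x = h⁻¹ • h⁻¹ •
        (Phi ε m (X (x + h • ev j + h • ev l)) - Phi ε m (X (x + h • ev j))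
          - (Phi ε m (X (x + h • ev l)) - Phi ε m (X x))) := by
      simp only [dq, smul_sub]
    rw [← hξ] at key
    have h1 := (ContinuousLinearMap.le_opNorm (fderiv ℝ (Phi ε m) (X x)) ξ).trans
      (mul_le_right (hDb ε hε (X x) hx0) (norm_nonneg _))
    have h2 := norm_sub_norm_le (Phi ε m (X (x + h • ev j + h • ev l)) - Phi ε m (X (x + h • ev j))
          - (Phi ε m (X (x + h • ev l)) - Phi ε m (X x))) (fderiv ℝ (Phi ε m) (X x) ξ)
    have e1 : ‖X x‖ ^ (m - 1) * ‖X x‖ = ‖X x‖ ^ m := by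
      rw [← rpow_add_one ht.ne']; congr 1; ring
    have h3 : ‖Phi ε m (X (x + h • ev j + h • ev l)) - Phi ε m (X (x + h • ev j))
          - (Phi ε m (X (x + h • ev l)) - Phi ε m (X x))‖ ≤ (D + C) * (‖X x‖ ^ m * ‖ξ‖
          + ‖X x‖ ^ (m - 1) * (‖X (x + h • ev l) - X x‖ * ‖X (x + h • ev j) - X x‖)) := by
      have p1 : 0 ≤ ‖X x‖ ^ m * ‖ξ‖ := by positivity
      have p2 : 0 ≤ ‖X x‖ ^ (m - 1) * (‖X (x + h • ev l) - X x‖ * ‖X (x + h • ev j) - X x‖) := by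
        positivity
      have e2 : C * ‖X x‖ ^ (m - 1) * (‖X x‖ / 8 * ‖ξ‖
          + ‖X (x + h • ev l) - X x‖ * ‖X (x + h • ev j) - X x‖)
          = C / 8 * (‖X x‖ ^ m * ‖ξ‖) + C * (‖X x‖ ^ (m - 1) *
            (‖X (x + h • ev l) - X x‖ * ‖X (x + h • ev j) - X x‖)) := by
        rw [← e1]; ring
      rw [e2] at key
      have p3 := mul_nonneg hC p1
      have p4 := mul_nonneg hD p2
      linarith
    rw [eP, eξ]
    simp only [dq, norm_smul]
    calc _ ≤ ‖h⁻¹‖ * (‖h⁻¹‖ * _) := mul_le_left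
          (mul_le_left h3 (norm_nonneg _)) (norm_nonneg _)
      _ = _ := by ring
  · have hle : ∀ y, ‖X y - X x‖ ≤ η → ‖X y‖ ≤ ε := fun y hy => by
      have := norm_sub_norm_le (X y) (X x)
      linarith
    simp only [dq]
    rw [Phi_zero hε (hle _ o1), Phi_zero hε (hle _ o2), Phi_zero hε (hle _ o3),
      Phi_zero hε (by linarith)]
    simp

lemma tendsto_integral_mul_dq_dq_neg (hg : Continuous g)
    (hφ : Smooth φ) (hs : HasCompactSupport φ) (j k : Fin n) :
    Tendsto (fun h => ∫ x, g x * dq (-h) j (dq (-h) k φ) x) (𝓝[≠] 0)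
      (𝓝 (∫ x, g x * pd (pd φ k) j x)) := by
  have h1 : Tendsto (fun h : ℝ => -h) (𝓝[≠] 0) (𝓝[≠] 0) := by
    refine tendsto_nhdsWithin_iff.2 ⟨?_, ?_⟩
    · have : Tendsto (fun h : ℝ => -h) (𝓝 0) (𝓝 (-0)) := continuous_neg.tendsto 0
      rw [neg_zero] at this
      exact this.mono_left nhdsWithin_le_nhds
    · filter_upwards [self_mem_nhdsWithin] with h hh using by simpa using hh
  exact (tendsto_integral_mul_dq_dq hg hφ hs j k).comp h1

lemma rpow_half_split {β : ℝ} (ht : 0 < t) :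
    t ^ m = t ^ (β / 2) * t ^ ((2 * m - β) / 2) := by
  rw [← rpow_add ht]; congr 1; ring

lemma rpow_half_sq {β : ℝ} (ht : 0 < t) : (t ^ (β / 2)) ^ 2 = t ^ β := by
  rw [← rpow_natCast, ← rpow_mul ht.le]; congr 1; push_cast; ring

lemma second_terms_sq_le (ht : 0 < t) :
    (t ^ ((α + p - 2) / 2) * a + t ^ ((p - 4 + α) / 2) * (b * c)) ^ 2
      ≤ 2 * (t ^ (α + p - 2) * a ^ 2) + (t ^ (p - 4 + α) * b ^ 4 + t ^ (p - 4 + α) * c ^ 4) := by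
  have e1 := rpow_half_sq (β := α + p - 2) ht
  have e2 := rpow_half_sq (β := p - 4 + α) ht
  have e3 : 0 ≤ t ^ (p - 4 + α) := by positivity
  have h1 := add_sq_le (a := t ^ ((α + p - 2) / 2) * a) (b := t ^ ((p - 4 + α) / 2) * (b * c))
  rw [mul_pow, mul_pow, e1, e2] at h1
  have h2 : 2 * (b * c) ^ 2 ≤ b ^ 4 + c ^ 4 := by nlinarith [sq_nonneg (b ^ 2 - c ^ 2)]
  have h3 := mul_le_left h2 e3
  linarith

lemma second_terms_split (ht : 0 < t) :
    t ^ m * a + t ^ (m - 1) * (b * c)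
      = (t ^ ((α + p - 2) / 2) * a + t ^ ((p - 4 + α) / 2) * (b * c))
        * t ^ ((2 * m + 2 - p - α) / 2) := by
  rw [rpow_half_split (m := m) (β := α + p - 2) ht,
    rpow_half_split (m := m - 1) (β := p - 4 + α) ht,
    show (2 * m - (α + p - 2)) / 2 = (2 * m + 2 - p - α) / 2 by ring,
    show (2 * (m - 1) - (p - 4 + α)) / 2 = (2 * m + 2 - p - α) / 2 by ring]
  ring

lemma setIntegral_sq_mul_rpow_le (hX : Continuous X)
    (hK : IsCompact K) {β : ℝ} (hw : IntegrableOn (fun x => ‖X x‖ ^ β) K)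
    (hφ : Continuous φ) (hε : 0 < ε) :
    ∫ x in bset X K ε, (‖X x‖ ^ (β / 2) * φ x) ^ 2
      ≤ ∫ x, φ x ^ 2 * K.indicator (fun x => ‖X x‖ ^ β) x := by
  have hA := bset_compact hX hK ε
  have e : ∫ x, φ x ^ 2 * K.indicator (fun x => ‖X x‖ ^ β) x = ∫ x in K, φ x ^ 2 * ‖X x‖ ^ β := by
    rw [← integral_indicator hK.measurableSet]
    congr 1 with x
    by_cases hx : x ∈ K <;> simp [hx]
  have hi : IntegrableOn (fun x => φ x ^ 2 * ‖X x‖ ^ β) K :=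
    hw.continuousOn_mul (hφ.pow 2).continuousOn hK
  rw [e]
  calc _ = ∫ x in bset X K ε, φ x ^ 2 * ‖X x‖ ^ β :=
        setIntegral_congr_fun hA.measurableSet fun x hx => by
          rw [mul_pow, rpow_half_sq (bset_pos hε hx), mul_comm]
    _ ≤ _ := setIntegral_mono_set hi (.of_forall fun x => by
          simp only [Pi.zero_apply]; positivity)
        (LE.le.eventuallyLE inter_subset_left)

namespace PData

include P

set_option maxHeartbeats 1000000 in
lemma second_deriv_bound (hm : -1 < m)
    (hK : IsCompact K)
    (hJ : ∃ B, ∀ ε, 0 < ε → ∀₀ h, ∀ k l,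
      ∫ x in bset X K ε, ‖X x‖ ^ (α + p - 2) * ‖dq h l (dq h k X) x‖ ^ 2 ≤ B)
    (h4 : ∃ B, ∀ ε, 0 < ε → ∀₀ h, ∀ k,
      ∫ x in bset X K ε, ‖X x‖ ^ (p - 4 + α) * ‖dq h k X x‖ ^ (4:ℝ) ≤ B)
    (hw : IntegrableOn (fun x => ‖X x‖ ^ (2 * m + 2 - p - α)) K) :
    ∃ C, ∀ φ, IsTestFun K φ → ∀ i j l, |∫ x, (pv m (X x)) i * pd (pd φ j) l x|
      ≤ C * √(∫ x, φ x ^ 2 * K.indicator (fun x => ‖X x‖ ^ (2 * m + 2 - p - α)) x) := by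
  obtain ⟨J, hJ⟩ := hJ
  obtain ⟨B, hB⟩ := h4
  obtain ⟨C, hC, hCb⟩ := exists_Phi_dq_dq (n := n) m
  refine ⟨C * √(2 * J + (B + B)), fun φ hφ i j l => ?_⟩
  refine abs_integral_pv_le P.cont hm i (pd_contDiff (pd_contDiff hφ.1 j) l).continuous
    (pd_cpt (pd_cpt hφ.2.1 j) l) fun ε hε => ?_
  have hi : Continuous fun z : Euc n => z i := by fun_prop
  have hVc : Continuous fun x => (Phi ε m (X x)) i :=
    hi.comp ((Phi_contDiff m hε).continuous.comp P.cont)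
  refine le_of_tendsto (tendsto_integral_mul_dq_dq_neg hVc hφ.1 hφ.2.1 l j).abs ?_
  filter_upwards [P.eventually_good (show 0 < ε / 16 by positivity), hB (ε / 2) (half_pos hε),
    hJ (ε / 2) (half_pos hε)] with h hg hBh hJh
  have hA := bset_compact P.cont hK (ε / 2)
  have hle := setIntegral_sq_mul_rpow_le P.cont hK hw hφ.1.continuous (half_pos hε)
  have hAK : bset X K (ε / 2) = K ∩ {x | ε / 2 ≤ ‖X x‖} := rfl
  have hApos : ∀ x ∈ bset X K (ε / 2), 0 < ‖X x‖ := fun x hx => bset_pos (half_pos hε) hx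
  have hr : ∀ β : ℝ, ContinuousOn (fun x => ‖X x‖ ^ β) (bset X K (ε / 2)) := fun β =>
    rpow_continuousOn_bset P.cont K (half_pos hε) β
  have hAmem : ∀ x ∈ bset X K (ε / 2), ε / 2 ≤ ‖X x‖ := fun x hx => hx.2
  obtain ⟨A, hAd⟩ : ∃ A, A = bset X K (ε / 2) := ⟨_, rfl⟩
  have hAm : MeasurableSet A := hAd ▸ hA.measurableSet
  have cφ := hφ.1.continuous
  have cY := (P.dqX_continuous h l)
  have cYl := (P.dqX_continuous h j)
  have cYY := dq_continuous (P.dqX_continuous h j) h l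
  have i4l := hBh l
  have i4j := hBh j
  have iJ := hJh j l
  rw [← hAd] at hA hle hApos hr hAmem i4l i4j iJ hAK
  clear hBh hJh hB hJ
  have e0 : |∫ x, (Phi ε m (X x)) i * dq (-h) l (dq (-h) j φ) x|
      = |∫ x, dq h j (dq h l fun x => (Phi ε m (X x)) i) x * φ x| := by
    have a1 := integral_dq_mul hVc (dq_continuous cφ (-h) j)
      (dq_cpt hφ.2.1 (-h) j) h l
    have a2 := integral_dq_mul (dq_continuous hVc h l) cφ hφ.2.1 h j
    rw [a2, a1, neg_neg]
  rw [e0]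
  have hco : ∀ x, dq h j (dq h l fun x => (Phi ε m (X x)) i) x
      = dq h j (dq h l fun x => Phi ε m (X x)) x i := fun x => by simp [dq]
  have hzero : ∀ x ∉ A, dq h j (dq h l fun x => (Phi ε m (X x)) i) x * φ x = 0 := fun x hx => by
    by_cases hxK : x ∈ K
    · have hlt : ‖X x‖ < ε / 2 := not_le.1 fun hle => hx (hAK ▸ ⟨hxK, hle⟩)
      rw [hco, (hCb X u ε (ε / 16) h x j l hε hg le_rfl).2 hlt]
      simp
    · rw [zero_off_tsupport fun hb => hxK (hφ.2.2 hb), mul_zero]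
  obtain ⟨F, hF⟩ : ∃ F : Euc n → ℝ, F = fun x => ‖X x‖ ^ ((α + p - 2) / 2)
      * ‖dq h l (dq h j X) x‖ + ‖X x‖ ^ ((p - 4 + α) / 2) * (‖dq h l X x‖ * ‖dq h j X x‖) :=
    ⟨_, rfl⟩
  obtain ⟨G, hG⟩ : ∃ G : Euc n → ℝ, G = fun x => ‖X x‖ ^ ((2 * m + 2 - p - α) / 2) * φ x :=
    ⟨_, rfl⟩
  have cF : ContinuousOn F A := by
    rw [hF]
    exact ((hr _).mul cYY.norm.continuousOn).add
      ((hr _).mul (cY.norm.mul cYl.norm).continuousOn)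
  have cG : ContinuousOn G A := by
    rw [hG]; exact (hr _).mul cφ.continuousOn
  have hbd : ∀ x ∈ A, |dq h j (dq h l fun x => (Phi ε m (X x)) i) x * φ x|
      ≤ C * (|F x| * |G x|) := fun x hx => by
    have ht := hApos x hx
    have k1 := (abs_apply_le_norm _ i).trans
      ((hCb X u ε (ε / 16) h x j l hε hg le_rfl).1 (hAmem x hx))
    rw [dq_comm X h h j l, second_terms_split (α := α) (p := p) ht] at k1
    rw [abs_mul, hco]
    refine (mul_le_right k1 (abs_nonneg _)).trans (le_of_eq ?_)
    have hF0 : 0 ≤ F x := by rw [hF]; positivity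
    rw [abs_of_nonneg hF0, hG, abs_mul, abs_of_nonneg (by positivity : 0 ≤
      ‖X x‖ ^ ((2 * m + 2 - p - α) / 2)), hF]
    ring
  have hF2 : ∫ x in A, F x ^ 2 ≤ 2 * J + (B + B) := by
    have c1 : IntegrableOn (fun x => ‖X x‖ ^ (α + p - 2) * ‖dq h l (dq h j X) x‖ ^ 2) A :=
      ((hr _).mul (cYY.norm.pow 2).continuousOn).integrableOn_compact hA
    have c2 : IntegrableOn (fun x => ‖X x‖ ^ (p - 4 + α) * ‖dq h l X x‖ ^ 4) A :=
      ((hr _).mul (cY.norm.pow 4).continuousOn).integrableOn_compact hA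
    have c3 : IntegrableOn (fun x => ‖X x‖ ^ (p - 4 + α) * ‖dq h j X x‖ ^ 4) A :=
      ((hr _).mul (cYl.norm.pow 4).continuousOn).integrableOn_compact hA
    have c1' : IntegrableOn (fun x => 2 * (‖X x‖ ^ (α + p - 2) * ‖dq h l (dq h j X) x‖ ^ 2)) A :=
      c1.const_mul 2
    have c23 : IntegrableOn (fun x => ‖X x‖ ^ (p - 4 + α) * ‖dq h l X x‖ ^ 4
        + ‖X x‖ ^ (p - 4 + α) * ‖dq h j X x‖ ^ 4) A := c2.add c3
    have c123 : IntegrableOn (fun x => 2 * (‖X x‖ ^ (α + p - 2) * ‖dq h l (dq h j X) x‖ ^ 2)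
        + (‖X x‖ ^ (p - 4 + α) * ‖dq h l X x‖ ^ 4
        + ‖X x‖ ^ (p - 4 + α) * ‖dq h j X x‖ ^ 4)) A := c1'.add c23
    have e4 : ∀ a : ℝ, a ^ (4:ℝ) = a ^ 4 := fun a => by
      rw [show (4:ℝ) = ((4:ℕ):ℝ) by norm_num, rpow_natCast]
    simp only [e4] at i4l i4j
    calc ∫ x in A, F x ^ 2 ≤ _ := setIntegral_mono_on
          ((cF.pow 2).integrableOn_compact hA) c123 hAm fun x hx => by
            rw [hF]; exact second_terms_sq_le (hApos x hx)
      _ = _ := by rw [integral_add c1' c23, integral_add c2 c3, integral_const_mul]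
      _ ≤ _ := add_le_add (mul_le_left iJ (by norm_num)) (add_le_add i4l i4j)
  rw [← setIntegral_eq_of_off hzero]
  have int1 : IntegrableOn (fun x => dq h j (dq h l fun x => (Phi ε m (X x)) i) x * φ x) A :=
    ((dq_continuous (dq_continuous hVc h l) h j).mul cφ).continuousOn.integrableOn_compact hA
  have cFG : ContinuousOn (fun x => C * (|F x| * |G x|)) A := (cF.abs.mul cG.abs).const_smul C
  calc |∫ x in A, dq h j (dq h l fun x => (Phi ε m (X x)) i) x * φ x|
      ≤ ∫ x in A, |dq h j (dq h l fun x => (Phi ε m (X x)) i) x * φ x| :=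
        abs_integral_le_integral_abs
    _ ≤ ∫ x in A, C * (|F x| * |G x|) :=
        setIntegral_mono_on int1.abs (cFG.integrableOn_compact hA) hAm hbd
    _ = C * ∫ x in A, |F x| * |G x| := integral_const_mul _ _
    _ ≤ C * (√(∫ x in A, F x ^ 2) * √(∫ x in A, G x ^ 2)) :=
        mul_le_left (setIntegral_mul_le_sqrt hA cF cG) hC
    _ ≤ _ := by
        rw [mul_assoc]
        refine mul_le_left (mul_le_mul (sqrt_le_sqrt hF2)
          (sqrt_le_sqrt ?_) (sqrt_nonneg _) (sqrt_nonneg _)) hC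
        rw [hG]; exact hle

end PData

lemma exists_pos_le_five (ha : 0 < a) (hb : 0 < b) (hc : 0 < c) (hd : 0 < d)
    (he : 0 < e) : ∃ κ, 0 < κ ∧ κ ≤ a ∧ κ < b ∧ κ ≤ c ∧ κ ≤ d ∧ κ ≤ e := by
  refine ⟨min a (min (b / 2) (min c (min d e))), by positivity, min_le_left _ _, ?_, ?_, ?_, ?_⟩
  · exact ((min_le_right _ _).trans (min_le_left _ _)).trans_lt (by linarith)
  · exact (min_le_right _ _).trans ((min_le_right _ _).trans (min_le_left _ _))
  · exact (min_le_right _ _).trans ((min_le_right _ _).trans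
      ((min_le_right _ _).trans (min_le_left _ _)))
  · exact (min_le_right _ _).trans ((min_le_right _ _).trans
      ((min_le_right _ _).trans (min_le_right _ _)))

lemma exists_integrable_representation
    (hg : Continuous g) (hw : Integrable w) (hw0 : ∀ x, 0 ≤ w x)
    (L : (Euc n → ℝ) → Euc n → ℝ) (hLc : ∀ φ, IsTestFun K φ → Continuous (L φ))
    (hLs : ∀ φ, IsTestFun K φ → HasCompactSupport (L φ))
    (hadd : ∀ φ ψ, IsTestFun K φ → IsTestFun K ψ → ∀ x,
      L (fun x => φ x + ψ x) x = L φ x + L ψ x)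
    (hsmul : ∀ (c : ℝ) φ, IsTestFun K φ → ∀ x, L (fun x => c * φ x) x = c * L φ x)
    (hT : ∀ φ, IsTestFun K φ → |∫ x, g x * L φ x| ≤ C * √(∫ x, φ x ^ 2 * w x)) :
    ∃ h : Euc n → ℝ, Integrable h ∧ ∀ φ, IsTestFun K φ → ∫ x, g x * L φ x = ∫ x, h x * φ x := by
  have hint : ∀ φ, IsTestFun K φ → Integrable fun x => g x * L φ x := fun φ hφ =>
    (hg.mul (hLc φ hφ)).integrable_cpt (hLs φ hφ).mul_left
  obtain ⟨G, hG, hGT⟩ := exists_representation hw hw0 (fun φ => ∫ x, g x * L φ x)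
    (fun φ ψ hφ hψ => by
      rw [← integral_add (hint φ hφ) (hint ψ hψ)]
      congr 1 with x
      rw [hadd φ ψ hφ hψ, mul_add])
    (fun c φ hφ => by
      rw [← integral_const_mul]
      congr 1 with x
      rw [hsmul c φ hφ]; ring) hT
  refine ⟨fun x => G x * √(w x), ?_, hGT⟩
  refine hG.integrable_mul ((memLp_two_iff_integrable_sq
    hw.1.aemeasurable.sqrt.aestronglyMeasurable).2 (hw.congr ?_))
  exact Eventually.of_forall fun x => (sq_sqrt (hw0 x)).symm

lemma pd_add (hφ : Smooth φ) (hψ : Smooth ψ)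
    (j : Fin n) : pd (fun x => φ x + ψ x) j = fun x => pd φ j x + pd ψ j x := by
  ext x
  simp only [pd]
  rw [fderiv_fun_add (hφ.differentiable (by simp) x) (hψ.differentiable (by simp) x),
    _root_.add_apply]

lemma pd_const_mul (hφ : Smooth φ) (c : ℝ)
    (j : Fin n) : pd (fun x => c * φ x) j = fun x => c * pd φ j x := by
  ext x
  simp only [pd]
  rw [fderiv_const_mul (hφ.differentiable (by simp) x), _root_.smul_apply, smul_eq_mul]

lemma integrableOn_rpow_of_le (hX : Continuous X)
    (hK : IsCompact K) {γ β : ℝ} (hγ : IntegrableOn (fun x => ‖X x‖ ^ γ) K)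
    (h0 : ∀ᵐ x ∂(volume.restrict K), X x ≠ 0) (hle : γ ≤ β) :
    IntegrableOn (fun x => ‖X x‖ ^ β) K := by
  have h1 : IntegrableOn (fun x => ‖X x‖ ^ (β - γ) * ‖X x‖ ^ γ) K :=
    hγ.continuousOn_mul (hX.norm.rpow_const fun x => Or.inr (by linarith)).continuousOn hK
  refine h1.congr (h0.mono fun x hx => ?_)
  simp only
  rw [← rpow_add (norm_pos_iff.2 hx)]; congr 1; ring

namespace PData

include P

theorem local_regularity {l₁ l₂ l₃ : ℝ} (hn : 0 < n) (hq : 2 ≤ q)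
    (hC0 : 0 ≤ C)
    (hC : HessBound n C q)
    (hs : |p - 2| < 1) (hsC : |p - 2| * C < 1) (hpq : (p - 2) * q < p - 1)
    (h1 : 0 ≤ l₁) (h2 : 0 ≤ l₂) (h3 : 0 ≤ l₃) (hsum : l₁ + l₂ + l₃ = 1)
    (h4 : l₁ * q + 2 * l₂ = 4) (ha : l₂ * (p - 3) - l₃ * (p - 1) < p - 4 + α)
    (hpα : 0 ≤ p + α) (hαp : 0 ≤ α + 2 - p) (hm : 0 ≤ m) (hαm : α < 2 * m + 1)
    {τ σ : ℝ} (hτ : 0 < τ) (hσ : ∀ x ∈ O, τ ≤ σ * f x) (hσ1 : |σ| = 1)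
    (hK : IsCompact K) (hKO : K ⊆ O) (i : Fin n) :
    (∀ j, ∃ h : Euc n → ℝ, Integrable h ∧
      ∀ φ, IsTestFun K φ → ∫ x, (pv m (X x)) i * pd φ j x = ∫ x, h x * φ x) ∧
    ∀ j l, ∃ h : Euc n → ℝ, Integrable h ∧
      ∀ φ, IsTestFun K φ → ∫ x, (pv m (X x)) i * pd (pd φ j) l x = ∫ x, h x * φ x := by
  obtain ⟨κ, hκ, hκ1, hκp, hκq, hκa, hκm⟩ := exists_pos_le_five one_pos
    (show 0 < p - 1 by linarith [P.one_lt]) (show 0 < p - 1 - (p - 2) * q by linarith)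
    (show 0 < p - 4 + α - (l₂ * (p - 3) - l₃ * (p - 1)) by linarith)
    (show 0 < 2 * m + 1 - α by linarith)
  have hneg : ∀ L, IsCompact L → L ⊆ O → IntegrableOn (fun x => ‖X x‖ ^ (-(p - 1 - κ))) L ∧
      ∀ᵐ x ∂(volume.restrict L), X x ≠ 0 := fun L hL hLO =>
    P.neg_power_integrable hκ hκ1 hκp hτ hσ hσ1 hL hLO
  have ha' : l₂ * (p - 3 + κ) - l₃ * (p - 1 - κ) ≤ p - 4 + α := by
    have : (l₂ + l₃) * κ ≤ 1 * κ := mul_le_right (by linarith) hκ.le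
    linarith
  have hI4 : ∀ L, IsCompact L → L ⊆ O → ∃ B, ∀ ε, 0 < ε → ∀₀ h, ∀ k,
      ∫ x in bset X L ε, ‖X x‖ ^ (p - 4 + α) * ‖dq h k X x‖ ^ (4:ℝ) ≤ B := fun L hL hLO =>
    P.weighted_four_bound hκ hκ1 h1 h2 h3 hsum (by linarith) h4 ha' hL hLO (hneg L hL hLO).1
      (P.eventually_integral_dq_rpow_le hn hq hC0 hC hs hsC (by linarith) hL hLO hneg)
  have hJ := P.weighted_second_bound hpα hαp hI4 hK hKO
  have hw : IntegrableOn (fun x => ‖X x‖ ^ (2 * m + 2 - p - α)) K :=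
    integrableOn_rpow_of_le P.cont hK (hneg K hK hKO).1 (hneg K hK hKO).2 (by linarith)
  obtain ⟨C₁, hC₁⟩ := P.first_deriv_bound hm hK hKO
  obtain ⟨C₂, hC₂⟩ := P.second_deriv_bound (by linarith) hK hJ (hI4 K hK hKO) hw
  have hg : Continuous fun x => (pv m (X x)) i :=
    (show Continuous fun z : Euc n => z i by fun_prop).comp
      ((pv_continuous (by linarith)).comp P.cont)
  refine ⟨fun j => ?_, fun j l => ?_⟩
  · refine exists_integrable_representation (w := K.indicator fun _ => 1) (C := C₁) hg
      ((integrable_indicator_iff hK.measurableSet).2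
        (integrableOn_const hK.measure_lt_top.ne))
      (fun x => indicator_nonneg (fun _ _ => zero_le_one) x) (fun φ => pd φ j)
      (fun φ hφ => (pd_contDiff hφ.1 j).continuous) (fun φ hφ => pd_cpt hφ.2.1 j)
      (fun φ ψ hφ hψ x => by rw [pd_add hφ.1 hψ.1])
      (fun c φ hφ x => by rw [pd_const_mul hφ.1]) fun φ hφ => ?_
    refine (hC₁ φ hφ i j).trans (le_of_eq ?_)
    congr 3 with x
    by_cases hx : x ∈ K
    · simp [hx]
    · simp [hx, zero_off_tsupport fun hb => hx (hφ.2.2 hb)]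
  · exact exists_integrable_representation hg
      ((integrable_indicator_iff hK.measurableSet).2 hw)
      (fun x => indicator_nonneg (fun _ _ => by positivity) x) (fun φ => pd (pd φ j) l)
      (fun φ hφ => (pd_contDiff (pd_contDiff hφ.1 j) l).continuous)
      (fun φ hφ => pd_cpt (pd_cpt hφ.2.1 j) l)
      (fun φ ψ hφ hψ x => by
        rw [pd_add hφ.1 hψ.1, pd_add (pd_contDiff hφ.1 j) (pd_contDiff hψ.1 j)])
      (fun c φ hφ x => by rw [pd_const_mul hφ.1, pd_const_mul (pd_contDiff hφ.1 j)])
      fun φ hφ => hC₂ φ hφ i j l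

end PData

lemma CZ_spec (h0 : CZ n q ≠ 0) (hw : Smooth w)
    (hws : HasCompactSupport w) :
    (∫ x, ‖iteratedFDeriv ℝ 2 w x‖ ^ q) ^ (1 / q)
      ≤ CZ n q * (∫ x, |lapl w x| ^ q) ^ (1 / q) := by
  unfold CZ at h0 ⊢
  set S := {C : ℝ | 0 ≤ C ∧ ∀ w : Euc n → ℝ, Smooth w → HasCompactSupport w →
    (∫ x, ‖iteratedFDeriv ℝ 2 w x‖ ^ q) ^ (1 / q) ≤ C * (∫ x, |lapl w x| ^ q) ^ (1 / q)}
  have hne : S.Nonempty := by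
    by_contra h
    rw [not_nonempty_iff_eq_empty.1 h, sInf_empty] at h0
    exact h0 rfl
  have hB : 0 ≤ (∫ x, |lapl w x| ^ q) ^ (1 / q) :=
    rpow_nonneg (integral_nonneg fun x => by positivity) _
  rcases hB.eq_or_lt with hB0 | hB0
  · obtain ⟨C, hC⟩ := hne
    have := hC.2 w hw hws
    rw [← hB0, mul_zero] at this ⊢
    exact this
  · rw [← div_le_iff₀ hB0]
    exact le_csInf hne fun C hC => (div_le_iff₀ hB0).2 (hC.2 w hw hws)

lemma CZ_nonneg (q : ℝ) : 0 ≤ CZ n q := sInf_nonneg fun _ hC => hC.1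

lemma lap_hasCompactSupport (hws : HasCompactSupport w) :
    HasCompactSupport (lap w) := by
  refine HasCompactSupport.of_support_subset_isCompact hws fun x hx => ?_
  by_contra hb
  refine hx (sum_eq_zero fun i _ => ?_)
  exact zero_off_tsupport fun h =>
    hb (tsupport_pd_subset w i (tsupport_pd_subset (pd w i) i h))

lemma CZ_eLpNorm (hq : 0 < q) (h0 : CZ n q ≠ 0)
    (hw : Smooth w) (hws : HasCompactSupport w) :
    eLpNorm (fun x => ‖iteratedFDeriv ℝ 2 w x‖) (ofReal q)
      ≤ ofReal (CZ n q) * eLpNorm (lap w) (ofReal q) := by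
  have hD : Continuous (fun x => ‖iteratedFDeriv ℝ 2 w x‖) :=
    (hw.continuous_iteratedFDeriv (m := 2) (WithTop.coe_le_coe.2 (le_top (a := (2:ℕ∞))))).norm
  have hDs : HasCompactSupport (fun x => ‖iteratedFDeriv ℝ 2 w x‖) := (hws.iteratedFDeriv 2).norm
  have hq0 : ofReal q ≠ 0 := by simpa using hq
  rw [(hD.memLp_of_hasCompactSupport hDs).eLpNorm_eq_integral_rpow_norm hq0 ofReal_ne_top,
    ((lap_continuous hw).memLp_of_hasCompactSupport
      (lap_hasCompactSupport hws)).eLpNorm_eq_integral_rpow_norm hq0 ofReal_ne_top,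
    ← ofReal_mul (CZ_nonneg q), toReal_ofReal hq.le]
  refine ofReal_le_ofReal ?_
  have := CZ_spec h0 hw hws
  rw [lapl_eq_lap hw, one_div] at this
  simpa only [norm_norm, norm_eq_abs, abs_norm] using this

/-- The stretching of the coordinate `i` by the factor `t`. -/
def stretch (i : Fin n) (t : ℝ) : Euc n →L[ℝ] Euc n :=
  ContinuousLinearMap.id ℝ (Euc n) + (t - 1) • (innerSL ℝ (ev i)).smulRight (ev i)

lemma stretch_ev (i j : Fin n) (t : ℝ) :
    stretch i t (ev j) = (if j = i then t else 1) • ev j := by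
  by_cases h : j = i
  · subst h
    simp [stretch, ev, sub_smul]
  · have : ⟪ev i, ev j⟫_ℝ = 0 := by
      rw [real_inner_comm, inner_ev]; simp [ev, Ne.symm h]
    simp [stretch, h, this]

lemma stretch_injective (i : Fin n) (ht : t ≠ 0) :
    Function.Injective (stretch i t) := by
  rw [injective_iff_map_eq_zero]
  intro x hx
  have e1 : x + (t - 1) • x i • ev i = 0 := by
    have h1 : ⟪ev i, x⟫_ℝ = x i := by rw [real_inner_comm, inner_ev]
    rw [← hx]
    simp [stretch, h1]
  have e2 : x i = 0 := by
    have := congrArg (fun z : Euc n => z i) e1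
    have h : t * x i = 0 := by simp [ev] at this; linarith
    exact (mul_eq_zero.1 h).resolve_left ht
  rw [e2] at e1
  simpa using e1

lemma pd_comp_stretch (hφ : Smooth φ) (i j : Fin n) (t : ℝ) :
    pd (fun x => φ (stretch i t x)) j
      = fun x => (if j = i then t else 1) * pd φ j (stretch i t x) := by
  funext x
  have h1 : HasFDerivAt φ (fderiv ℝ φ (stretch i t x)) (stretch i t x) :=
    (hφ.differentiable (by simp) _).hasFDerivAt
  have h2 := (h1.comp x (stretch i t).hasFDerivAt).fderiv
  change fderiv ℝ (φ ∘ (stretch i t)) x (ev j) = _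
  rw [h2, ContinuousLinearMap.comp_apply, stretch_ev, map_smul, smul_eq_mul]
  rfl

lemma pd_pd_comp_stretch (hφ : Smooth φ) (i j : Fin n) (t : ℝ) :
    pd (pd (fun x => φ (stretch i t x)) j) j
      = fun x => (if j = i then t else 1) ^ 2 * pd (pd φ j) j (stretch i t x) := by
  have h : Smooth fun x => pd φ j (stretch i t x) :=
    (pd_contDiff hφ j).comp (stretch i t).contDiff
  rw [pd_comp_stretch hφ, pd_const_mul h, pd_comp_stretch (pd_contDiff hφ j)]
  funext x
  ring

lemma exists_eLpNorm_comp_stretch (i : Fin n) (ht : t ≠ 0) {r : ℝ≥0∞} (hr : r ≠ ⊤) :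
    ∃ c : ℝ≥0∞, c ≠ 0 ∧ c ≠ ⊤ ∧ ∀ g : Euc n → ℝ, Continuous g →
      eLpNorm (fun x => g (stretch i t x)) r = c * eLpNorm g r := by
  have hdet : LinearMap.det (stretch i t : Euc n →ₗ[ℝ] Euc n) ≠ 0 :=
    ((LinearEquiv.ofInjectiveEndo (stretch i t : Euc n →ₗ[ℝ] Euc n)
      (stretch_injective i ht)).isUnit_det').ne_zero
  have hmap := Measure.map_linearMap_addHaar_eq_smul_addHaar (volume : Measure (Euc n)) hdet
  have hc : 0 < |(LinearMap.det (stretch i t : Euc n →ₗ[ℝ] Euc n))⁻¹| :=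
    abs_pos.2 (inv_ne_zero hdet)
  refine ⟨ofReal |(LinearMap.det (stretch i t : Euc n →ₗ[ℝ] Euc n))⁻¹|
    ^ (1 / r).toReal, ?_, ?_, fun g hg => ?_⟩
  · exact (ENNReal.rpow_pos (ENNReal.ofReal_pos.2 hc) ofReal_ne_top).ne'
  · exact rpow_ne_top_of_nonneg toReal_nonneg ofReal_ne_top
  · rw [← smul_eq_mul, ← eLpNorm_smul_measure_of_ne_top hr, ← hmap]
    exact (eLpNorm_map_measure hg.aestronglyMeasurable
      (stretch i t).continuous.aemeasurable).symm

lemma eq_zero_of_pd_eq_zero (hφ : Smooth φ)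
    (hs : HasCompactSupport φ) (h : ∀ x, pd φ i x = 0) (x : Euc n) : φ x = 0 := by
  have hd : ∀ t : ℝ, HasDerivAt (fun t : ℝ => φ (x + t • ev i)) 0 t := fun t => by
    have h1 : HasFDerivAt φ (fderiv ℝ φ (x + t • ev i)) (x + t • ev i) :=
      (hφ.differentiable (by simp) _).hasFDerivAt
    have h2 : HasDerivAt (fun t : ℝ => x + t • ev i) (ev i) t := by
      simpa using ((hasDerivAt_id t).smul_const (ev i)).const_add x
    have h3 := h1.comp_hasDerivAt t h2
    rwa [show fderiv ℝ φ (x + t • ev i) (ev i) = 0 from h _] at h3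
  have hconst := is_const_of_deriv_eq_zero (fun t => (hd t).differentiableAt)
    fun t => (hd t).deriv
  obtain ⟨R, hR⟩ := hs.isBounded.exists_norm_le
  have e := hconst 0 (|R| + ‖x‖ + 1)
  simp only [zero_smul, add_zero] at e
  rw [e]
  refine zero_off_tsupport fun hb => ?_
  have h1 := hR _ hb
  have h2 : |R| + ‖x‖ + 1 ≤ ‖x‖ + ‖x + (|R| + ‖x‖ + 1) • ev i‖ := by
    have := norm_sub_le (x + (|R| + ‖x‖ + 1) • ev i) x
    rw [add_sub_cancel_left, norm_smul, norm_ev, mul_one, norm_eq_abs,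
      abs_of_nonneg (by positivity)] at this
    linarith
  linarith [le_abs_self R]

lemma exists_pd_pd_ne_zero (i : Fin n) : ∃ φ : Euc n → ℝ, Smooth φ ∧
    HasCompactSupport φ ∧ ∃ x, pd (pd φ i) i x ≠ 0 := by
  obtain ⟨φ, hφ⟩ := exists_cutoff (O := (univ : Set (Euc n))) (K := {0}) isOpen_univ
    isCompact_singleton (subset_univ _)
  refine ⟨φ, hφ.contDiff, hφ.cpt, ?_⟩
  by_contra! h
  have h1 := eq_zero_of_pd_eq_zero (pd_contDiff hφ.contDiff i) (pd_cpt hφ.cpt i) h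
  have h2 := eq_zero_of_pd_eq_zero hφ.contDiff hφ.cpt h1 0
  rw [hφ.one (mem_singleton _)] at h2
  exact one_ne_zero h2

lemma lap_comp_stretch (hφ : Smooth φ) (i : Fin n) (t : ℝ) :
    lap (fun x => φ (stretch i t x)) = fun x => t ^ 2 * pd (pd φ i) i (stretch i t x)
      + ∑ j ∈ Finset.univ.erase i, pd (pd φ j) j (stretch i t x) := by
  funext x
  rw [lap, ← Finset.add_sum_erase _ _ (Finset.mem_univ i)]
  congr 1
  · rw [pd_pd_comp_stretch hφ]; simp
  · refine sum_congr rfl fun j hj => ?_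
    rw [pd_pd_comp_stretch hφ]; simp [Finset.ne_of_mem_erase hj]

lemma one_le_CZ (hn : 0 < n) (hq : 1 ≤ q) (h0 : CZ n q ≠ 0) : 1 ≤ CZ n q := by
  obtain ⟨φ, hφ, hs, x0, hx0⟩ := exists_pd_pd_ne_zero (⟨0, hn⟩ : Fin n)
  obtain ⟨i, hi⟩ : ∃ i : Fin n, i = ⟨0, hn⟩ := ⟨_, rfl⟩
  rw [← hi] at hx0
  obtain ⟨g, hg⟩ : ∃ g, g = pd (pd φ i) i := ⟨_, rfl⟩
  obtain ⟨R, hR⟩ : ∃ R : Euc n → ℝ, R = fun y => ∑ j ∈ Finset.univ.erase i, pd (pd φ j) j y :=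
    ⟨_, rfl⟩
  have hc : ∀ j, Continuous (pd (pd φ j) j) := fun j =>
    (pd_contDiff (pd_contDiff hφ j) j).continuous
  have hcs : ∀ j, HasCompactSupport (pd (pd φ j) j) := fun j =>
    pd_cpt (pd_cpt hs j) j
  have hgc : Continuous g := hg ▸ hc i
  have hRc : Continuous R := hR ▸ continuous_finsetSum _ fun j _ => hc j
  have hgL : MemLp g (ofReal q) := by
    rw [hg]; exact (hc i).memLp_of_hasCompactSupport (hcs i)
  have hRL : MemLp R (ofReal q) := by
    rw [hR]; exact memLp_finsetSum _ fun j _ => (hc j).memLp_of_hasCompactSupport (hcs j)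
  have hq1 : 1 ≤ ofReal q := by simpa using ofReal_le_ofReal hq
  have ha0 : eLpNorm g (ofReal q) ≠ 0 := by
    intro h
    rw [eLpNorm_eq_zero_iff hgL.1 (by positivity)] at h
    have := (hgc.ae_eq_iff_eq volume continuous_const).1 h
    exact hx0 (by rw [← hg, this]; rfl)
  have key : ∀ t : ℝ, 0 < t → ofReal (t ^ 2) * eLpNorm g (ofReal q)
      ≤ ofReal (CZ n q) * (ofReal (t ^ 2) * eLpNorm g (ofReal q)
        + eLpNorm R (ofReal q)) := fun t ht => by
    obtain ⟨c, hc0, hct, hcc⟩ := exists_eLpNorm_comp_stretch i ht.ne'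
      (ofReal_ne_top (r := q))
    have hwc : Smooth fun x => φ (stretch i t x) := hφ.comp (stretch i t).contDiff
    have hws : HasCompactSupport fun x => φ (stretch i t x) :=
      hs.comp_isClosedEmbedding (LinearMap.isClosedEmbedding_of_injective
        (f := (stretch i t : Euc n →ₗ[ℝ] Euc n)) (LinearMap.ker_eq_bot.2 (stretch_injective i ht.ne')))
    have hsm : eLpNorm (fun x => t ^ 2 * g x) (ofReal q)
        = ofReal (t ^ 2) * eLpNorm g (ofReal q) := by
      have := eLpNorm_const_smul (μ := volume) (p := ofReal q) (t ^ 2) g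
      rw [enorm_eq_ofReal (by positivity)] at this
      exact this
    have e1 : eLpNorm (pd (pd (fun x => φ (stretch i t x)) i) i) (ofReal q)
        = c * (ofReal (t ^ 2) * eLpNorm g (ofReal q)) := by
      rw [pd_pd_comp_stretch hφ, ← hsm,
        ← hcc (fun x => t ^ 2 * g x) (continuous_const.mul hgc), hg]
      simp
    have e2 : eLpNorm (pd (pd (fun x => φ (stretch i t x)) i) i) (ofReal q)
        ≤ eLpNorm (fun x => ‖iteratedFDeriv ℝ 2 (fun x => φ (stretch i t x)) x‖)
          (ofReal q) :=
      eLpNorm_mono fun x => by simpa using abs_pd_pd_le hwc x i i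
    have e3 : eLpNorm (lap fun x => φ (stretch i t x)) (ofReal q)
        ≤ c * (ofReal (t ^ 2) * eLpNorm g (ofReal q)
          + eLpNorm R (ofReal q)) := by
      have : (lap fun x => φ (stretch i t x))
          = fun x => (fun y => t ^ 2 * g y + R y) (stretch i t x) := by
        rw [lap_comp_stretch hφ, hg, hR]
      rw [this, hcc (fun y => t ^ 2 * g y + R y) ((continuous_const.mul hgc).add hRc), ← hsm]
      gcongr
      exact eLpNorm_add_le (continuous_const.mul hgc).aestronglyMeasurable hRL.1 hq1
    have e4 := e1.symm.le.trans (e2.trans ((CZ_eLpNorm (by linarith) h0 hwc hws).trans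
      (mul_le_mul_right e3 _)))
    rw [mul_left_comm (ofReal (CZ n q)) c] at e4
    exact (ENNReal.mul_le_mul_iff_right hc0 hct).1 e4
  have keyR : ∀ t : ℝ, 0 < t → t ^ 2 * (eLpNorm g (ofReal q)).toReal
      ≤ CZ n q * (t ^ 2 * (eLpNorm g (ofReal q)).toReal
        + (eLpNorm R (ofReal q)).toReal) := fun t ht => by
    have := toReal_mono (mul_ne_top ofReal_ne_top (ENNReal.add_ne_top.2
      ⟨mul_ne_top ofReal_ne_top hgL.2.ne, hRL.2.ne⟩)) (key t ht)
    rwa [toReal_mul, toReal_mul, ENNReal.toReal_add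
      (mul_ne_top ofReal_ne_top hgL.2.ne) hRL.2.ne, toReal_mul,
      toReal_ofReal (by positivity), toReal_ofReal (CZ_nonneg q)] at this
  obtain ⟨a, hae⟩ : ∃ a, a = (eLpNorm g (ofReal q)).toReal := ⟨_, rfl⟩
  obtain ⟨r, hre⟩ : ∃ r, r = (eLpNorm R (ofReal q)).toReal := ⟨_, rfl⟩
  have ha : 0 < a := hae ▸ ENNReal.toReal_pos ha0 hgL.2.ne
  have hr : 0 ≤ r := hre ▸ toReal_nonneg
  rw [← hae, ← hre] at keyR
  by_contra! hlt
  have hC := CZ_nonneg (n := n) q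
  have hd : 0 < a * (1 - CZ n q) := mul_pos ha (by linarith)
  have := keyR √((CZ n q * r + 1) / (a * (1 - CZ n q))) (by positivity)
  rw [sq_sqrt (by positivity)] at this
  have h3 : (CZ n q * r + 1) / (a * (1 - CZ n q)) * (a * (1 - CZ n q)) = CZ n q * r + 1 :=
    div_mul_cancel₀ _ hd.ne'
  nlinarith

lemma qseq_four (N : ℕ) : qseq 4 N = 2 * 2 ^ N + 2 := by
  induction N with
  | zero => norm_num [qseq]
  | succ N ih => rw [qseq, ih]; ring

lemma exists_interpolation_weights {N : ℕ} (hq : 4 < q) (hp0 : 1 < p)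
    (hp : p < 2 + 1 / (q - 1)) (hqN : qseq 4 N < q) (hqN1 : q ≤ qseq 4 (N + 1))
    (hα : α > (q - qseq 4 N) * (1 - p) / (2 ^ N * q) + (3 - p) / 2 ^ N + 1) :
    1 < α ∧ ∃ l₁ l₂ l₃ : ℝ, 0 ≤ l₁ ∧ 0 ≤ l₂ ∧ 0 ≤ l₃ ∧ l₁ + l₂ + l₃ = 1 ∧
      l₁ * q + 2 * l₂ = 4 ∧ l₂ * (p - 3) - l₃ * (p - 1) < p - 4 + α := by
  have hp3 : p < 7 / 3 := by
    have : 1 / (q - 1) < 1 / 3 := one_div_lt_one_div_of_lt (by norm_num) (by linarith)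
    linarith
  rw [qseq_four] at hqN hα
  rw [qseq_four, pow_succ] at hqN1
  have hT : (1 : ℝ) ≤ 2 ^ N := one_le_pow₀ (by norm_num)
  generalize (2 : ℝ) ^ N = T at *
  obtain ⟨r, hr⟩ : ∃ r, r = (2 * T + 2) / q := ⟨_, rfl⟩
  have hq0 : 0 < q := by linarith
  have hT0 : 0 < T := by linarith
  have hrq : r * q = 2 * T + 2 := by rw [hr]; field_simp
  have hr1 : r < 1 := by rw [hr, div_lt_one hq0]; exact hqN
  have hr2 : 1 / 2 ≤ r := by
    rw [hr, div_le_div_iff₀ two_pos hq0]; linarith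
  have hα' : 1 + T⁻¹ * (3 - p) + T⁻¹ * (1 - r) * (1 - p) < α := by
    refine lt_of_eq_of_lt ?_ hα
    rw [hr]; field_simp; ring
  have hi : 0 < T⁻¹ := inv_pos.2 hT0
  have hi1 : T⁻¹ ≤ 1 := inv_le_one_of_one_le₀ hT
  have hiT : T⁻¹ * T = 1 := inv_mul_cancel₀ hT0.ne'
  generalize T⁻¹ = l at *
  refine ⟨?_, l * r, 1 - l, l * (1 - r), by positivity, by linarith,
    mul_nonneg hi.le (by linarith), by ring, ?_, by linarith⟩
  · have : 0 ≤ (3 - p) + (1 - r) * (1 - p) := by nlinarith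
    nlinarith [mul_nonneg hi.le this]
  · linear_combination l * hrq + 2 * hiT

lemma CZ_parameters (hn : 0 < n) (hq : 4 < q) (hp1 : 2 - 1 / CZ n q < p)
    (hp2 : p < min (2 + 1 / (q - 1)) (2 + 1 / CZ n q)) :
    CZ n q ≠ 0 ∧ 1 < p ∧ |p - 2| < 1 ∧ |p - 2| * CZ n q < 1 ∧ (p - 2) * q < p - 1 := by
  obtain ⟨ha, hb⟩ := lt_min_iff.1 hp2
  have h0 : CZ n q ≠ 0 := by
    intro h
    rw [h] at hp1 hb
    simp at hp1 hb
    linarith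
  have h1 := one_le_CZ hn (by linarith) h0
  have hlt : |p - 2| < 1 / CZ n q := abs_sub_lt_iff.2 ⟨by linarith, by linarith⟩
  have hle : 1 / CZ n q ≤ 1 := by rw [div_le_one (by linarith)]; exact h1
  refine ⟨h0, by linarith, hlt.trans_le hle, (lt_div_iff₀ (by linarith)).1 hlt, ?_⟩
  have : (p - 2) * (q - 1) < 1 := (lt_div_iff₀ (by linarith)).1 (by linarith)
  linarith

lemma DifferentiableAt.hasFDerivAt_gradient
    (h : DifferentiableAt ℝ u x) : HasFDerivAt u (innerSL ℝ (gradient u x)) x := by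
  have e : innerSL ℝ (gradient u x) = InnerProductSpace.toDual ℝ (Euc n) (gradient u x) := by
    ext y
    simp
  rw [e]
  exact h.hasGradientAt.hasFDerivAt

lemma C1Loc.continuousOn_gradient {β : ℝ≥0}
    (hΩ : IsOpen Ω) (hβ : 0 < β) (hu : C1Loc Ω β u) : ContinuousOn (gradient u) Ω := by
  intro x hx
  obtain ⟨K, hK, hxK, hKΩ⟩ := exists_compact_subset hΩ hx
  obtain ⟨C, hC⟩ := hu.2 K hKΩ hK
  exact ((hC.continuousOn hβ).continuousAt (mem_interior_iff_mem_nhds.1 hxK)).continuousWithinAt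

lemma Cutoff.exists_localization {L : Set (Euc n)} (hχ : Cutoff Ω L χ)
    (hΩ : IsOpen Ω) (hd : ∀ x ∈ Ω, DifferentiableAt ℝ u x)
    (hc : ContinuousOn (gradient u) Ω) : ∃ X : Euc n → Euc n, Continuous X ∧
      (∀ x, HasFDerivAt (fun x => χ x * u x) (innerSL ℝ (X x)) x) ∧
      ∀ x ∈ L, X x = gradient u x := by
  have hχd : ∀ x, DifferentiableAt ℝ χ x := hχ.contDiff.differentiable (by simp)
  have hχg : Continuous (gradient χ) :=
    (InnerProductSpace.toDual ℝ (Euc n)).symm.continuous.comp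
      (hχ.contDiff.continuous_fderiv (by simp))
  have hout : ∀ x ∉ Ω, χ =ᶠ[𝓝 x] 0 := fun x hx =>
    notMem_tsupport_iff_eventuallyEq.1 fun h => hx (hχ.sub h)
  have hgout : ∀ {x} {c : ℝ}, χ =ᶠ[𝓝 x] (fun _ => c) → gradient χ x = 0 := fun {x c} h => by
    rw [h.gradient_eq, gradient_fun_const]
  refine ⟨fun x => χ x • gradient u x + u x • gradient χ x, ?_, fun x => ?_, fun x hx => ?_⟩
  · rw [continuous_iff_continuousAt]
    intro x
    by_cases hx : x ∈ Ω
    · exact (hχ.contDiff.continuous.continuousAt.smul (hc.continuousAt (hΩ.mem_nhds hx))).add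
        ((hd x hx).continuousAt.smul hχg.continuousAt)
    · have : (fun x => χ x • gradient u x + u x • gradient χ x) =ᶠ[𝓝 x] fun _ => 0 := by
        filter_upwards [(hout x hx).eventuallyEq_nhds] with y hy
        rw [hgout (c := 0) hy, hy.self_of_nhds]
        simp
      exact continuousAt_const.congr this.symm
  · by_cases hx : x ∈ Ω
    · have e : innerSL ℝ (χ x • gradient u x + u x • gradient χ x)
          = χ x • innerSL ℝ (gradient u x) + u x • innerSL ℝ (gradient χ x) := by
        simp only [map_add, map_smul]
      rw [e]
      exact (hχd x).hasFDerivAt_gradient.mul (hd x hx).hasFDerivAt_gradient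
    · have h1 : (fun x => χ x * u x) =ᶠ[𝓝 x] fun _ => 0 := by
        filter_upwards [hout x hx] with y hy
        simp [hy]
      have h2 : χ x • gradient u x + u x • gradient χ x = 0 := by
        rw [hgout (c := 0) (hout x hx), (hout x hx).self_of_nhds]
        simp
      simp only [h2, map_zero]
      exact (hasFDerivAt_const (0 : ℝ) x).congr_of_eventuallyEq h1
  · have h1 : χ =ᶠ[𝓝 x] fun _ => 1 := Eventually.filter_mono (nhds_le_nhdsSet hx) hχ.one_nhds
    simp only [hgout h1, hχ.one hx, one_smul, smul_zero, add_zero]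

lemma gradient_apply (g : Euc n → ℝ) (x : Euc n) (j : Fin n) : gradient g x j = pd g j x := by
  have h : ⟪gradient g x, ev j⟫_ℝ = gradient g x j := inner_ev _ _
  rw [← h, gradient, InnerProductSpace.toDual_symm_apply]
  rfl

lemma fderiv_apply_eq_sum_pd (g : Euc n → ℝ) (x v : Euc n) :
    fderiv ℝ g x v = ∑ j, v j * pd g j x := by
  have h : ⟪gradient g x, v⟫_ℝ = fderiv ℝ g x v := by
    rw [gradient, InnerProductSpace.toDual_symm_apply]
  rw [← h, PiLp.inner_apply]
  refine sum_congr rfl fun j _ => ?_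
  rw [gradient_apply]; simp

lemma pd_zero_of_notMem (h : tsupport g ⊆ K) (j : Fin n)
    (hx : x ∉ K) : pd g j x = 0 :=
  zero_off_tsupport fun h' => hx (h (tsupport_pd_subset g j h'))

lemma weakEq_of_smooth (hO : IsOpen O) {V : Euc n → Euc n}
    (hV : Continuous V) (hg : Continuous g)
    (h : ∀ φ, IsTestFun O φ → ∫ x, fderiv ℝ φ x (V x) = ∫ x, g x * φ x) : WeakEq O V g := by
  intro φ hφ hs hsub
  obtain ⟨K, ψ, hK, hKO, hφK, hψ, h0, h1⟩ := exists_seq_smooth_approx hO hφ hs hsub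
  have hVj : ∀ j, Continuous fun x => V x j := fun j => (EuclideanSpace.proj j).continuous.comp hV
  have hpdc : ∀ {θ : Euc n → ℝ}, ContDiff ℝ 1 θ → ∀ j, Continuous (pd θ j) := fun hθ j =>
    (hθ.continuous_fderiv (by simp)).clm_apply continuous_const
  have hψ1 : ∀ m, ContDiff ℝ 1 (ψ m) := fun m => (hψ m).1.of_le (by simp)
  have t1 : Tendsto (fun m => ∫ x, g x * ψ m x) atTop (𝓝 (∫ x, g x * φ x)) :=
    tendsto_integral_mul_of_unif hK (hg.continuousOn.integrableOn_compact hK) hφ.continuous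
      (fun m => (hψ m).1.continuous)
      (fun x hx => zero_off_tsupport fun h' => hx (hφK h'))
      (fun m x hx => zero_off_tsupport fun h' => hx ((hψ m).2.2 h')) h0
  have t2 : ∀ j, Tendsto (fun m => ∫ x, V x j * pd (ψ m) j x) atTop
      (𝓝 (∫ x, V x j * pd φ j x)) := fun j =>
    tendsto_integral_mul_of_unif hK ((hVj j).continuousOn.integrableOn_compact hK) (hpdc hφ j)
      (fun m => hpdc (hψ1 m) j) (fun x hx => pd_zero_of_notMem hφK j hx)
      (fun m x hx => pd_zero_of_notMem (hψ m).2.2 j hx) fun m x => by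
        refine le_trans ?_ (h1 m x)
        have := (fderiv ℝ (ψ m) x - fderiv ℝ φ x).le_opNorm (ev j)
        rwa [norm_ev, mul_one] at this
  have e : ∀ {θ : Euc n → ℝ}, ContDiff ℝ 1 θ → HasCompactSupport θ →
      ∫ x, fderiv ℝ θ x (V x) = ∑ j, ∫ x, V x j * pd θ j x := fun {θ} hθ hθs => by
    rw [← integral_finsetSum]
    · exact integral_congr_ae (.of_forall fun x => fderiv_apply_eq_sum_pd θ x (V x))
    · exact fun j _ => ((hVj j).mul (hpdc hθ j)).integrable_cpt
        (HasCompactSupport.mul_left (hθs.mono' (subset_closure.trans (tsupport_pd_subset θ j))))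
  rw [e hφ hs]
  refine tendsto_nhds_unique (tendsto_finsetSum _ fun j _ => t2 j) (t1.congr fun m => ?_)
  rw [← e (hψ1 m) (hψ m).2.1]
  exact (h (ψ m) ⟨(hψ m).1, (hψ m).2.1, (hψ m).2.2.trans hKO⟩).symm

lemma exists_PData (hΩ : IsOpen Ω) {β β' : ℝ≥0} (hβ : 0 < β)
    (hβ' : 0 < β') (hu : C1Loc Ω β u) (hf : C1Loc Ω β' f)
    (hsol : IsPWeakSol p Ω u f) (hp1 : 1 < p) (hp3 : p < 3) (hK : IsCompact K)
    (hKΩ : K ⊆ Ω) : ∃ (O : Set (Euc n)) (U F : Euc n → ℝ) (X : Euc n → Euc n),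
      PData p O U F X ∧ K ⊆ O ∧ ∀ x ∈ O, X x = gradient u x ∧ F x = f x ∧ x ∈ Ω := by
  obtain ⟨L, hL, hKL, hLΩ⟩ := exists_compact_between hK hΩ hKΩ
  obtain ⟨χ, hχ⟩ := exists_cutoff hΩ hL hLΩ
  obtain ⟨X, hX, hXd, hXe⟩ := hχ.exists_localization hΩ hu.1 (hu.continuousOn_gradient hΩ hβ)
  obtain ⟨Y, hY, hYd, -⟩ := hχ.exists_localization hΩ hf.1 (hf.continuousOn_gradient hΩ hβ')
  have hF1 : ContDiff ℝ 1 fun x => χ x * f x := by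
    rw [contDiff_one_iff_fderiv]
    refine ⟨fun x => (hYd x).differentiableAt, ?_⟩
    have : fderiv ℝ (fun x => χ x * f x) = fun x => innerSL ℝ (Y x) :=
      funext fun x => (hYd x).fderiv
    rw [this]
    exact (innerSL ℝ).continuous.comp hY
  refine ⟨interior L, fun x => χ x * u x, fun x => χ x * f x, X, ⟨hp1, hp3, isOpen_interior, hXd,
    hX, hχ.cpt.mul_right, hF1, hχ.cpt.mul_right, ?_⟩, hKL, fun x hx => ⟨hXe x (interior_subset hx),
    by simp [hχ.one (interior_subset hx)], hLΩ (interior_subset hx)⟩⟩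
  refine weakEq_of_smooth isOpen_interior ((pv_continuous (by linarith)).comp hX) hF1.continuous
    fun φ hφ => ?_
  have hφΩ : IsTestFun Ω φ := ⟨hφ.1, hφ.2.1, hφ.2.2.trans (interior_subset.trans hLΩ)⟩
  have key := hsol φ hφΩ
  have hz : ∀ x ∉ interior L, φ x = 0 ∧ fderiv ℝ φ x = 0 := fun x hx =>
    ⟨zero_off_tsupport fun h => hx (hφ.2.2 h),
      zero_off_tsupport fun h => hx (hφ.2.2 (tsupport_fderiv_subset ℝ h))⟩
  have hin : ∀ x v, ⟪v, gradient φ x⟫_ℝ = fderiv ℝ φ x v := fun x v => by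
    rw [real_inner_comm, gradient, InnerProductSpace.toDual_symm_apply]
  rw [setIntegral_eq_of_off, setIntegral_eq_of_off] at key
  · refine (integral_congr_ae (.of_forall fun x => ?_)).trans
      (key.trans (integral_congr_ae (.of_forall fun x => ?_)))
    · by_cases hx : x ∈ interior L
      · simp only [hin, hXe x (interior_subset hx), pv, map_smul, smul_eq_mul]
      · simp only [hin, (hz x hx).2, _root_.zero_apply, mul_zero]
    · by_cases hx : x ∈ interior L
      · simp only [hχ.one (interior_subset hx), one_mul]
      · simp only [(hz x hx).1, mul_zero]
  · exact fun x hx => by rw [(hz x fun h => hx (hLΩ (interior_subset h))).1, mul_zero]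
  · exact fun x hx => by
      rw [hin, (hz x fun h => hx (hLΩ (interior_subset h))).2, _root_.zero_apply, mul_zero]

lemma IsTestFun.pd (hφ : IsTestFun Ω φ) (j : Fin n) :
    IsTestFun Ω (pd φ j) :=
  ⟨pd_contDiff hφ.1 j, pd_cpt hφ.2.1 j, (tsupport_pd_subset φ j).trans hφ.2.2⟩

lemma memW2Loc_one_of_local (hΩ : IsOpen Ω)
    (hg : ContinuousOn g Ω)
    (h1 : ∀ K, IsCompact K → K ⊆ Ω → ∀ j, ∃ h, Integrable h ∧ ∀ φ, IsTestFun (interior K) φ →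
      ∫ x in Ω, g x * pd φ j x = ∫ x, h x * φ x)
    (h2 : ∀ K, IsCompact K → K ⊆ Ω → ∀ j l, ∃ h, Integrable h ∧ ∀ φ, IsTestFun (interior K) φ →
      ∫ x in Ω, g x * pd (pd φ j) l x = ∫ x, h x * φ x) : MemW2Loc Ω 1 g := by
  choose d hdi hd using fun j => exists_glued_representation hΩ
    (fun φ => ∫ x in Ω, g x * pd φ j x) fun K hK hKΩ => h1 K hK hKΩ j
  choose d2 hd2i hd2 using fun l j => exists_glued_representation hΩ
    (fun φ => ∫ x in Ω, g x * pd (pd φ j) l x) fun K hK hKΩ => h2 K hK hKΩ j l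
  have hset : ∀ (a : Euc n → ℝ) φ, IsTestFun Ω φ → ∫ x in Ω, a x * φ x = ∫ x, a x * φ x :=
    fun a φ hφ => setIntegral_eq_of_off fun x hx => by
      rw [zero_off_tsupport fun h => hx (hφ.2.2 h), mul_zero]
  refine ⟨fun j x => - d j x, d2, fun j φ hφ => ?_, fun l j φ hφ => ?_, fun K hKΩ hK => ?_⟩
  · simp only [neg_mul, integral_neg, neg_neg]
    rw [hset _ _ hφ]
    exact hd j φ hφ
  · simp only [neg_mul, integral_neg]
    rw [hset _ _ hφ, hset _ _ (hφ.pd j), ← hd2 l j φ hφ, ← hd l _ (hφ.pd j)]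
  · simp only [rpow_one, abs_neg]
    exact ⟨((hg.mono hKΩ).integrableOn_compact hK).abs, fun j => (hdi j K hK hKΩ).abs,
      fun l j => (hd2i l j K hK hKΩ).abs⟩

end

theorem stress_field_second_order_signed
    {n : ℕ} (hn : 2 ≤ n) (Ω : Set (Euc n)) (hΩo : IsOpen Ω) (hΩc : IsConnected Ω)
    (p q : ℝ) (β β' : ℝ≥0) (hβ : 0 < β) (hβ1 : β < 1) (hβ' : 0 < β') (hβ'1 : β' < 1)
    (u f : Euc n → ℝ) (hu : C1Loc Ω β u) (hsol : IsPWeakSol p Ω u f)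
    (N : ℕ) (hq0 : qseq 4 0 < q) (hqN : qseq 4 N < q) (hqN1 : q ≤ qseq 4 (N + 1))
    (hp1 : 2 - 1 / CZ n q < p)
    (hp2 : p < min (2 + 1 / (q - 1)) (2 + 1 / CZ n q))
    (hf1 : MemW2Loc Ω (q / (q - 1)) f) (hf2 : C1Loc Ω β' f)
    (hsign : ∃ τ : ℝ, 0 < τ ∧ ((∀ x ∈ Ω, τ ≤ f x) ∨ (∀ x ∈ Ω, f x ≤ -τ)))
    (α k : ℝ)
    (hα : α > (q - qseq 4 N) * (1 - p) / (2 ^ N * q) + (3 - p) / 2 ^ N + 1)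
    (hk : k > (α + 1) / 2) :
    ∀ i : Fin n, MemW2Loc Ω 1 (fun x => ‖gradient u x‖ ^ (k - 1) * gradient u x i) := by
  intro i
  have hq : 4 < q := hq0
  have hn0 : 0 < n := by omega
  obtain ⟨hCZ, hp, hs, hsC, hpq⟩ := CZ_parameters hn0 hq hp1 hp2
  obtain ⟨hα1, l₁, l₂, l₃, hl₁, hl₂, hl₃, hsum, h4, ha⟩ :=
    exists_interpolation_weights hq hp (lt_min_iff.1 hp2).1 hqN hqN1 hα
  have hp3 := (abs_lt.1 hs).2
  obtain ⟨τ, hτ, hσ⟩ := hsign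
  obtain ⟨σ, hσ1, hστ⟩ : ∃ σ : ℝ, |σ| = 1 ∧ ∀ x ∈ Ω, τ ≤ σ * f x := by
    rcases hσ with h | h
    · exact ⟨1, by simp, fun x hx => by linarith [h x hx]⟩
    · exact ⟨-1, by simp, fun x hx => by linarith [h x hx]⟩
  have hloc : ∀ K, IsCompact K → K ⊆ Ω →
      (∀ j, ∃ h, Integrable h ∧ ∀ φ, IsTestFun (interior K) φ →
        ∫ x in Ω, ‖gradient u x‖ ^ (k - 1) * gradient u x i * pd φ j x = ∫ x, h x * φ x) ∧
      ∀ j l, ∃ h, Integrable h ∧ ∀ φ, IsTestFun (interior K) φ →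
        ∫ x in Ω, ‖gradient u x‖ ^ (k - 1) * gradient u x i * pd (pd φ j) l x
          = ∫ x, h x * φ x := fun K hK hKΩ => by
    obtain ⟨O, U, F, X, P, hKO, hO⟩ :=
      exists_PData hΩo hβ hβ' hu hf2 hsol hp (by linarith) hK hKΩ
    have hKK : ∀ {φ : Euc n → ℝ}, IsTestFun (interior K) φ → IsTestFun K φ := fun h =>
      ⟨h.1, h.2.1, h.2.2.trans interior_subset⟩
    have he : ∀ φ, IsTestFun (interior K) φ →
        ∫ x in Ω, ‖gradient u x‖ ^ (k - 1) * gradient u x i * φ x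
          = ∫ x, pv (k - 1) (X x) i * φ x := fun φ hφ => by
      rw [setIntegral_eq_of_off]
      · refine integral_congr_ae (Filter.Eventually.of_forall fun x => ?_)
        by_cases hx : x ∈ K
        · simp [pv, (hO x (hKO hx)).1]
        · simp [zero_off_tsupport fun h => hx ((hKK hφ).2.2 h)]
      · exact fun x hx => by
          rw [zero_off_tsupport fun h => hx (hKΩ ((hKK hφ).2.2 h)), mul_zero]
    obtain ⟨h1, h2⟩ := P.local_regularity hn0 (by linarith) (CZ_nonneg q)
      (fun w hw hws => CZ_eLpNorm (by linarith) hCZ hw hws) hs hsC hpq hl₁ hl₂ hl₃ hsum h4 ha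
      (by linarith) (by linarith) (m := k - 1) (by linarith) (by linarith) hτ
      (fun x hx => by rw [(hO x hx).2.1]; exact hστ x (hO x hx).2.2) hσ1 hK hKO i
    refine ⟨fun j => ?_, fun j l => ?_⟩
    · obtain ⟨h, hi, hh⟩ := h1 j
      exact ⟨h, hi, fun φ hφ => (he _ (hφ.pd j)).trans (hh φ (hKK hφ))⟩
    · obtain ⟨h, hi, hh⟩ := h2 j l
      exact ⟨h, hi, fun φ hφ => (he _ ((hφ.pd j).pd l)).trans (hh φ (hKK hφ))⟩
  have hc := hu.continuousOn_gradient hΩo hβ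
  refine memW2Loc_one_of_local hΩo ?_ (fun K hK hKΩ => (hloc K hK hKΩ).1)
    fun K hK hKΩ => (hloc K hK hKΩ).2
  refine ContinuousOn.mul ?_ ((EuclideanSpace.proj i).continuous.comp_continuousOn hc)
  exact hc.norm.rpow_const fun x _ => Or.inr (by linarith)

end
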